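/- Let U be an open connected set in ℝ^l and x₀ ∈ ℝ^l a point in the closure of U. Let x ↦ ζ(x) and x ↦ ξ(x) be continuous maps from U ∪ {x₀} to L¹(P; ℝ) and L¹(P; ℝ^d) respectively, whose restrictions to U are analytic, and such that ζ(x) > 0 P-a.s. for every x ∈ U ∪ {x₀}. For each x ∈ U ∪ {x₀}, define the probability measure Q(x) by dQ(x)/dP = ζ(x)/E_P[ζ(x)], and let S(x) be a right-continuous adapted version of the Q(x)-martingale S_t(x) = E_{Q(x)}[ξ(x)/ζ(x) | F_t]. If S(x₀) has the MRP, then the exception set I = {x ∈ U : S(x) does not have the MRP} has Lebesgue measure zero. -/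

import Mathlib

open MeasureTheory Filter Set
open scoped ENNReal NNReal

noncomputable section

/-- A stopping time with values in `[0, ∞]` relative to the filtration `F`. -/
def IsStoppingTimeENN {Ω : Type*} {m : MeasurableSpace Ω}
    (F : Filtration ℝ≥0 m) (τ : Ω → ℝ≥0∞) : Prop :=
  ∀ t : ℝ≥0, MeasurableSet[F t] {ω | τ ω ≤ (t : ℝ≥0∞)}

/-- The process `M` stopped at the `[0, ∞]`-valued random time `τ`,
i.e. `t ↦ M_{t ∧ τ}`. -/
def stoppedAtENN {Ω E : Type*} (M : ℝ≥0 → Ω → E) (τ : Ω → ℝ≥0∞) : ℝ≥0 → Ω → E :=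
  fun t ω => if τ ω ≤ (t : ℝ≥0∞) then M (τ ω).toNNReal ω else M t ω

/-- A process `S` is a local martingale under `R` if there is a nondecreasing sequence of
`[0, ∞]`-valued stopping times `τ n ↑ ∞` pointwise such that every stopped process
`S^{τ n}` is an `R`-martingale. -/
def IsLocalMartingale {Ω : Type*} {m : MeasurableSpace Ω} {E : Type*}
    [NormedAddCommGroup E] [NormedSpace ℝ E] [CompleteSpace E]
    (F : Filtration ℝ≥0 m) (S : ℝ≥0 → Ω → E) (R : Measure Ω) : Prop :=
  ∃ τ : ℕ → Ω → ℝ≥0∞,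
    (∀ n, IsStoppingTimeENN F (τ n)) ∧
    (∀ ω, Monotone fun n => τ n ω) ∧
    (∀ ω, (⨆ n, τ n ω) = ∞) ∧
    (∀ n, Martingale (stoppedAtENN S (τ n)) F R)

/-- `S` has the Martingale Representation Property relative to the reference measure `P` and
the measure `Q`: by Jacod's theorem this is taken to mean that `Q` is the unique probability
measure equivalent to `P` under which `S` is a local martingale. -/
def HasMRP {Ω : Type*} {m : MeasurableSpace Ω} {E : Type*}
    [NormedAddCommGroup E] [NormedSpace ℝ E] [CompleteSpace E]
    (F : Filtration ℝ≥0 m) (S : ℝ≥0 → Ω → E) (P Q : Measure Ω) : Prop :=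
  IsLocalMartingale F S Q ∧
    ∀ R : Measure Ω, IsProbabilityMeasure R → (R ≪ P ∧ P ≪ R) →
      IsLocalMartingale F S R → R = Q

set_option linter.unusedSectionVars false
set_option linter.unusedVariables false
namespace DM

open Topology

/-- Cantor index. -/
def idx : ℕ → (ℕ → Bool) → ℕ
  | 0, _ => 0
  | n + 1, b => 2 * idx n b + (b n).toNat

lemma idx_lt (n : ℕ) (b : ℕ → Bool) : idx n b < 2 ^ n := by
  induction n with
  | zero => simp [idx]
  | succ n ih =>
    have := Bool.toNat_lt (b n)
    simp only [idx, pow_succ]; omega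

lemma idx_succ_div (n : ℕ) (b : ℕ → Bool) : idx (n + 1) b / 2 = idx n b := by
  have := Bool.toNat_lt (b n)
  simp only [idx]; omega

lemma idx_congr (n : ℕ) (b b' : ℕ → Bool) (h : ∀ k < n, b k = b' k) : idx n b = idx n b' := by
  induction n with
  | zero => rfl
  | succ n ih => simp only [idx]; rw [ih (fun k hk => h k (by omega)), h n (by omega)]

lemma exists_idx (n i : ℕ) (hi : i < 2 ^ n) : ∃ b, idx n b = i := by
  induction n generalizing i with
  | zero => exact ⟨fun _ => false, by simp at hi; simp [idx, hi]⟩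
  | succ n ih =>
    obtain ⟨b, hb⟩ := ih (i / 2) (by rw [pow_succ] at hi; omega)
    refine ⟨Function.update b n (decide (i % 2 = 1)), ?_⟩
    have : idx n (Function.update b n (decide (i % 2 = 1))) = i / 2 := by
      rw [← hb]; apply idx_congr; intro k hk; simp [Function.update, hk.ne]
    simp only [idx, this, Function.update_self]
    by_cases h : i % 2 = 1
    · simp [h]; omega
    · simp [h]; omega

/-- A branch with given index. -/
def br (n i : ℕ) : ℕ → Bool := if h : i < 2 ^ n then (exists_idx n i h).choose else fun _ => false

lemma idx_br {n i : ℕ} (h : i < 2 ^ n) : idx n (br n i) = i := by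
  rw [br, dif_pos h]; exact (exists_idx n i h).choose_spec

lemma continuous_idx (n : ℕ) : Continuous (idx n) := by
  induction n with
  | zero => exact continuous_const
  | succ n ih =>
    have h2 : Continuous fun b : ℕ → Bool => (b n).toNat :=
      (continuous_of_discreteTopology (f := Bool.toNat)).comp (continuous_apply n)
    exact (ih.const_mul 2).add h2

/-- grid times -/
def tm (n i : ℕ) : ℝ := (i : ℝ) / 2 ^ n

lemma tm_mono (n : ℕ) {i j : ℕ} (h : i ≤ j) : tm n i ≤ tm n j := by
  unfold tm; gcongr

lemma tm_succ (n i : ℕ) : tm (n + 1) (2 * i) = tm n i := by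
  unfold tm; rw [pow_succ]; push_cast; field_simp

lemma tm_div_le (n j : ℕ) : tm n (j / 2) ≤ tm (n + 1) j := by
  rw [← tm_succ]; exact tm_mono _ (by omega)

lemma tm_top (n : ℕ) : tm n (2 ^ n) = 1 := by simp [tm]

variable {Ω : Type*} {m : MeasurableSpace Ω}

/-- the space on which Doléans measures live -/
structure KK (𝒢 : Filtration ℝ m) where
  /-- point -/
  fst : Ω
  /-- branch -/
  snd : ℕ → Bool

/-- level `n` σ-algebra -/
@[reducible]
def lev (𝒢 : Filtration ℝ m) (n : ℕ) : MeasurableSpace (KK 𝒢) where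
  MeasurableSet' B := ∃ C : ℕ → Set Ω, (∀ i, MeasurableSet[𝒢 (tm n i)] (C i)) ∧
    B = {k | k.fst ∈ C (idx n k.snd)}
  measurableSet_empty := ⟨fun _ => ∅, fun _ => @MeasurableSet.empty _ (_), by simp⟩
  measurableSet_compl := by
    rintro B ⟨C, hC, rfl⟩
    exact ⟨fun i => (C i)ᶜ, fun i => (hC i).compl, rfl⟩
  measurableSet_iUnion := by
    intro f hf
    choose C hC h using hf
    refine ⟨fun i => ⋃ j, C j i, fun i => MeasurableSet.iUnion fun j => hC j i, ?_⟩
    ext k; simp [h]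

lemma lev_succ (𝒢 : Filtration ℝ m) (n : ℕ) : lev 𝒢 n ≤ lev 𝒢 (n + 1) := by
  rintro B ⟨C, hC, rfl⟩
  refine ⟨fun j => C (j / 2), fun j => 𝒢.mono (tm_div_le n j) _ (hC _), ?_⟩
  simp only [idx_succ_div]

lemma lev_mono (𝒢 : Filtration ℝ m) : Monotone (lev 𝒢) := monotone_nat_of_le_succ (lev_succ 𝒢)

instance (𝒢 : Filtration ℝ m) : MeasurableSpace (KK 𝒢) := ⨆ n, lev 𝒢 n

lemma lev_le (𝒢 : Filtration ℝ m) (n : ℕ) : lev 𝒢 n ≤ (inferInstance : MeasurableSpace (KK 𝒢)) :=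
  le_iSup (lev 𝒢) n

/-- lift of a level-`n` process -/
def lift (𝒢 : Filtration ℝ m) {E : Type*} (n : ℕ) (f : ℕ → Ω → E) : KK 𝒢 → E :=
  fun k => f (idx n k.snd) k.fst

lemma measurable_lift {𝒢 : Filtration ℝ m} {E : Type*} [MeasurableSpace E] {n : ℕ}
    {f : ℕ → Ω → E} (hf : ∀ i, Measurable[𝒢 (tm n i)] (f i)) : Measurable[lev 𝒢 n] (lift 𝒢 n f) := by
  intro s hs
  exact ⟨fun i => f i ⁻¹' s, fun i => hf i hs, rfl⟩

/-- section map -/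
def sec (𝒢 : Filtration ℝ m) (n i : ℕ) : Ω → KK 𝒢 := fun ω => ⟨ω, br n i⟩

lemma measurable_sec' (𝒢 : Filtration ℝ m) {n i : ℕ} (hi : i < 2 ^ n) :
    Measurable[𝒢 (tm n i), lev 𝒢 n] (sec 𝒢 n i) := by
  rintro B ⟨C, hC, rfl⟩
  have : sec 𝒢 n i ⁻¹' {k | k.fst ∈ C (idx n k.snd)} = C i := by
    ext ω; simp [sec, idx_br hi]
  rw [this]; exact hC i

lemma measurable_sec (𝒢 : Filtration ℝ m) {n i : ℕ} (hi : i < 2 ^ n) :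
    Measurable[m, lev 𝒢 n] (sec 𝒢 n i) :=
  fun _ hB => 𝒢.le _ _ (measurable_sec' 𝒢 hi hB)

lemma lift_sec (𝒢 : Filtration ℝ m) {E : Type*} {n i : ℕ} (hi : i < 2 ^ n) (f : ℕ → Ω → E) (ω : Ω) :
    lift 𝒢 n f (sec 𝒢 n i ω) = f i ω := by simp [lift, sec, idx_br hi]

/-- every level-`n` measurable function is a lift -/
lemma eq_lift {𝒢 : Filtration ℝ m} {E : Type*} [MeasurableSpace E] [MeasurableSingletonClass E]
    [Zero E] {n : ℕ} {ψ : KK 𝒢 → E}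
    (hψ : Measurable[lev 𝒢 n] ψ) :
    ∃ f : ℕ → Ω → E, (∀ i, Measurable[𝒢 (tm n i)] (f i)) ∧ ψ = lift 𝒢 n f ∧
      ∀ i ω, i < 2 ^ n → f i ω = ψ (sec 𝒢 n i ω) := by
  refine ⟨fun i => if i < 2 ^ n then ψ ∘ sec 𝒢 n i else fun _ => 0, ?_, ?_, ?_⟩
  · intro i
    by_cases hi : i < 2 ^ n
    · simp only [hi, if_true]; exact hψ.comp (measurable_sec' 𝒢 hi)
    · simp only [hi, if_false]; exact measurable_const
  · funext k
    have hk := idx_lt n k.snd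
    simp only [lift, hk, if_true, Function.comp]
    obtain ⟨C, hC, h⟩ := hψ (measurableSet_singleton (ψ k))
    have h1 : k ∈ ψ ⁻¹' {ψ k} := rfl
    rw [h] at h1
    have h2 : sec 𝒢 n (idx n k.snd) k.fst ∈ ψ ⁻¹' {ψ k} := by
      rw [h]; simp only [sec, mem_ofPred_eq, idx_br hk]; exact h1
    exact (h2 : _ = _).symm
  · intro i ω hi; simp [hi]

/-- Projection to `Ω`. -/
def pr (𝒢 : Filtration ℝ m) (B : Set (KK 𝒢)) : Set Ω := {ω | ∃ b, (⟨ω, b⟩ : KK 𝒢) ∈ B}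

lemma pr_eq {𝒢 : Filtration ℝ m} {n : ℕ} {B : Set (KK 𝒢)} (hB : MeasurableSet[lev 𝒢 n] B) :
    pr 𝒢 B = ⋃ i ∈ Finset.range (2 ^ n), sec 𝒢 n i ⁻¹' B := by
  obtain ⟨C, hC, rfl⟩ := hB
  ext ω
  simp only [pr, mem_ofPred_eq, mem_iUnion, Finset.mem_range, mem_preimage, sec, exists_prop]
  constructor
  · rintro ⟨b, hb⟩; exact ⟨idx n b, idx_lt n b, by rw [idx_br (idx_lt n b)]; exact hb⟩
  · rintro ⟨i, hi, h⟩; exact ⟨br n i, h⟩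

lemma measurableSet_pr {𝒢 : Filtration ℝ m} {n : ℕ} {B : Set (KK 𝒢)}
    (hB : MeasurableSet[lev 𝒢 n] B) : MeasurableSet[m] (pr 𝒢 B) := by
  rw [pr_eq hB]
  exact Finset.measurableSet_biUnion _ fun i hi => measurable_sec 𝒢 (Finset.mem_range.1 hi) hB

lemma isClosed_fiber {𝒢 : Filtration ℝ m} {n : ℕ} {B : Set (KK 𝒢)}
    (hB : MeasurableSet[lev 𝒢 n] B) (ω : Ω) :
    IsClosed {b : ℕ → Bool | (⟨ω, b⟩ : KK 𝒢) ∈ B} := by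
  obtain ⟨C, hC, rfl⟩ := hB
  exact (isClosed_discrete {i | ω ∈ C i}).preimage (continuous_idx n)

lemma iInter_pr {𝒢 : Filtration ℝ m} {s : ℕ → Set (KK 𝒢)} (hs : ∀ j, ∃ n, MeasurableSet[lev 𝒢 n] (s j))
    (hanti : Antitone s) (hempty : ⋂ j, s j = ∅) : ⋂ j, pr 𝒢 (s j) = ∅ := by
  by_contra hne
  obtain ⟨ω, hω⟩ := nonempty_iff_ne_empty.2 hne
  rw [mem_iInter] at hω
  have := IsCompact.nonempty_iInter_of_sequence_nonempty_isCompact_isClosed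
    (fun j => {b : ℕ → Bool | (⟨ω, b⟩ : KK 𝒢) ∈ s j})
    (fun j b hb => hanti (Nat.le_succ j) hb) (fun j => hω j)
    ((hs 0).elim fun n h => (isClosed_fiber h ω).isCompact)
    (fun j => (hs j).elim fun n h => isClosed_fiber h ω)
  obtain ⟨b, hb⟩ := this
  have : (⟨ω, b⟩ : KK 𝒢) ∈ ⋂ j, s j := by
    rw [mem_iInter] at hb ⊢; exact hb
  rw [hempty] at this; exact this

/-- the ring of all level sets -/
def ring (𝒢 : Filtration ℝ m) : Set (Set (KK 𝒢)) := {B | ∃ n, MeasurableSet[lev 𝒢 n] B}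

lemma isSetRing_ring (𝒢 : Filtration ℝ m) : IsSetRing (ring 𝒢) where
  empty_mem := ⟨0, @MeasurableSet.empty _ (_)⟩
  union_mem := by
    rintro s t ⟨n, hn⟩ ⟨k, hk⟩
    exact ⟨max n k, (lev_mono 𝒢 (le_max_left n k) _ hn).union (lev_mono 𝒢 (le_max_right n k) _ hk)⟩
  sdiff_mem := by
    rintro s t ⟨n, hn⟩ ⟨k, hk⟩
    exact ⟨max n k, (lev_mono 𝒢 (le_max_left n k) _ hn).diff (lev_mono 𝒢 (le_max_right n k) _ hk)⟩

lemma generateFrom_ring (𝒢 : Filtration ℝ m) :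
    (inferInstance : MeasurableSpace (KK 𝒢)) = MeasurableSpace.generateFrom (ring 𝒢) := by
  apply le_antisymm
  · refine iSup_le fun n B hB => MeasurableSpace.measurableSet_generateFrom ⟨n, hB⟩
  · refine MeasurableSpace.generateFrom_le ?_
    rintro B ⟨n, hB⟩; exact lev_le 𝒢 n _ hB

lemma isPiSystem_ring (𝒢 : Filtration ℝ m) : IsPiSystem (ring 𝒢) :=
  fun _ hs _ ht _ => (isSetRing_ring 𝒢).inter_mem hs ht

/-- projective limit of level measures -/
theorem exists_limit_measure {𝒢 : Filtration ℝ m} (μ : Measure Ω) [IsFiniteMeasure μ]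
    (ν : (n : ℕ) → @Measure (KK 𝒢) (lev 𝒢 n)) (C : ℝ≥0)
    (hν : ∀ n B, MeasurableSet[lev 𝒢 n] B → ν (n + 1) B = ν n B)
    (hb : ∀ n B, MeasurableSet[lev 𝒢 n] B → ν n B ≤ C * μ (pr 𝒢 B)) :
    ∃ L : Measure (KK 𝒢), ∀ n B, MeasurableSet[lev 𝒢 n] B → L B = ν n B := by
  classical
  have hν' : ∀ n k B, n ≤ k → MeasurableSet[lev 𝒢 n] B → ν k B = ν n B := by
    intro n k B hnk hB
    induction k, hnk using Nat.le_induction with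
    | base => rfl
    | succ k hk ih => rw [hν k B (lev_mono 𝒢 hk _ hB), ih]
  let c : Set (KK 𝒢) → ℝ≥0∞ := fun B => ν (sInf {n | MeasurableSet[lev 𝒢 n] B}) B
  have hc : ∀ n B, MeasurableSet[lev 𝒢 n] B → c B = ν n B := by
    intro n B hB
    have hne : {n | MeasurableSet[lev 𝒢 n] B}.Nonempty := ⟨n, hB⟩
    exact (hν' _ n B (Nat.sInf_le hB) (Nat.sInf_mem hne)).symm
  let M : AddContent ℝ≥0∞ (ring 𝒢) := (isSetRing_ring 𝒢).addContent_of_union c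
    (by rw [hc 0 _ (@MeasurableSet.empty _ (_))]; exact measure_empty (μ := ν 0))
    (by
      rintro s t ⟨n, hn⟩ ⟨k, hk⟩ hd
      have h1 := lev_mono 𝒢 (le_max_left n k) _ hn
      have h2 := lev_mono 𝒢 (le_max_right n k) _ hk
      rw [hc _ _ h1, hc _ _ h2, hc _ _ (h1.union h2)]
      exact @measure_union _ (lev 𝒢 (max n k)) _ _ _ hd h2)
  have hM : ∀ B, M B = c B := fun B => rfl
  have hsub : M.IsSigmaSubadditive := by
    refine isSigmaSubadditive_of_addContent_iUnion_eq_tsum (isSetRing_ring 𝒢) ?_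
    intro f hf hU hd
    refine addContent_iUnion_eq_sum_of_tendsto_zero (isSetRing_ring 𝒢) M ?_ ?_ hf hU hd
    · rintro s ⟨n, hn⟩
      rw [hM, hc n _ hn]
      exact ((hb n s hn).trans_lt (ENNReal.mul_lt_top ENNReal.coe_lt_top (measure_lt_top _ _))).ne
    · intro s hs hanti hem
      have h1 : Tendsto (fun j => μ (pr 𝒢 (s j))) atTop (𝓝 0) := by
        have := tendsto_measure_iInter_atTop (μ := μ) (s := fun j => pr 𝒢 (s j))
          (fun j => (hs j).elim fun n h => (measurableSet_pr h).nullMeasurableSet)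
          (fun i j hij ω ⟨b, hb⟩ => ⟨b, hanti hij hb⟩) ⟨0, measure_ne_top _ _⟩
        rwa [iInter_pr hs hanti hem, measure_empty] at this
      have h2 : Tendsto (fun j => (C : ℝ≥0∞) * μ (pr 𝒢 (s j))) atTop (𝓝 0) := by
        simpa using ENNReal.Tendsto.const_mul h1 (Or.inr ENNReal.coe_ne_top)
      refine tendsto_of_tendsto_of_tendsto_of_le_of_le tendsto_const_nhds h2 (fun _ => zero_le) ?_
      intro j
      obtain ⟨n, hn⟩ := hs j
      show M (s j) ≤ _
      rw [hM, hc n _ hn]; exact hb n _ hn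
  refine ⟨M.measure (isSetRing_ring 𝒢).isSetSemiring (generateFrom_ring 𝒢).le hsub, ?_⟩
  intro n B hB
  rw [AddContent.measure_eq M _ (generateFrom_ring 𝒢) hsub ⟨n, hB⟩, hM, hc n B hB]

end DM

namespace DM

open Topology

variable {Ω : Type*} {m : MeasurableSpace Ω}

/-- bounded measurable random variables -/
def Bd (μ : Measure Ω) (X : Ω → ℝ) : Prop := Measurable X ∧ ∃ C : ℝ, 0 ≤ C ∧ ∀ᵐ ω ∂μ, |X ω| ≤ C

section Bd
variable {μ : Measure Ω}

lemma Bd.of_le {X : Ω → ℝ} (hX : Measurable X) (C : ℝ) (h : ∀ᵐ ω ∂μ, |X ω| ≤ C) : Bd μ X :=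
  ⟨hX, max C 0, le_max_right _ _, h.mono fun _ h => h.trans (le_max_left _ _)⟩

lemma Bd.const (c : ℝ) : Bd μ (fun _ => c) := Bd.of_le measurable_const |c| (by simp)

lemma Bd.add {X Y : Ω → ℝ} (hX : Bd μ X) (hY : Bd μ Y) : Bd μ (fun ω => X ω + Y ω) := by
  obtain ⟨mX, C, hC, bX⟩ := hX; obtain ⟨mY, D, hD, bY⟩ := hY
  refine ⟨mX.add mY, C + D, by positivity, ?_⟩
  filter_upwards [bX, bY] with ω h1 h2
  exact (abs_add_le _ _).trans (add_le_add h1 h2)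

lemma Bd.neg {X : Ω → ℝ} (hX : Bd μ X) : Bd μ (fun ω => - X ω) := by
  obtain ⟨mX, C, hC, bX⟩ := hX
  exact ⟨mX.neg, C, hC, by simpa using bX⟩

lemma Bd.sub {X Y : Ω → ℝ} (hX : Bd μ X) (hY : Bd μ Y) : Bd μ (fun ω => X ω - Y ω) := by
  simpa [sub_eq_add_neg] using hX.add hY.neg

lemma Bd.mul {X Y : Ω → ℝ} (hX : Bd μ X) (hY : Bd μ Y) : Bd μ (fun ω => X ω * Y ω) := by
  obtain ⟨mX, C, hC, bX⟩ := hX; obtain ⟨mY, D, hD, bY⟩ := hY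
  refine ⟨mX.mul mY, C * D, by positivity, ?_⟩
  filter_upwards [bX, bY] with ω h1 h2
  rw [abs_mul]; gcongr

lemma Bd.sq {X : Ω → ℝ} (hX : Bd μ X) : Bd μ (fun ω => X ω ^ 2) := by
  simpa [pow_two] using hX.mul hX

lemma Bd.const_mul {X : Ω → ℝ} (hX : Bd μ X) (c : ℝ) : Bd μ (fun ω => c * X ω) :=
  (Bd.const c).mul hX

lemma Bd.sum {ι : Type*} (s : Finset ι) {X : ι → Ω → ℝ} (hX : ∀ i ∈ s, Bd μ (X i)) :
    Bd μ (fun ω => ∑ i ∈ s, X i ω) := by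
  classical
  induction s using Finset.induction_on with
  | empty => simpa using Bd.const 0
  | insert a s ha ih =>
    simp only [Finset.sum_insert ha]
    exact (hX a (Finset.mem_insert_self a s)).add (ih fun i hi => hX i (Finset.mem_insert_of_mem hi))

lemma Bd.integrable [IsFiniteMeasure μ] {X : Ω → ℝ} (hX : Bd μ X) : Integrable X μ := by
  obtain ⟨mX, C, hC, bX⟩ := hX
  exact Integrable.of_bound mX.aestronglyMeasurable C (by simpa using bX)

lemma Bd.indicator {A : Set Ω} (hA : MeasurableSet A) : Bd μ (A.indicator fun _ => (1 : ℝ)) := by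
  refine Bd.of_le (measurable_const.indicator hA) 1 (ae_of_all _ fun ω => ?_)
  by_cases h : ω ∈ A <;> simp [h]

end Bd

variable (𝒢 : Filtration ℝ m) (μ : Measure Ω)

/-- the closed martingale -/
def mc (X : Ω → ℝ) (s : ℝ) : Ω → ℝ := μ[X | 𝒢 s]

/-- increments along the grid -/
def inc (X : Ω → ℝ) (n i : ℕ) : Ω → ℝ := fun ω => mc 𝒢 μ X (tm n (i + 1)) ω - mc 𝒢 μ X (tm n i) ω

variable {𝒢 μ}

lemma mc_meas (X : Ω → ℝ) (s : ℝ) : Measurable[𝒢 s] (mc 𝒢 μ X s) :=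
  stronglyMeasurable_condExp.measurable

lemma mc_meas' (X : Ω → ℝ) (s : ℝ) : Measurable (mc 𝒢 μ X s) :=
  (mc_meas X s).mono (𝒢.le s) le_rfl

lemma mc_meas_of_le (X : Ω → ℝ) {s t : ℝ} (h : s ≤ t) : Measurable[𝒢 t] (mc 𝒢 μ X s) :=
  (mc_meas X s).mono (𝒢.mono h) le_rfl

lemma mc_bound {X : Ω → ℝ} {C : ℝ} (_hC : 0 ≤ C) (h : ∀ᵐ ω ∂μ, |X ω| ≤ C) (s : ℝ) :
    ∀ᵐ ω ∂μ, |mc 𝒢 μ X s ω| ≤ C := by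
  exact ae_bdd_abs_condExp_of_ae_bdd_abs (m := 𝒢 s) (μ := μ) (R := C) (f := X) h

lemma Bd.mc {X : Ω → ℝ} (hX : Bd μ X) (s : ℝ) : Bd μ (mc 𝒢 μ X s) := by
  obtain ⟨mX, C, hC, bX⟩ := hX
  exact ⟨mc_meas' X s, C, hC, mc_bound hC bX s⟩

lemma Bd.inc {X : Ω → ℝ} (hX : Bd μ X) (n i : ℕ) : Bd μ (inc 𝒢 μ X n i) := (hX.mc _).sub (hX.mc _)

lemma inc_meas' (X : Ω → ℝ) (n i : ℕ) : Measurable (inc 𝒢 μ X n i) := (mc_meas' _ _).sub (mc_meas' _ _)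

variable [IsFiniteMeasure μ]

lemma int_mul_mc {f Z : Ω → ℝ} {t : ℝ} (hf : Measurable[𝒢 t] f) (hfb : Bd μ f) (hZ : Bd μ Z) :
    ∫ ω, f ω * mc 𝒢 μ Z t ω ∂μ = ∫ ω, f ω * Z ω ∂μ := by
  have h := condExp_mul_of_stronglyMeasurable_left (m := 𝒢 t) (μ := μ) (f := f) (g := Z)
    hf.stronglyMeasurable (hfb.mul hZ).integrable hZ.integrable
  have h2 : ∫ ω, (μ[f * Z | 𝒢 t]) ω ∂μ = ∫ ω, (f * Z) ω ∂μ := integral_condExp (𝒢.le t)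
  rw [integral_congr_ae h] at h2
  exact h2

lemma int_mul_mc_le {f Z : Ω → ℝ} {s t : ℝ} (hst : s ≤ t) (hf : Measurable[𝒢 s] f) (hfb : Bd μ f)
    (hZ : Bd μ Z) :
    ∫ ω, f ω * mc 𝒢 μ Z t ω ∂μ = ∫ ω, f ω * mc 𝒢 μ Z s ω ∂μ := by
  rw [int_mul_mc hf hfb hZ, int_mul_mc (hf.mono (𝒢.mono hst) le_rfl) hfb hZ]

lemma pythag {f X : Ω → ℝ} {s t : ℝ} (hst : s ≤ t) (hf : Measurable[𝒢 s] f) (hfb : Bd μ f)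
    (hX : Bd μ X) :
    ∫ ω, f ω * (mc 𝒢 μ X t ω - mc 𝒢 μ X s ω) ^ 2 ∂μ =
      ∫ ω, f ω * mc 𝒢 μ X t ω ^ 2 ∂μ - ∫ ω, f ω * mc 𝒢 μ X s ω ^ 2 ∂μ := by
  have h1 := int_mul_mc_le (μ := μ) (Z := X) hst (hf.mul (mc_meas X s)) (hfb.mul (hX.mc s)) hX
  have e : (fun ω => f ω * (mc 𝒢 μ X t ω - mc 𝒢 μ X s ω) ^ 2) = fun ω =>
      (f ω * mc 𝒢 μ X t ω ^ 2 - f ω * mc 𝒢 μ X s ω ^ 2) -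
      2 * (f ω * mc 𝒢 μ X s ω * mc 𝒢 μ X t ω - f ω * mc 𝒢 μ X s ω * mc 𝒢 μ X s ω) := by
    funext ω; ring
  have i1 := (hfb.mul (hX.mc (𝒢 := 𝒢) t).sq).integrable
  have i2 := (hfb.mul (hX.mc (𝒢 := 𝒢) s).sq).integrable
  have i3 := ((hfb.mul (hX.mc (𝒢 := 𝒢) s)).mul (hX.mc (𝒢 := 𝒢) t)).integrable
  have i4 := ((hfb.mul (hX.mc (𝒢 := 𝒢) s)).mul (hX.mc (𝒢 := 𝒢) s)).integrable
  have j1 : Integrable (fun ω => f ω * mc 𝒢 μ X t ω ^ 2 - f ω * mc 𝒢 μ X s ω ^ 2) μ := i1.sub i2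
  have j2 : Integrable (fun ω => f ω * mc 𝒢 μ X s ω * mc 𝒢 μ X t ω
    - f ω * mc 𝒢 μ X s ω * mc 𝒢 μ X s ω) μ := i3.sub i4
  rw [e, integral_sub j1 (j2.const_mul 2), integral_sub i1 i2, integral_const_mul,
    integral_sub i3 i4]
  simp only [Pi.mul_apply] at h1
  rw [h1]; ring

/-- the discrete content at level `n` -/
def dn (𝒢 : Filtration ℝ m) (μ : Measure Ω) (X : Ω → ℝ) (n : ℕ) : @Measure (KK 𝒢) (lev 𝒢 n) :=
  ∑ i ∈ Finset.range (2 ^ n),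
    @Measure.map _ _ m (lev 𝒢 n) (sec 𝒢 n i) (μ.withDensity fun ω => ENNReal.ofReal (inc 𝒢 μ X n i ω ^ 2))

lemma dn_apply (X : Ω → ℝ) (n : ℕ) {B : Set (KK 𝒢)} (hB : MeasurableSet[lev 𝒢 n] B) :
    dn 𝒢 μ X n B = ∑ i ∈ Finset.range (2 ^ n),
      ∫⁻ ω in sec 𝒢 n i ⁻¹' B, ENNReal.ofReal (inc 𝒢 μ X n i ω ^ 2) ∂μ := by
  rw [dn, Measure.finsetSum_apply]
  refine Finset.sum_congr rfl fun i hi => ?_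
  have hs := measurable_sec 𝒢 (Finset.mem_range.1 hi)
  rw [Measure.map_apply hs hB, withDensity_apply _ (hs hB)]

lemma setLI_eq {X : Ω → ℝ} (hX : Bd μ X) {A : Set Ω} {s t : ℝ} (hst : s ≤ t)
    (hA : MeasurableSet[𝒢 s] A) :
    ∫⁻ ω in A, ENNReal.ofReal ((mc 𝒢 μ X t ω - mc 𝒢 μ X s ω) ^ 2) ∂μ = ENNReal.ofReal
      (∫ ω, A.indicator (fun _ => (1:ℝ)) ω * mc 𝒢 μ X t ω ^ 2 ∂μ
        - ∫ ω, A.indicator (fun _ => (1:ℝ)) ω * mc 𝒢 μ X s ω ^ 2 ∂μ) := by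
  have hAm := 𝒢.le s _ hA
  rw [← pythag hst (measurable_const.indicator hA) (Bd.indicator hAm) hX,
    ← ofReal_integral_eq_lintegral_ofReal, ← integral_indicator hAm]
  · congr 2; funext ω; by_cases h : ω ∈ A <;> simp [h]
  · exact ((hX.mc t).sub (hX.mc s)).sq.integrable.integrableOn
  · exact ae_of_all _ fun ω => by positivity

lemma pyth_nonneg {X f : Ω → ℝ} (hX : Bd μ X) {s t : ℝ} (hst : s ≤ t)
    (hf : Measurable[𝒢 s] f) (hfb : Bd μ f) (h0 : ∀ ω, 0 ≤ f ω) :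
    ∫ ω, f ω * mc 𝒢 μ X s ω ^ 2 ∂μ ≤ ∫ ω, f ω * mc 𝒢 μ X t ω ^ 2 ∂μ := by
  have := pythag hst hf hfb hX
  have h2 : 0 ≤ ∫ ω, f ω * (mc 𝒢 μ X t ω - mc 𝒢 μ X s ω) ^ 2 ∂μ :=
    integral_nonneg fun ω => mul_nonneg (h0 ω) (sq_nonneg _)
  linarith

lemma sec_preimage_succ {n i : ℕ} (hi : i < 2 ^ n) {B : Set (KK 𝒢)} (hB : MeasurableSet[lev 𝒢 n] B)
    (e : ℕ) (he : e < 2) : sec 𝒢 (n + 1) (2 * i + e) ⁻¹' B = sec 𝒢 n i ⁻¹' B := by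
  obtain ⟨C, hC, rfl⟩ := hB
  have h1 : 2 * i + e < 2 ^ (n + 1) := by rw [pow_succ]; omega
  ext ω
  simp only [sec, mem_preimage, mem_ofPred_eq, idx_br hi]
  rw [← idx_succ_div, idx_br h1]
  have : (2 * i + e) / 2 = i := by omega
  rw [this]

lemma sum_pairs (f : ℕ → ℝ≥0∞) (N : ℕ) :
    ∑ j ∈ Finset.range (2 * N), f j = ∑ i ∈ Finset.range N, (f (2 * i) + f (2 * i + 1)) := by
  induction N with
  | zero => simp
  | succ N ih =>
    rw [Finset.sum_range_succ, ← ih, show 2 * (N + 1) = 2 * N + 1 + 1 by ring,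
      Finset.sum_range_succ, Finset.sum_range_succ]
    ring

lemma tm_succ' (n i : ℕ) : tm (n + 1) (2 * i + 1 + 1) = tm n (i + 1) := tm_succ n (i + 1)

lemma dn_succ {X : Ω → ℝ} (hX : Bd μ X) (n : ℕ) {B : Set (KK 𝒢)} (hB : MeasurableSet[lev 𝒢 n] B) :
    dn 𝒢 μ X (n + 1) B = dn 𝒢 μ X n B := by
  rw [dn_apply X n hB, dn_apply X (n + 1) (lev_succ 𝒢 n _ hB), pow_succ, mul_comm, sum_pairs]
  refine Finset.sum_congr rfl fun i hi => ?_
  have hi' := Finset.mem_range.1 hi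
  have h0 := sec_preimage_succ hi' hB 0 (by norm_num)
  rw [add_zero] at h0
  rw [h0, sec_preimage_succ hi' hB 1 (by norm_num)]
  have hA := measurable_sec' 𝒢 hi' hB
  set A := sec 𝒢 n i ⁻¹' B
  have t1 : tm n i ≤ tm (n + 1) (2 * i + 1) := by
    rw [← tm_succ n i]; exact tm_mono (n + 1) (Nat.le_succ _)
  have t2 : tm (n + 1) (2 * i + 1) ≤ tm n (i + 1) := by
    rw [← tm_succ' n i]; exact tm_mono (n + 1) (Nat.le_succ _)
  simp only [inc, tm_succ', tm_succ]
  rw [setLI_eq hX t1 hA, setLI_eq hX t2 (𝒢.mono t1 _ hA), setLI_eq hX (t1.trans t2) hA,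
    ← ENNReal.ofReal_add]
  · congr 1; ring
  all_goals
    rw [sub_nonneg]
  · exact pyth_nonneg hX t1 (measurable_const.indicator hA) (Bd.indicator (𝒢.le _ _ hA))
      (fun ω => indicator_nonneg (by simp) _)
  · exact pyth_nonneg hX t2 (measurable_const.indicator (𝒢.mono t1 _ hA)) (Bd.indicator (𝒢.le _ _ hA))
      (fun ω => indicator_nonneg (by simp) _)

lemma dn_bound {X : Ω → ℝ} {C : ℝ} (hC : 0 ≤ C) (hX : Measurable X) (hXC : ∀ᵐ ω ∂μ, |X ω| ≤ C)
    (n : ℕ) {B : Set (KK 𝒢)}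
    (hB : MeasurableSet[lev 𝒢 n] B) :
    dn 𝒢 μ X n B ≤ ((C ^ 2).toNNReal : ℝ≥0) * μ (pr 𝒢 B) := by
  have hXb : Bd μ X := Bd.of_le hX C hXC
  set A : ℕ → Set Ω := fun i => sec 𝒢 n i ⁻¹' B with hA
  set U : ℕ → Set Ω := fun N => ⋃ i ∈ Finset.range N, A i with hU
  have hAm : ∀ i < 2 ^ n, MeasurableSet[𝒢 (tm n i)] (A i) := fun i hi => measurable_sec' 𝒢 hi hB
  have hUm : ∀ N ≤ 2 ^ n, ∀ j, N ≤ j + 1 → MeasurableSet[𝒢 (tm n j)] (U N) := by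
    intro N hN j hj
    refine @Finset.measurableSet_biUnion _ _ (𝒢 (tm n j)) _ _ fun i hi => ?_
    have := Finset.mem_range.1 hi
    exact 𝒢.mono (tm_mono n (by omega)) _ (hAm i (by omega))
  have hUm' : ∀ N ≤ 2 ^ n, MeasurableSet (U N) := fun N hN => 𝒢.le _ _ (hUm N hN N (by omega))
  have key : ∀ N ≤ 2 ^ n, ∑ i ∈ Finset.range N, ∫⁻ ω in A i, ENNReal.ofReal (inc 𝒢 μ X n i ω ^ 2) ∂μ
      ≤ ENNReal.ofReal (∫ ω, (U N).indicator (fun _ => (1:ℝ)) ω * mc 𝒢 μ X (tm n N) ω ^ 2 ∂μ) := by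
    intro N
    induction N with
    | zero => simp
    | succ N ih =>
      intro hN
      rw [Finset.sum_range_succ]
      have h1 := ih (by omega)
      have hsub : A N ⊆ U (N + 1) := by
        intro ω hω; simp only [hU, mem_iUnion]; exact ⟨N, by simp, hω⟩
      have hsub2 : U N ⊆ U (N + 1) := by
        intro ω hω; simp only [hU, mem_iUnion, Finset.mem_range] at hω ⊢
        obtain ⟨i, hi, h⟩ := hω; exact ⟨i, by omega, h⟩
      have hm1 := hUm (N + 1) hN N le_rfl
      have h2 : ∫⁻ ω in A N, ENNReal.ofReal (inc 𝒢 μ X n N ω ^ 2) ∂μ ≤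
          ∫⁻ ω in U (N + 1), ENNReal.ofReal (inc 𝒢 μ X n N ω ^ 2) ∂μ :=
        lintegral_mono_set hsub
      simp only [inc] at h2
      rw [setLI_eq hXb (tm_mono n (Nat.le_succ N)) hm1] at h2
      have h3 : ∫ ω, (U N).indicator (fun _ => (1:ℝ)) ω * mc 𝒢 μ X (tm n N) ω ^ 2 ∂μ ≤
          ∫ ω, (U (N+1)).indicator (fun _ => (1:ℝ)) ω * mc 𝒢 μ X (tm n N) ω ^ 2 ∂μ := by
        refine integral_mono ((Bd.indicator (hUm' N (by omega))).mul (hXb.mc _).sq).integrable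
          ((Bd.indicator (hUm' (N+1) hN)).mul (hXb.mc _).sq).integrable fun ω => ?_
        exact mul_le_mul_of_nonneg_right (indicator_le_indicator_of_subset hsub2 (fun _ => zero_le_one) ω) (sq_nonneg _)
      have h4 := pyth_nonneg (f := (U (N+1)).indicator (fun _ => (1:ℝ))) hXb
        (tm_mono n (Nat.le_succ N)) (measurable_const.indicator hm1)
        (Bd.indicator (hUm' (N+1) hN)) (fun ω => indicator_nonneg (by simp) _)
      refine (add_le_add h1 h2).trans ?_
      rw [← ENNReal.ofReal_add]
      · apply ENNReal.ofReal_le_ofReal; linarith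
      · exact integral_nonneg fun ω => mul_nonneg (indicator_nonneg (by simp) _) (sq_nonneg _)
      · linarith
  rw [dn_apply X n hB]
  refine (key (2 ^ n) le_rfl).trans ?_
  have hpr : pr 𝒢 B = U (2 ^ n) := pr_eq hB
  rw [hpr]
  have : ∫ ω, (U (2^n)).indicator (fun _ => (1:ℝ)) ω * mc 𝒢 μ X (tm n (2^n)) ω ^ 2 ∂μ ≤
      ∫ ω, (U (2^n)).indicator (fun _ => C ^ 2) ω ∂μ := by
    refine integral_mono_ae ((Bd.indicator (hUm' _ le_rfl)).mul (hXb.mc _).sq).integrable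
      ((integrable_const _).indicator (hUm' _ le_rfl)) ?_
    filter_upwards [mc_bound (𝒢 := 𝒢) hC hXC (tm n (2 ^ n))] with ω hω
    have : mc 𝒢 μ X (tm n (2^n)) ω ^ 2 ≤ C ^ 2 := sq_le_sq' (by linarith [abs_le.1 hω]) (abs_le.1 hω).2
    by_cases h : ω ∈ U (2 ^ n) <;> simp [h, this]
  refine (ENNReal.ofReal_le_ofReal this).trans ?_
  rw [integral_indicator (hUm' _ le_rfl), setIntegral_const, smul_eq_mul, mul_comm,
    ENNReal.ofReal_mul (by positivity), measureReal_def, ENNReal.ofReal_toReal (measure_ne_top _ _)]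
  rfl

theorem exists_dm {X : Ω → ℝ} (hX : Bd μ X) :
    ∃ L : Measure (KK 𝒢), ∀ n B, MeasurableSet[lev 𝒢 n] B → L B = dn 𝒢 μ X n B := by
  obtain ⟨mX, C, hC, bX⟩ := hX
  exact exists_limit_measure μ (dn 𝒢 μ X) (C ^ 2).toNNReal
    (fun n B hB => dn_succ (Bd.of_le mX C bX) n hB) (fun n B hB => dn_bound hC mX bX n hB)

open Classical in
/-- Doléans measure of a bounded martingale -/
def dm (𝒢 : Filtration ℝ m) (μ : Measure Ω) [IsFiniteMeasure μ] (X : Ω → ℝ) : Measure (KK 𝒢) :=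
  if hX : Bd μ X then (exists_dm (𝒢 := 𝒢) hX).choose else 0

lemma dm_apply {X : Ω → ℝ} (hX : Bd μ X) {n : ℕ} {B : Set (KK 𝒢)} (hB : MeasurableSet[lev 𝒢 n] B) :
    dm 𝒢 μ X B = dn 𝒢 μ X n B := by
  rw [dm, dif_pos hX]; exact (exists_dm hX).choose_spec n B hB

instance dm_finite (X : Ω → ℝ) : IsFiniteMeasure (dm 𝒢 μ X) := by
  by_cases hX : Bd μ X
  · constructor
    obtain ⟨mX, C, hC, bX⟩ := id hX
    rw [dm_apply hX (n := 0) (@MeasurableSet.univ _ (_))]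
    exact (dn_bound hC mX bX 0 (@MeasurableSet.univ _ (_))).trans_lt
      (ENNReal.mul_lt_top ENNReal.coe_lt_top (measure_lt_top _ _))
  · rw [dm, dif_neg hX]; infer_instance

lemma dm_null {X : Ω → ℝ} {p : Ω → Prop}
    (hnull : ∀ s, MeasurableSet s → μ s = 0 → MeasurableSet[𝒢 0] s)
    (hp : ∀ᵐ ω ∂μ, p ω) : ∀ᵐ k ∂(dm 𝒢 μ X), p k.fst := by
  by_cases hX : Bd μ X
  · obtain ⟨mX, C, hC, bX⟩ := id hX
    have h0 : μ {ω | ¬ p ω} = 0 := hp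
    obtain ⟨N, hN, hNm, hN0⟩ := exists_measurable_superset_of_null h0
    have hB : MeasurableSet[lev 𝒢 0] {k : KK 𝒢 | k.fst ∈ N} :=
      ⟨fun _ => N, fun i => 𝒢.mono (by unfold tm; positivity) _ (hnull N hNm hN0), rfl⟩
    have h1 : dm 𝒢 μ X {k : KK 𝒢 | k.fst ∈ N} = 0 := by
      rw [dm_apply hX hB]
      refine le_antisymm ((dn_bound hC mX bX 0 hB).trans ?_) zero_le
      have : pr 𝒢 {k : KK 𝒢 | k.fst ∈ N} ⊆ N := by rintro ω ⟨b, hb⟩; exact hb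
      rw [measure_mono_null this hN0]; simp
    refine measure_mono_null ?_ h1
    intro k hk; exact hN hk
  · rw [dm, dif_neg hX]; simp

lemma dm_trim {X : Ω → ℝ} (hX : Bd μ X) (n : ℕ) : (dm 𝒢 μ X).trim (lev_le 𝒢 n) = dn 𝒢 μ X n := by
  refine @Measure.ext _ (lev 𝒢 n) _ _ fun B hB => ?_
  rw [trim_measurableSet_eq _ hB, dm_apply hX hB]

lemma dm_lintegral {X : Ω → ℝ} (hX : Bd μ X) {n : ℕ} {ψ : KK 𝒢 → ℝ≥0∞} (hψ : Measurable[lev 𝒢 n] ψ) :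
    ∫⁻ k, ψ k ∂(dm 𝒢 μ X) = ∑ i ∈ Finset.range (2 ^ n),
      ∫⁻ ω, ENNReal.ofReal (inc 𝒢 μ X n i ω ^ 2) * ψ (sec 𝒢 n i ω) ∂μ := by
  rw [← lintegral_trim (lev_le 𝒢 n) hψ, dm_trim hX, dn, lintegral_finsetSum_measure]
  refine Finset.sum_congr rfl fun i hi => ?_
  have hs := measurable_sec 𝒢 (Finset.mem_range.1 hi)
  rw [@lintegral_map _ _ m (lev 𝒢 n) _ _ _ hψ hs, lintegral_withDensity_eq_lintegral_mul (g := fun ω => ψ (sec 𝒢 n i ω)) _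
    ((inc_meas' X n i).pow_const 2).ennreal_ofReal (hψ.comp hs)]
  rfl

/-- level-n bounded adapted processes -/
def Pn (𝒢 : Filtration ℝ m) (n : ℕ) (f : ℕ → Ω → ℝ) : Prop :=
  (∀ i, Measurable[𝒢 (tm n i)] (f i)) ∧ ∃ C : ℝ, ∀ i ω, |f i ω| ≤ C

lemma Pn.bd {n : ℕ} {f : ℕ → Ω → ℝ} (hf : Pn 𝒢 n f) (i : ℕ) : Bd μ (f i) :=
  hf.2.elim fun C hC => Bd.of_le ((hf.1 i).mono (𝒢.le _) le_rfl) C (ae_of_all _ fun ω => hC i ω)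

lemma Pn.lift_meas {n : ℕ} {f : ℕ → Ω → ℝ} (hf : Pn 𝒢 n f) : Measurable (lift 𝒢 n f) :=
  (measurable_lift hf.1).mono (lev_le 𝒢 n) le_rfl

lemma Pn.lift_integrable {n : ℕ} {f : ℕ → Ω → ℝ} (hf : Pn 𝒢 n f) (L : Measure (KK 𝒢)) [IsFiniteMeasure L] :
    Integrable (lift 𝒢 n f) L :=
  hf.2.elim fun C hC => Integrable.of_bound hf.lift_meas.aestronglyMeasurable C
    (ae_of_all _ fun _ => hC _ _)

lemma dm_integral {X : Ω → ℝ} (hX : Bd μ X) {n : ℕ} {f : ℕ → Ω → ℝ} (hf : Pn 𝒢 n f) :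
    ∫ k, lift 𝒢 n f k ∂(dm 𝒢 μ X) = ∑ i ∈ Finset.range (2 ^ n),
      ∫ ω, f i ω * inc 𝒢 μ X n i ω ^ 2 ∂μ := by
  have pos : ∀ g : ℕ → Ω → ℝ, Pn 𝒢 n g → (∀ i ω, 0 ≤ g i ω) → ∫ k, lift 𝒢 n g k ∂(dm 𝒢 μ X) =
      ∑ i ∈ Finset.range (2 ^ n), ∫ ω, g i ω * inc 𝒢 μ X n i ω ^ 2 ∂μ := by
    intro g hg h0
    rw [integral_eq_lintegral_of_nonneg_ae (ae_of_all _ fun k => h0 (idx n k.snd) k.fst : 0 ≤ᵐ[dm 𝒢 μ X] lift 𝒢 n g)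
      hg.lift_meas.aestronglyMeasurable,
      dm_lintegral hX (measurable_lift hg.1).ennreal_ofReal, ENNReal.toReal_sum]
    · refine Finset.sum_congr rfl fun i hi => ?_
      have hi := Finset.mem_range.1 hi
      rw [integral_eq_lintegral_of_nonneg_ae]
      · congr 1
        refine lintegral_congr fun ω => ?_
        rw [lift_sec 𝒢 hi, ← ENNReal.ofReal_mul (sq_nonneg _), mul_comm]
      · exact ae_of_all _ fun ω => mul_nonneg (h0 _ _) (sq_nonneg _)
      · exact ((hg.bd i).mul (hX.inc n i).sq).1.aestronglyMeasurable
    · intro i hi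
      have hi := Finset.mem_range.1 hi
      simp only [lift_sec 𝒢 hi, ← ENNReal.ofReal_mul (sq_nonneg _)]
      exact (((hX.inc n i).sq.mul (hg.bd i)).integrable.lintegral_lt_top).ne
  obtain ⟨C, hC⟩ := id hf.2
  have p1 : Pn 𝒢 n (fun i ω => C + f i ω) := ⟨fun i => measurable_const.add (hf.1 i), |C| + C,
    fun i ω => (abs_add_le _ _).trans (add_le_add le_rfl (hC i ω))⟩
  have p2 : Pn 𝒢 n (fun i ω => C) := ⟨fun i => measurable_const, |C|, fun i ω => le_rfl⟩
  have h1 := pos _ p1 (fun i ω => by linarith [(abs_le.1 (hC i ω)).1])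
  have h2 := pos _ p2 (fun i ω => (abs_nonneg _).trans (hC i ω))
  have e : lift 𝒢 n (fun i ω => C + f i ω) = fun k => lift 𝒢 n (fun i ω => C) k + lift 𝒢 n f k := rfl
  rw [e, integral_add (p2.lift_integrable _) (hf.lift_integrable _), h2] at h1
  have e2 : ∀ i ∈ Finset.range (2 ^ n), ∫ ω, (C + f i ω) * inc 𝒢 μ X n i ω ^ 2 ∂μ =
      ∫ ω, C * inc 𝒢 μ X n i ω ^ 2 ∂μ + ∫ ω, f i ω * inc 𝒢 μ X n i ω ^ 2 ∂μ := by
    intro i hi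
    rw [← integral_add (((hX.inc n i).sq.const_mul C)).integrable
      ((hf.bd i).mul (hX.inc n i).sq).integrable]
    congr 1; funext ω; ring
  rw [Finset.sum_congr rfl e2, Finset.sum_add_distrib] at h1
  exact add_left_cancel h1

end DM

namespace DM

open Topology

variable {Ω : Type*} {m : MeasurableSpace Ω} {𝒢 : Filtration ℝ m} {μ : Measure Ω} [IsFiniteMeasure μ]

lemma inc_add {X Y : Ω → ℝ} (hX : Bd μ X) (hY : Bd μ Y) (n i : ℕ) :
    ∀ᵐ ω ∂μ, inc 𝒢 μ (fun ω => X ω + Y ω) n i ω = inc 𝒢 μ X n i ω + inc 𝒢 μ Y n i ω := by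
  filter_upwards [condExp_add hX.integrable hY.integrable (𝒢 (tm n i)),
    condExp_add hX.integrable hY.integrable (𝒢 (tm n (i+1)))] with ω h1 h2
  have h1 : (μ[fun ω => X ω + Y ω | 𝒢 (tm n i)]) ω = _ := h1
  have h2 : (μ[fun ω => X ω + Y ω | 𝒢 (tm n (i+1))]) ω = _ := h2
  simp only [inc, mc, h1, h2, Pi.add_apply]; ring

lemma inc_sub {X Y : Ω → ℝ} (hX : Bd μ X) (hY : Bd μ Y) (n i : ℕ) :
    ∀ᵐ ω ∂μ, inc 𝒢 μ (fun ω => X ω - Y ω) n i ω = inc 𝒢 μ X n i ω - inc 𝒢 μ Y n i ω := by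
  filter_upwards [condExp_sub hX.integrable hY.integrable (𝒢 (tm n i)),
    condExp_sub hX.integrable hY.integrable (𝒢 (tm n (i+1)))] with ω h1 h2
  have h1 : (μ[fun ω => X ω - Y ω | 𝒢 (tm n i)]) ω = _ := h1
  have h2 : (μ[fun ω => X ω - Y ω | 𝒢 (tm n (i+1))]) ω = _ := h2
  simp only [inc, mc, h1, h2, Pi.sub_apply]; ring

lemma mc_const_mul (X : Ω → ℝ) (c s : ℝ) :
    ∀ᵐ ω ∂μ, mc 𝒢 μ (fun ω => c * X ω) s ω = c * mc 𝒢 μ X s ω :=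
  condExp_smul (μ := μ) c X (𝒢 s)

lemma mc_add {X Y : Ω → ℝ} (hX : Bd μ X) (hY : Bd μ Y) (s : ℝ) :
    ∀ᵐ ω ∂μ, mc 𝒢 μ (fun ω => X ω + Y ω) s ω = mc 𝒢 μ X s ω + mc 𝒢 μ Y s ω :=
  condExp_add hX.integrable hY.integrable (𝒢 s)

lemma mc_sub {X Y : Ω → ℝ} (hX : Bd μ X) (hY : Bd μ Y) (s : ℝ) :
    ∀ᵐ ω ∂μ, mc 𝒢 μ (fun ω => X ω - Y ω) s ω = mc 𝒢 μ X s ω - mc 𝒢 μ Y s ω :=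
  condExp_sub hX.integrable hY.integrable (𝒢 s)

lemma inc_const_mul (X : Ω → ℝ) (c : ℝ) (n i : ℕ) :
    ∀ᵐ ω ∂μ, inc 𝒢 μ (fun ω => c * X ω) n i ω = c * inc 𝒢 μ X n i ω := by
  filter_upwards [mc_const_mul (μ := μ) (𝒢 := 𝒢) X c (tm n i), mc_const_mul (μ := μ) (𝒢 := 𝒢) X c (tm n (i+1))] with ω h1 h2
  simp only [inc, h1, h2]; ring

lemma inc_sum {ι : Type*} (s : Finset ι) {X : ι → Ω → ℝ} (hX : ∀ a, Bd μ (X a)) (c : ι → ℝ) (n i : ℕ) :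
    ∀ᵐ ω ∂μ, inc 𝒢 μ (fun ω => ∑ a ∈ s, c a * X a ω) n i ω = ∑ a ∈ s, c a * inc 𝒢 μ (X a) n i ω := by
  classical
  induction s using Finset.induction_on with
  | empty =>
    simp only [Finset.sum_empty]
    filter_upwards [inc_const_mul (μ := μ) (𝒢 := 𝒢) (fun _ => 0) 0 n i] with ω h
    simpa using h
  | insert a s ha ih =>
    simp only [Finset.sum_insert ha]
    filter_upwards [ih, inc_const_mul (μ := μ) (𝒢 := 𝒢) (X a) (c a) n i,
      inc_add (𝒢 := 𝒢) ((hX a).const_mul (c a)) (Bd.sum s fun b _ => (hX b).const_mul (c b)) n i] with ω h1 h2 h3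
    rw [h3, h1, h2]

/-- uniqueness -/
lemma unique_zero (L : Measure (KK 𝒢)) [IsFiniteMeasure L] {g : KK 𝒢 → ℝ} (hg : Integrable g L)
    (h : ∀ n f, Pn 𝒢 n f → ∫ k, lift 𝒢 n f k * g k ∂L = 0) : g =ᵐ[L] 0 := by
  have hb : ∀ B ∈ ring 𝒢, ∫ k in B, g k ∂L = 0 := by
    rintro B ⟨n, hB⟩
    have hBm := lev_le 𝒢 n _ hB
    obtain ⟨C, hC, rfl⟩ := id hB
    have hP : Pn 𝒢 n (fun i => (C i).indicator fun _ => (1:ℝ)) :=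
      ⟨fun i => measurable_const.indicator (hC i), 1, fun i ω => by by_cases h : ω ∈ C i <;> simp [h]⟩
    rw [← integral_indicator hBm, ← h n _ hP]
    congr 1; funext k
    by_cases hk : k.fst ∈ C (idx n k.snd) <;> simp [lift, hk]
  have huniv : ∫ k, g k ∂L = 0 := by
    have := hb univ ⟨0, @MeasurableSet.univ _ (_)⟩
    simpa using this
  have hall : ∀ B, MeasurableSet B → ∫ k in B, g k ∂L = 0 := by
    intro B hB
    induction B, hB using MeasurableSpace.induction_on_inter (generateFrom_ring 𝒢) (isPiSystem_ring 𝒢) with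
    | empty => simp
    | basic t ht => exact hb t ht
    | compl t ht ih =>
      have := integral_add_compl ht hg
      rw [ih, huniv] at this; linarith
    | iUnion f hd hm ih =>
      rw [integral_iUnion hm hd hg.integrableOn]; simp [ih]
  refine ae_eq_zero_of_forall_setIntegral_eq_of_sigmaFinite (fun s hs _ => hg.integrableOn) fun s hs _ => hall s hs

lemma unique_eq (L : Measure (KK 𝒢)) [IsFiniteMeasure L] {g g' : KK 𝒢 → ℝ} (hg : Integrable g L)
    (hg' : Integrable g' L)
    (h : ∀ n f, Pn 𝒢 n f → ∫ k, lift 𝒢 n f k * g k ∂L = ∫ k, lift 𝒢 n f k * g' k ∂L) : g =ᵐ[L] g' := by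
  have bm : ∀ n f, Pn 𝒢 n f → ∀ {g : KK 𝒢 → ℝ}, Integrable g L → Integrable (fun k => lift 𝒢 n f k * g k) L := by
    intro n f hf g hg
    obtain ⟨C, hC⟩ := hf.2
    exact hg.bdd_mul (c := C) hf.lift_meas.aestronglyMeasurable (ae_of_all _ fun k => by simpa [lift] using hC _ _)
  have := unique_zero L (hg.sub hg') fun n f hf => by
    have e : (fun k => lift 𝒢 n f k * (g - g') k) = fun k => lift 𝒢 n f k * g k - lift 𝒢 n f k * g' k := by
      funext k; simp [mul_sub]
    rw [e, integral_sub (bm n f hf hg) (bm n f hf hg'), h n f hf, sub_self]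
  filter_upwards [this] with k hk
  simpa [sub_eq_zero] using hk

lemma Pn.mul_int {n : ℕ} {f : ℕ → Ω → ℝ} (hf : Pn 𝒢 n f) {L : Measure (KK 𝒢)} {g : KK 𝒢 → ℝ}
    (hg : Integrable g L) : Integrable (fun k => lift 𝒢 n f k * g k) L := by
  obtain ⟨C, hC⟩ := hf.2
  exact hg.bdd_mul (c := C) hf.lift_meas.aestronglyMeasurable (ae_of_all _ fun k => by simpa [lift] using hC _ _)

lemma dm_parallelogram {X Y : Ω → ℝ} (hX : Bd μ X) (hY : Bd μ Y) :
    dm 𝒢 μ (fun ω => X ω + Y ω) + dm 𝒢 μ (fun ω => X ω - Y ω) =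
      (2 : ℝ≥0) • dm 𝒢 μ X + (2 : ℝ≥0) • dm 𝒢 μ Y := by
  have key : ∀ B ∈ ring 𝒢, (dm 𝒢 μ (fun ω => X ω + Y ω) + dm 𝒢 μ (fun ω => X ω - Y ω)) B =
      ((2 : ℝ≥0) • dm 𝒢 μ X + (2 : ℝ≥0) • dm 𝒢 μ Y) B := by
    rintro B ⟨n, hB⟩
    simp only [Measure.add_apply, Measure.smul_apply]
    rw [dm_apply (hX.add hY) hB, dm_apply (hX.sub hY) hB, dm_apply hX hB, dm_apply hY hB,
      dn_apply _ n hB, dn_apply _ n hB, dn_apply _ n hB, dn_apply _ n hB]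
    simp only [ENNReal.smul_def, smul_eq_mul]
    rw [Finset.mul_sum, Finset.mul_sum, ← Finset.sum_add_distrib, ← Finset.sum_add_distrib]
    refine Finset.sum_congr rfl fun i hi => ?_
    have mm : ∀ Z : Ω → ℝ, Measurable fun ω => ENNReal.ofReal (inc 𝒢 μ Z n i ω ^ 2) := fun Z =>
      ((inc_meas' Z n i).pow_const 2).ennreal_ofReal
    rw [← lintegral_const_mul _ (mm X), ← lintegral_const_mul _ (mm Y), ← lintegral_add_left (mm _),
      ← lintegral_add_left ((mm X).const_mul _)]
    refine lintegral_congr_ae ?_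
    filter_upwards [ae_restrict_of_ae (inc_add (𝒢 := 𝒢) hX hY n i), ae_restrict_of_ae (inc_sub (𝒢 := 𝒢) hX hY n i)] with ω h1 h2
    rw [h1, h2, show ((2:ℝ≥0):ℝ≥0∞) = ENNReal.ofReal 2 by simp, ← ENNReal.ofReal_mul (by norm_num),
      ← ENNReal.ofReal_mul (by norm_num), ← ENNReal.ofReal_add (by positivity) (by positivity),
      ← ENNReal.ofReal_add (by positivity) (by positivity)]
    congr 1; ring
  refine ext_of_generate_finite _ (generateFrom_ring 𝒢) (isPiSystem_ring 𝒢) key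
    (key univ ⟨0, @MeasurableSet.univ _ (_)⟩)

/-- bounded variables dominated by `L` -/
def AC (𝒢 : Filtration ℝ m) (μ : Measure Ω) [IsFiniteMeasure μ] (L : Measure (KK 𝒢)) (X : Ω → ℝ) : Prop :=
  Bd μ X ∧ dm 𝒢 μ X ≪ L

lemma ac_of_add {α : Type*} {mα : MeasurableSpace α} {a b c d L : Measure α} (h : a + b = (2:ℝ≥0) • c + (2:ℝ≥0) • d)
    (hc : c ≪ L) (hd : d ≪ L) : a ≪ L ∧ b ≪ L := by
  have : a + b ≪ L := by
    rw [h]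
    refine Measure.AbsolutelyContinuous.mk fun s hs h0 => ?_
    simp [hc h0, hd h0]
  exact ⟨(Measure.absolutelyContinuous_of_le (Measure.le_add_right le_rfl)).trans this,
    (Measure.absolutelyContinuous_of_le (Measure.le_add_left le_rfl)).trans this⟩

lemma AC.add {L : Measure (KK 𝒢)} {X Y : Ω → ℝ} (hX : AC 𝒢 μ L X) (hY : AC 𝒢 μ L Y) :
    AC 𝒢 μ L (fun ω => X ω + Y ω) := ⟨hX.1.add hY.1, (ac_of_add (dm_parallelogram hX.1 hY.1) hX.2 hY.2).1⟩

lemma AC.sub {L : Measure (KK 𝒢)} {X Y : Ω → ℝ} (hX : AC 𝒢 μ L X) (hY : AC 𝒢 μ L Y) :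
    AC 𝒢 μ L (fun ω => X ω - Y ω) := ⟨hX.1.sub hY.1, (ac_of_add (dm_parallelogram hX.1 hY.1) hX.2 hY.2).2⟩

lemma dm_const_mul {X : Ω → ℝ} (hX : Bd μ X) (c : ℝ) :
    dm 𝒢 μ (fun ω => c * X ω) = (c ^ 2).toNNReal • dm 𝒢 μ X := by
  have key : ∀ B ∈ ring 𝒢, dm 𝒢 μ (fun ω => c * X ω) B = ((c ^ 2).toNNReal • dm 𝒢 μ X) B := by
    rintro B ⟨n, hB⟩
    simp only [Measure.smul_apply]
    rw [dm_apply (hX.const_mul c) hB, dm_apply hX hB, dn_apply _ n hB, dn_apply _ n hB]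
    simp only [ENNReal.smul_def, smul_eq_mul]
    rw [Finset.mul_sum]
    refine Finset.sum_congr rfl fun i hi => ?_
    rw [← lintegral_const_mul _ ((inc_meas' X n i).pow_const 2).ennreal_ofReal]
    refine lintegral_congr_ae ?_
    filter_upwards [ae_restrict_of_ae (inc_const_mul (μ := μ) (𝒢 := 𝒢) X c n i)] with ω h1
    rw [h1, mul_pow, ENNReal.ofReal_mul (sq_nonneg _)]; rfl
  refine ext_of_generate_finite _ (generateFrom_ring 𝒢) (isPiSystem_ring 𝒢) key
    (key univ ⟨0, @MeasurableSet.univ _ (_)⟩)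

lemma AC.const_mul {L : Measure (KK 𝒢)} {X : Ω → ℝ} (hX : AC 𝒢 μ L X) (c : ℝ) :
    AC 𝒢 μ L (fun ω => c * X ω) := ⟨hX.1.const_mul c, by
  rw [dm_const_mul hX.1]
  exact Measure.AbsolutelyContinuous.smul_left hX.2 _⟩

lemma AC.zero {L : Measure (KK 𝒢)} : AC 𝒢 μ L (fun ω => 0) := by
  refine ⟨Bd.const 0, ?_⟩
  have := dm_const_mul (𝒢 := 𝒢) (Bd.const (μ := μ) 0) 0
  simp only [zero_mul] at this
  rw [this]; simp

lemma AC.sum {L : Measure (KK 𝒢)} {ι : Type*} (s : Finset ι) {X : ι → Ω → ℝ} (hX : ∀ a ∈ s, AC 𝒢 μ L (X a)) :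
    AC 𝒢 μ L (fun ω => ∑ a ∈ s, X a ω) := by
  classical
  induction s using Finset.induction_on with
  | empty => simpa using AC.zero
  | insert a s ha ih =>
    simp only [Finset.sum_insert ha]
    exact (hX a (Finset.mem_insert_self a s)).add (ih fun i hi => hX i (Finset.mem_insert_of_mem hi))

/-- density of Doléans measure -/
def rd (L : Measure (KK 𝒢)) (μ : Measure Ω) [IsFiniteMeasure μ] (X : Ω → ℝ) : KK 𝒢 → ℝ :=
  fun k => ((dm 𝒢 μ X).rnDeriv L k).toReal

lemma rd_integrable (L : Measure (KK 𝒢)) (X : Ω → ℝ) : Integrable (rd L μ X) L :=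
  Measure.integrable_toReal_rnDeriv

lemma rd_meas (L : Measure (KK 𝒢)) (X : Ω → ℝ) : Measurable (rd L μ X) :=
  (Measure.measurable_rnDeriv _ _).ennreal_toReal

lemma rd_nonneg (L : Measure (KK 𝒢)) (X : Ω → ℝ) (k : KK 𝒢) : 0 ≤ rd L μ X k := ENNReal.toReal_nonneg

lemma rd_spec {L : Measure (KK 𝒢)} [IsFiniteMeasure L] {X : Ω → ℝ} (hX : AC 𝒢 μ L X) {n : ℕ} {f : ℕ → Ω → ℝ}
    (hf : Pn 𝒢 n f) : ∫ k, lift 𝒢 n f k * rd L μ X k ∂L =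
      ∑ i ∈ Finset.range (2 ^ n), ∫ ω, f i ω * inc 𝒢 μ X n i ω ^ 2 ∂μ := by
  rw [← dm_integral hX.1 hf, ← integral_rnDeriv_smul hX.2]
  congr 1; funext k; simp only [rd, smul_eq_mul, mul_comm]

/-- covariation density -/
def gam (L : Measure (KK 𝒢)) (μ : Measure Ω) [IsFiniteMeasure μ] (X Y : Ω → ℝ) : KK 𝒢 → ℝ :=
  fun k => (rd L μ (fun ω => X ω + Y ω) k - rd L μ (fun ω => X ω - Y ω) k) / 4

lemma gam_integrable (L : Measure (KK 𝒢)) (X Y : Ω → ℝ) : Integrable (gam L μ X Y) L :=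
  ((rd_integrable L _).sub (rd_integrable L _)).div_const 4

lemma gam_meas (L : Measure (KK 𝒢)) (X Y : Ω → ℝ) : Measurable (gam L μ X Y) :=
  ((rd_meas L _).sub (rd_meas L _)).div_const 4

lemma gam_spec {L : Measure (KK 𝒢)} [IsFiniteMeasure L] {X Y : Ω → ℝ} (hX : AC 𝒢 μ L X)
    (hY : AC 𝒢 μ L Y) {n : ℕ} {f : ℕ → Ω → ℝ}
    (hf : Pn 𝒢 n f) : ∫ k, lift 𝒢 n f k * gam L μ X Y k ∂L =
      ∑ i ∈ Finset.range (2 ^ n), ∫ ω, f i ω * (inc 𝒢 μ X n i ω * inc 𝒢 μ Y n i ω) ∂μ := by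
  have e : (fun k => lift 𝒢 n f k * gam L μ X Y k) = fun k =>
      (lift 𝒢 n f k * rd L μ (fun ω => X ω + Y ω) k - lift 𝒢 n f k * rd L μ (fun ω => X ω - Y ω) k) / 4 := by
    funext k; simp only [gam]; ring
  rw [e, integral_div, integral_sub (hf.mul_int (rd_integrable L _)) (hf.mul_int (rd_integrable L _)),
    rd_spec (hX.add hY) hf, rd_spec (hX.sub hY) hf, ← Finset.sum_sub_distrib, Finset.sum_div]
  refine Finset.sum_congr rfl fun i hi => ?_
  have i1 := ((hf.bd (μ := μ) i).mul ((hX.1.add hY.1).inc (𝒢 := 𝒢) n i).sq).integrable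
  have i2 := ((hf.bd (μ := μ) i).mul ((hX.1.sub hY.1).inc (𝒢 := 𝒢) n i).sq).integrable
  rw [← integral_sub i1 i2, ← integral_div]
  refine integral_congr_ae ?_
  filter_upwards [inc_add (𝒢 := 𝒢) hX.1 hY.1 n i, inc_sub (𝒢 := 𝒢) hX.1 hY.1 n i] with ω h1 h2
  rw [h1, h2]; ring

lemma gam_sum {L : Measure (KK 𝒢)} [IsFiniteMeasure L] {ι : Type*} (s : Finset ι) {X : ι → Ω → ℝ} {Y : Ω → ℝ}
    (hX : ∀ a, AC 𝒢 μ L (X a)) (hY : AC 𝒢 μ L Y) (c : ι → ℝ) :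
    gam L μ (fun ω => ∑ a ∈ s, c a * X a ω) Y =ᵐ[L] fun k => ∑ a ∈ s, c a * gam L μ (X a) Y k := by
  refine unique_eq L (gam_integrable _ _ _)
    (integrable_finsetSum s fun a _ => (gam_integrable L (X a) Y).const_mul (c a)) fun n f hf => ?_
  rw [gam_spec (AC.sum s fun a _ => (hX a).const_mul (c a)) hY hf]
  simp only [Finset.mul_sum]
  rw [integral_finsetSum _ fun a _ => hf.mul_int ((gam_integrable L (X a) Y).const_mul (c a))]
  have e : ∀ a ∈ s, ∫ k, lift 𝒢 n f k * (c a * gam L μ (X a) Y k) ∂L =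
      ∑ i ∈ Finset.range (2 ^ n), ∫ ω, f i ω * (c a * inc 𝒢 μ (X a) n i ω * inc 𝒢 μ Y n i ω) ∂μ := by
    intro a _
    have : (fun k => lift 𝒢 n f k * (c a * gam L μ (X a) Y k)) = fun k => c a * (lift 𝒢 n f k * gam L μ (X a) Y k) := by
      funext k; ring
    rw [this, integral_const_mul, gam_spec (hX a) hY hf, Finset.mul_sum]
    refine Finset.sum_congr rfl fun i _ => ?_
    rw [← integral_const_mul]; congr 1; funext ω; ring
  rw [Finset.sum_congr rfl e, Finset.sum_comm]
  refine Finset.sum_congr rfl fun i _ => ?_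
  rw [← integral_finsetSum _ fun a _ => ((hf.bd (μ := μ) i).mul
    ((((hX a).1.inc (𝒢 := 𝒢) n i).const_mul (c a)).mul (hY.1.inc n i))).integrable]
  refine integral_congr_ae ?_
  filter_upwards [inc_sum (𝒢 := 𝒢) s (fun a => (hX a).1) c n i] with ω h
  rw [h, Finset.sum_mul, Finset.mul_sum]

lemma gam_comm {L : Measure (KK 𝒢)} [IsFiniteMeasure L] {X Y : Ω → ℝ} (hX : AC 𝒢 μ L X)
    (hY : AC 𝒢 μ L Y) : gam L μ X Y =ᵐ[L] gam L μ Y X := by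
  refine unique_eq L (gam_integrable _ _ _) (gam_integrable _ _ _) fun n f hf => ?_
  rw [gam_spec hX hY hf, gam_spec hY hX hf]
  simp only [mul_comm (inc 𝒢 μ X n _ _)]

lemma gam_self {L : Measure (KK 𝒢)} [IsFiniteMeasure L] {X : Ω → ℝ} (hX : AC 𝒢 μ L X) :
    gam L μ X X =ᵐ[L] rd L μ X := by
  refine unique_eq L (gam_integrable _ _ _) (rd_integrable _ _) fun n f hf => ?_
  rw [gam_spec hX hX hf, rd_spec hX hf]
  simp only [pow_two]

lemma gam_psd {L : Measure (KK 𝒢)} [IsFiniteMeasure L] {ι : Type*} [Fintype ι] {X : ι → Ω → ℝ}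
    (hX : ∀ a, AC 𝒢 μ L (X a)) :
    ∀ᵐ k ∂L, (Matrix.of fun a b => gam L μ (X a) (X b) k).PosSemidef := by
  have h1 : ∀ q : ι → ℚ, ∀ᵐ k ∂L, 0 ≤ ∑ a, ∑ b, (q a : ℝ) * (q b : ℝ) * gam L μ (X a) (X b) k := by
    intro q
    set Z : Ω → ℝ := fun ω => ∑ a, (q a : ℝ) * X a ω
    have hZ : AC 𝒢 μ L Z := AC.sum _ fun a _ => (hX a).const_mul _
    have h2 : ∀ a, ∀ᵐ k ∂L, gam L μ Z (X a) k = ∑ b, (q b : ℝ) * gam L μ (X b) (X a) k := fun a =>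
      gam_sum Finset.univ hX (hX a) (fun b => (q b : ℝ))
    have h3 : ∀ a, ∀ᵐ k ∂L, gam L μ (X a) Z k = gam L μ Z (X a) k := fun a => gam_comm (hX a) hZ
    filter_upwards [gam_sum Finset.univ hX hZ (fun b => (q b : ℝ)), gam_self hZ, ae_all_iff.2 h2, ae_all_iff.2 h3]
      with k a1 a2 a3 a4
    have : rd L μ Z k = ∑ a, ∑ b, (q a : ℝ) * (q b : ℝ) * gam L μ (X a) (X b) k := by
      rw [← a2, a1]
      simp only [a4, a3, Finset.mul_sum]
      rw [Finset.sum_comm]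
      refine Finset.sum_congr rfl fun a _ => Finset.sum_congr rfl fun b _ => ?_
      ring
    rw [← this]; exact rd_nonneg _ _ _
  have h4 : ∀ a b, ∀ᵐ k ∂L, gam L μ (X a) (X b) k = gam L μ (X b) (X a) k := fun a b => gam_comm (hX a) (hX b)
  filter_upwards [ae_all_iff.2 h1, ae_all_iff.2 fun a => ae_all_iff.2 (h4 a)] with k hk hs
  refine Matrix.PosSemidef.of_dotProduct_mulVec_nonneg ?_ ?_
  · ext a b; simp [hs b a]
  · have hd : DenseRange (fun q : ι → ℚ => fun a => (q a : ℝ)) :=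
      DenseRange.piMap fun _ => Rat.denseRange_cast
    have hc : IsClosed {x : ι → ℝ | 0 ≤ ∑ a, ∑ b, x a * x b * gam L μ (X a) (X b) k} :=
      isClosed_le continuous_const (by fun_prop)
    intro x
    have := hd.induction_on (p := fun x => 0 ≤ ∑ a, ∑ b, x a * x b * gam L μ (X a) (X b) k) x hc hk
    have e : star x ⬝ᵥ (Matrix.of fun a b => gam L μ (X a) (X b) k).mulVec x =
        ∑ a, ∑ b, x a * x b * gam L μ (X a) (X b) k := by
      simp only [dotProduct, Matrix.mulVec, Finset.mul_sum, Matrix.of_apply]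
      refine Finset.sum_congr rfl fun a _ => Finset.sum_congr rfl fun b _ => ?_
      simp only [Pi.star_apply, star_trivial]; ring
    rw [e]; exact this

lemma psd_gram {ι : Type*} [Fintype ι] {A : Matrix ι ι ℝ} (hA : A.PosSemidef) :
    ∃ (r : ℕ) (u : ι → EuclideanSpace ℝ (Fin r)), ∀ a b, inner ℝ (u a) (u b) = A a b := by
  obtain ⟨r, v, hv⟩ := Matrix.posSemidef_iff_eq_sum_vecMulVec.1 hA
  refine ⟨r, fun a => WithLp.toLp 2 fun i => v i a, fun a b => ?_⟩
  rw [hv, Matrix.sum_apply]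
  simp [PiLp.inner_apply, Matrix.vecMulVec_apply, mul_comm]

end DM

namespace DM

open Topology

section alg
variable {ι J : Type*} [Fintype ι] [Fintype J]

/-- bilinear form -/
def bil (A : ι → ι → ℝ) (x y : ι → ℝ) : ℝ := ∑ a, ∑ b, x a * y b * A a b

/-- residual coefficients -/
def rs (α : ι → ℝ) (β : J → ι → ℝ) (c : J → ℝ) : ι → ℝ := fun a => α a - ∑ j, c j * β j a

lemma bil_inner {A : ι → ι → ℝ} {r : ℕ} {u : ι → EuclideanSpace ℝ (Fin r)}
    (hu : ∀ a b, inner ℝ (u a) (u b) = A a b) (x y : ι → ℝ) :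
    bil A x y = inner ℝ (∑ a, x a • u a) (∑ a, y a • u a) := by
  rw [bil, sum_inner]
  refine Finset.sum_congr rfl fun a _ => ?_
  rw [inner_sum]
  refine Finset.sum_congr rfl fun b _ => ?_
  rw [real_inner_smul_left, real_inner_smul_right, hu]
  ring

lemma rs_vec {r : ℕ} (u : ι → EuclideanSpace ℝ (Fin r)) (α : ι → ℝ) (β : J → ι → ℝ) (c : J → ℝ) :
    ∑ a, rs α β c a • u a = ∑ a, α a • u a - ∑ j, c j • ∑ a, β j a • u a := by
  simp only [rs, sub_smul, Finset.sum_sub_distrib, Finset.smul_sum, Finset.sum_smul, smul_smul]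
  congr 1
  rw [Finset.sum_comm]

lemma bil_nonneg {A : ι → ι → ℝ} (hA : (Matrix.of A).PosSemidef) (x : ι → ℝ) : 0 ≤ bil A x x := by
  obtain ⟨r, u, hu⟩ := psd_gram hA
  rw [bil_inner (A := A) (fun a b => hu a b)]; exact real_inner_self_nonneg

/-- Tikhonov solution -/
def tik [DecidableEq J] (A : ι → ι → ℝ) (α : ι → ℝ) (β : J → ι → ℝ) (δ : ℝ) : J → ℝ :=
  ((Matrix.of fun i j => bil A (β i) (β j)) + δ • (1 : Matrix J J ℝ))⁻¹.mulVec (fun j => bil A (β j) α)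

lemma tik_eq [DecidableEq J] {A : ι → ι → ℝ} (hA : (Matrix.of A).PosSemidef) (α : ι → ℝ) (β : J → ι → ℝ)
    {δ : ℝ} (hδ : 0 < δ) (j : J) :
    ∑ i, bil A (β j) (β i) * tik A α β δ i + δ * tik A α β δ j = bil A (β j) α := by
  obtain ⟨r, u, hu⟩ := psd_gram hA
  have hu' := bil_inner (A := A) (fun a b => hu a b)
  set M := (Matrix.of fun i j => bil A (β i) (β j)) + δ • (1 : Matrix J J ℝ) with hM
  have hpd : M.PosDef := by
    refine Matrix.PosDef.of_dotProduct_mulVec_pos ?_ ?_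
    · ext a b
      by_cases h : a = b
      · subst h; simp [hM]
      · have h' : ¬ b = a := fun e => h e.symm
        simp only [hM, Matrix.conjTranspose_apply, Matrix.add_apply, Matrix.of_apply, Matrix.smul_apply,
          Matrix.one_apply, h, h', if_false, star_trivial, smul_zero, add_zero]
        rw [hu', hu', real_inner_comm]
    · intro x hx
      have e : star x ⬝ᵥ M.mulVec x = ‖∑ j, x j • ∑ a, β j a • u a‖ ^ 2 + δ * ∑ j, x j ^ 2 := by
        rw [hM, Matrix.add_mulVec, dotProduct_add, Matrix.smul_mulVec, Matrix.one_mulVec, dotProduct_smul,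
          ← real_inner_self_eq_norm_sq]
        congr 1
        · simp only [dotProduct, Matrix.mulVec, Matrix.of_apply, hu', star_trivial, Finset.mul_sum]
          rw [sum_inner]
          refine Finset.sum_congr rfl fun i _ => ?_
          rw [inner_sum]
          refine Finset.sum_congr rfl fun j _ => ?_
          rw [real_inner_smul_left, real_inner_smul_right]
          ring
        · simp [dotProduct, pow_two]
      rw [e]
      have : 0 < ∑ j, x j ^ 2 := by
        obtain ⟨j, hj⟩ := Function.ne_iff.1 hx
        exact Finset.sum_pos' (fun _ _ => sq_nonneg _) ⟨j, Finset.mem_univ _, by have : x j ≠ 0 := hj; positivity⟩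
      positivity
  have h1 : M.mulVec (tik A α β δ) = fun j => bil A (β j) α := by
    rw [tik, Matrix.mulVec_mulVec, ← hM, Matrix.mul_nonsing_inv _ ((Matrix.isUnit_iff_isUnit_det _).1 hpd.isUnit),
      Matrix.one_mulVec]
  have h2 := congrFun h1 j
  rw [← h2, hM, Matrix.add_mulVec, Matrix.smul_mulVec, Matrix.one_mulVec]
  simp [Matrix.mulVec, dotProduct]

lemma tik_min [DecidableEq J] {A : ι → ι → ℝ} (hA : (Matrix.of A).PosSemidef) (α : ι → ℝ) (β : J → ι → ℝ)
    {δ : ℝ} (hδ : 0 < δ) (c : J → ℝ) :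
    bil A (rs α β (tik A α β δ)) (rs α β (tik A α β δ)) + δ * ∑ j, tik A α β δ j ^ 2 ≤
      bil A (rs α β c) (rs α β c) + δ * ∑ j, c j ^ 2 := by
  obtain ⟨r, u, hu⟩ := psd_gram hA
  have hu' := bil_inner (A := A) (fun a b => hu a b)
  have he := tik_eq hA α β hδ
  set φ := tik A α β δ
  rw [hu', hu', rs_vec, rs_vec]
  simp only [hu'] at he
  set w := ∑ a, α a • u a
  set b : J → EuclideanSpace ℝ (Fin r) := fun j => ∑ a, β j a • u a
  have he' : ∀ j, inner ℝ (w - ∑ j, φ j • b j) (b j) = δ * φ j := by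
    intro j
    have := he j
    have h0 : inner ℝ (∑ j, φ j • b j) (b j) = ∑ i, φ i * inner ℝ (b i) (b j) := by
      rw [sum_inner]; simp only [real_inner_smul_left]
    rw [inner_sub_left, h0]
    have h2 : inner ℝ (b j) w = inner ℝ w (b j) := real_inner_comm _ _
    have h3 : ∀ i, inner ℝ (b j) (b i) * φ i = φ i * inner ℝ (b i) (b j) := fun i => by
      rw [real_inner_comm, mul_comm]
    change ∑ i, inner ℝ (b j) (b i) * φ i + δ * φ j = inner ℝ (b j) w at this
    simp only [h3, h2] at this
    linarith
  set e := w - ∑ j, φ j • b j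
  have h4 : w - ∑ j, c j • b j = e - ∑ j, (c j - φ j) • b j := by
    simp only [e, sub_smul, Finset.sum_sub_distrib]; abel
  change inner ℝ e e + _ ≤ inner ℝ (w - ∑ j, c j • b j) (w - ∑ j, c j • b j) + _
  rw [h4]
  set s := ∑ j, (c j - φ j) • b j
  have h5 : inner ℝ e s = ∑ j, (c j - φ j) * (δ * φ j) := by
    simp only [s, inner_sum, real_inner_smul_right, he']
  have h6 : ∑ j, c j ^ 2 = ∑ j, φ j ^ 2 + 2 * ∑ j, (c j - φ j) * φ j + ∑ j, (c j - φ j) ^ 2 := by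
    rw [Finset.mul_sum, ← Finset.sum_add_distrib, ← Finset.sum_add_distrib]
    exact Finset.sum_congr rfl fun j _ => by ring
  have h7 : ∑ j, (c j - φ j) * (δ * φ j) = δ * ∑ j, (c j - φ j) * φ j := by
    rw [Finset.mul_sum]; exact Finset.sum_congr rfl fun j _ => by ring
  have h8 : inner ℝ (e - s) (e - s) = inner ℝ e e - 2 * inner ℝ e s + inner ℝ s s := by
    rw [real_inner_self_eq_norm_sq, real_inner_self_eq_norm_sq, real_inner_self_eq_norm_sq, norm_sub_sq_real]
  have h9 : 0 ≤ inner ℝ s s := real_inner_self_nonneg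
  have h10 : 0 ≤ ∑ j, (c j - φ j) ^ 2 := Finset.sum_nonneg fun _ _ => sq_nonneg _
  rw [h8, h5, h6, h7]
  nlinarith [mul_nonneg hδ.le h10]

/-- infimum zero is attained -/
lemma exists_rs_zero {A : ι → ι → ℝ} (hA : (Matrix.of A).PosSemidef) (α : ι → ℝ) (β : J → ι → ℝ)
    (c : ℕ → J → ℝ) (h : Tendsto (fun r => bil A (rs α β (c r)) (rs α β (c r))) atTop (𝓝 0)) :
    ∃ c, bil A (rs α β c) (rs α β c) = 0 := by
  obtain ⟨r, u, hu⟩ := psd_gram hA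
  have hu' := bil_inner (A := A) (fun a b => hu a b)
  simp only [hu', rs_vec] at h ⊢
  set w := ∑ a, α a • u a
  set b : J → EuclideanSpace ℝ (Fin r) := fun j => ∑ a, β j a • u a
  have h1 : w ∈ (Submodule.span ℝ (range b)) := by
    have hcl : IsClosed ((Submodule.span ℝ (range b) : Submodule ℝ _) : Set (EuclideanSpace ℝ (Fin r))) :=
      Submodule.closed_of_finiteDimensional _
    refine hcl.mem_of_tendsto (f := fun n => ∑ j, c n j • b j) (b := atTop) ?_
      (Eventually.of_forall fun n => ?_)
    · rw [tendsto_iff_norm_sub_tendsto_zero]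
      have h2 : Tendsto (fun n => Real.sqrt (inner ℝ (w - ∑ j, c n j • b j) (w - ∑ j, c n j • b j))) atTop (𝓝 0) := by
        have := (Real.continuous_sqrt.tendsto 0).comp h
        rwa [Real.sqrt_zero] at this
      refine h2.congr fun n => ?_
      rw [real_inner_self_eq_norm_sq, Real.sqrt_sq (norm_nonneg _), norm_sub_rev]
    · exact Submodule.sum_mem _ fun j _ => Submodule.smul_mem _ _ (Submodule.subset_span ⟨j, rfl⟩)
  obtain ⟨c', hc'⟩ := (Submodule.mem_span_range_iff_exists_fun ℝ).1 h1
  exact ⟨c', by change inner ℝ (w - ∑ j, c' j • b j) (w - ∑ j, c' j • b j) = 0; rw [hc']; simp⟩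

end alg

variable {Ω : Type*} {m : MeasurableSpace Ω} {𝒢 : Filtration ℝ m} {μ : Measure Ω} [IsFiniteMeasure μ]

/-- refinement -/
def rfn (n0 n : ℕ) (f : ℕ → Ω → ℝ) : ℕ → Ω → ℝ := fun i => f (i / 2 ^ (n - n0))

lemma idx_div (n0 e : ℕ) (b : ℕ → Bool) : idx (n0 + e) b / 2 ^ e = idx n0 b := by
  induction e with
  | zero => simp
  | succ e ih => rw [← ih, ← add_assoc, ← idx_succ_div (n0 + e), Nat.div_div_eq_div_mul, pow_succ, mul_comm]

lemma tm_pow (n0 e i : ℕ) : tm (n0 + e) (i * 2 ^ e) = tm n0 i := by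
  simp only [tm]; push_cast; rw [pow_add]; field_simp

lemma tm_div_pow_le (n0 e i : ℕ) : tm n0 (i / 2 ^ e) ≤ tm (n0 + e) i := by
  rw [← tm_pow n0 e]; exact tm_mono _ (Nat.div_mul_le_self _ _)

lemma Pn.rfn {n0 n : ℕ} (h : n0 ≤ n) {f : ℕ → Ω → ℝ} (hf : Pn 𝒢 n0 f) : Pn 𝒢 n (rfn n0 n f) := by
  obtain ⟨e, rfl⟩ := Nat.exists_eq_add_of_le h
  obtain ⟨C, hC⟩ := hf.2
  refine ⟨fun i => ?_, C, fun i ω => hC _ _⟩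
  have := tm_div_pow_le n0 e i
  simp only [DM.rfn, Nat.add_sub_cancel_left]
  exact (hf.1 _).mono (𝒢.mono this) le_rfl

lemma lift_rfn {n0 n : ℕ} (h : n0 ≤ n) (f : ℕ → Ω → ℝ) (k : KK 𝒢) : lift 𝒢 n (rfn n0 n f) k = lift 𝒢 n0 f k := by
  obtain ⟨e, rfl⟩ := Nat.exists_eq_add_of_le h
  simp only [lift, rfn, Nat.add_sub_cancel_left, idx_div]

lemma rfn_rfn {n0 n1 n : ℕ} (h : n0 ≤ n1) (h' : n1 ≤ n) (f : ℕ → Ω → ℝ) : rfn n1 n (rfn n0 n1 f) = rfn n0 n f := by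
  obtain ⟨e, rfl⟩ := Nat.exists_eq_add_of_le h
  obtain ⟨e', rfl⟩ := Nat.exists_eq_add_of_le h'
  funext i
  simp only [rfn, Nat.add_sub_cancel_left, Nat.div_div_eq_div_mul]
  rw [show n0 + e + e' - n0 = e + e' by omega, pow_add, mul_comm]

lemma Pn.add {n : ℕ} {f g : ℕ → Ω → ℝ} (hf : Pn 𝒢 n f) (hg : Pn 𝒢 n g) : Pn 𝒢 n (fun i ω => f i ω + g i ω) := by
  obtain ⟨C, hC⟩ := hf.2; obtain ⟨D, hD⟩ := hg.2
  exact ⟨fun i => (hf.1 i).add (hg.1 i), C + D, fun i ω => (abs_add_le _ _).trans (add_le_add (hC i ω) (hD i ω))⟩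

lemma Pn.mul {n : ℕ} {f g : ℕ → Ω → ℝ} (hf : Pn 𝒢 n f) (hg : Pn 𝒢 n g) : Pn 𝒢 n (fun i ω => f i ω * g i ω) := by
  obtain ⟨C, hC⟩ := hf.2; obtain ⟨D, hD⟩ := hg.2
  refine ⟨fun i => (hf.1 i).mul (hg.1 i), C * D, fun i ω => ?_⟩
  rw [abs_mul]; exact mul_le_mul (hC i ω) (hD i ω) (abs_nonneg _) ((abs_nonneg _).trans (hC i ω))

lemma Pn.const {n : ℕ} (c : ℝ) : Pn 𝒢 n (fun i ω => c) := ⟨fun i => measurable_const, |c|, fun i ω => le_rfl⟩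

lemma Pn.neg {n : ℕ} {f : ℕ → Ω → ℝ} (hf : Pn 𝒢 n f) : Pn 𝒢 n (fun i ω => - f i ω) := by
  simpa using (Pn.const (𝒢 := 𝒢) (-1)).mul hf

lemma Pn.sub {n : ℕ} {f g : ℕ → Ω → ℝ} (hf : Pn 𝒢 n f) (hg : Pn 𝒢 n g) : Pn 𝒢 n (fun i ω => f i ω - g i ω) := by
  simpa [sub_eq_add_neg] using hf.add hg.neg

lemma Pn.sum {n : ℕ} {ι : Type*} (s : Finset ι) {f : ι → ℕ → Ω → ℝ} (hf : ∀ a, Pn 𝒢 n (f a)) :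
    Pn 𝒢 n (fun i ω => ∑ a ∈ s, f a i ω) := by
  classical
  induction s using Finset.induction_on with
  | empty => simpa using Pn.const 0
  | insert a s ha ih => simp only [Finset.sum_insert ha]; exact (hf a).add ih

variable {ι J : Type*} [Fintype ι] [Fintype J]

/-- Gram matrix of the family -/
def GG (L : Measure (KK 𝒢)) (μ : Measure Ω) [IsFiniteMeasure μ] (X : ι → Ω → ℝ) (k : KK 𝒢) : ι → ι → ℝ :=
  fun a b => gam L μ (X a) (X b) k

/-- discrete energy -/
def qs (𝒢 : Filtration ℝ m) (μ : Measure Ω) (X : ι → Ω → ℝ) (n : ℕ) (f : ι → ℕ → Ω → ℝ) : ℝ :=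
  ∑ i ∈ Finset.range (2 ^ n), ∫ ω, (∑ a, f a i ω * inc 𝒢 μ (X a) n i ω) ^ 2 ∂μ

lemma qs_eq {L : Measure (KK 𝒢)} [IsFiniteMeasure L] {X : ι → Ω → ℝ} (hX : ∀ a, AC 𝒢 μ L (X a)) {n : ℕ}
    {f : ι → ℕ → Ω → ℝ} (hf : ∀ a, Pn 𝒢 n (f a)) :
    qs 𝒢 μ X n f = ∫ k, bil (GG L μ X k) (fun a => lift 𝒢 n (f a) k) (fun a => lift 𝒢 n (f a) k) ∂L := by
  have h1 : ∀ a b, Integrable (fun k => lift 𝒢 n (f a) k * lift 𝒢 n (f b) k * GG L μ X k a b) L := fun a b =>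
    ((hf a).mul (hf b)).mul_int (gam_integrable L (X a) (X b))
  have h2 : ∀ a b, ∫ k, lift 𝒢 n (f a) k * lift 𝒢 n (f b) k * GG L μ X k a b ∂L =
    ∑ i ∈ Finset.range (2 ^ n), ∫ ω, f a i ω * f b i ω * (inc 𝒢 μ (X a) n i ω * inc 𝒢 μ (X b) n i ω) ∂μ := fun a b =>
    gam_spec (hX a) (hX b) ((hf a).mul (hf b))
  simp only [bil]
  rw [integral_finsetSum _ fun a _ => integrable_finsetSum _ fun b _ => h1 a b]
  have h3 : ∀ a ∈ (Finset.univ : Finset ι), ∫ k, ∑ b, lift 𝒢 n (f a) k * lift 𝒢 n (f b) k * GG L μ X k a b ∂L =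
      ∑ i ∈ Finset.range (2 ^ n), ∑ b, ∫ ω, f a i ω * f b i ω * (inc 𝒢 μ (X a) n i ω * inc 𝒢 μ (X b) n i ω) ∂μ := by
    intro a _
    rw [integral_finsetSum _ fun b _ => h1 a b, Finset.sum_comm]
    exact Finset.sum_congr rfl fun b _ => h2 a b
  rw [Finset.sum_congr rfl h3, Finset.sum_comm, qs]
  refine Finset.sum_congr rfl fun i _ => ?_
  have h4 : ∀ a b, Integrable (fun ω => f a i ω * f b i ω * (inc 𝒢 μ (X a) n i ω * inc 𝒢 μ (X b) n i ω)) μ := fun a b =>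
    ((((hf a).mul (hf b)).bd i).mul (((hX a).1.inc n i).mul ((hX b).1.inc n i))).integrable
  rw [← Finset.sum_congr rfl fun a _ => integral_finsetSum _ fun b _ => h4 a b,
    ← integral_finsetSum _ fun a _ => integrable_finsetSum _ fun b _ => h4 a b]
  congr 1; funext ω
  rw [pow_two, Finset.sum_mul_sum]
  refine Finset.sum_congr rfl fun a _ => Finset.sum_congr rfl fun b _ => ?_
  ring

lemma bil_bound (A : ι → ι → ℝ) (x : ι → ℝ) {C : ℝ} (hC : ∀ a, |x a| ≤ C) :
    |bil A x x| ≤ C ^ 2 * ∑ a, ∑ b, |A a b| := by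
  simp only [bil, Finset.mul_sum]
  refine (Finset.abs_sum_le_sum_abs _ _).trans (Finset.sum_le_sum fun a _ =>
    (Finset.abs_sum_le_sum_abs _ _).trans (Finset.sum_le_sum fun b _ => ?_))
  rw [abs_mul, abs_mul, pow_two]
  have := hC a; have := hC b; have := (abs_nonneg _).trans (hC a)
  gcongr

lemma GG_int (L : Measure (KK 𝒢)) (X : ι → Ω → ℝ) : Integrable (fun k => ∑ a, ∑ b, |GG L μ X k a b|) L :=
  integrable_finsetSum _ fun a _ => integrable_finsetSum _ fun b _ => (gam_integrable L (X a) (X b)).abs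

lemma continuous_bil (A : ι → ι → ℝ) : Continuous (fun x : ι → ℝ => bil A x x) := by
  unfold bil; fun_prop

lemma bil_meas {L : Measure (KK 𝒢)} {X : ι → Ω → ℝ} {x y : KK 𝒢 → ι → ℝ} (hx : ∀ a, Measurable fun k => x k a)
    (hy : ∀ a, Measurable fun k => y k a) : Measurable fun k => bil (GG L μ X k) (x k) (y k) := by
  unfold bil GG
  exact Finset.measurable_sum _ fun a _ => Finset.measurable_sum _ fun b _ =>
    ((hx a).mul (hy b)).mul (gam_meas _ _ _)

lemma lim_qs {L : Measure (KK 𝒢)} [IsFiniteMeasure L] {X : ι → Ω → ℝ} (hX : ∀ a, AC 𝒢 μ L (X a))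
    {f : ℕ → ι → ℕ → Ω → ℝ} (hf : ∀ᶠ n in atTop, ∀ a, Pn 𝒢 n (f n a)) (C : ℝ) (hC : ∀ n a i ω, |f n a i ω| ≤ C)
    {x : KK 𝒢 → ι → ℝ} (hx : ∀ᵐ k ∂L, ∀ a, Tendsto (fun n => lift 𝒢 n (f n a) k) atTop (𝓝 (x k a))) :
    Tendsto (fun n => qs 𝒢 μ X n (f n)) atTop (𝓝 (∫ k, bil (GG L μ X k) (x k) (x k) ∂L)) := by
  have h1 : Tendsto (fun n => ∫ k, bil (GG L μ X k) (fun a => lift 𝒢 n (f n a) k) (fun a => lift 𝒢 n (f n a) k) ∂L)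
      atTop (𝓝 (∫ k, bil (GG L μ X k) (x k) (x k) ∂L)) := by
    refine tendsto_integral_filter_of_dominated_convergence (fun k => C ^ 2 * ∑ a, ∑ b, |GG L μ X k a b|) ?_ ?_
      ((GG_int L X).const_mul _) ?_
    · filter_upwards [hf] with n hn
      exact (bil_meas (fun a => (hn a).lift_meas) (fun a => (hn a).lift_meas)).aestronglyMeasurable
    · exact Eventually.of_forall fun n => ae_of_all _ fun k => bil_bound _ _ fun a => hC n a _ _
    · filter_upwards [hx] with k hk
      exact ((continuous_bil (GG L μ X k)).tendsto _).comp (tendsto_pi_nhds.2 hk)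
  refine h1.congr' ?_
  filter_upwards [hf] with n hn
  rw [qs_eq hX hn]

end DM

namespace DM

open Topology

lemma ae_tendsto_zero_of_geom {α : Type*} {mα : MeasurableSpace α} {ν : Measure α} {f : ℕ → α → ℝ}
    (hf : ∀ r, Integrable (f r) ν) {C : ℝ} (h : ∀ r, ∫ x, |f r x| ∂ν ≤ C * (1 / 2) ^ r) :
    ∀ᵐ x ∂ν, Tendsto (fun r => f r x) atTop (𝓝 0) := by
  have h1 : ∀ r, ∫⁻ x, ENNReal.ofReal |f r x| ∂ν ≤ ENNReal.ofReal (C * (1 / 2) ^ r) := by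
    intro r
    rw [← ofReal_integral_eq_lintegral_ofReal (hf r).abs (ae_of_all _ fun _ => abs_nonneg _)]
    exact ENNReal.ofReal_le_ofReal (h r)
  have h2 : ∫⁻ x, ∑' r, ENNReal.ofReal |f r x| ∂ν ≠ ∞ := by
    rw [lintegral_tsum fun r => (hf r).abs.aemeasurable.ennreal_ofReal]
    refine ne_top_of_le_ne_top ?_ (ENNReal.tsum_le_tsum h1)
    have hC : 0 ≤ C := by
      have := h 0
      simp only [pow_zero, mul_one] at this
      exact (integral_nonneg fun _ => abs_nonneg _).trans this
    rw [← ENNReal.ofReal_tsum_of_nonneg (fun r => by positivity)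
      ((summable_geometric_of_lt_one (by norm_num) (by norm_num)).mul_left C)]
    exact ENNReal.ofReal_ne_top
  have h3 := ae_lt_top' (AEMeasurable.tsum fun r => (hf r).abs.aemeasurable.ennreal_ofReal) h2
  filter_upwards [h3] with x hx
  have h4 := ENNReal.tendsto_atTop_zero_of_tsum_ne_top hx.ne
  have h5 := (ENNReal.tendsto_toReal (a := 0) (by simp)).comp h4
  simp only [ENNReal.toReal_zero] at h5
  refine (tendsto_zero_iff_abs_tendsto_zero _).2 (h5.congr fun r => ?_)
  simp

variable {Ω : Type*} {m : MeasurableSpace Ω} {𝒢 : Filtration ℝ m} {μ : Measure Ω} [IsFiniteMeasure μ]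
variable {ι J : Type*} [Fintype ι] [Fintype J]

/-- data for the span/rel equivalence -/
structure Dat (L : Measure (KK 𝒢)) (μ : Measure Ω) [IsFiniteMeasure μ] (X : ι → Ω → ℝ)
    (f : ℕ → ι → ℕ → Ω → ℝ) (g : ℕ → J → ι → ℕ → Ω → ℝ) (x : KK 𝒢 → ι → ℝ) (y : KK 𝒢 → J → ι → ℝ) (C : ℝ) : Prop where
  ac : ∀ a, AC 𝒢 μ L (X a)
  fP : ∀ n a, Pn 𝒢 n (f n a)
  fC : ∀ n a i ω, |f n a i ω| ≤ C
  gP : ∀ n j a, Pn 𝒢 n (g n j a)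
  gC : ∀ n j a i ω, |g n j a i ω| ≤ C
  xm : ∀ a, Measurable fun k => x k a
  ym : ∀ j a, Measurable fun k => y k j a
  fl : ∀ᵐ k ∂L, ∀ a, Tendsto (fun n => lift 𝒢 n (f n a) k) atTop (𝓝 (x k a))
  gl : ∀ᵐ k ∂L, ∀ j a, Tendsto (fun n => lift 𝒢 n (g n j a) k) atTop (𝓝 (y k j a))

/-- the discrete relation -/
def RelA (𝒢 : Filtration ℝ m) (μ : Measure Ω) (X : ι → Ω → ℝ)
    (f : ℕ → ι → ℕ → Ω → ℝ) (g : ℕ → J → ι → ℕ → Ω → ℝ) : Prop :=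
  ∀ ε > 0, ∃ (n0 : ℕ) (φ : J → ℕ → Ω → ℝ), (∀ j, Pn 𝒢 n0 (φ j)) ∧ ∀ n ≥ n0,
    qs 𝒢 μ X n (fun a i ω => f n a i ω - ∑ j, rfn n0 n (φ j) i ω * g n j a i ω) ≤ ε

variable {L : Measure (KK 𝒢)} [IsFiniteMeasure L] {X : ι → Ω → ℝ}
    {f : ℕ → ι → ℕ → Ω → ℝ} {g : ℕ → J → ι → ℕ → Ω → ℝ} {x : KK 𝒢 → ι → ℝ} {y : KK 𝒢 → J → ι → ℝ} {C : ℝ}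

lemma Dat.x_le (D : Dat L μ X f g x y C) : ∀ᵐ k ∂L, ∀ a, |x k a| ≤ C := by
  filter_upwards [D.fl] with k hk a
  exact le_of_tendsto (hk a).abs (Eventually.of_forall fun n => D.fC n a _ _)

lemma Dat.y_le (D : Dat L μ X f g x y C) : ∀ᵐ k ∂L, ∀ j a, |y k j a| ≤ C := by
  filter_upwards [D.gl] with k hk j a
  exact le_of_tendsto (hk j a).abs (Eventually.of_forall fun n => D.gC n j a _ _)

lemma Dat.tend (D : Dat L μ X f g x y C) {n0 : ℕ} {φ : J → ℕ → Ω → ℝ} (hφ : ∀ j, Pn 𝒢 n0 (φ j)) :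
    Tendsto (fun n => qs 𝒢 μ X n (fun a i ω => f n a i ω - ∑ j, rfn n0 n (φ j) i ω * g n j a i ω)) atTop
      (𝓝 (∫ k, bil (GG L μ X k) (rs (x k) (y k) fun j => lift 𝒢 n0 (φ j) k)
        (rs (x k) (y k) fun j => lift 𝒢 n0 (φ j) k) ∂L)) := by
  choose E hE using fun j => (hφ j).2
  refine lim_qs D.ac ?_ (C + ∑ j, E j * C) ?_ ?_
  · filter_upwards [eventually_ge_atTop n0] with n hn a
    exact (D.fP n a).sub (Pn.sum _ fun j => ((hφ j).rfn hn).mul (D.gP n j a))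
  · intro n a i ω
    refine (abs_sub _ _).trans (add_le_add (D.fC n a i ω) ((Finset.abs_sum_le_sum_abs _ _).trans
      (Finset.sum_le_sum fun j _ => ?_)))
    rw [abs_mul]
    exact mul_le_mul (hE j _ _) (D.gC n j a i ω) (abs_nonneg _) ((abs_nonneg _).trans (hE j 0 ω))
  · filter_upwards [D.fl, D.gl] with k h1 h2 a
    simp only [rs]
    have : Tendsto (fun n => lift 𝒢 n (f n a) k - ∑ j, lift 𝒢 n0 (φ j) k * lift 𝒢 n (g n j a) k) atTop
        (𝓝 (x k a - ∑ j, lift 𝒢 n0 (φ j) k * y k j a)) :=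
      (h1 a).sub (tendsto_finsetSum _ fun j _ => (h2 j a).const_mul _)
    refine this.congr' ?_
    filter_upwards [eventually_ge_atTop n0] with n hn
    simp only [← lift_rfn hn (φ _) k]
    rfl

lemma rs_meas (D : Dat L μ X f g x y C) {c : KK 𝒢 → J → ℝ} (hc : ∀ j, Measurable fun k => c k j) (a : ι) :
    Measurable fun k => rs (x k) (y k) (c k) a :=
  (D.xm a).sub (Finset.measurable_sum _ fun j _ => (hc j).mul (D.ym j a))

lemma Dat.int (D : Dat L μ X f g x y C) {c : KK 𝒢 → J → ℝ} (hc : ∀ j, Measurable fun k => c k j)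
    (E : ℝ) (hE : ∀ k j, |c k j| ≤ E) :
    Integrable (fun k => bil (GG L μ X k) (rs (x k) (y k) (c k)) (rs (x k) (y k) (c k))) L := by
  refine Integrable.mono' ((GG_int (μ := μ) L X).const_mul ((C + ∑ j : J, E * C) ^ 2))
    (bil_meas (μ := μ) (L := L) (X := X) (rs_meas D hc) (rs_meas D hc)).aestronglyMeasurable ?_
  filter_upwards [D.x_le, D.y_le] with k h1 h2
  refine bil_bound _ _ fun a => ?_
  refine (abs_sub _ _).trans (add_le_add (h1 a) ((Finset.abs_sum_le_sum_abs _ _).trans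
      (Finset.sum_le_sum fun j _ => ?_)))
  rw [abs_mul]
  exact mul_le_mul (hE _ _) (h2 j a) (abs_nonneg _) ((abs_nonneg _).trans (hE k j))

theorem span_of_rel (D : Dat L μ X f g x y C) (h : RelA 𝒢 μ X f g) :
    ∀ᵐ k ∂L, ∃ c, bil (GG L μ X k) (rs (x k) (y k) c) (rs (x k) (y k) c) = 0 := by
  have h1 := fun r : ℕ => h ((1 / 2) ^ r) (by positivity)
  choose n0 φ hφ hb using h1
  have hpsd : ∀ᵐ k ∂L, (Matrix.of (GG L μ X k)).PosSemidef := gam_psd D.ac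
  have hm : ∀ r j, Measurable fun k => lift 𝒢 (n0 r) (φ r j) k := fun r j => (hφ r j).lift_meas
  have h_itg : ∀ r, Integrable (fun k => bil (GG L μ X k) (rs (x k) (y k) fun j => lift 𝒢 (n0 r) (φ r j) k)
      (rs (x k) (y k) fun j => lift 𝒢 (n0 r) (φ r j) k)) L := by
    intro r
    choose E hE using fun j => (hφ r j).2
    refine D.int (hm r) (∑ j, |E j|) fun k j => ?_
    exact ((hE j _ _).trans (le_abs_self _)).trans
      (Finset.single_le_sum (f := fun j => |E j|) (fun _ _ => abs_nonneg _) (Finset.mem_univ j))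
  have hle : ∀ r, ∫ k, |bil (GG L μ X k) (rs (x k) (y k) fun j => lift 𝒢 (n0 r) (φ r j) k)
      (rs (x k) (y k) fun j => lift 𝒢 (n0 r) (φ r j) k)| ∂L ≤ 1 * (1 / 2) ^ r := by
    intro r
    have h3 := le_of_tendsto (D.tend (hφ r)) (by
      filter_upwards [eventually_ge_atTop (n0 r)] with n hn using hb r n hn)
    rw [one_mul]
    refine le_trans (le_of_eq ?_) h3
    refine integral_congr_ae ?_
    filter_upwards [hpsd] with k hk
    exact abs_of_nonneg (bil_nonneg hk _)
  filter_upwards [ae_tendsto_zero_of_geom h_itg hle, hpsd] with k h3 h4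
  exact exists_rs_zero h4 _ _ _ h3

/-- level condexp approximations -/
lemma approx_lev (L : Measure (KK 𝒢)) [IsFiniteMeasure L] {φ : KK 𝒢 → ℝ} (hφ : Measurable φ) {E : ℝ}
    (hE : ∀ k, |φ k| ≤ E) :
    ∃ f : ℕ → ℕ → Ω → ℝ, (∀ n, Pn 𝒢 n (f n)) ∧ (∀ n i ω, |f n i ω| ≤ E) ∧
      ∀ᵐ k ∂L, Tendsto (fun n => lift 𝒢 n (f n) k) atTop (𝓝 (φ k)) := by
  rcases isEmpty_or_nonempty (KK 𝒢) with hemp | ⟨⟨k0⟩⟩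
  · have : IsEmpty Ω := ⟨fun ω => hemp.false ⟨ω, fun _ => false⟩⟩
    exact ⟨fun _ _ _ => 0, fun n => Pn.const 0, fun n i ω => this.elim ω, ae_of_all _ fun k => hemp.elim k⟩
  have hE0 : 0 ≤ E := (abs_nonneg _).trans (hE k0)
  let F : Filtration ℕ (inferInstance : MeasurableSpace (KK 𝒢)) := ⟨lev 𝒢, lev_mono 𝒢, lev_le 𝒢⟩
  have h_itg : Integrable φ L := Integrable.of_bound hφ.aestronglyMeasurable E (ae_of_all _ hE)
  have hlim := h_itg.tendsto_ae_condExp (ℱ := F) hφ.stronglyMeasurable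
  have hm : ∀ n, Measurable[lev 𝒢 n] (L[φ | F n]) := fun n => stronglyMeasurable_condExp.measurable
  have hb : ∀ n, ∀ᵐ k ∂L, |(L[φ | F n]) k| ≤ E := fun n =>
    ae_bdd_abs_condExp_of_ae_bdd_abs (R := E) (ae_of_all _ hE)
  choose f hf1 hf2 hf3 using fun n => eq_lift (hm n)
  refine ⟨fun n i ω => max (-E) (min E (f n i ω)), fun n => ⟨fun i => ?_, E, fun i ω => ?_⟩, fun n i ω => ?_, ?_⟩
  · exact measurable_const.max (measurable_const.min (hf1 n i))
  · exact abs_le.2 ⟨le_max_left _ _, max_le (by linarith) (min_le_left _ _)⟩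
  · exact abs_le.2 ⟨le_max_left _ _, max_le (by linarith) (min_le_left _ _)⟩
  · filter_upwards [hlim, ae_all_iff.2 hb] with k h1 h2
    refine h1.congr fun n => ?_
    have h3 := abs_le.1 (h2 n)
    have h4 : (L[φ | F n]) k = f n (idx n k.snd) k.fst := congrFun (hf2 n) k
    rw [h4] at h3 ⊢
    simp only [lift]
    rw [min_eq_right h3.2, max_eq_right h3.1]

lemma tik_meas [DecidableEq J] (D : Dat L μ X f g x y C) (δ : ℝ) (j : J) :
    Measurable fun k => tik (GG L μ X k) (x k) (y k) δ j := by
  have hB : ∀ i j, Measurable fun k => bil (GG L μ X k) (y k i) (y k j) := fun i j => bil_meas (D.ym i) (D.ym j)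
  have hv : ∀ i, Measurable fun k => bil (GG L μ X k) (y k i) (x k) := fun i => bil_meas (D.ym i) D.xm
  simp only [tik, Matrix.mulVec, dotProduct]
  refine Finset.measurable_sum _ fun i _ => Measurable.mul ?_ (hv i)
  simp only [Matrix.inv_def, Matrix.smul_apply, smul_eq_mul, Ring.inverse_eq_inv]
  have hc : Continuous fun A : J → J → ℝ => (Matrix.of A + δ • (1 : Matrix J J ℝ)) := by fun_prop
  have hA : Measurable fun k => (fun i j => bil (GG L μ X k) (y k i) (y k j) : J → J → ℝ) :=
    measurable_pi_lambda _ fun i => measurable_pi_lambda _ fun j => hB i j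
  refine Measurable.mul (Measurable.inv ?_) ?_
  · exact (hc.matrix_det).measurable.comp hA
  · exact ((hc.matrix_adjugate).matrix_elem j i).measurable.comp hA

theorem rel_of_span (D : Dat L μ X f g x y C)
    (h : ∀ᵐ k ∂L, ∃ c, bil (GG L μ X k) (rs (x k) (y k) c) (rs (x k) (y k) c) = 0) : RelA 𝒢 μ X f g := by
  classical
  intro ε hε
  have hpsd : ∀ᵐ k ∂L, (Matrix.of (GG L μ X k)).PosSemidef := gam_psd D.ac
  -- truncated Tikhonov
  set T : ℕ → KK 𝒢 → J → ℝ := fun r k => tik (GG L μ X k) (x k) (y k) (1 / (r + 1)) with hT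
  set Φ : ℕ → KK 𝒢 → J → ℝ := fun r k j => if ∑ i, T r k i ^ 2 ≤ r then T r k j else 0 with hΦ
  have hTm : ∀ r j, Measurable fun k => T r k j := fun r j => tik_meas D _ j
  have hΦm : ∀ r j, Measurable fun k => Φ r k j := fun r j =>
    Measurable.ite (measurableSet_le (Finset.measurable_sum _ fun i _ => (hTm r i).pow_const 2) measurable_const)
      (hTm r j) measurable_const
  have hΦb : ∀ r k j, |Φ r k j| ≤ r + 1 := by
    intro r k j
    simp only [hΦ]
    split_ifs with h
    · have h1 : T r k j ^ 2 ≤ r := (Finset.single_le_sum (f := fun i => T r k i ^ 2) (fun _ _ => sq_nonneg _) (Finset.mem_univ j)).trans h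
      apply abs_le_of_sq_le_sq _ (by positivity)
      nlinarith [(Nat.cast_nonneg r : (0:ℝ) ≤ r)]
    · simp; positivity
  let I : (J → ℝ) → KK 𝒢 → ℝ := fun c k => bil (GG L μ X k) (rs (x k) (y k) c) (rs (x k) (y k) c)
  have hlim1 : Tendsto (fun r => ∫ k, I (Φ r k) k ∂L) atTop (𝓝 (∫ k, (0:ℝ) ∂L)) := by
    refine tendsto_integral_of_dominated_convergence (fun k => I 0 k) ?_ ?_ ?_ ?_
    · exact fun r => (bil_meas (rs_meas D (hΦm r)) (rs_meas D (hΦm r))).aestronglyMeasurable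
    · exact D.int (c := fun _ => 0) (fun j => measurable_const) 0 (by simp)
    · intro r
      filter_upwards [hpsd] with k hk
      have hk' : 0 ≤ I (Φ r k) k := bil_nonneg hk _
      rw [Real.norm_eq_abs, abs_of_nonneg hk']
      by_cases hs : ∑ i, T r k i ^ 2 ≤ r
      · have : Φ r k = T r k := by funext j; simp [hΦ, hs]
        rw [this]
        have h2 := tik_min hk (x k) (y k) (δ := 1 / ((r:ℝ) + 1)) (by positivity) 0
        simp only [Pi.zero_apply, ne_eq, OfNat.ofNat_ne_zero, not_false_eq_true, zero_pow, Finset.sum_const_zero, mul_zero, add_zero] at h2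
        have h3 : 0 ≤ 1 / ((r:ℝ) + 1) * ∑ j, T r k j ^ 2 := by positivity
        exact (le_add_of_nonneg_right h3).trans h2
      · have : Φ r k = 0 := by funext j; simp [hΦ, hs]
        rw [this]
    · filter_upwards [hpsd, h] with k hk ⟨c, hc⟩
      have h2 : ∀ r : ℕ, I (T r k) k + 1 / ((r:ℝ) + 1) * ∑ j, T r k j ^ 2 ≤ 1 / ((r:ℝ) + 1) * ∑ j, c j ^ 2 := by
        intro r
        have := tik_min hk (x k) (y k) (δ := 1 / ((r:ℝ) + 1)) (by positivity) c
        rw [hc, zero_add] at this; exact this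
      have h3 : ∀ r : ℕ, ∑ j, T r k j ^ 2 ≤ ∑ j, c j ^ 2 := by
        intro r
        have h4 := h2 r
        have h5 : 0 ≤ I (T r k) k := bil_nonneg hk _
        exact le_of_mul_le_mul_left (by linarith) (show 0 < 1 / ((r:ℝ) + 1) by positivity)
      have h6 : Tendsto (fun r : ℕ => 1 / ((r:ℝ) + 1) * ∑ j, c j ^ 2) atTop (𝓝 0) := by
        simpa using (tendsto_one_div_add_atTop_nhds_zero_nat (𝕜 := ℝ)).mul_const (∑ j, c j ^ 2)
      refine squeeze_zero' (Eventually.of_forall fun r => bil_nonneg hk _) ?_ h6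
      obtain ⟨N, hN⟩ := exists_nat_ge (∑ j, c j ^ 2)
      filter_upwards [eventually_ge_atTop N] with r hr
      have hs : ∑ i, T r k i ^ 2 ≤ r := (h3 r).trans (hN.trans (by exact_mod_cast hr))
      have : Φ r k = T r k := by funext j; simp [hΦ, hs]
      have h7 : 0 ≤ 1 / ((r:ℝ) + 1) * ∑ j, T r k j ^ 2 := by positivity
      rw [this]
      linarith [h2 r]
  rw [integral_zero] at hlim1
  obtain ⟨r, hr⟩ := (hlim1.eventually (gt_mem_nhds (show (0:ℝ) < ε / 2 by positivity))).exists
  -- approximate Φ r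
  choose φ hφ1 hφ2 hφ3 using fun j => approx_lev L (hΦm r j) (fun k => hΦb r k j)
  have hlim2 : Tendsto (fun n => ∫ k, I (fun j => lift 𝒢 n (φ j n) k) k ∂L) atTop (𝓝 (∫ k, I (Φ r k) k ∂L)) := by
    refine tendsto_integral_of_dominated_convergence
      (fun k => (C + ∑ j : J, ((r:ℝ) + 1) * C) ^ 2 * ∑ a, ∑ b, |GG L μ X k a b|) ?_ ((GG_int L X).const_mul _) ?_ ?_
    · exact fun n => (bil_meas (rs_meas D fun j => (hφ1 j n).lift_meas) (rs_meas D fun j => (hφ1 j n).lift_meas)).aestronglyMeasurable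
    · intro n
      filter_upwards [D.x_le, D.y_le] with k h1 h2
      refine bil_bound _ _ fun a => ?_
      refine (abs_sub _ _).trans (add_le_add (h1 a) ((Finset.abs_sum_le_sum_abs _ _).trans
          (Finset.sum_le_sum fun j _ => ?_)))
      rw [abs_mul]
      exact mul_le_mul (hφ2 j n _ _) (h2 j a) (abs_nonneg _) (by positivity)
    · filter_upwards [ae_all_iff.2 hφ3] with k hk
      refine ((continuous_bil (GG L μ X k)).tendsto _).comp (tendsto_pi_nhds.2 fun a => ?_)
      exact tendsto_const_nhds.sub (tendsto_finsetSum _ fun j _ => (hk j).mul_const _)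
  obtain ⟨n0, hn0⟩ := (hlim2.eventually (gt_mem_nhds hr)).exists
  have h8 := (D.tend (fun j => hφ1 j n0)).eventually (gt_mem_nhds (hn0.trans (half_lt_self hε)))
  obtain ⟨n1, hn1⟩ := eventually_atTop.1 h8
  refine ⟨max n0 n1, fun j => rfn n0 (max n0 n1) (φ j n0), fun j => (hφ1 j n0).rfn (le_max_left _ _), fun n hn => ?_⟩
  have h9 := hn1 n ((le_max_right _ _).trans hn)
  simp only [rfn_rfn (le_max_left n0 n1) hn]
  exact h9.le

end DM

namespace DM

open Topology

variable {Ω : Type*} {m : MeasurableSpace Ω} {𝒢 : Filtration ℝ m} {μ : Measure Ω} [IsFiniteMeasure μ]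

/-- grid filtration at level n -/
def gf (𝒢 : Filtration ℝ m) (n : ℕ) : Filtration ℕ m :=
  ⟨fun i => 𝒢 (tm n i), fun i j h => 𝒢.mono (tm_mono n h), fun i => 𝒢.le _⟩

lemma gf_mart (X : Ω → ℝ) (n : ℕ) : Martingale (fun i => mc 𝒢 μ X (tm n i)) (gf 𝒢 n) μ :=
  martingale_condExp X (gf 𝒢 n) μ

lemma idx_step (n e : ℕ) (b : ℕ → Bool) : idx n b * 2 ^ e ≤ idx (n + e) b := by
  rw [← idx_div n e b]; exact Nat.div_mul_le_self _ _

/-- chain argument for upcrossings along a branch -/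
lemma chain_up {v : ℝ → ℝ} {a b : ℝ} (hab : a < b) {β : ℕ → Bool} {f : ℕ → ℕ → Unit → ℝ}
    (hf : ∀ n i, f n i () = v (tm n i))
    (h1 : ∃ᶠ n in atTop, v (tm n (idx n β)) < a) (h2 : ∃ᶠ n in atTop, b < v (tm n (idx n β))) (K : ℕ) :
    ∃ N, b < v (tm N (idx N β)) ∧ ∀ e, K ≤ upcrossingsBefore a b (f (N + e)) (idx N β * 2 ^ e + 1) () := by
  induction K with
  | zero => obtain ⟨N, hN⟩ := h2.exists; exact ⟨N, hN, fun e => Nat.zero_le _⟩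
  | succ K ih =>
    obtain ⟨N, hN, hK⟩ := ih
    obtain ⟨N1, hN1, ha⟩ := (frequently_atTop.1 h1) N
    obtain ⟨N2, hN2, hb⟩ := (frequently_atTop.1 h2) N1
    obtain ⟨e1, rfl⟩ := Nat.exists_eq_add_of_le hN1
    obtain ⟨e2, rfl⟩ := Nat.exists_eq_add_of_le hN2
    refine ⟨_, hb, fun e => ?_⟩
    have hlt : idx N β * 2 ^ e1 < idx (N + e1) β := by
      refine lt_of_le_of_ne (idx_step N e1 β) fun h => ?_
      rw [← h, tm_pow] at ha
      linarith
    have hK' := hK (e1 + (e2 + e))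
    have e1' : N + (e1 + (e2 + e)) = N + e1 + e2 + e := by ring
    rw [e1'] at hK'
    refine Nat.succ_le_of_lt (lt_of_le_of_lt hK' ?_)
    refine upcrossingsBefore_lt_of_exists_upcrossing hab (N₁ := idx (N + e1) β * 2 ^ (e2 + e)) ?_ ?_ ?_ ?_
    · rw [pow_add 2 e1, ← mul_assoc]
      refine Nat.succ_le_of_lt (Nat.mul_lt_mul_of_pos_right hlt (by positivity))
    · rw [hf, add_assoc (N + e1), tm_pow]; exact ha
    · rw [pow_add, ← mul_assoc]
      exact Nat.mul_le_mul_right _ (idx_step _ _ _)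
    · rw [hf, tm_pow]; exact hb

lemma upc_unit {a b : ℝ} (f : ℕ → Ω → ℝ) (N : ℕ) (ω : Ω) :
    upcrossingsBefore a b f N ω = upcrossingsBefore a b (fun i (_ : Unit) => f i ω) N () := by
  have hu : ∀ (M k : ℕ), upperCrossingTime a b f M k ω =
      upperCrossingTime a b (fun i (_ : Unit) => f i ω) M k () := by
    intro M k
    induction k with
    | zero => simp
    | succ k ih =>
      rw [upperCrossingTime_succ]
      simp only [ih]
      rfl
  simp only [upcrossingsBefore, hu]

lemma branch_conv {X : Ω → ℝ} (hX : Bd μ X) :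
    ∀ᵐ ω ∂μ, ∀ β : ℕ → Bool, ∃ c, Tendsto (fun n => mc 𝒢 μ X (tm n (idx n β)) ω) atTop (𝓝 c) := by
  obtain ⟨mX, C, hC, bX⟩ := id hX
  have key : ∀ a b : ℚ, (a : ℝ) < b → ∀ᵐ ω ∂μ,
      liminf (fun n => ((upcrossingsBefore (a:ℝ) b (fun i => mc 𝒢 μ X (tm n i)) (2 ^ n) ω : ℕ) : ℝ≥0∞)) atTop < ∞ := by
    intro a b hab
    have hm : ∀ n, Measurable fun ω => ((upcrossingsBefore (a:ℝ) b (fun i => mc 𝒢 μ X (tm n i)) (2 ^ n) ω : ℕ) : ℝ≥0∞) :=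
      fun n => measurable_from_top.comp ((gf_mart X n).1.measurable_upcrossingsBefore hab)
    refine ae_lt_top (Measurable.liminf hm) (ne_top_of_le_ne_top ?_ (lintegral_liminf_le hm))
    have hb : ∀ n, ∫⁻ ω, ((upcrossingsBefore (a:ℝ) b (fun i => mc 𝒢 μ X (tm n i)) (2 ^ n) ω : ℕ) : ℝ≥0∞) ∂μ
        ≤ ENNReal.ofReal ((C + |(a:ℝ)|) * μ.real univ / (b - a)) := by
      intro n
      have h1 := (gf_mart (𝒢 := 𝒢) (μ := μ) X n).submartingale.mul_integral_upcrossingsBefore_le_integral_pos_part a b (2 ^ n)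
      have h2 := (gf_mart (𝒢 := 𝒢) (μ := μ) X n).1.integrable_upcrossingsBefore (N := 2 ^ n) (μ := μ) hab
      have h3 : ∫ ω, (mc 𝒢 μ X (tm n (2 ^ n)) ω - a)⁺ ∂μ ≤ (C + |(a:ℝ)|) * μ.real univ := by
        calc _ ≤ ∫ ω, (C + |(a:ℝ)|) ∂μ := by
              refine integral_mono_of_nonneg (ae_of_all _ fun _ => posPart_nonneg _) (integrable_const _) ?_
              filter_upwards [mc_bound (𝒢 := 𝒢) hC bX (tm n (2 ^ n))] with ω hω
              refine sup_le ?_ (by positivity)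
              have := (abs_le.1 hω).2; have := neg_abs_le (a:ℝ); linarith
          _ = _ := by simp [mul_comm]
      have h4 : ∫ ω, (upcrossingsBefore (a:ℝ) b (fun i => mc 𝒢 μ X (tm n i)) (2 ^ n) ω : ℝ) ∂μ
          ≤ (C + |(a:ℝ)|) * μ.real univ / (b - a) := by
        rw [le_div_iff₀ (by linarith), mul_comm]; exact h1.trans h3
      refine le_trans (le_of_eq ?_) (ENNReal.ofReal_le_ofReal h4)
      rw [ofReal_integral_eq_lintegral_ofReal h2 (ae_of_all _ fun _ => by positivity)]
      simp
    refine ne_top_of_le_ne_top ENNReal.ofReal_ne_top (liminf_le_of_frequently_le' (Frequently.of_forall hb))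
  have key2 := ae_all_iff.2 fun a : ℚ => ae_all_iff.2 fun b : ℚ => eventually_imp_distrib_left.2 (key a b)
  have hbd : ∀ᵐ ω ∂μ, ∀ n i, |mc 𝒢 μ X (tm n i) ω| ≤ C :=
    ae_all_iff.2 fun n => ae_all_iff.2 fun i => mc_bound hC bX _
  filter_upwards [key2, hbd] with ω hω hb β
  refine tendsto_of_no_upcrossings Rat.isDenseEmbedding_coe_real.dense ?_ ?_ ?_
  · rintro _ ⟨a, rfl⟩ _ ⟨b, rfl⟩ hab ⟨h1, h2⟩
    have h3 := hω a b hab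
    have : Tendsto (fun n => ((upcrossingsBefore (a:ℝ) b (fun i => mc 𝒢 μ X (tm n i)) (2 ^ n) ω : ℕ) : ℝ≥0∞)) atTop (𝓝 ∞) := by
      rw [ENNReal.tendsto_nhds_top_iff_nat]
      intro K
      obtain ⟨N, hN, hK⟩ := chain_up (v := fun t => mc 𝒢 μ X t ω) hab (f := fun n i _ => mc 𝒢 μ X (tm n i) ω)
        (fun _ _ => rfl) h1 h2 (K + 1)
      filter_upwards [eventually_ge_atTop N] with n hn
      obtain ⟨e, rfl⟩ := Nat.exists_eq_add_of_le hn
      have h4 := (hK e).trans (upcrossingsBefore_mono (f := fun i (_ : Unit) => mc 𝒢 μ X (tm (N + e) i) ω) hab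
        (show idx N β * 2 ^ e + 1 ≤ 2 ^ (N + e) by
          rw [pow_add]; exact Nat.succ_le_of_lt (Nat.mul_lt_mul_of_pos_right (idx_lt N β) (by positivity))) ())
      rw [upc_unit]
      exact_mod_cast h4
    rw [this.liminf_eq] at h3
    exact lt_irrefl _ h3
  · exact isBoundedUnder_of ⟨C, fun n => (abs_le.1 (hb _ _)).2⟩
  · exact isBoundedUnder_of ⟨-C, fun n => (abs_le.1 (hb _ _)).1⟩

/-- maximal inequality from below -/
lemma min_ineq {Y : Ω → ℝ} (hY : Bd μ Y) (δ : ℝ) (s : ℕ → ℝ) (hs : Monotone s) (N : ℕ) :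
    ∫ ω in {ω | ∃ i < N, mc 𝒢 μ Y (s i) ω ≤ δ}, Y ω ∂μ ≤ δ * μ.real {ω | ∃ i < N, mc 𝒢 μ Y (s i) ω ≤ δ} := by
  have hmB : ∀ N t, (∀ i < N, s i ≤ t) → MeasurableSet[𝒢 t] {ω | ∃ i < N, mc 𝒢 μ Y (s i) ω ≤ δ} := by
    intro N t ht
    have : {ω | ∃ i < N, mc 𝒢 μ Y (s i) ω ≤ δ} = ⋃ i ∈ Finset.range N, {ω | mc 𝒢 μ Y (s i) ω ≤ δ} := by
      ext ω; simp
    rw [this]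
    refine @Finset.measurableSet_biUnion _ _ (_) _ _ fun i hi => ?_
    exact (mc_meas_of_le Y (ht i (Finset.mem_range.1 hi))) measurableSet_Iic
  induction N with
  | zero => simp
  | succ N ih =>
    set B := {ω | ∃ i < N, mc 𝒢 μ Y (s i) ω ≤ δ} with hB
    set A := {ω | mc 𝒢 μ Y (s N) ω ≤ δ} \ B with hA
    have hBm : MeasurableSet[𝒢 (s N)] B := hmB N (s N) fun i hi => hs hi.le
    have hAm : MeasurableSet[𝒢 (s N)] A :=
      @MeasurableSet.diff _ (_) _ _ ((mc_meas Y (s N)) measurableSet_Iic) hBm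
    have hE : {ω | ∃ i < N + 1, mc 𝒢 μ Y (s i) ω ≤ δ} = B ∪ A := by
      ext ω
      simp only [hA, hB, Set.mem_ofPred_eq, Set.union_sdiff_self, Set.mem_union, Order.lt_add_one_iff]
      constructor
      · rintro ⟨i, hi, h⟩
        rcases hi.lt_or_eq with h' | rfl
        · exact Or.inl ⟨i, h', h⟩
        · exact Or.inr h
      · rintro (⟨i, hi, h⟩ | h)
        · exact ⟨i, hi.le, h⟩
        · exact ⟨N, le_rfl, h⟩
    have hdis : Disjoint B A := disjoint_sdiff_self_right
    rw [hE, setIntegral_union hdis (𝒢.le _ _ hAm) hY.integrable.integrableOn hY.integrable.integrableOn,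
      measureReal_union hdis (𝒢.le _ _ hAm), mul_add]
    refine add_le_add ih ?_
    rw [← setIntegral_condExp (𝒢.le (s N)) hY.integrable hAm]
    calc _ ≤ ∫ ω in A, δ ∂μ := by
          refine setIntegral_mono_on integrable_condExp.integrableOn (integrable_const _).integrableOn (𝒢.le _ _ hAm) ?_
          intro ω hω; exact hω.1
      _ = _ := by simp [mul_comm]

lemma pos_low {Y : Ω → ℝ} (hY : Bd μ Y) (hpos : ∀ᵐ ω ∂μ, 0 < Y ω) :
    ∀ᵐ ω ∂μ, ∃ δ > 0, ∀ n, ∀ i ≤ 2 ^ n, δ ≤ mc 𝒢 μ Y (tm n i) ω := by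
  set B : ℕ → ℕ → Set Ω := fun r n => {ω | ∃ i < 2 ^ n + 1, mc 𝒢 μ Y (tm n i) ω ≤ 1 / ((r:ℝ) + 1)} with hB
  have hBm : ∀ r n, MeasurableSet (B r n) := by
    intro r n
    have : B r n = ⋃ i ∈ Finset.range (2 ^ n + 1), {ω | mc 𝒢 μ Y (tm n i) ω ≤ 1 / ((r:ℝ) + 1)} := by
      ext ω; simp [hB]
    rw [this]
    exact Finset.measurableSet_biUnion _ fun i hi => measurableSet_le (mc_meas' _ _) measurable_const
  have hmono : ∀ r, Monotone (B r) := fun r => monotone_nat_of_le_succ fun n ω ⟨i, hi, h⟩ =>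
    ⟨2 * i, by rw [pow_succ]; omega, by rw [tm_succ]; exact h⟩
  set E : ℕ → Set Ω := fun r => ⋃ n, B r n with hE
  have hEm : ∀ r, MeasurableSet (E r) := fun r => MeasurableSet.iUnion (hBm r)
  have h1 : ∀ r, ∫ ω in E r, Y ω ∂μ ≤ 1 / ((r:ℝ) + 1) * μ.real univ := by
    intro r
    refine le_of_tendsto (tendsto_setIntegral_of_monotone (hBm r) (hmono r) hY.integrable.integrableOn)
      (Eventually.of_forall fun n => ?_)
    refine (min_ineq hY (1 / ((r:ℝ) + 1)) (tm n) (fun i j h => tm_mono n h) (2 ^ n + 1)).trans ?_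
    exact mul_le_mul_of_nonneg_left (measureReal_mono (μ := μ) (Set.subset_univ _)) (by positivity)
  have h2 : ∫ ω in ⋂ r, E r, Y ω ∂μ ≤ 0 := by
    have ht : Tendsto (fun r : ℕ => 1 / ((r:ℝ) + 1) * μ.real univ) atTop (𝓝 0) := by
      simpa using (tendsto_one_div_add_atTop_nhds_zero_nat (𝕜 := ℝ)).mul_const (μ.real univ)
    refine ge_of_tendsto ht (Eventually.of_forall fun r => le_trans ?_ (h1 r))
    exact setIntegral_mono_set hY.integrable.integrableOn (ae_restrict_of_ae (hpos.mono fun ω h => h.le))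
      (Set.iInter_subset _ r).eventuallyLE
  have hIm : MeasurableSet (⋂ r, E r) := MeasurableSet.iInter hEm
  have h3 : μ (⋂ r, E r) = 0 := by
    have h4 := (setIntegral_eq_zero_iff_of_nonneg_ae (ae_restrict_of_ae (hpos.mono fun ω h => h.le))
      hY.integrable.integrableOn).1 (le_antisymm h2 (setIntegral_nonneg_of_ae (hpos.mono fun ω h => h.le)))
    have h5 : ∀ᵐ ω ∂(μ.restrict (⋂ r, E r)), False := by
      filter_upwards [h4, ae_restrict_of_ae hpos] with ω h h'
      rw [h] at h'; exact lt_irrefl _ h'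
    simpa using h5
  filter_upwards [measure_eq_zero_iff_ae_notMem.1 h3] with ω hω
  simp only [hE, hB, Set.mem_iInter, Set.mem_iUnion, Set.mem_ofPred_eq, not_forall, not_exists, not_and, not_le] at hω
  obtain ⟨r, hr⟩ := hω
  exact ⟨1 / ((r:ℝ) + 1), by positivity, fun n i hi => (hr n i (by omega)).le⟩

/-- null sets transfer -/
def NL (L : Measure (KK 𝒢)) (μ : Measure Ω) : Prop :=
  ∀ p : Ω → Prop, (∀ᵐ ω ∂μ, p ω) → ∀ᵐ k ∂L, p k.fst

/-- left limit -/
def lm (μ : Measure Ω) (X : Ω → ℝ) (k : KK 𝒢) : ℝ :=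
  limsup (fun n => lift 𝒢 n (fun i => mc 𝒢 μ X (tm n i)) k) atTop

lemma lm_meas (X : Ω → ℝ) : Measurable (lm (𝒢 := 𝒢) μ X) := by
  refine Measurable.limsup fun n => ?_
  exact (measurable_lift fun i => mc_meas X _).mono (lev_le 𝒢 n) le_rfl

variable {L : Measure (KK 𝒢)}

lemma lm_tendsto (hL : NL L μ) {X : Ω → ℝ} (hX : Bd μ X) :
    ∀ᵐ k ∂L, Tendsto (fun n => lift 𝒢 n (fun i => mc 𝒢 μ X (tm n i)) k) atTop (𝓝 (lm μ X k)) := by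
  filter_upwards [hL _ (branch_conv (𝒢 := 𝒢) hX)] with k hk
  obtain ⟨c, hc⟩ := hk k.snd
  have : lm μ X k = c := hc.limsup_eq
  rw [this]; exact hc

lemma lm_pos (hL : NL L μ) {X : Ω → ℝ} (hX : Bd μ X) (hpos : ∀ᵐ ω ∂μ, 0 < X ω) : ∀ᵐ k ∂L, 0 < lm μ X k := by
  filter_upwards [lm_tendsto hL hX, hL _ (pos_low (𝒢 := 𝒢) hX hpos)] with k h1 ⟨δ, hδ, h2⟩
  exact hδ.trans_le (ge_of_tendsto h1 (Eventually.of_forall fun n => h2 n _ (idx_lt _ _).le))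

lemma lm_le (hL : NL L μ) {X : Ω → ℝ} (hX : Measurable X) {C : ℝ} (hC : 0 ≤ C) (hb : ∀ᵐ ω ∂μ, |X ω| ≤ C) :
    ∀ᵐ k ∂L, |lm μ X k| ≤ C := by
  have hbd : ∀ᵐ ω ∂μ, ∀ n i, |mc 𝒢 μ X (tm n i) ω| ≤ C :=
    ae_all_iff.2 fun n => ae_all_iff.2 fun i => mc_bound hC hb _
  filter_upwards [lm_tendsto hL ⟨hX, C, hC, hb⟩, hL _ hbd] with k h1 h2
  exact le_of_tendsto h1.abs (Eventually.of_forall fun n => h2 n _)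

end DM

namespace DM

open Topology

variable {Ω : Type*} {m : MeasurableSpace Ω} {𝒢 : Filtration ℝ m} {μ : Measure Ω} [IsFiniteMeasure μ]
variable {ι J : Type*} [Fintype ι] [Fintype J]

/-- clipping -/
def cl (C x : ℝ) : ℝ := max (-C) (min C x)

lemma cl_abs {C : ℝ} (hC : 0 ≤ C) (x : ℝ) : |cl C x| ≤ C :=
  abs_le.2 ⟨le_max_left _ _, max_le (by linarith) (min_le_left _ _)⟩

lemma cl_eq {C x : ℝ} (h : |x| ≤ C) : cl C x = x := by
  have h3 := abs_le.1 h
  rw [cl, min_eq_right h3.2, max_eq_right h3.1]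

/-- discrete wedge increments -/
def W (𝒢 : Filtration ℝ m) (μ : Measure Ω) (X Z : Ω → ℝ) (n i : ℕ) (ω : Ω) : ℝ :=
  mc 𝒢 μ X (tm n i) ω * inc 𝒢 μ Z n i ω - mc 𝒢 μ Z (tm n i) ω * inc 𝒢 μ X n i ω

/-- gated discrete relation -/
def Rel (𝒢 : Filtration ℝ m) (μ : Measure Ω) (γ : ℕ → ℕ → Ω → ℝ) (A B : Ω → ℝ) (p q : J → Ω → ℝ) : Prop :=
  ∀ ε > 0, ∃ (n0 : ℕ) (φ : J → ℕ → Ω → ℝ), (∀ j, Pn 𝒢 n0 (φ j)) ∧ ∀ n ≥ n0,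
    ∑ i ∈ Finset.range (2 ^ n), ∫ ω, (γ n i ω * (W 𝒢 μ A B n i ω -
      ∑ j, rfn n0 n (φ j) i ω * W 𝒢 μ (p j) (q j) n i ω)) ^ 2 ∂μ ≤ ε

/-- gates -/
structure Gate (L : Measure (KK 𝒢)) (γ : ℕ → ℕ → Ω → ℝ) (γl : KK 𝒢 → ℝ) : Prop where
  P : ∀ n, Pn 𝒢 n (γ n)
  le : ∀ n i ω, |γ n i ω| ≤ 1
  meas : Measurable γl
  lim : ∀ᵐ k ∂L, Tendsto (fun n => lift 𝒢 n (γ n) k) atTop (𝓝 (γl k))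

lemma Gate.one (L : Measure (KK 𝒢)) : Gate L (fun _ _ _ => 1) (fun _ => 1) :=
  ⟨fun n => Pn.const 1, fun _ _ _ => by simp, measurable_const, ae_of_all _ fun k => tendsto_const_nhds⟩

/-- wedge vector -/
def Bv {r : ℕ} (μ : Measure Ω) (X : ι → Ω → ℝ) (k : KK 𝒢) (u : ι → EuclideanSpace ℝ (Fin r)) (a b : ι) :
    EuclideanSpace ℝ (Fin r) := lm μ (X a) k • u b - lm μ (X b) k • u a

/-- Gram realization -/
def Gr (L : Measure (KK 𝒢)) (μ : Measure Ω) [IsFiniteMeasure μ] (X : ι → Ω → ℝ) (k : KK 𝒢) {r : ℕ}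
    (u : ι → EuclideanSpace ℝ (Fin r)) : Prop := ∀ a b, inner ℝ (u a) (u b) = gam L μ (X a) (X b) k

lemma exists_gr {L : Measure (KK 𝒢)} [IsFiniteMeasure L] {X : ι → Ω → ℝ} (h : ∀ a, AC 𝒢 μ L (X a)) :
    ∀ᵐ k ∂L, ∃ r, ∃ u : ι → EuclideanSpace ℝ (Fin r), Gr L μ X k u := by
  filter_upwards [gam_psd h] with k hk
  obtain ⟨r, u, hu⟩ := psd_gram hk
  exact ⟨r, u, fun a b => hu a b⟩

section
variable [DecidableEq ι]

/-- wedge coefficients -/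
def wc (g : ℝ) (x : ι → ℝ) (a b : ι) (c : ι) : ℝ := g * ((if c = b then x a else 0) - (if c = a then x b else 0))

lemma wc_sum {E : Type*} [AddCommGroup E] [Module ℝ E] (g : ℝ) (x : ι → ℝ) (a b : ι) (u : ι → E) :
    ∑ c, wc g x a b c • u c = g • (x a • u b - x b • u a) := by
  simp only [wc, mul_sub, sub_smul, Finset.sum_sub_distrib, mul_ite, mul_zero, ite_smul, zero_smul]
  simp [smul_sub, smul_smul]

lemma wc_sum' (g : ℝ) (x : ι → ℝ) (a b : ι) (u : ι → ℝ) :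
    ∑ c, wc g x a b c * u c = g * (x a * u b - x b * u a) := by
  simpa using wc_sum g x a b u

lemma wc_abs {g : ℝ} (hg : |g| ≤ 1) {C : ℝ} (hC : 0 ≤ C) {x : ι → ℝ} (hx : ∀ a, |x a| ≤ C) (a b c : ι) :
    |wc g x a b c| ≤ 2 * C := by
  rw [wc, abs_mul]
  have h1 : |(if c = b then x a else 0) - (if c = a then x b else 0)| ≤ C + C := by
    refine (abs_sub _ _).trans (add_le_add ?_ ?_)
    · split_ifs; exacts [hx a, by simpa]
    · split_ifs; exacts [hx b, by simpa]
  calc _ ≤ 1 * (C + C) := mul_le_mul hg h1 (abs_nonneg _) (by norm_num)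
    _ = _ := by ring

variable {L : Measure (KK 𝒢)} [IsFiniteMeasure L] {X : ι → Ω → ℝ} {γ : ℕ → ℕ → Ω → ℝ} {γl : KK 𝒢 → ℝ}

lemma wc_Pn (hγ : Gate L γ γl) {C : ℝ} (hC : 0 ≤ C) (n : ℕ) (a b c : ι) :
    Pn 𝒢 n (fun i ω => wc (γ n i ω) (fun e => cl C (mc 𝒢 μ (X e) (tm n i) ω)) a b c) := by
  refine ⟨fun i => ?_, 2 * C, fun i ω => wc_abs (hγ.le n i ω) hC (fun e => cl_abs hC _) a b c⟩
  have h1 : ∀ e, Measurable[𝒢 (tm n i)] fun ω => cl C (mc 𝒢 μ (X e) (tm n i) ω) := fun e =>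
    measurable_const.max (measurable_const.min (mc_meas (X e) (tm n i)))
  unfold wc
  refine Measurable.mul ((hγ.P n).1 i) (Measurable.sub ?_ ?_)
  · split_ifs
    exacts [h1 a, measurable_const]
  · split_ifs
    exacts [h1 b, measurable_const]

lemma wc_tend {g : ℕ → ℝ} {g' : ℝ} {x : ℕ → ι → ℝ} {x' : ι → ℝ} (hg : Tendsto g atTop (𝓝 g'))
    (hx : ∀ a, Tendsto (fun n => x n a) atTop (𝓝 (x' a))) (a b c : ι) :
    Tendsto (fun n => wc (g n) (x n) a b c) atTop (𝓝 (wc g' x' a b c)) := by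
  unfold wc
  refine hg.mul (Tendsto.sub ?_ ?_)
  · split_ifs
    exacts [hx a, tendsto_const_nhds]
  · split_ifs
    exacts [hx b, tendsto_const_nhds]

lemma wc_meas (hγ : Gate L γ γl) (a b c : ι) :
    Measurable fun k => wc (γl k) (fun e => lm μ (X e) k) a b c := by
  unfold wc
  refine Measurable.mul hγ.meas (Measurable.sub ?_ ?_)
  · split_ifs
    exacts [lm_meas _, measurable_const]
  · split_ifs
    exacts [lm_meas _, measurable_const]

lemma mkDat (hL : NL L μ) (hX : ∀ a, AC 𝒢 μ L (X a)) (hγ : Gate L γ γl) {C : ℝ} (hC : 0 ≤ C)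
    (hb : ∀ a, ∀ᵐ ω ∂μ, |X a ω| ≤ C) (a b : ι) (p q : J → ι) :
    Dat L μ X (fun n c i ω => wc (γ n i ω) (fun e => cl C (mc 𝒢 μ (X e) (tm n i) ω)) a b c)
      (fun n j c i ω => wc (γ n i ω) (fun e => cl C (mc 𝒢 μ (X e) (tm n i) ω)) (p j) (q j) c)
      (fun k c => wc (γl k) (fun e => lm μ (X e) k) a b c)
      (fun k j c => wc (γl k) (fun e => lm μ (X e) k) (p j) (q j) c) (2 * C) := by
  have hlim : ∀ᵐ k ∂L, ∀ e, Tendsto (fun n => cl C (mc 𝒢 μ (X e) (tm n (idx n k.snd)) k.fst)) atTop (𝓝 (lm μ (X e) k)) := by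
    refine ae_all_iff.2 fun e => ?_
    have hbd : ∀ᵐ ω ∂μ, ∀ n i, |mc 𝒢 μ (X e) (tm n i) ω| ≤ C :=
      ae_all_iff.2 fun n => ae_all_iff.2 fun i => mc_bound hC (hb e) _
    filter_upwards [lm_tendsto hL (hX e).1, hL _ hbd] with k h1 h2
    refine h1.congr fun n => ?_
    rw [cl_eq (h2 _ _)]; rfl
  refine ⟨hX, fun n c => wc_Pn hγ hC n a b c, fun n c i ω => wc_abs (hγ.le n i ω) hC (fun e => cl_abs hC _) _ _ _,
    fun n j c => wc_Pn hγ hC n _ _ c, fun n j c i ω => wc_abs (hγ.le n i ω) hC (fun e => cl_abs hC _) _ _ _,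
    fun c => wc_meas hγ a b c, fun j c => wc_meas hγ _ _ c, ?_, ?_⟩
  · filter_upwards [hlim, hγ.lim] with k h1 h2 c
    exact wc_tend h2 h1 a b c
  · filter_upwards [hlim, hγ.lim] with k h1 h2 j c
    exact wc_tend h2 h1 _ _ c

lemma rel_iff_relA {C : ℝ} (hC : 0 ≤ C) (hb : ∀ a, ∀ᵐ ω ∂μ, |X a ω| ≤ C) (a b : ι) (p q : J → ι) :
    Rel 𝒢 μ γ (X a) (X b) (fun j => X (p j)) (fun j => X (q j)) ↔
    RelA 𝒢 μ X (fun n c i ω => wc (γ n i ω) (fun e => cl C (mc 𝒢 μ (X e) (tm n i) ω)) a b c)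
      (fun n j c i ω => wc (γ n i ω) (fun e => cl C (mc 𝒢 μ (X e) (tm n i) ω)) (p j) (q j) c) := by
  unfold Rel RelA
  have key : ∀ n0 n (φ : J → ℕ → Ω → ℝ), ∑ i ∈ Finset.range (2 ^ n), ∫ ω, (γ n i ω * (W 𝒢 μ (X a) (X b) n i ω -
      ∑ j, rfn n0 n (φ j) i ω * W 𝒢 μ (X (p j)) (X (q j)) n i ω)) ^ 2 ∂μ =
      qs 𝒢 μ X n (fun c i ω => wc (γ n i ω) (fun e => cl C (mc 𝒢 μ (X e) (tm n i) ω)) a b c -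
        ∑ j, rfn n0 n (φ j) i ω * wc (γ n i ω) (fun e => cl C (mc 𝒢 μ (X e) (tm n i) ω)) (p j) (q j) c) := by
    intro n0 n φ
    rw [qs]
    refine Finset.sum_congr rfl fun i _ => integral_congr_ae ?_
    filter_upwards [ae_all_iff.2 fun e => mc_bound (𝒢 := 𝒢) hC (hb e) (tm n i)] with ω h
    simp only [cl_eq (h _)]
    congr 1
    simp only [sub_mul, Finset.sum_sub_distrib, Finset.sum_mul]
    rw [Finset.sum_comm]
    simp only [mul_assoc, ← Finset.mul_sum, wc_sum', W, mul_sub]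
    congr 1
    rw [Finset.mul_sum]
    refine Finset.sum_congr rfl fun j _ => ?_
    ring
  simp only [key]

lemma bil_wc {k : KK 𝒢} {r : ℕ} {u : ι → EuclideanSpace ℝ (Fin r)} (hu : Gr L μ X k u) (g : ℝ) (a b : ι) (p q : J → ι)
    (c : J → ℝ) :
    bil (GG L μ X k) (rs (fun e => wc g (fun e => lm μ (X e) k) a b e)
      (fun j e => wc g (fun e => lm μ (X e) k) (p j) (q j) e) c)
      (rs (fun e => wc g (fun e => lm μ (X e) k) a b e)
      (fun j e => wc g (fun e => lm μ (X e) k) (p j) (q j) e) c) =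
    ‖g • (Bv μ X k u a b - ∑ j, c j • Bv μ X k u (p j) (q j))‖ ^ 2 := by
  rw [bil_inner (A := GG L μ X k) (u := u) (fun a b => hu a b), real_inner_self_eq_norm_sq, rs_vec, wc_sum]
  simp only [wc_sum]
  simp only [smul_sub, Finset.smul_sum, Bv, smul_smul, mul_comm g, mul_assoc]

theorem rel_span (hL : NL L μ) (hX : ∀ a, AC 𝒢 μ L (X a)) (hγ : Gate L γ γl) (a b : ι) (p q : J → ι)
    (h : Rel 𝒢 μ γ (X a) (X b) (fun j => X (p j)) (fun j => X (q j))) :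
    ∀ᵐ k ∂L, γl k ≠ 0 → ∀ (r : ℕ) (u : ι → EuclideanSpace ℝ (Fin r)), Gr L μ X k u →
      Bv μ X k u a b ∈ Submodule.span ℝ (range fun j => Bv μ X k u (p j) (q j)) := by
  choose C hC hb using fun a => (hX a).1.2
  have hb' : ∀ a, ∀ᵐ ω ∂μ, |X a ω| ≤ ∑ a, C a := fun a => (hb a).mono fun ω h =>
    h.trans (Finset.single_le_sum (fun a _ => hC a) (Finset.mem_univ a))
  have hC' : 0 ≤ ∑ a, C a := Finset.sum_nonneg fun a _ => hC a
  filter_upwards [span_of_rel (mkDat hL hX hγ hC' hb' a b p q) ((rel_iff_relA hC' hb' a b p q).1 h)] with k ⟨c, hc⟩ hk r u hu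
  rw [bil_wc hu] at hc
  have h1 : Bv μ X k u a b - ∑ j, c j • Bv μ X k u (p j) (q j) = 0 := by
    have := norm_eq_zero.1 (pow_eq_zero_iff (two_ne_zero)|>.1 hc)
    exact (smul_eq_zero.1 this).resolve_left hk
  rw [sub_eq_zero.1 h1]
  exact Submodule.sum_mem _ fun j _ => Submodule.smul_mem _ _ (Submodule.subset_span ⟨j, rfl⟩)

theorem span_rel (hL : NL L μ) (hX : ∀ a, AC 𝒢 μ L (X a)) (hγ : Gate L γ γl) (a b : ι) (p q : J → ι)
    (h : ∀ᵐ k ∂L, γl k ≠ 0 → ∀ (r : ℕ) (u : ι → EuclideanSpace ℝ (Fin r)), Gr L μ X k u →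
      Bv μ X k u a b ∈ Submodule.span ℝ (range fun j => Bv μ X k u (p j) (q j))) :
    Rel 𝒢 μ γ (X a) (X b) (fun j => X (p j)) (fun j => X (q j)) := by
  choose C hC hb using fun a => (hX a).1.2
  have hb' : ∀ a, ∀ᵐ ω ∂μ, |X a ω| ≤ ∑ a, C a := fun a => (hb a).mono fun ω h =>
    h.trans (Finset.single_le_sum (fun a _ => hC a) (Finset.mem_univ a))
  have hC' : 0 ≤ ∑ a, C a := Finset.sum_nonneg fun a _ => hC a
  rw [rel_iff_relA hC' hb' a b p q]
  refine rel_of_span (mkDat hL hX hγ hC' hb' a b p q) ?_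
  filter_upwards [h, exists_gr hX] with k hk ⟨r, u, hu⟩
  by_cases h0 : γl k = 0
  · refine ⟨0, ?_⟩
    rw [bil_wc hu, h0]; simp
  · obtain ⟨c, hc⟩ := (Submodule.mem_span_range_iff_exists_fun ℝ).1 (hk h0 r u hu)
    refine ⟨c, ?_⟩
    rw [bil_wc hu, hc]; simp
end

end DM

namespace DM

open Topology

variable {Ω : Type*} {m : MeasurableSpace Ω} {𝒢 : Filtration ℝ m} {μ : Measure Ω} [IsFiniteMeasure μ]
variable {J : Type*} [Fintype J]

lemma tm_le_succ (n i : ℕ) : tm n i ≤ tm n (i + 1) := tm_mono n (Nat.le_succ i)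

lemma sum_inc_sq_le {H : Ω → ℝ} (hH : Bd μ H) (n N : ℕ) :
    ∑ i ∈ Finset.range N, ∫ ω, inc 𝒢 μ H n i ω ^ 2 ∂μ ≤ ∫ ω, H ω ^ 2 ∂μ := by
  have h1 : ∀ i, ∫ ω, inc 𝒢 μ H n i ω ^ 2 ∂μ =
      ∫ ω, mc 𝒢 μ H (tm n (i+1)) ω ^ 2 ∂μ - ∫ ω, mc 𝒢 μ H (tm n i) ω ^ 2 ∂μ := by
    intro i
    have := pythag (μ := μ) (𝒢 := 𝒢) (f := fun _ => 1) (tm_le_succ n i) measurable_const (Bd.const 1) hH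
    simpa [inc] using this
  simp only [h1]
  rw [Finset.sum_range_sub (fun i => ∫ ω, mc 𝒢 μ H (tm n i) ω ^ 2 ∂μ)]
  have h2 : 0 ≤ ∫ ω, mc 𝒢 μ H (tm n 0) ω ^ 2 ∂μ := integral_nonneg fun _ => sq_nonneg _
  have h3 : ∫ ω, mc 𝒢 μ H (tm n N) ω ^ 2 ∂μ ≤ ∫ ω, H ω ^ 2 ∂μ := by
    have h4 := int_mul_mc (μ := μ) (𝒢 := 𝒢) (t := tm n N) (mc_meas H (tm n N)) (hH.mc _) hH
    have h5 : 0 ≤ ∫ ω, (H ω - mc 𝒢 μ H (tm n N) ω) ^ 2 ∂μ := integral_nonneg fun _ => sq_nonneg _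
    have h6 : ∫ ω, (H ω - mc 𝒢 μ H (tm n N) ω) ^ 2 ∂μ = ∫ ω, H ω ^ 2 ∂μ -
        2 * ∫ ω, mc 𝒢 μ H (tm n N) ω * H ω ∂μ + ∫ ω, mc 𝒢 μ H (tm n N) ω * mc 𝒢 μ H (tm n N) ω ∂μ := by
      rw [← integral_const_mul, ← integral_sub hH.sq.integrable (((hH.mc _).mul hH).const_mul 2).integrable,
        ← integral_add (hH.sq.sub (((hH.mc _).mul hH).const_mul 2)).integrable ((hH.mc _).mul (hH.mc _)).integrable]
      congr 1; funext ω; ring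
    rw [h6, ← h4] at h5
    simp only [pow_two] at h5 ⊢
    linarith
  linarith

lemma bmo_pt {C h h' y y' : ℝ} (hy : |y| ≤ C) (hy' : |y'| ≤ C) :
    -((h' ^ 2 - h ^ 2) * (y' ^ 2 - y ^ 2)) ≤ 1 / 2 * (h ^ 2 * (y' - y) ^ 2) + 12 * C ^ 2 * (h' - h) ^ 2 := by
  have hC : 0 ≤ C := (abs_nonneg _).trans hy
  have h1 : |y' + y| ≤ 2 * C := (abs_add_le _ _).trans (by linarith)
  have h2 : |y' - y| ≤ 2 * C := (abs_sub _ _).trans (by linarith)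
  set D := h' - h
  have e : h' ^ 2 - h ^ 2 = 2 * h * D + D ^ 2 := by simp only [D]; ring
  rw [e]
  have e2 : -((2 * h * D + D ^ 2) * (y' ^ 2 - y ^ 2)) = -(2 * D * (y' + y)) * (h * (y' - y)) - D ^ 2 * ((y' + y) * (y' - y)) := by ring
  rw [e2]
  have s1 : (y' + y) ^ 2 ≤ 4 * C ^ 2 := by nlinarith [abs_le.1 h1, sq_abs (y' + y), abs_nonneg (y' + y)]
  have s2 : |(y' + y) * (y' - y)| ≤ 4 * C ^ 2 := by
    rw [abs_mul]; nlinarith [abs_nonneg (y' + y), abs_nonneg (y' - y)]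
  have s3 := (abs_le.1 s2).1
  have s4 : -(2 * D * (y' + y)) * (h * (y' - y)) ≤ 1 / 2 * (h * (y' - y)) ^ 2 + 2 * (D ^ 2 * (y' + y) ^ 2) := by
    nlinarith [sq_nonneg (2 * D * (y' + y) + h * (y' - y))]
  have s5 : D ^ 2 * (y' + y) ^ 2 ≤ D ^ 2 * (4 * C ^ 2) := mul_le_mul_of_nonneg_left s1 (sq_nonneg _)
  have s6 : D ^ 2 * (-(4 * C ^ 2)) ≤ D ^ 2 * ((y' + y) * (y' - y)) := mul_le_mul_of_nonneg_left s3 (sq_nonneg _)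
  nlinarith

lemma bmo {Y H : Ω → ℝ} (mY : Measurable Y) {C : ℝ} (hC : 0 ≤ C) (bY : ∀ᵐ ω ∂μ, |Y ω| ≤ C) (hH : Bd μ H) (n : ℕ) (N : ℕ) :
    ∑ i ∈ Finset.range N, ∫ ω, (mc 𝒢 μ H (tm n i) ω * inc 𝒢 μ Y n i ω) ^ 2 ∂μ ≤ 26 * C ^ 2 * ∫ ω, H ω ^ 2 ∂μ := by
  have hY : Bd μ Y := ⟨mY, C, hC, bY⟩
  have step : ∀ i, ∫ ω, (mc 𝒢 μ H (tm n i) ω * inc 𝒢 μ Y n i ω) ^ 2 ∂μ ≤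
      (∫ ω, (mc 𝒢 μ H (tm n (i+1)) ω * mc 𝒢 μ Y (tm n (i+1)) ω) ^ 2 ∂μ - ∫ ω, (mc 𝒢 μ H (tm n i) ω * mc 𝒢 μ Y (tm n i) ω) ^ 2 ∂μ)
      + 1 / 2 * ∫ ω, (mc 𝒢 μ H (tm n i) ω * inc 𝒢 μ Y n i ω) ^ 2 ∂μ + 12 * C ^ 2 * ∫ ω, inc 𝒢 μ H n i ω ^ 2 ∂μ := by
    intro i
    set h := mc 𝒢 μ H (tm n i) with hh
    set h' := mc 𝒢 μ H (tm n (i+1)) with hh'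
    set y := mc 𝒢 μ Y (tm n i) with hy
    set y' := mc 𝒢 μ Y (tm n (i+1)) with hy'
    have Bh : Bd μ h := hH.mc _
    have Bh' : Bd μ h' := hH.mc _
    have By : Bd μ y := hY.mc _
    have By' : Bd μ y' := hY.mc _
    have p1 := pythag (μ := μ) (𝒢 := 𝒢) (f := fun ω => h ω ^ 2) (tm_le_succ n i) ((mc_meas H _).pow_const 2) Bh.sq hY
    have p2 := pyth_nonneg (μ := μ) (𝒢 := 𝒢) (f := fun ω => y ω ^ 2) hH (tm_le_succ n i) ((mc_meas Y _).pow_const 2) By.sq (fun _ => sq_nonneg _)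
    simp only [← hh, ← hh', ← hy, ← hy'] at p1 p2
    have e1 : ∫ ω, (h ω * inc 𝒢 μ Y n i ω) ^ 2 ∂μ = ∫ ω, h ω ^ 2 * (y' ω - y ω) ^ 2 ∂μ := by
      congr 1; funext ω; rw [mul_pow]; rfl
    have e2 : ∫ ω, inc 𝒢 μ H n i ω ^ 2 ∂μ = ∫ ω, (h' ω - h ω) ^ 2 ∂μ := rfl
    have key : ∫ ω, (h ω ^ 2 * y' ω ^ 2 - h ω ^ 2 * y ω ^ 2) ∂μ ≤
        ∫ ω, (((h' ω * y' ω) ^ 2 - (h ω * y ω) ^ 2) + 1 / 2 * (h ω ^ 2 * (y' ω - y ω) ^ 2) + 12 * C ^ 2 * (h' ω - h ω) ^ 2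
          - (y ω ^ 2 * h' ω ^ 2 - y ω ^ 2 * h ω ^ 2)) ∂μ := by
      refine integral_mono_ae ((Bh.sq.mul By'.sq).sub (Bh.sq.mul By.sq)).integrable
        (((((Bh'.mul By').sq.sub (Bh.mul By).sq).add ((Bh.sq.mul (By'.sub By).sq).const_mul _)).add
          ((Bh'.sub Bh).sq.const_mul _)).sub ((By.sq.mul Bh'.sq).sub (By.sq.mul Bh.sq))).integrable ?_
      filter_upwards [mc_bound (𝒢 := 𝒢) hC bY (tm n i), mc_bound (𝒢 := 𝒢) hC bY (tm n (i+1))] with ω b1 b2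
      have := bmo_pt (C := C) (h := h ω) (h' := h' ω) b1 b2
      linear_combination this
    rw [integral_sub (Bh.sq.mul By'.sq).integrable (Bh.sq.mul By.sq).integrable,
      integral_sub ((((Bh'.mul By').sq.sub (Bh.mul By).sq).add ((Bh.sq.mul (By'.sub By).sq).const_mul _)).add
          ((Bh'.sub Bh).sq.const_mul _)).integrable ((By.sq.mul Bh'.sq).sub (By.sq.mul Bh.sq)).integrable,
      integral_add (((Bh'.mul By').sq.sub (Bh.mul By).sq).add ((Bh.sq.mul (By'.sub By).sq).const_mul _)).integrable
          ((Bh'.sub Bh).sq.const_mul _).integrable,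
      integral_add ((Bh'.mul By').sq.sub (Bh.mul By).sq).integrable ((Bh.sq.mul (By'.sub By).sq).const_mul _).integrable,
      integral_sub (Bh'.mul By').sq.integrable (Bh.mul By).sq.integrable,
      integral_sub (By.sq.mul Bh'.sq).integrable (By.sq.mul Bh.sq).integrable,
      integral_const_mul, integral_const_mul] at key
    rw [e1, e2]
    linarith
  have hs := Finset.sum_le_sum fun i (_ : i ∈ Finset.range N) => step i
  rw [Finset.sum_add_distrib, Finset.sum_add_distrib, ← Finset.mul_sum, ← Finset.mul_sum,
    Finset.sum_range_sub (fun i => ∫ ω, (mc 𝒢 μ H (tm n i) ω * mc 𝒢 μ Y (tm n i) ω) ^ 2 ∂μ)] at hs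
  have h0 : 0 ≤ ∫ ω, (mc 𝒢 μ H (tm n 0) ω * mc 𝒢 μ Y (tm n 0) ω) ^ 2 ∂μ := integral_nonneg fun _ => sq_nonneg _
  have h1 : ∫ ω, (mc 𝒢 μ H (tm n N) ω * mc 𝒢 μ Y (tm n N) ω) ^ 2 ∂μ ≤ C ^ 2 * ∫ ω, H ω ^ 2 ∂μ := by
    have h2 : ∫ ω, (mc 𝒢 μ H (tm n N) ω * mc 𝒢 μ Y (tm n N) ω) ^ 2 ∂μ ≤ ∫ ω, C ^ 2 * mc 𝒢 μ H (tm n N) ω ^ 2 ∂μ := by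
      refine integral_mono_ae ((hH.mc _).mul (hY.mc _)).sq.integrable ((hH.mc _).sq.const_mul _).integrable ?_
      filter_upwards [mc_bound (𝒢 := 𝒢) hC bY (tm n N)] with ω b1
      simp only [mul_pow]
      rw [mul_comm]
      exact mul_le_mul_of_nonneg_right (by nlinarith [abs_le.1 b1, sq_abs (mc 𝒢 μ Y (tm n N) ω), abs_nonneg (mc 𝒢 μ Y (tm n N) ω)]) (sq_nonneg _)
    rw [integral_const_mul] at h2
    refine h2.trans (mul_le_mul_of_nonneg_left ?_ (sq_nonneg _))
    have h4 := int_mul_mc (μ := μ) (𝒢 := 𝒢) (t := tm n N) (mc_meas H (tm n N)) (hH.mc _) hH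
    have h5 : 0 ≤ ∫ ω, (H ω - mc 𝒢 μ H (tm n N) ω) ^ 2 ∂μ := integral_nonneg fun _ => sq_nonneg _
    have h6 : ∫ ω, (H ω - mc 𝒢 μ H (tm n N) ω) ^ 2 ∂μ = ∫ ω, H ω ^ 2 ∂μ -
        2 * ∫ ω, mc 𝒢 μ H (tm n N) ω * H ω ∂μ + ∫ ω, mc 𝒢 μ H (tm n N) ω * mc 𝒢 μ H (tm n N) ω ∂μ := by
      rw [← integral_const_mul, ← integral_sub hH.sq.integrable (((hH.mc _).mul hH).const_mul 2).integrable,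
        ← integral_add (hH.sq.sub (((hH.mc _).mul hH).const_mul 2)).integrable ((hH.mc _).mul (hH.mc _)).integrable]
      congr 1; funext ω; ring
    rw [h6, ← h4] at h5
    simp only [pow_two] at h5 ⊢
    linarith
  have h3 := mul_le_mul_of_nonneg_left (sum_inc_sq_le (𝒢 := 𝒢) hH n N) (show 0 ≤ 12 * C ^ 2 by positivity)
  linarith

lemma Bd.W {X Z : Ω → ℝ} (hX : Bd μ X) (hZ : Bd μ Z) (n i : ℕ) : Bd μ (W 𝒢 μ X Z n i) :=
  ((hX.mc _).mul (hZ.inc _ _)).sub ((hZ.mc _).mul (hX.inc _ _))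

lemma W_energy {Y H : Ω → ℝ} (mY : Measurable Y) {C : ℝ} (hC : 0 ≤ C) (bY : ∀ᵐ ω ∂μ, |Y ω| ≤ C) (hH : Bd μ H) (n : ℕ) (N : ℕ) :
    ∑ i ∈ Finset.range N, ∫ ω, W 𝒢 μ Y H n i ω ^ 2 ∂μ ≤ 54 * C ^ 2 * ∫ ω, H ω ^ 2 ∂μ := by
  have hY : Bd μ Y := ⟨mY, C, hC, bY⟩
  have h1 : ∀ i, ∫ ω, W 𝒢 μ Y H n i ω ^ 2 ∂μ ≤ 2 * C ^ 2 * ∫ ω, inc 𝒢 μ H n i ω ^ 2 ∂μ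
      + 2 * ∫ ω, (mc 𝒢 μ H (tm n i) ω * inc 𝒢 μ Y n i ω) ^ 2 ∂μ := by
    intro i
    rw [← integral_const_mul, ← integral_const_mul, ← integral_add ((hH.inc _ _).sq.const_mul _).integrable
      (((hH.mc _).mul (hY.inc _ _)).sq.const_mul _).integrable]
    refine integral_mono_ae (hY.W hH n i).sq.integrable (((hH.inc _ _).sq.const_mul _).add
      (((hH.mc _).mul (hY.inc _ _)).sq.const_mul _)).integrable ?_
    filter_upwards [mc_bound (𝒢 := 𝒢) hC bY (tm n i)] with ω b1
    simp only [DM.W]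
    set y := mc 𝒢 μ Y (tm n i) ω
    set dh := inc 𝒢 μ H n i ω
    set z := mc 𝒢 μ H (tm n i) ω * inc 𝒢 μ Y n i ω
    have s1 : y ^ 2 ≤ C ^ 2 := by nlinarith [abs_le.1 b1, sq_abs y, abs_nonneg y]
    have s2 : (y * dh) ^ 2 ≤ C ^ 2 * dh ^ 2 := by rw [mul_pow]; exact mul_le_mul_of_nonneg_right s1 (sq_nonneg _)
    nlinarith [sq_nonneg (y * dh + z)]
  have hs := Finset.sum_le_sum fun i (_ : i ∈ Finset.range N) => h1 i
  rw [Finset.sum_add_distrib, ← Finset.mul_sum, ← Finset.mul_sum] at hs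
  have h2 := bmo (𝒢 := 𝒢) mY hC bY hH n N
  have h3 := mul_le_mul_of_nonneg_left (sum_inc_sq_le (𝒢 := 𝒢) hH n N) (show 0 ≤ 2 * C ^ 2 by positivity)
  linarith

lemma W_add {Y F G : Ω → ℝ} (hF : Bd μ F) (hG : Bd μ G) (n i : ℕ) :
    ∀ᵐ ω ∂μ, W 𝒢 μ Y (fun ω => F ω + G ω) n i ω = W 𝒢 μ Y F n i ω + W 𝒢 μ Y G n i ω := by
  filter_upwards [mc_add (𝒢 := 𝒢) hF hG (tm n i), inc_add (𝒢 := 𝒢) hF hG n i] with ω h1 h2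
  simp only [W, h1, h2]; ring

lemma W_sub {Y F G : Ω → ℝ} (hF : Bd μ F) (hG : Bd μ G) (n i : ℕ) :
    ∀ᵐ ω ∂μ, W 𝒢 μ Y (fun ω => F ω - G ω) n i ω = W 𝒢 μ Y F n i ω - W 𝒢 μ Y G n i ω := by
  filter_upwards [mc_sub (𝒢 := 𝒢) hF hG (tm n i), inc_sub (𝒢 := 𝒢) hF hG n i] with ω h1 h2
  simp only [W, h1, h2]; ring

lemma W_const_mul (Y F : Ω → ℝ) (c : ℝ) (n i : ℕ) :
    ∀ᵐ ω ∂μ, W 𝒢 μ Y (fun ω => c * F ω) n i ω = c * W 𝒢 μ Y F n i ω := by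
  filter_upwards [mc_const_mul (𝒢 := 𝒢) (μ := μ) F c (tm n i), inc_const_mul (𝒢 := 𝒢) (μ := μ) F c n i] with ω h1 h2
  simp only [W, h1, h2]; ring

/-- gate bounds only -/
structure GB (𝒢 : Filtration ℝ m) (γ : ℕ → ℕ → Ω → ℝ) : Prop where
  P : ∀ n, Pn 𝒢 n (γ n)
  le : ∀ n i ω, |γ n i ω| ≤ 1

lemma GB.one : GB 𝒢 (fun _ _ _ => 1) := ⟨fun n => Pn.const 1, fun _ _ _ => by simp⟩

variable {γ : ℕ → ℕ → Ω → ℝ} {Y F G : Ω → ℝ} {p q : J → Ω → ℝ}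

lemma res_bd (hγ : GB 𝒢 γ) (hY : Bd μ Y) (hF : Bd μ F) (hp : ∀ j, Bd μ (p j)) (hq : ∀ j, Bd μ (q j)) {n0 n : ℕ}
    (h : n0 ≤ n) {φ : J → ℕ → Ω → ℝ} (hφ : ∀ j, Pn 𝒢 n0 (φ j)) (i : ℕ) :
    Bd μ (fun ω => γ n i ω * (W 𝒢 μ Y F n i ω - ∑ j, rfn n0 n (φ j) i ω * W 𝒢 μ (p j) (q j) n i ω)) :=
  ((hγ.P n).bd i).mul ((hY.W hF n i).sub (Bd.sum _ fun j _ => (((hφ j).rfn h).bd i).mul ((hp j).W (hq j) n i)))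

lemma sq_int_le_two {f g h : Ω → ℝ} (hf : Bd μ f) (hg : Bd μ g) (hh : Bd μ h) (he : ∀ᵐ ω ∂μ, |f ω| ≤ |g ω| + |h ω|) :
    ∫ ω, f ω ^ 2 ∂μ ≤ 2 * ∫ ω, g ω ^ 2 ∂μ + 2 * ∫ ω, h ω ^ 2 ∂μ := by
  rw [← integral_const_mul, ← integral_const_mul, ← integral_add (hg.sq.const_mul _).integrable (hh.sq.const_mul _).integrable]
  refine integral_mono_ae hf.sq.integrable ((hg.sq.const_mul _).add (hh.sq.const_mul _)).integrable ?_
  filter_upwards [he] with ω hω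
  have h1 : f ω ^ 2 ≤ (|g ω| + |h ω|) ^ 2 := by
    rw [← sq_abs (f ω)]; exact pow_le_pow_left₀ (abs_nonneg _) hω 2
  nlinarith [sq_nonneg (|g ω| - |h ω|), sq_abs (g ω), sq_abs (h ω)]

theorem Rel.closure (hγ : GB 𝒢 γ) (hY : Bd μ Y) (hF : Bd μ F) (hp : ∀ j, Bd μ (p j)) (hq : ∀ j, Bd μ (q j))
    (h : ∀ ε > 0, ∃ v, Bd μ v ∧ ∫ ω, (F ω - v ω) ^ 2 ∂μ ≤ ε ∧ Rel 𝒢 μ γ Y v p q) : Rel 𝒢 μ γ Y F p q := by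
  intro ε hε
  obtain ⟨mY, C, hC, bY⟩ := id hY
  obtain ⟨v, hv, h1, h2⟩ := h (ε / (4 * (54 * C ^ 2 + 1))) (by positivity)
  obtain ⟨n0, φ, hφ, hb⟩ := h2 (ε / 4) (by positivity)
  refine ⟨n0, φ, hφ, fun n hn => ?_⟩
  have hs : ∀ i, ∫ ω, (γ n i ω * (W 𝒢 μ Y F n i ω - ∑ j, rfn n0 n (φ j) i ω * W 𝒢 μ (p j) (q j) n i ω)) ^ 2 ∂μ ≤
      2 * ∫ ω, (γ n i ω * (W 𝒢 μ Y v n i ω - ∑ j, rfn n0 n (φ j) i ω * W 𝒢 μ (p j) (q j) n i ω)) ^ 2 ∂μ +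
      2 * ∫ ω, W 𝒢 μ Y (fun ω => F ω - v ω) n i ω ^ 2 ∂μ := by
    intro i
    refine sq_int_le_two (res_bd hγ hY hF hp hq hn hφ i) (res_bd hγ hY hv hp hq hn hφ i) (hY.W (hF.sub hv) n i) ?_
    filter_upwards [W_sub (𝒢 := 𝒢) (Y := Y) hF hv n i] with ω hω
    rw [hω]
    set R := ∑ j, rfn n0 n (φ j) i ω * W 𝒢 μ (p j) (q j) n i ω
    have e : γ n i ω * (W 𝒢 μ Y F n i ω - R) = γ n i ω * (W 𝒢 μ Y v n i ω - R) + γ n i ω * (W 𝒢 μ Y F n i ω - W 𝒢 μ Y v n i ω) := by ring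
    rw [e]
    refine (abs_add_le _ _).trans (add_le_add le_rfl ?_)
    rw [abs_mul]
    exact mul_le_of_le_one_left (abs_nonneg _) (hγ.le n i ω)
  have hs' := Finset.sum_le_sum fun i (_ : i ∈ Finset.range (2 ^ n)) => hs i
  rw [Finset.sum_add_distrib, ← Finset.mul_sum, ← Finset.mul_sum] at hs'
  have h3 := W_energy (𝒢 := 𝒢) mY hC bY (hF.sub hv) n (2 ^ n)
  have h4 := hb n hn
  have h5 : 54 * C ^ 2 * ∫ ω, (F ω - v ω) ^ 2 ∂μ ≤ ε / 4 := by
    calc _ ≤ (54 * C ^ 2 + 1) * (ε / (4 * (54 * C ^ 2 + 1))) :=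
          mul_le_mul (by linarith) h1 (integral_nonneg fun _ => sq_nonneg _) (by positivity)
      _ = ε / 4 := by field_simp
  linarith

lemma Rel.add (hγ : GB 𝒢 γ) (hY : Bd μ Y) (hF : Bd μ F) (hG : Bd μ G) (hp : ∀ j, Bd μ (p j)) (hq : ∀ j, Bd μ (q j))
    (h1 : Rel 𝒢 μ γ Y F p q) (h2 : Rel 𝒢 μ γ Y G p q) : Rel 𝒢 μ γ Y (fun ω => F ω + G ω) p q := by
  intro ε hε
  obtain ⟨n1, φ, hφ, hb1⟩ := h1 (ε / 4) (by positivity)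
  obtain ⟨n2, ψ, hψ, hb2⟩ := h2 (ε / 4) (by positivity)
  set n0 := max n1 n2
  have hφ' : ∀ j, Pn 𝒢 n0 (rfn n1 n0 (φ j)) := fun j => (hφ j).rfn (le_max_left _ _)
  have hψ' : ∀ j, Pn 𝒢 n0 (rfn n2 n0 (ψ j)) := fun j => (hψ j).rfn (le_max_right _ _)
  refine ⟨n0, fun j i ω => rfn n1 n0 (φ j) i ω + rfn n2 n0 (ψ j) i ω, fun j => (hφ' j).add (hψ' j), fun n hn => ?_⟩
  have hs : ∀ i, ∫ ω, (γ n i ω * (W 𝒢 μ Y (fun ω => F ω + G ω) n i ω - ∑ j, rfn n0 n (fun i ω => rfn n1 n0 (φ j) i ω + rfn n2 n0 (ψ j) i ω) i ω * W 𝒢 μ (p j) (q j) n i ω)) ^ 2 ∂μ ≤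
      2 * ∫ ω, (γ n i ω * (W 𝒢 μ Y F n i ω - ∑ j, rfn n1 n (φ j) i ω * W 𝒢 μ (p j) (q j) n i ω)) ^ 2 ∂μ +
      2 * ∫ ω, (γ n i ω * (W 𝒢 μ Y G n i ω - ∑ j, rfn n2 n (ψ j) i ω * W 𝒢 μ (p j) (q j) n i ω)) ^ 2 ∂μ := by
    intro i
    refine sq_int_le_two (res_bd hγ hY (hF.add hG) hp hq hn (fun j => (hφ' j).add (hψ' j)) i)
      (res_bd hγ hY hF hp hq ((le_max_left _ _).trans hn) hφ i) (res_bd hγ hY hG hp hq ((le_max_right _ _).trans hn) hψ i) ?_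
    filter_upwards [W_add (𝒢 := 𝒢) (Y := Y) hF hG n i] with ω hω
    rw [hω]
    have e : ∀ j, rfn n0 n (fun i ω => rfn n1 n0 (φ j) i ω + rfn n2 n0 (ψ j) i ω) i ω = rfn n1 n (φ j) i ω + rfn n2 n (ψ j) i ω := by
      intro j
      rw [← rfn_rfn (le_max_left n1 n2) hn, ← rfn_rfn (le_max_right n1 n2) hn]; rfl
    simp only [e, add_mul, Finset.sum_add_distrib]
    refine le_trans (le_of_eq ?_) (abs_add_le _ _)
    congr 1; ring
  have hs' := Finset.sum_le_sum fun i (_ : i ∈ Finset.range (2 ^ n)) => hs i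
  rw [Finset.sum_add_distrib, ← Finset.mul_sum, ← Finset.mul_sum] at hs'
  have h4 := hb1 n ((le_max_left _ _).trans hn)
  have h5 := hb2 n ((le_max_right _ _).trans hn)
  linarith

lemma Rel.const_mul (c : ℝ)
    (h1 : Rel 𝒢 μ γ Y F p q) : Rel 𝒢 μ γ Y (fun ω => c * F ω) p q := by
  intro ε hε
  obtain ⟨n1, φ, hφ, hb1⟩ := h1 (ε / (c ^ 2 + 1)) (by positivity)
  refine ⟨n1, fun j i ω => c * φ j i ω, fun j => (Pn.const c).mul (hφ j), fun n hn => ?_⟩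
  have hs : ∀ i, ∫ ω, (γ n i ω * (W 𝒢 μ Y (fun ω => c * F ω) n i ω - ∑ j, rfn n1 n (fun i ω => c * φ j i ω) i ω * W 𝒢 μ (p j) (q j) n i ω)) ^ 2 ∂μ =
      c ^ 2 * ∫ ω, (γ n i ω * (W 𝒢 μ Y F n i ω - ∑ j, rfn n1 n (φ j) i ω * W 𝒢 μ (p j) (q j) n i ω)) ^ 2 ∂μ := by
    intro i
    rw [← integral_const_mul]
    refine integral_congr_ae ?_
    filter_upwards [W_const_mul (𝒢 := 𝒢) (μ := μ) Y F c n i] with ω hω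
    rw [hω]
    have e : ∀ j, rfn n1 n (fun i ω => c * φ j i ω) i ω = c * rfn n1 n (φ j) i ω := fun j => rfl
    simp only [e, mul_assoc, ← Finset.mul_sum]
    ring
  simp only [hs, ← Finset.mul_sum]
  calc _ ≤ (c ^ 2 + 1) * (ε / (c ^ 2 + 1)) :=
        mul_le_mul (by linarith) (hb1 n hn) (Finset.sum_nonneg fun i _ => integral_nonneg fun _ => sq_nonneg _) (by positivity)
    _ = ε := by field_simp

/-- exact relation from pathwise identity at all fine levels -/
lemma Rel.of_exact {n0 : ℕ} {φ : J → ℕ → Ω → ℝ} (hφ : ∀ j, Pn 𝒢 n0 (φ j))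
    (h : ∀ n ≥ n0, ∀ i < 2 ^ n, ∀ᵐ ω ∂μ, W 𝒢 μ Y F n i ω = ∑ j, rfn n0 n (φ j) i ω * W 𝒢 μ (p j) (q j) n i ω) :
    Rel 𝒢 μ γ Y F p q := by
  intro ε hε
  refine ⟨n0, φ, hφ, fun n hn => le_trans (le_of_eq ?_) hε.le⟩
  refine Finset.sum_eq_zero fun i hi => ?_
  rw [← integral_zero Ω ℝ (μ := μ)]
  refine integral_congr_ae ?_
  filter_upwards [h n hn i (Finset.mem_range.1 hi)] with ω hω
  rw [hω]; simp

end DM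

namespace DM

open Topology

variable {Ω : Type*} {m : MeasurableSpace Ω} {𝒢 : Filtration ℝ m} {μ : Measure Ω} [IsFiniteMeasure μ]
variable {J : Type*} [Fintype J]

lemma W_eq (X Z : Ω → ℝ) (n i : ℕ) (ω : Ω) : W 𝒢 μ X Z n i ω =
    mc 𝒢 μ X (tm n i) ω * mc 𝒢 μ Z (tm n (i + 1)) ω - mc 𝒢 μ Z (tm n i) ω * mc 𝒢 μ X (tm n (i + 1)) ω := by
  simp only [W, inc]; ring

lemma W_self (X : Ω → ℝ) (n i : ℕ) (ω : Ω) : W 𝒢 μ X X n i ω = 0 := by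
  rw [W_eq]; ring

lemma mc_mc (X : Ω → ℝ) {r t : ℝ} (h : r ≤ t) : mc 𝒢 μ (mc 𝒢 μ X t) r =ᵐ[μ] mc 𝒢 μ X r :=
  condExp_condExp_of_le (𝒢.mono h) (𝒢.le t)

lemma mc_congr {X Z : Ω → ℝ} (h : X =ᵐ[μ] Z) (r : ℝ) : mc 𝒢 μ X r =ᵐ[μ] mc 𝒢 μ Z r := condExp_congr_ae h

lemma mc_mul {f g : Ω → ℝ} {r : ℝ} (hf : Measurable[𝒢 r] f) (hfg : Integrable (fun ω => f ω * g ω) μ) (hg : Integrable g μ) :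
    mc 𝒢 μ (fun ω => f ω * g ω) r =ᵐ[μ] fun ω => f ω * mc 𝒢 μ g r ω :=
  condExp_mul_of_stronglyMeasurable_left hf.stronglyMeasurable hfg hg

lemma mc_zero (r : ℝ) : mc 𝒢 μ (fun _ => 0) r = 0 := condExp_zero

/-- martingale values of an elementary integral -/
lemma elem_mc {Y M h : Ω → ℝ} (hY : Bd μ Y) (hM : Bd μ M) (hh : Bd μ h) {s t : ℝ} (hst : s ≤ t) {a σs σt : Ω → ℝ}
    (ha : Measurable[𝒢 s] a) (hab : Bd μ a) (hs : Measurable[𝒢 s] σs) (ht : Measurable[𝒢 t] σt)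
    (es : mc 𝒢 μ M s =ᵐ[μ] fun ω => σs ω * mc 𝒢 μ Y s ω) (et : mc 𝒢 μ M t =ᵐ[μ] fun ω => σt ω * mc 𝒢 μ Y t ω)
    (he : h =ᵐ[μ] fun ω => a ω * (σt ω - σs ω) * Y ω) :
    (∀ r, t ≤ r → mc 𝒢 μ h r =ᵐ[μ] fun ω => a ω * (σt ω - σs ω) * mc 𝒢 μ Y r ω) ∧
    (∀ r, s ≤ r → r ≤ t → mc 𝒢 μ h r =ᵐ[μ] fun ω => a ω * (mc 𝒢 μ M r ω - σs ω * mc 𝒢 μ Y r ω)) ∧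
    (∀ r, r ≤ s → mc 𝒢 μ h r =ᵐ[μ] fun _ => 0) := by
  have hle : ∀ {u v : ℝ}, u ≤ v → ∀ {f : Ω → ℝ}, Measurable[𝒢 u] f → Measurable[𝒢 v] f :=
    fun huv f hf => hf.mono (𝒢.mono huv) le_rfl
  have h1 : ∀ r, t ≤ r → mc 𝒢 μ h r =ᵐ[μ] fun ω => a ω * (σt ω - σs ω) * mc 𝒢 μ Y r ω := by
    intro r hr
    refine (mc_congr he r).trans (mc_mul ?_ (hh.integrable.congr he) hY.integrable)
    exact ((hle (hst.trans hr) ha).mul ((hle hr ht).sub (hle (hst.trans hr) hs)))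
  have h2 : ∀ r, s ≤ r → r ≤ t → mc 𝒢 μ h r =ᵐ[μ] fun ω => a ω * (mc 𝒢 μ M r ω - σs ω * mc 𝒢 μ Y r ω) := by
    intro r hsr hrt
    have e1 : mc 𝒢 μ h t =ᵐ[μ] fun ω => a ω * mc 𝒢 μ M t ω - (a ω * σs ω) * mc 𝒢 μ Y t ω := by
      filter_upwards [h1 t le_rfl, et] with ω h1 h2
      rw [h1, h2]; ring
    have i1 : Bd μ (fun ω => a ω * mc 𝒢 μ M t ω) := hab.mul (hM.mc t)
    have i2 : Integrable (fun ω => (a ω * σs ω) * mc 𝒢 μ Y t ω) μ := by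
      refine (i1.sub (hh.mc t (𝒢 := 𝒢))).integrable.congr ?_
      filter_upwards [e1] with ω h; rw [h]; ring
    have e2 : mc 𝒢 μ h r =ᵐ[μ] fun ω => mc 𝒢 μ (fun ω => a ω * mc 𝒢 μ M t ω) r ω - mc 𝒢 μ (fun ω => (a ω * σs ω) * mc 𝒢 μ Y t ω) r ω := by
      refine (mc_mc h hrt).symm.trans ((mc_congr e1 r).trans ?_)
      exact condExp_sub i1.integrable i2 _
    have e3 := mc_mul (𝒢 := 𝒢) (r := r) (hle hsr ha) i1.integrable (hM.mc t).integrable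
    have e4 := mc_mul (𝒢 := 𝒢) (f := fun ω => a ω * σs ω) (r := r) ((hle hsr ha).mul (hle hsr hs)) i2 (hY.mc t).integrable
    filter_upwards [e2, e3, e4, mc_mc (𝒢 := 𝒢) (μ := μ) M hrt, mc_mc (𝒢 := 𝒢) (μ := μ) Y hrt] with ω a1 a2 a3 a4 a5
    rw [a1, a2, a3, a4, a5]; ring
  refine ⟨h1, h2, fun r hr => ?_⟩
  have e : mc 𝒢 μ h s =ᵐ[μ] fun _ => 0 := by
    filter_upwards [h2 s le_rfl hst, es] with ω a1 a2
    rw [a1, a2]; ring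
  refine (mc_mc h hr).symm.trans ((mc_congr e r).trans ?_)
  rw [mc_zero]; rfl

theorem elem_rel [DecidableEq J] {γ : ℕ → ℕ → Ω → ℝ} {Y h : Ω → ℝ} {M : J → Ω → ℝ} (hY : Bd μ Y) (hM : ∀ j, Bd μ (M j)) (hh : Bd μ h) (j : J)
    {n0 i0 i1 : ℕ} (hi : i0 ≤ i1) {A : Set Ω} {σs σt : Ω → ℝ}
    (hA : MeasurableSet[𝒢 (tm n0 i0)] A) (hs : Measurable[𝒢 (tm n0 i0)] σs) (ht : Measurable[𝒢 (tm n0 i1)] σt)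
    (es : mc 𝒢 μ (M j) (tm n0 i0) =ᵐ[μ] fun ω => σs ω * mc 𝒢 μ Y (tm n0 i0) ω)
    (et : mc 𝒢 μ (M j) (tm n0 i1) =ᵐ[μ] fun ω => σt ω * mc 𝒢 μ Y (tm n0 i1) ω)
    (he : h =ᵐ[μ] fun ω => A.indicator (fun _ => (1:ℝ)) ω * (σt ω - σs ω) * Y ω) :
    Rel 𝒢 μ γ Y h (fun _ => Y) M := by
  set a := A.indicator (fun _ => (1:ℝ)) with ha
  have ham : Measurable[𝒢 (tm n0 i0)] a := measurable_const.indicator hA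
  have hab : Bd μ a := Bd.indicator (𝒢.le _ _ hA)
  obtain ⟨c1, c2, c3⟩ := elem_mc hY (hM j) hh (tm_mono n0 hi) ham hab hs ht es et he
  let φ : J → ℕ → Ω → ℝ := fun j' i ω => if j' = j then (if i0 ≤ i ∧ i < i1 then a ω else 0) else 0
  have hφ : ∀ j', Pn 𝒢 n0 (φ j') := by
    intro j'
    refine ⟨fun i => ?_, 1, fun i ω => ?_⟩
    · simp only [φ]
      split_ifs with h1 h2
      · exact ham.mono (𝒢.mono (tm_mono _ h2.1)) le_rfl
      · exact measurable_const
      · exact measurable_const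
    · simp only [φ]
      split_ifs with h1 h2
      · by_cases h : ω ∈ A <;> simp [ha, h]
      · simp
      · simp
  refine Rel.of_exact hφ fun n hn i hi' => ?_
  obtain ⟨e, rfl⟩ := Nat.exists_eq_add_of_le hn
  have k1 : i0 ≤ i / 2 ^ e ↔ i0 * 2 ^ e ≤ i := Nat.le_div_iff_mul_le (by positivity)
  have k2 : i / 2 ^ e < i1 ↔ i < i1 * 2 ^ e := Nat.div_lt_iff_lt_mul (by positivity)
  have hsum : ∀ ω, ∑ j', rfn n0 (n0 + e) (φ j') i ω * W 𝒢 μ Y (M j') (n0 + e) i ω =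
      (if i0 * 2 ^ e ≤ i ∧ i < i1 * 2 ^ e then a ω else 0) * W 𝒢 μ Y (M j) (n0 + e) i ω := by
    intro ω
    rw [Finset.sum_eq_single j]
    · simp [rfn, φ, k1, k2]
    · intro b _ hb; simp [rfn, φ, hb]
    · simp
  simp only [hsum]
  simp only [W_eq]
  rw [← tm_pow n0 e i0] at c2 c3
  rw [← tm_pow n0 e i1] at c1 c2
  rcases lt_or_ge i (i0 * 2 ^ e) with h1 | h1
  · filter_upwards [c3 _ (tm_mono _ h1.le), c3 _ (tm_mono _ h1)] with ω b1 b2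
    have : ¬ (i0 * 2 ^ e ≤ i ∧ i < i1 * 2 ^ e) := by omega
    rw [if_neg this, b1, b2]; ring
  rcases lt_or_ge i (i1 * 2 ^ e) with h2 | h2
  · filter_upwards [c2 _ (tm_mono _ h1) (tm_mono _ h2.le), c2 _ (tm_mono _ (h1.trans (Nat.le_succ i))) (tm_mono _ h2)] with ω b1 b2
    rw [if_pos ⟨h1, h2⟩, b1, b2]; ring
  · filter_upwards [c1 _ (tm_mono _ h2), c1 _ (tm_mono _ (h2.trans (Nat.le_succ i)))] with ω b1 b2
    have : ¬ (i0 * 2 ^ e ≤ i ∧ i < i1 * 2 ^ e) := by omega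
    rw [if_neg this, b1, b2]; ring

lemma self_rel {γ : ℕ → ℕ → Ω → ℝ} {Y : Ω → ℝ} {p q : J → Ω → ℝ} : Rel 𝒢 μ γ Y Y p q :=
  Rel.of_exact (n0 := 0) (φ := fun _ _ _ => 0) (fun _ => Pn.const 0) fun n _ i _ => ae_of_all _ fun ω => by
    simp [W_self, rfn]

end DM

namespace DM

open Topology

variable {Ω : Type*} {m : MeasurableSpace Ω} {𝒢 : Filtration ℝ m} {P : Measure Ω} [IsFiniteMeasure P]
variable {J : Type*} [Fintype J]

/-- the weighted measure -/
def wD (P : Measure Ω) (D : Ω → ℝ) : Measure Ω := P.withDensity fun ω => ENNReal.ofReal (D ω)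

/-- weights -/
class Wt (P : Measure Ω) (D : Ω → ℝ) : Prop where
  meas : Measurable D
  pos : ∀ ω, 0 < D ω
  int : Integrable D P

/-- normalized variable -/
def nf (D f : Ω → ℝ) : Ω → ℝ := fun ω => f ω / D ω

/-- domination -/
def Dm (P : Measure Ω) (D f : Ω → ℝ) : Prop := Measurable f ∧ ∃ C : ℝ, 0 ≤ C ∧ ∀ᵐ ω ∂P, |f ω| ≤ C * D ω

variable {D D' : Ω → ℝ}

instance [h : Wt P D] : IsFiniteMeasure (wD P D) := isFiniteMeasure_withDensity_ofReal h.int.2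

lemma wD_ac : wD P D ≪ P := withDensity_absolutelyContinuous _ _

lemma ac_wD [h : Wt P D] : P ≪ wD P D :=
  withDensity_absolutelyContinuous' h.meas.ennreal_ofReal.aemeasurable
    (ae_of_all _ fun ω => by simpa using h.pos ω)

lemma wD_integral [h : Wt P D] (g : Ω → ℝ) : ∫ ω, g ω ∂(wD P D) = ∫ ω, D ω * g ω ∂P := by
  rw [wD, integral_withDensity_eq_integral_toReal_smul h.meas.ennreal_ofReal (ae_of_all _ fun _ => ENNReal.ofReal_lt_top)]
  refine integral_congr_ae (ae_of_all _ fun ω => ?_)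
  simp [ENNReal.toReal_ofReal (h.pos ω).le]

lemma wD_setIntegral [h : Wt P D] (g : Ω → ℝ) {A : Set Ω} (hA : MeasurableSet A) :
    ∫ ω in A, g ω ∂(wD P D) = ∫ ω in A, D ω * g ω ∂P := by
  rw [wD, setIntegral_withDensity_eq_setIntegral_toReal_smul h.meas.ennreal_ofReal (ae_of_all _ fun _ => ENNReal.ofReal_lt_top) _ hA]
  refine integral_congr_ae (ae_of_all _ fun ω => ?_)
  simp [ENNReal.toReal_ofReal (h.pos ω).le]

lemma wD_integrable [h : Wt P D] {g : Ω → ℝ} : Integrable g (wD P D) ↔ Integrable (fun ω => D ω * g ω) P := by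
  rw [wD, integrable_withDensity_iff_integrable_smul' h.meas.ennreal_ofReal (ae_of_all _ fun _ => ENNReal.ofReal_lt_top)]
  refine integrable_congr (ae_of_all _ fun ω => ?_)
  simp [ENNReal.toReal_ofReal (h.pos ω).le]

lemma Dm.integrable [h : Wt P D] {f : Ω → ℝ} (hf : Dm P D f) : Integrable f P := by
  obtain ⟨m, C, hC, b⟩ := hf
  exact (h.int.const_mul C).mono' m.aestronglyMeasurable b

lemma Dm.bd [h : Wt P D] {f : Ω → ℝ} (hf : Dm P D f) : Bd (wD P D) (nf D f) := by
  obtain ⟨m, C, hC, b⟩ := hf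
  refine Bd.of_le (m.div h.meas) C (wD_ac.ae_le ?_)
  filter_upwards [b] with ω hω
  rw [nf, abs_div, abs_of_pos (h.pos ω)]
  exact (div_le_iff₀ (h.pos ω)).2 hω

lemma Dm.mono {f : Ω → ℝ} (hf : Dm P D f) {K : ℝ} (hK : 0 ≤ K) (h : ∀ᵐ ω ∂P, D ω ≤ K * D' ω) : Dm P D' f := by
  obtain ⟨m, C, hC, b⟩ := hf
  refine ⟨m, C * K, by positivity, ?_⟩
  filter_upwards [b, h] with ω h1 h2
  rw [mul_assoc]
  exact h1.trans (mul_le_mul_of_nonneg_left h2 hC)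

lemma condExp_pos' {f : Ω → ℝ} (hf : Integrable f P) (hp : ∀ᵐ ω ∂P, 0 < f ω) {m' : MeasurableSpace Ω} (hm : m' ≤ m) :
    ∀ᵐ ω ∂P, 0 < P[f | m'] ω := by
  have hA : MeasurableSet[m'] {ω | P[f | m'] ω ≤ 0} :=
    (stronglyMeasurable_condExp (f := f) (m := m') (μ := P)).measurable measurableSet_Iic
  have h1 := setIntegral_condExp hm hf hA
  have h2 : ∫ ω in {ω | P[f | m'] ω ≤ 0}, P[f | m'] ω ∂P ≤ 0 := setIntegral_nonpos (hm _ hA) fun ω h => h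
  have h3 : P {ω | P[f | m'] ω ≤ 0} = 0 := by
    by_contra h
    have h4 : 0 < ∫ ω in {ω | P[f | m'] ω ≤ 0}, f ω ∂P := by
      rw [setIntegral_pos_iff_support_of_nonneg_ae (ae_restrict_of_ae (hp.mono fun ω h => h.le)) hf.integrableOn]
      refine lt_of_lt_of_eq (pos_iff_ne_zero.2 h) (measure_congr ?_)
      filter_upwards [hp] with ω hω
      refine propext ⟨fun h => ⟨hω.ne', h⟩, fun h => h.2⟩
    linarith
  filter_upwards [measure_eq_zero_iff_ae_notMem.1 h3] with ω hω
  exact not_le.1 hω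

lemma mc_posP {f : Ω → ℝ} (hf : Integrable f P) (hp : ∀ᵐ ω ∂P, 0 < f ω) (s : ℝ) :
    ∀ᵐ ω ∂P, 0 < mc 𝒢 P f s ω := condExp_pos' hf hp (𝒢.le s)

/-- Bayes -/
lemma bayes [h : Wt P D] {f : Ω → ℝ} (hf : Integrable f P) (s : ℝ) :
    mc 𝒢 P f s =ᵐ[P] fun ω => mc 𝒢 (wD P D) (nf D f) s ω * mc 𝒢 P D s ω := by
  have i1 : Integrable (fun ω => mc 𝒢 (wD P D) (nf D f) s ω * D ω) P := by
    have := wD_integrable.1 (integrable_condExp (f := nf D f) (μ := wD P D) (m := 𝒢 s))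
    simpa only [mul_comm, mc] using this
  have e0 : ∀ ω, D ω * nf D f ω = f ω := fun ω => mul_div_cancel₀ _ (h.pos ω).ne'
  have i2 : Integrable (nf D f) (wD P D) := by
    rw [wD_integrable]; simpa only [e0] using hf
  refine EventuallyEq.trans ?_ (mc_mul (mc_meas _ _) i1 h.int)
  refine (ae_eq_condExp_of_forall_setIntegral_eq (𝒢.le s) i1 (fun A hA _ => integrable_condExp.integrableOn)
    (fun A hA _ => ?_) stronglyMeasurable_condExp.aestronglyMeasurable)
  rw [mc, setIntegral_condExp (𝒢.le s) hf hA]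
  have h1 := wD_setIntegral (P := P) (D := D) (mc 𝒢 (wD P D) (nf D f) s) (𝒢.le s _ hA)
  have h2 := wD_setIntegral (P := P) (D := D) (nf D f) (𝒢.le s _ hA)
  rw [mc, setIntegral_condExp (𝒢.le s) i2 hA, h2] at h1
  simp only [e0] at h1
  rw [h1]; simp only [mul_comm, mc]

/-- unnormalized wedge -/
def PW (𝒢 : Filtration ℝ m) (P : Measure Ω) (A B : Ω → ℝ) (n i : ℕ) (ω : Ω) : ℝ :=
  mc 𝒢 P A (tm n i) ω * mc 𝒢 P B (tm n (i + 1)) ω - mc 𝒢 P B (tm n i) ω * mc 𝒢 P A (tm n (i + 1)) ω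

lemma W_PW [h : Wt P D] {A B : Ω → ℝ} (hA : Integrable A P) (hB : Integrable B P) (n i : ℕ) :
    ∀ᵐ ω ∂P, W 𝒢 (wD P D) (nf D A) (nf D B) n i ω =
      PW 𝒢 P A B n i ω / (mc 𝒢 P D (tm n i) ω * mc 𝒢 P D (tm n (i + 1)) ω) := by
  filter_upwards [bayes (𝒢 := 𝒢) (D := D) hA (tm n i), bayes (𝒢 := 𝒢) (D := D) hA (tm n (i + 1)),
    bayes (𝒢 := 𝒢) (D := D) hB (tm n i), bayes (𝒢 := 𝒢) (D := D) hB (tm n (i + 1)),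
    mc_posP (𝒢 := 𝒢) h.int (ae_of_all _ h.pos) (tm n i), mc_posP (𝒢 := 𝒢) h.int (ae_of_all _ h.pos) (tm n (i + 1))] with ω a1 a2 a3 a4 a5 a6
  rw [W_eq, PW, a1, a2, a3, a4]
  field_simp

lemma W_meas (X Z : Ω → ℝ) (n i : ℕ) {μ : Measure Ω} : Measurable[𝒢 (tm n (i + 1))] (W 𝒢 μ X Z n i) := by
  have := tm_le_succ n i
  exact ((mc_meas_of_le X this).mul ((mc_meas _ _).sub (mc_meas_of_le _ this))).sub
    ((mc_meas_of_le Z this).mul ((mc_meas _ _).sub (mc_meas_of_le _ this)))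

lemma wD_int_meas [h : Wt P D] {g : Ω → ℝ} {s : ℝ} (hg : Measurable[𝒢 s] g) (hb : Bd (wD P D) g) :
    Integrable (fun ω => g ω * mc 𝒢 P D s ω) P ∧ ∫ ω, g ω ∂(wD P D) = ∫ ω, g ω * mc 𝒢 P D s ω ∂P := by
  have i1 : Integrable (fun ω => g ω * D ω) P := by
    simpa only [mul_comm] using wD_integrable.1 hb.integrable
  have h1 := mc_mul hg i1 h.int
  refine ⟨(integrable_congr h1).1 integrable_condExp, ?_⟩
  rw [← integral_congr_ae h1, mc, integral_condExp (𝒢.le s), wD_integral]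
  simp only [mul_comm]

theorem Rel.transfer [h : Wt P D] [h' : Wt P D'] (hle : ∀ᵐ ω ∂P, D ω ≤ D' ω) {γ : ℕ → ℕ → Ω → ℝ} (hγ : GB 𝒢 γ)
    {A B : Ω → ℝ} {p q : J → Ω → ℝ} (hA : Dm P D A) (hB : Dm P D B) (hp : ∀ j, Dm P D (p j)) (hq : ∀ j, Dm P D (q j))
    (hR : Rel 𝒢 (wD P D) γ (nf D A) (nf D B) (fun j => nf D (p j)) (fun j => nf D (q j))) :
    Rel 𝒢 (wD P D') γ (nf D' A) (nf D' B) (fun j => nf D' (p j)) (fun j => nf D' (q j)) := by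
  have hm : ∀ {f}, Dm P D f → Dm P D' f := fun hf => hf.mono zero_le_one (by simpa using hle)
  intro ε hε
  obtain ⟨n0, φ, hφ, hb⟩ := hR ε hε
  refine ⟨n0, φ, hφ, fun n hn => (Finset.sum_le_sum fun i _ => ?_).trans (hb n hn)⟩
  set g : Ω → ℝ := fun ω => γ n i ω * (W 𝒢 (wD P D) (nf D A) (nf D B) n i ω -
      ∑ j, rfn n0 n (φ j) i ω * W 𝒢 (wD P D) (nf D (p j)) (nf D (q j)) n i ω) with hg
  set g' : Ω → ℝ := fun ω => γ n i ω * (W 𝒢 (wD P D') (nf D' A) (nf D' B) n i ω -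
      ∑ j, rfn n0 n (φ j) i ω * W 𝒢 (wD P D') (nf D' (p j)) (nf D' (q j)) n i ω) with hg'
  have le1 := tm_le_succ n i
  have mγ : Measurable[𝒢 (tm n (i + 1))] (γ n i) := ((hγ.P n).1 i).mono (𝒢.mono le1) le_rfl
  have mφ : ∀ j, Measurable[𝒢 (tm n (i + 1))] (rfn n0 n (φ j) i) := fun j => (((hφ j).rfn hn).1 i).mono (𝒢.mono le1) le_rfl
  have mg : Measurable[𝒢 (tm n (i + 1))] g :=
    mγ.mul ((W_meas _ _ n i).sub (Finset.measurable_sum _ fun j _ => (mφ j).mul (W_meas _ _ n i)))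
  have mg' : Measurable[𝒢 (tm n (i + 1))] g' :=
    mγ.mul ((W_meas _ _ n i).sub (Finset.measurable_sum _ fun j _ => (mφ j).mul (W_meas _ _ n i)))
  have bg : Bd (wD P D) g := res_bd hγ hA.bd hB.bd (fun j => (hp j).bd) (fun j => (hq j).bd) hn hφ i
  have bg' : Bd (wD P D') g' := res_bd hγ (hm hA).bd (hm hB).bd (fun j => (hm (hp j)).bd) (fun j => (hm (hq j)).bd) hn hφ i
  obtain ⟨j1, e1⟩ := wD_int_meas (mg.pow_const 2) bg.sq
  obtain ⟨j2, e2⟩ := wD_int_meas (mg'.pow_const 2) bg'.sq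
  rw [e1, e2]
  refine integral_mono_ae j2 j1 ?_
  have ww := ae_all_iff.2 fun j => W_PW (𝒢 := 𝒢) (D := D) (hp j).integrable (hq j).integrable n i
  have ww' := ae_all_iff.2 fun j => W_PW (𝒢 := 𝒢) (D := D') (hp j).integrable (hq j).integrable n i
  have mono : ∀ s, ∀ᵐ ω ∂P, mc 𝒢 P D s ω ≤ mc 𝒢 P D' s ω := fun s => condExp_mono h.int h'.int hle
  filter_upwards [ww, ww', W_PW (𝒢 := 𝒢) (D := D) hA.integrable hB.integrable n i,
    W_PW (𝒢 := 𝒢) (D := D') hA.integrable hB.integrable n i, mono (tm n i), mono (tm n (i + 1)),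
    mc_posP (𝒢 := 𝒢) h.int (ae_of_all _ h.pos) (tm n i), mc_posP (𝒢 := 𝒢) h.int (ae_of_all _ h.pos) (tm n (i + 1))]
    with ω a1 a2 a3 a4 a5 a6 a7 a8
  simp only [hg, hg', a1, a2, a3, a4]
  set x := mc 𝒢 P D (tm n i) ω
  set y := mc 𝒢 P D (tm n (i + 1)) ω
  set x' := mc 𝒢 P D' (tm n i) ω
  set y' := mc 𝒢 P D' (tm n (i + 1)) ω
  have s1 : ∀ z : ℝ, (γ n i ω * (PW 𝒢 P A B n i ω / z - ∑ j, rfn n0 n (φ j) i ω * (PW 𝒢 P (p j) (q j) n i ω / z))) =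
      (γ n i ω * (PW 𝒢 P A B n i ω - ∑ j, rfn n0 n (φ j) i ω * PW 𝒢 P (p j) (q j) n i ω)) / z := by
    intro z
    simp only [← mul_div_assoc, ← Finset.sum_div, ← sub_div]
  rw [s1, s1]
  set Z := γ n i ω * (PW 𝒢 P A B n i ω - ∑ j, rfn n0 n (φ j) i ω * PW 𝒢 P (p j) (q j) n i ω)
  have p1 : 0 < x' := a7.trans_le a5
  have p2 : 0 < y' := a8.trans_le a6
  have q1 : (Z / (x * y)) ^ 2 * y = Z ^ 2 / (x ^ 2 * y) := by field_simp
  have q2 : (Z / (x' * y')) ^ 2 * y' = Z ^ 2 / (x' ^ 2 * y') := by field_simp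
  show (Z / (x' * y')) ^ 2 * y' ≤ (Z / (x * y)) ^ 2 * y
  rw [q1, q2]
  gcongr

lemma exists_dom {ι : Type*} [Countable ι] {g : ι → Ω → ℝ} (hg : ∀ i, Integrable (g i) P)
    (hs : Summable fun i => ∫ ω, |g i ω| ∂P) :
    ∃ G : Ω → ℝ, Measurable G ∧ Integrable G P ∧ (∀ ω, 0 ≤ G ω) ∧ ∀ᵐ ω ∂P, ∀ i, |g i ω| ≤ G ω := by
  have hm : ∀ i, AEMeasurable (fun ω => ‖g i ω‖ₑ) P := fun i => (hg i).1.enorm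
  have hfin : ∫⁻ ω, ∑' i, ‖g i ω‖ₑ ∂P ≠ ∞ := by
    rw [lintegral_tsum hm]
    have : ∀ i, ∫⁻ ω, ‖g i ω‖ₑ ∂P = ENNReal.ofReal (∫ ω, |g i ω| ∂P) := by
      intro i
      rw [ofReal_integral_eq_lintegral_ofReal (hg i).abs (ae_of_all _ fun _ => abs_nonneg _)]
      refine lintegral_congr fun ω => ?_
      rw [← Real.norm_eq_abs, ofReal_norm]
    simp only [this]
    exact hs.tsum_ofReal_ne_top
  have hmt : AEMeasurable (fun ω => ∑' i, ‖g i ω‖ₑ) P := AEMeasurable.tsum hm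
  have h_itg := integrable_toReal_of_lintegral_ne_top hmt hfin
  have hme : AEMeasurable (fun ω => (∑' i, ‖g i ω‖ₑ).toReal) P := hmt.ennreal_toReal
  refine ⟨fun ω => |hme.mk _ ω|, hme.measurable_mk.abs, (h_itg.congr hme.ae_eq_mk).abs, fun _ => abs_nonneg _, ?_⟩
  filter_upwards [hme.ae_eq_mk, ae_lt_top' hmt hfin] with ω h1 h2 i
  rw [← h1, abs_of_nonneg ENNReal.toReal_nonneg]
  have := ENNReal.toReal_mono h2.ne (ENNReal.le_tsum i (f := fun i => ‖g i ω‖ₑ))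
  simpa using this

lemma exists_wt {ι : Type*} [Countable ι] {g : ι → Ω → ℝ} (hg : ∀ i, Integrable (g i) P) :
    ∃ D, Wt P D ∧ ∀ i, ∃ C : ℝ, 0 ≤ C ∧ ∀ᵐ ω ∂P, |g i ω| ≤ C * D ω := by
  obtain ⟨e, he⟩ := exists_injective_nat ι
  have hpos : ∀ i, 0 < (1 / 2 : ℝ) ^ (e i) / (1 + ∫ ω, |g i ω| ∂P) := fun i =>
    div_pos (by positivity) (by have : 0 ≤ ∫ ω, |g i ω| ∂P := integral_nonneg fun _ => abs_nonneg _
                                linarith)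
  have hs : Summable fun i => ∫ ω, |((1 / 2 : ℝ) ^ (e i) / (1 + ∫ ω, |g i ω| ∂P)) * g i ω| ∂P := by
    refine Summable.of_nonneg_of_le (fun i => integral_nonneg fun _ => abs_nonneg _) (fun i => ?_)
      (summable_geometric_two.comp_injective he)
    simp only [abs_mul, abs_of_pos (hpos i)]
    rw [integral_const_mul]
    have h0 : 0 ≤ ∫ ω, |g i ω| ∂P := integral_nonneg fun _ => abs_nonneg _
    rw [div_mul_eq_mul_div, div_le_iff₀ (by linarith)]
    exact mul_le_mul_of_nonneg_left (by linarith) (by positivity)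
  obtain ⟨G, m1, m2, m3, m4⟩ := exists_dom (fun i => (hg i).const_mul _) hs
  refine ⟨fun ω => 1 + G ω, ⟨measurable_const.add m1, fun ω => by have := m3 ω; linarith, (integrable_const _).add m2⟩, fun i => ?_⟩
  refine ⟨((1 / 2 : ℝ) ^ (e i) / (1 + ∫ ω, |g i ω| ∂P))⁻¹, (inv_pos.2 (hpos i)).le, ?_⟩
  filter_upwards [m4] with ω hω
  have := hω i
  rw [abs_mul, abs_of_pos (hpos i)] at this
  rw [le_inv_mul_iff₀ (hpos i)]
  linarith

end DM

namespace DM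

open Topology

variable {Ω : Type*} {m : MeasurableSpace Ω} {𝒢 : Filtration ℝ m} {P : Measure Ω} [IsFiniteMeasure P]
variable {J : Type*} [Fintype J] [DecidableEq J]

/-- elementary integrals -/
def El (𝒢 : Filtration ℝ m) (p0 : Ω → ℝ) (σ : J → ℕ → ℕ → Ω → ℝ) : Set (Ω → ℝ) :=
  {v | v = p0 ∨ ∃ j n i0 i1, i0 ≤ i1 ∧ i1 < 2 ^ n ∧ ∃ A, MeasurableSet[𝒢 (tm n i0)] A ∧
    v = fun ω => A.indicator (fun _ => (1:ℝ)) ω * (σ j n i1 ω - σ j n i0 ω) * p0 ω}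

section lin
variable {D : Ω → ℝ} [Wt P D]
lemma Dm.add {f g : Ω → ℝ} (hf : Dm P D f) (hg : Dm P D g) : Dm P D (f + g) := by
  obtain ⟨m1, C1, h1, b1⟩ := hf
  obtain ⟨m2, C2, h2, b2⟩ := hg
  refine ⟨m1.add m2, C1 + C2, by positivity, ?_⟩
  filter_upwards [b1, b2] with ω a1 a2
  rw [add_mul]
  exact (abs_add_le _ _).trans (add_le_add a1 a2)

lemma Dm.smul {f : Ω → ℝ} (hf : Dm P D f) (c : ℝ) : Dm P D (c • f) := by
  obtain ⟨m1, C1, h1, b1⟩ := hf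
  refine ⟨m1.const_smul c, |c| * C1, by positivity, ?_⟩
  filter_upwards [b1] with ω a1
  simp only [Pi.smul_apply, smul_eq_mul, abs_mul, mul_assoc]
  exact mul_le_mul_of_nonneg_left a1 (abs_nonneg _)

lemma nf_add (f g : Ω → ℝ) : nf D (f + g) = fun ω => nf D f ω + nf D g ω := by
  funext ω; simp [nf, add_div]
lemma nf_smul (c : ℝ) (f : Ω → ℝ) : nf D (c • f) = fun ω => c * nf D f ω := by
  funext ω; simp [nf, mul_div_assoc]
lemma nf_sub (f g : Ω → ℝ) : nf D (f - g) = fun ω => nf D f ω - nf D g ω := by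
  funext ω; simp [nf, sub_div]
end lin

lemma mc_nf_of {D : Ω → ℝ} [h : Wt P D] {p q σ : Ω → ℝ} (hp : Integrable p P) (hq : Integrable q P) {s : ℝ}
    (e : mc 𝒢 P q s =ᵐ[P] fun ω => σ ω * mc 𝒢 P p s ω) :
    mc 𝒢 (wD P D) (nf D q) s =ᵐ[wD P D] fun ω => σ ω * mc 𝒢 (wD P D) (nf D p) s ω := by
  refine wD_ac.ae_le ?_
  filter_upwards [e, bayes (𝒢 := 𝒢) (D := D) hp s, bayes (𝒢 := 𝒢) (D := D) hq s, mc_posP (𝒢 := 𝒢) h.int (ae_of_all _ h.pos) s] with ω a1 a2 a3 a4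
  rw [a2, a3, ← mul_assoc] at a1
  exact mul_right_cancel₀ a4.ne' a1

theorem dens_rel {p0 : Ω → ℝ} {m0 : J → Ω → ℝ} (mp : Measurable p0) (ip : Integrable p0 P)
    (mm : ∀ j, Measurable (m0 j)) (im : ∀ j, Integrable (m0 j) P) {σ : J → ℕ → ℕ → Ω → ℝ}
    (mσ : ∀ j n i, Measurable[𝒢 (tm n i)] (σ j n i)) (iσ : ∀ j n i, i < 2 ^ n → Integrable (fun ω => σ j n i ω * p0 ω) P)
    (eσ : ∀ j n i, i < 2 ^ n → mc 𝒢 P (m0 j) (tm n i) =ᵐ[P] fun ω => σ j n i ω * mc 𝒢 P p0 (tm n i) ω)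
    (hd : ∀ f, Integrable f P → ∀ ε > 0, ∃ v ∈ Submodule.span ℝ (El 𝒢 p0 σ), Integrable v P ∧ ∫ ω, |f ω - v ω| ∂P ≤ ε)
    {ι : Type*} [Countable ι] {f : ι → Ω → ℝ} (mf : ∀ k, Measurable (f k)) (jf : ∀ k, Integrable (f k) P) :
    ∃ D, Wt P D ∧ Dm P D p0 ∧ (∀ j, Dm P D (m0 j)) ∧ (∀ k, Dm P D (f k)) ∧
      ∀ D', Wt P D' → (∀ᵐ ω ∂P, D ω ≤ D' ω) → ∀ γ, GB 𝒢 γ → ∀ k,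
        Rel 𝒢 (wD P D') γ (nf D' p0) (nf D' (f k)) (fun _ : J => nf D' p0) (fun j => nf D' (m0 j)) := by
  choose v hv iv bv using fun k (n : ℕ) => hd (f k) (jf k) ((1 / 4 : ℝ) ^ n) (by positivity)
  have hG : ∀ k, ∃ G : Ω → ℝ, Measurable G ∧ Integrable G P ∧ (∀ ω, 0 ≤ G ω) ∧ ∀ᵐ ω ∂P, ∀ n : ℕ, |2 ^ n * (f k ω - v k n ω)| ≤ G ω := by
    intro k
    refine exists_dom (fun n => ((jf k).sub (iv k n)).const_mul _) ?_
    refine Summable.of_nonneg_of_le (fun n => integral_nonneg fun _ => abs_nonneg _) (fun n => ?_) summable_geometric_two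
    simp only [abs_mul]
    rw [integral_const_mul]
    calc _ ≤ |(2:ℝ) ^ n| * (1 / 4 : ℝ) ^ n := mul_le_mul_of_nonneg_left (bv k n) (abs_nonneg _)
      _ = (1 / 2) ^ n := by rw [abs_of_pos (by positivity), ← mul_pow]; norm_num
  choose G mG iG pG bG using hG
  let g : (Unit ⊕ J ⊕ ι ⊕ ι ⊕ {x : J × ℕ × ℕ // x.2.2 < 2 ^ x.2.1}) → Ω → ℝ := fun
    | .inl _ => p0
    | .inr (.inl j) => m0 j
    | .inr (.inr (.inl k)) => f k
    | .inr (.inr (.inr (.inl k))) => G k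
    | .inr (.inr (.inr (.inr x))) => fun ω => σ x.1.1 x.1.2.1 x.1.2.2 ω * p0 ω
  have hg : ∀ i, Integrable (g i) P := by
    rintro (_ | j | k | k | ⟨x, hx⟩)
    exacts [ip, im j, jf k, iG k, iσ _ _ _ hx]
  obtain ⟨D, hD, hb⟩ := exists_wt hg
  refine ⟨D, hD, ⟨mp, hb (.inl ())⟩, fun j => ⟨mm j, hb (.inr (.inl j))⟩, fun k => ⟨mf k, hb (.inr (.inr (.inl k)))⟩,
    fun D' hD' hle γ hγ k => ?_⟩
  have up : ∀ {f}, Dm P D f → Dm P D' f := fun hf => hf.mono zero_le_one (by simpa using hle)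
  have dp : Dm P D' p0 := up ⟨mp, hb (.inl ())⟩
  have dm : ∀ j, Dm P D' (m0 j) := fun j => up ⟨mm j, hb (.inr (.inl j))⟩
  have df : Dm P D' (f k) := up ⟨mf k, hb (.inr (.inr (.inl k)))⟩
  have dG : Dm P D' (G k) := up ⟨mG k, hb (.inr (.inr (.inr (.inl k))))⟩
  have dσ : ∀ j n i, i < 2 ^ n → Dm P D' (fun ω => σ j n i ω * p0 ω) := fun j n i hi =>
    up ⟨((mσ j n i).mono (𝒢.le _) le_rfl).mul mp, hb (.inr (.inr (.inr (.inr ⟨(j, n, i), hi⟩))))⟩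
  have key : ∀ v ∈ Submodule.span ℝ (El 𝒢 p0 σ), Dm P D' v ∧
      Rel 𝒢 (wD P D') γ (nf D' p0) (nf D' v) (fun _ : J => nf D' p0) (fun j => nf D' (m0 j)) := by
    intro v hv
    induction hv using Submodule.span_induction with
    | mem v hv =>
      rcases hv with rfl | ⟨j, n, i0, i1, h01, h1, A, hA, rfl⟩
      · exact ⟨dp, self_rel⟩
      · have d : Dm P D' (fun ω => A.indicator (fun _ => (1:ℝ)) ω * (σ j n i1 ω - σ j n i0 ω) * p0 ω) := by
          obtain ⟨m1, C1, c1, b1⟩ := dσ j n i1 h1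
          obtain ⟨m2, C2, c2, b2⟩ := dσ j n i0 (h01.trans_lt h1)
          refine ⟨((measurable_const.indicator (𝒢.le _ _ hA)).mul (((mσ j n i1).mono (𝒢.le _) le_rfl).sub ((mσ j n i0).mono (𝒢.le _) le_rfl))).mul mp, C1 + C2, by positivity, ?_⟩
          filter_upwards [b1, b2] with ω a1 a2
          have : |A.indicator (fun _ => (1:ℝ)) ω| ≤ 1 := by by_cases h : ω ∈ A <;> simp [h]
          rw [mul_assoc, abs_mul]
          refine (mul_le_of_le_one_left (abs_nonneg _) this).trans ?_
          rw [sub_mul, add_mul]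
          exact (abs_sub _ _).trans (add_le_add a1 a2)
        refine ⟨d, elem_rel dp.bd (fun j => (dm j).bd) d.bd j h01 hA (mσ j n i0) (mσ j n i1)
          (mc_nf_of ip (im j) (eσ j n i0 (h01.trans_lt h1))) (mc_nf_of ip (im j) (eσ j n i1 h1)) (ae_of_all _ fun ω => ?_)⟩
        simp only [nf]; ring
    | zero =>
      refine ⟨⟨measurable_const, 0, le_rfl, by simp⟩, ?_⟩
      have := (self_rel (𝒢 := 𝒢) (μ := wD P D') (γ := γ) (Y := nf D' p0) (p := fun _ : J => nf D' p0) (q := fun j => nf D' (m0 j))).const_mul 0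
      convert this using 1
      funext ω; simp [nf]
    | add x y _ _ hx hy =>
      refine ⟨hx.1.add hy.1, ?_⟩
      rw [nf_add]
      exact Rel.add hγ dp.bd hx.1.bd hy.1.bd (fun _ => dp.bd) (fun j => (dm j).bd) hx.2 hy.2
    | smul c x _ hx =>
      refine ⟨hx.1.smul c, ?_⟩
      rw [nf_smul]
      exact hx.2.const_mul c
  refine Rel.closure hγ dp.bd df.bd (fun _ => dp.bd) (fun j => (dm j).bd) fun ε hε => ?_
  obtain ⟨_, C, hC, bC⟩ := dG
  have hlim : Tendsto (fun n : ℕ => (C * (1 / 2) ^ n) ^ 2 * (wD P D').real univ) atTop (𝓝 ((C * 0) ^ 2 * (wD P D').real univ)) :=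
    ((tendsto_const_nhds.mul (tendsto_pow_atTop_nhds_zero_of_lt_one (by norm_num) (by norm_num))).pow 2).mul_const _
  have hlt : ∀ᶠ n : ℕ in atTop, (C * (1 / 2) ^ n) ^ 2 * (wD P D').real univ < ε :=
    hlim.eventually (gt_mem_nhds (by simpa using hε))
  obtain ⟨n, hn⟩ := hlt.exists
  obtain ⟨k1, k2⟩ := key _ (hv k n)
  refine ⟨nf D' (v k n), k1.bd, ?_, k2⟩
  refine le_trans ?_ hn.le
  have e : ∀ᵐ ω ∂(wD P D'), (nf D' (f k) ω - nf D' (v k n) ω) ^ 2 ≤ (C * (1 / 2) ^ n) ^ 2 := by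
    refine wD_ac.ae_le ?_
    filter_upwards [bG k, bC] with ω a1 a2
    have a3 := (a1 n).trans ((le_abs_self _).trans a2)
    rw [abs_mul, abs_of_pos (by positivity : (0:ℝ) < 2 ^ n)] at a3
    have a4 : |nf D' (f k) ω - nf D' (v k n) ω| ≤ C * (1 / 2) ^ n := by
      rw [nf, nf, ← sub_div, abs_div, abs_of_pos (hD'.pos ω), div_le_iff₀ (hD'.pos ω), one_div, inv_pow]
      rw [mul_assoc, mul_left_comm, ← div_eq_inv_mul, le_div_iff₀ (by positivity)]
      linarith
    rw [← sq_abs]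
    exact pow_le_pow_left₀ (abs_nonneg _) a4 2
  calc _ ≤ ∫ ω, (C * (1 / 2) ^ n) ^ 2 ∂(wD P D') :=
        integral_mono_ae (df.bd.sub k1.bd).sq.integrable (integrable_const _) e
    _ = _ := by simp [mul_comm]

end DM

namespace DM
open Topology

section annd
variable {Ω : Type*} {m : MeasurableSpace Ω} {P : Measure Ω} [IsProbabilityMeasure P]

/-- every functional on `L¹` is represented by a bounded function -/
lemma l1_dual (φ : StrongDual ℝ (Lp ℝ 1 P)) : ∃ h : Ω → ℝ, Measurable h ∧ (∃ C, ∀ ω, |h ω| ≤ C) ∧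
    ∀ f : Lp ℝ 1 P, φ f = ∫ ω, f ω * h ω ∂P := by
  have mem1 : ∀ g : Lp ℝ 2 P, MemLp g 1 P := fun g => (Lp.memLp g).mono_exponent (by norm_num)
  let ψ0 : Lp ℝ 2 P →ₗ[ℝ] ℝ :=
    { toFun := fun g => φ ((mem1 g).toLp g)
      map_add' := fun a b => by
        rw [← map_add]; congr 1
        rw [← MemLp.toLp_add]
        exact MemLp.toLp_congr _ _ (Lp.coeFn_add a b)
      map_smul' := fun c a => by
        rw [RingHom.id_apply, ← map_smul]; congr 1
        rw [← MemLp.toLp_const_smul]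
        exact MemLp.toLp_congr _ _ (Lp.coeFn_smul c a) }
  have hb : ∀ g, ‖ψ0 g‖ ≤ ‖φ‖ * ‖g‖ := by
    intro g
    refine (φ.le_opNorm _).trans (mul_le_mul_of_nonneg_left ?_ (norm_nonneg _))
    rw [Lp.norm_toLp, Lp.norm_def]
    refine ENNReal.toReal_mono (Lp.eLpNorm_ne_top g) ?_
    exact eLpNorm_le_eLpNorm_of_exponent_le (by norm_num) (Lp.aestronglyMeasurable g)
  let ψ := ψ0.mkContinuous ‖φ‖ hb
  obtain ⟨h, hh⟩ := (InnerProductSpace.toDual ℝ (Lp ℝ 2 P)).surjective ψ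
  have hind : ∀ A (hA : MeasurableSet A), φ (indicatorConstLp 1 hA (measure_ne_top P A) (1:ℝ)) = ∫ ω in A, h ω ∂P := by
    intro A hA
    have e1 : ψ (indicatorConstLp 2 hA (measure_ne_top P A) (1:ℝ)) = ∫ ω in A, h ω ∂P := by
      rw [← hh, InnerProductSpace.toDual_apply_apply, real_inner_comm, L2.inner_indicatorConstLp_one]
    rw [← e1]
    change φ _ = φ _
    congr 1
    refine Lp.ext ?_
    refine (indicatorConstLp_coeFn (p := 1) (hs := hA) (hμs := measure_ne_top P A) (c := (1:ℝ))).trans ?_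
    exact (indicatorConstLp_coeFn (p := 2) (hs := hA) (hμs := measure_ne_top P A) (c := (1:ℝ))).symm.trans (MemLp.coeFn_toLp _).symm
  have hnorm : ∀ A, MeasurableSet A → |∫ ω in A, h ω ∂P| ≤ ‖φ‖ * P.real A := by
    intro A hA
    rw [← hind A hA, ← Real.norm_eq_abs]
    refine (φ.le_opNorm _).trans (mul_le_mul_of_nonneg_left ?_ (norm_nonneg _))
    rw [norm_indicatorConstLp (by norm_num) (by norm_num)]
    simp
  have ih : Integrable h P := (mem1 h).integrable le_rfl
  have up : ∀ᵐ ω ∂P, h ω ≤ ‖φ‖ := by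
    refine ae_le_of_forall_setIntegral_le ih (integrable_const _) fun A hA _ => ?_
    rw [setIntegral_const, smul_eq_mul, mul_comm]
    exact (le_abs_self _).trans (hnorm A hA)
  have lo : ∀ᵐ ω ∂P, -‖φ‖ ≤ h ω := by
    refine ae_le_of_forall_setIntegral_le (integrable_const _) ih fun A hA _ => ?_
    rw [setIntegral_const, smul_eq_mul, mul_comm, neg_mul]
    exact neg_le_of_abs_le (hnorm A hA)
  have mh : Measurable h := (Lp.stronglyMeasurable h).measurable
  refine ⟨fun ω => cl ‖φ‖ (h ω), ?_, ⟨‖φ‖, fun ω => cl_abs (norm_nonneg _) _⟩, ?_⟩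
  · unfold cl; fun_prop
  have hcl : (fun ω => cl ‖φ‖ (h ω)) =ᵐ[P] h := by
    filter_upwards [up, lo] with ω a b
    exact cl_eq (abs_le.2 ⟨b, a⟩)
  have hbd : ∀ᵐ ω ∂P, ‖h ω‖ ≤ ‖φ‖ := by
    filter_upwards [up, lo] with ω a b
    exact abs_le.2 ⟨b, a⟩
  have int : ∀ f : Lp ℝ 1 P, Integrable (fun ω => f ω * h ω) P := fun f =>
    (L1.integrable_coeFn f).mul_bdd ih.1 hbd
  intro f
  have : ∫ ω, f ω * cl ‖φ‖ (h ω) ∂P = ∫ ω, f ω * h ω ∂P := integral_congr_ae (by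
    filter_upwards [hcl] with ω a; rw [a])
  rw [this]
  let χ0 : Lp ℝ 1 P →ₗ[ℝ] ℝ :=
    { toFun := fun g => ∫ ω, g ω * h ω ∂P
      map_add' := fun a b => by
        rw [← integral_add (int a) (int b)]
        refine integral_congr_ae ?_
        filter_upwards [Lp.coeFn_add a b] with ω e
        rw [e, Pi.add_apply, add_mul]
      map_smul' := fun c a => by
        rw [RingHom.id_apply, smul_eq_mul, ← integral_const_mul]
        refine integral_congr_ae ?_
        filter_upwards [Lp.coeFn_smul c a] with ω e
        rw [e, Pi.smul_apply, smul_eq_mul, mul_assoc] }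
  have hb2 : ∀ g, ‖χ0 g‖ ≤ ‖φ‖ * ‖g‖ := by
    intro g
    rw [L1.norm_eq_integral_norm, ← integral_const_mul]
    refine norm_integral_le_of_norm_le ((L1.integrable_coeFn g).norm.const_mul _) ?_
    filter_upwards [hbd] with ω a
    rw [norm_mul, mul_comm]
    exact mul_le_mul_of_nonneg_right a (norm_nonneg _)
  let χ := χ0.mkContinuous ‖φ‖ hb2
  change φ f = χ f
  refine Lp.induction (by norm_num) (motive := fun f => φ f = χ f) ?_ ?_ ?_ f
  · intro c s hs hμ
    have : (Lp.simpleFunc.indicatorConst 1 hs hμ.ne c : Lp ℝ 1 P) = c • indicatorConstLp 1 hs hμ.ne (1:ℝ) := by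
      rw [Lp.simpleFunc.coe_indicatorConst]
      refine Lp.ext ?_
      refine indicatorConstLp_coeFn.trans ?_
      refine EventuallyEq.trans ?_ (Lp.coeFn_smul _ _).symm
      filter_upwards [indicatorConstLp_coeFn (p := 1) (hs := hs) (hμs := hμ.ne) (c := (1:ℝ))] with ω e
      rw [Pi.smul_apply, e]
      by_cases hω : ω ∈ s <;> simp [hω]
    rw [this, map_smul, map_smul, hind]
    congr 1
    change _ = ∫ ω, _ * h ω ∂P
    rw [← integral_indicator hs]
    refine integral_congr_ae ?_
    filter_upwards [indicatorConstLp_coeFn (p := 1) (hs := hs) (hμs := hμ.ne) (c := (1:ℝ))] with ω e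
    rw [e]
    by_cases hω : ω ∈ s <;> simp [hω]
  · intro f g hf hg _ h1 h2
    rw [map_add, map_add, h1, h2]
  · exact isClosed_eq φ.continuous χ.continuous

lemma ann_dense (K : Submodule ℝ (Ω → ℝ)) (hK : ∀ v ∈ K, Integrable v P)
    (hann : ∀ g : Ω → ℝ, Measurable g → (∃ C, ∀ ω, |g ω| ≤ C) → (∀ v ∈ K, ∫ ω, v ω * g ω ∂P = 0) → g =ᵐ[P] 0)
    {f : Ω → ℝ} (hf : Integrable f P) {ε : ℝ} (hε : 0 < ε) : ∃ v ∈ K, ∫ ω, |f ω - v ω| ∂P ≤ ε := by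
  let K' : Submodule ℝ (Lp ℝ 1 P) :=
    { carrier := {g | ∃ v ∈ K, g =ᵐ[P] v}
      add_mem' := by
        rintro a b ⟨v, hv, e⟩ ⟨w, hw, e'⟩
        exact ⟨v + w, K.add_mem hv hw, (Lp.coeFn_add a b).trans (e.add e')⟩
      zero_mem' := ⟨0, K.zero_mem, Lp.coeFn_zero _ _ _⟩
      smul_mem' := by
        rintro c a ⟨v, hv, e⟩
        exact ⟨c • v, K.smul_mem c hv, (Lp.coeFn_smul c a).trans (e.const_smul c)⟩ }
  have hmem : hf.toL1 f ∈ closure (K' : Set (Lp ℝ 1 P)) := by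
    by_contra hn
    obtain ⟨φ, u, h1, h2⟩ := geometric_hahn_banach_closed_point (s := closure (K' : Set (Lp ℝ 1 P)))
      K'.convex.closure isClosed_closure hn
    have hz : ∀ a ∈ K', φ a = 0 := by
      intro a ha
      by_contra hne
      have := h1 ((u / φ a) • a) (subset_closure (K'.smul_mem _ ha))
      rw [map_smul, smul_eq_mul, div_mul_cancel₀ _ hne] at this
      exact lt_irrefl _ this
    obtain ⟨h, mh, hC, hφ⟩ := l1_dual φ
    have h0 : h =ᵐ[P] 0 := by
      refine hann h mh hC fun v hv => ?_
      have := hz ((hK v hv).toL1 v) ⟨v, hv, Integrable.coeFn_toL1 _⟩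
      rw [hφ] at this
      rw [← this]
      refine integral_congr_ae ?_
      filter_upwards [Integrable.coeFn_toL1 (hK v hv)] with ω e
      rw [e]
    have a1 : φ (hf.toL1 f) = 0 := by
      rw [hφ]
      refine integral_eq_zero_of_ae ?_
      filter_upwards [h0] with ω e
      rw [e]; simp
    have a2 := h1 0 (subset_closure K'.zero_mem)
    rw [map_zero] at a2
    linarith
  obtain ⟨g, ⟨v, hv, e⟩, hg⟩ := Metric.mem_closure_iff.1 hmem ε hε
  refine ⟨v, hv, ?_⟩
  rw [dist_eq_norm, L1.norm_eq_integral_norm] at hg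
  refine le_of_eq_of_le (integral_congr_ae ?_) hg.le
  filter_upwards [Lp.coeFn_sub (hf.toL1 f) g, e, hf.coeFn_toL1] with ω a b c
  rw [a, Pi.sub_apply, b, c, Real.norm_eq_abs]

end annd
end DM

namespace DM
open Topology

section time
variable {Ω : Type*} {m : MeasurableSpace Ω}

/-- time change from `[0,1)` to `[0,∞)` -/
def tcs (s : ℝ) : ℝ≥0 := (s / (1 - s)).toNNReal
/-- inverse time change -/
def uu (t : ℝ≥0) : ℝ := t / (1 + t)

lemma tcs_mono {s t : ℝ} (h : s ≤ t) (ht : t < 1) : tcs s ≤ tcs t := by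
  refine Real.toNNReal_mono ?_
  rw [div_le_div_iff₀ (by linarith) (by linarith)]
  nlinarith

lemma uu_nonneg (t : ℝ≥0) : 0 ≤ uu t := by unfold uu; positivity
lemma uu_lt (t : ℝ≥0) : uu t < 1 := by
  unfold uu
  rw [div_lt_one (by positivity)]
  linarith

lemma uu_mono {s t : ℝ≥0} (h : s ≤ t) : uu s ≤ uu t := by
  unfold uu
  have h' : (s : ℝ) ≤ t := h
  have := s.2
  rw [div_le_div_iff₀ (by positivity) (by positivity)]
  nlinarith

lemma tcs_uu (t : ℝ≥0) : tcs (uu t) = t := by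
  have h : (0:ℝ) < 1 + t := by positivity
  have : uu t / (1 - uu t) = t := by
    unfold uu
    have : (1 : ℝ) - t / (1 + t) = 1 / (1 + t) := by field_simp; ring
    rw [this]; field_simp
  rw [tcs, this, Real.toNNReal_coe]

lemma uu_tcs {s : ℝ} (h0 : 0 ≤ s) (h1 : s < 1) : uu (tcs s) = s := by
  have : (0:ℝ) < 1 - s := by linarith
  rw [uu, tcs, Real.coe_toNNReal _ (by positivity)]
  field_simp; ring

lemma tcs_lt {s t : ℝ} (h0 : 0 ≤ s) (h : s < t) (ht : t < 1) : tcs s < tcs t := by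
  refine lt_of_not_ge fun hh => ?_
  have := uu_mono hh
  rw [uu_tcs (h0.trans h.le) ht, uu_tcs h0 (h.trans ht)] at this
  linarith

lemma tcs_cont {s : ℝ} (h : s < 1) : ContinuousAt tcs s := by
  unfold tcs
  refine continuous_real_toNNReal.continuousAt.comp ?_
  exact ContinuousAt.div continuousAt_id (continuousAt_const.sub continuousAt_id) (by linarith)

open Classical in
/-- time changed filtration -/
def TC (F : Filtration ℝ≥0 m) : Filtration ℝ m where
  seq s := if s < 1 then F (tcs s) else m
  mono' := by
    intro s t h
    dsimp only
    by_cases ht : t < 1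
    · rw [if_pos ht, if_pos (h.trans_lt ht)]
      exact F.mono (tcs_mono h ht)
    · rw [if_neg ht]
      split_ifs
      · exact F.le _
      · exact le_rfl
  le' := by
    intro s
    split_ifs
    · exact F.le _
    · exact le_rfl

variable {F : Filtration ℝ≥0 m}
lemma TC_lt {s : ℝ} (h : s < 1) : (TC F) s = F (tcs s) := if_pos h
lemma TC_ge {s : ℝ} (h : 1 ≤ s) : (TC F) s = m := if_neg (not_lt.2 h)

lemma tm_lt {n i : ℕ} (h : i < 2 ^ n) : tm n i < 1 := by
  unfold tm
  rw [div_lt_one (by positivity)]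
  exact_mod_cast h
lemma tm_nonneg {n i : ℕ} : 0 ≤ tm n i := by unfold tm; positivity

/-- grid times in `[0,∞)` -/
def th (n i : ℕ) : ℝ≥0 := tcs (tm n i)

lemma TC_tm {n i : ℕ} (h : i < 2 ^ n) : (TC F) (tm n i) = F (th n i) := TC_lt (tm_lt h)

lemma th_mono {n i j : ℕ} (h : i ≤ j) (hj : j < 2 ^ n) : th n i ≤ th n j := tcs_mono (tm_mono n h) (tm_lt hj)

/-- next grid index -/
def ap (t : ℝ≥0) (k : ℕ) : ℕ := ⌊uu t * 2 ^ k⌋₊ + 1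

lemma ap_mono {s t : ℝ≥0} (h : s ≤ t) (k : ℕ) : ap s k ≤ ap t k := by
  unfold ap
  gcongr
  exact uu_mono h

lemma lt_tm_ap (t : ℝ≥0) (k : ℕ) : uu t < tm k (ap t k) := by
  unfold tm ap
  rw [lt_div_iff₀ (by positivity)]
  push_cast
  exact Nat.lt_floor_add_one _

lemma tm_ap_le (t : ℝ≥0) (k : ℕ) : tm k (ap t k) ≤ uu t + (1 / 2) ^ k := by
  unfold tm ap
  rw [div_le_iff₀ (by positivity), add_mul, ← mul_pow]
  push_cast
  have := Nat.floor_le (a := uu t * 2 ^ k) (by have := uu_nonneg t; positivity)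
  norm_num
  exact this

lemma tm_ap_tendsto (t : ℝ≥0) : Tendsto (fun k => tm k (ap t k)) atTop (𝓝 (uu t)) := by
  refine tendsto_of_tendsto_of_tendsto_of_le_of_le tendsto_const_nhds ?_ (fun k => (lt_tm_ap t k).le) (fun k => tm_ap_le t k)
  simpa using (tendsto_const_nhds (x := uu t)).add (tendsto_pow_atTop_nhds_zero_of_lt_one (r := (1/2:ℝ)) (by norm_num) (by norm_num))

lemma ap_lt (t : ℝ≥0) : ∀ᶠ k in atTop, ap t k < 2 ^ k := by
  filter_upwards [(tm_ap_tendsto t).eventually (gt_mem_nhds (uu_lt t))] with k hk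
  unfold tm at hk
  rw [div_lt_one (by positivity)] at hk
  exact_mod_cast hk

lemma lt_th_ap {t : ℝ≥0} {k : ℕ} (h : ap t k < 2 ^ k) : t < th k (ap t k) := by
  have := tcs_lt (uu_nonneg t) (lt_tm_ap t k) (tm_lt h)
  rwa [tcs_uu] at this

lemma th_ap_tendsto (t : ℝ≥0) : Tendsto (fun k => th k (ap t k)) atTop (𝓝 t) := by
  have := (tcs_cont (uu_lt t)).tendsto.comp (tm_ap_tendsto t)
  rwa [tcs_uu] at this

lemma th_ap_tendsto' (t : ℝ≥0) : Tendsto (fun k => th k (ap t k)) atTop (𝓝[≥] t) := by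
  refine tendsto_nhdsWithin_iff.2 ⟨th_ap_tendsto t, ?_⟩
  filter_upwards [ap_lt t] with k hk
  exact (lt_th_ap hk).le

/-- convergence of conditional expectations under pointwise convergence -/
lemma ui_lim {μ : Measure Ω} [IsFiniteMeasure μ] {Ξ : Ω → ℝ} (hΞ : Integrable Ξ μ) {mn : ℕ → MeasurableSpace Ω}
    (hmn : ∀ n, mn n ≤ m) {f : ℕ → Ω → ℝ} (hf : ∀ n, f n =ᵐ[μ] μ[Ξ | mn n]) {g : Ω → ℝ}
    (hg : ∀ᵐ ω ∂μ, Tendsto (fun n => f n ω) atTop (𝓝 (g ω))) :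
    Integrable g μ ∧ ∀ b : Ω → ℝ, Measurable b → (∃ C, ∀ ω, |b ω| ≤ C) →
      Tendsto (fun n => ∫ ω, f n ω * b ω ∂μ) atTop (𝓝 (∫ ω, g ω * b ω ∂μ)) := by
  have ui : UniformIntegrable f 1 μ := (hΞ.uniformIntegrable_condExp hmn).ae_eq fun n => (hf n).symm
  have ig : Integrable g μ := ui.integrable_of_ae_tendsto hg
  have hL := tendsto_Lp_finite_of_tendsto_ae le_rfl (by norm_num) ui.1 (memLp_one_iff_integrable.2 ig) ui.2.1 hg
  refine ⟨ig, fun b mb ⟨C, hC⟩ => ?_⟩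
  have ifn : ∀ n, Integrable (f n) μ := fun n => (integrable_congr (hf n)).2 integrable_condExp
  have ifb : ∀ n, Integrable (fun ω => f n ω * b ω) μ := fun n => (ifn n).mul_bdd mb.aestronglyMeasurable (ae_of_all _ hC)
  have igb : Integrable (fun ω => g ω * b ω) μ := ig.mul_bdd mb.aestronglyMeasurable (ae_of_all _ hC)
  rw [tendsto_iff_norm_sub_tendsto_zero]
  have h2 : Tendsto (fun n => C * (eLpNorm (f n - g) 1 μ).toReal) atTop (𝓝 0) := by
    have := ((ENNReal.tendsto_toReal (by simp)).comp hL).const_mul C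
    simpa using this
  refine squeeze_zero (fun n => norm_nonneg _) (fun n => ?_) h2
  rw [← integral_sub (ifb n) igb]
  have e : (eLpNorm (f n - g) 1 μ).toReal = ∫ ω, ‖f n ω - g ω‖ ∂μ := by
    rw [eLpNorm_one_eq_lintegral_enorm]
    exact (integral_norm_eq_lintegral_enorm ((ifn n).sub ig).1).symm
  rw [e, ← integral_const_mul]
  refine norm_integral_le_of_norm_le (((ifn n).sub ig).norm.const_mul C) (ae_of_all _ fun ω => ?_)
  rw [← sub_mul, norm_mul, mul_comm]
  exact mul_le_mul_of_nonneg_right (hC ω) (norm_nonneg _)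

variable {P : Measure Ω} [IsProbabilityMeasure P] {d : ℕ}

/-- scalar data of the model at a point -/
structure SD (F : Filtration ℝ≥0 m) (P : Measure Ω) (p : Ω → ℝ) (ξ : Fin d → Ω → ℝ) (s : Fin d → ℝ≥0 → Ω → ℝ) : Prop where
  wt : Wt P p
  mξ : ∀ j, Measurable (ξ j)
  iξ : ∀ j, Integrable (ξ j) P
  ms : ∀ j t, Measurable[F t] (s j t)
  rc : ∀ j ω t, ContinuousWithinAt (fun r => s j r ω) (Ici t) t
  ver : ∀ j t, s j t =ᵐ[wD P p] (wD P p)[nf p (ξ j) | F t]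

variable {p : Ω → ℝ} {ξ : Fin d → Ω → ℝ} {s : Fin d → ℝ≥0 → Ω → ℝ}

lemma SD.inf (h : SD F P p ξ s) (j : Fin d) : Integrable (nf p (ξ j)) (wD P p) := by
  have := h.wt
  rw [wD_integrable]
  refine (h.iξ j).congr (ae_of_all _ fun ω => ?_)
  simp only [nf]
  rw [mul_div_cancel₀ _ (this.pos ω).ne']

lemma SD.int (h : SD F P p ξ s) (j : Fin d) (t : ℝ≥0) : Integrable (s j t) (wD P p) :=
  (integrable_congr (h.ver j t)).2 integrable_condExp

lemma SD.set (h : SD F P p ξ s) (j : Fin d) (t : ℝ≥0) {A : Set Ω} (hA : MeasurableSet[F t] A) :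
    ∫ ω in A, s j t ω ∂(wD P p) = ∫ ω in A, nf p (ξ j) ω ∂(wD P p) := by
  have := h.wt
  rw [setIntegral_congr_ae (F.le t _ hA) ((h.ver j t).mono fun _ h _ => h), setIntegral_condExp (F.le t) (h.inf j) hA]

/-- process on the grid -/
def gs (s : Fin d → ℝ≥0 → Ω → ℝ) (j : Fin d) (n i : ℕ) : Ω → ℝ := s j (th n i)

lemma SD.gs_meas (h : SD F P p ξ s) (j : Fin d) (n i : ℕ) : Measurable[(TC F) (tm n i)] (gs s j n i) := by
  rcases lt_or_ge i (2 ^ n) with hi | hi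
  · rw [TC_tm hi]; exact h.ms j _
  · rw [TC_ge]
    · exact (h.ms j _).mono (F.le _) le_rfl
    · rw [← tm_top n]; exact tm_mono n hi

lemma SD.gs_int (h : SD F P p ξ s) (j : Fin d) (n i : ℕ) : Integrable (fun ω => gs s j n i ω * p ω) P := by
  have := h.wt
  have := wD_integrable.1 (h.int j (th n i))
  simpa only [mul_comm, gs] using this

lemma SD.gs_eq (h : SD F P p ξ s) (j : Fin d) (n i : ℕ) (hi : i < 2 ^ n) :
    mc (TC F) P (ξ j) (tm n i) =ᵐ[P] fun ω => gs s j n i ω * mc (TC F) P p (tm n i) ω := by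
  have := h.wt
  filter_upwards [bayes (𝒢 := TC F) (D := p) (h.iξ j) (tm n i), ac_wD (D := p).ae_le (h.ver j (th n i))] with ω a b
  rw [a, gs, b, mc, TC_tm hi]

/-- density from the uniqueness property -/
theorem SD.dense (h : SD F P p ξ s)
    (hM : ∀ g, Wt P g → ∫ ω, g ω ∂P = ∫ ω, p ω ∂P → (∀ j t, Integrable (fun ω => s j t ω * g ω) P) →
      (∀ j r t, r ≤ t → ∀ A, MeasurableSet[F r] A → ∫ ω in A, s j t ω * g ω ∂P = ∫ ω in A, s j r ω * g ω ∂P) → g =ᵐ[P] p)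
    (f : Ω → ℝ) (hf : Integrable f P) (ε : ℝ) (hε : 0 < ε) :
    ∃ v ∈ Submodule.span ℝ (El (TC F) p (gs s)), Integrable v P ∧ ∫ ω, |f ω - v ω| ∂P ≤ ε := by
  have wt := h.wt
  have hE : ∀ v ∈ El (TC F) p (gs s), Integrable v P := by
    rintro v (rfl | ⟨j, n, i0, i1, h01, h1, A, hA, rfl⟩)
    · exact wt.int
    · have i2 : Integrable (fun ω => gs s j n i1 ω * p ω - gs s j n i0 ω * p ω) P := (h.gs_int j n i1).sub (h.gs_int j n i0)
      refine (i2.indicator ((TC F).le _ _ hA)).congr (ae_of_all _ fun ω => ?_)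
      by_cases hω : ω ∈ A <;> simp [hω, sub_mul]
  have hK : ∀ v ∈ Submodule.span ℝ (El (TC F) p (gs s)), Integrable v P := by
    intro v hv
    induction hv using Submodule.span_induction with
    | mem v hv => exact hE v hv
    | zero => exact integrable_zero _ _ _
    | add x y _ _ hx hy => exact hx.add hy
    | smul c x _ hx => exact hx.smul c
  suffices hs : ∀ g : Ω → ℝ, Measurable g → (∃ C, ∀ ω, |g ω| ≤ C) →
      (∀ v ∈ Submodule.span ℝ (El (TC F) p (gs s)), ∫ ω, v ω * g ω ∂P = 0) → g =ᵐ[P] 0 by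
    obtain ⟨v, hv, hb⟩ := ann_dense (P := P) (Submodule.span ℝ (El (TC F) p (gs s))) hK hs hf hε
    exact ⟨v, hv, hK v hv, hb⟩
  rintro g mg ⟨C, hC⟩ hann
  have hann' : ∀ v ∈ El (TC F) p (gs s), ∫ ω, v ω * g ω ∂P = 0 := fun v hv => hann v (Submodule.subset_span hv)
  have hC0 : 0 ≤ |C| := abs_nonneg C
  set δ : ℝ := 1 / (2 * (|C| + 1)) with hδ
  have δp : 0 < δ := by positivity
  have hδg : ∀ ω, |δ * g ω| ≤ 1 / 2 := by
    intro ω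
    rw [abs_mul, abs_of_pos δp, hδ, div_mul_eq_mul_div, one_mul, div_le_div_iff₀ (by positivity) (by norm_num)]
    have := (hC ω).trans (le_abs_self C)
    linarith
  have pg : Integrable (fun ω => p ω * g ω) P := wt.int.mul_bdd mg.aestronglyMeasurable (ae_of_all _ hC)
  have eint : ∀ ω, p ω * (1 + δ * g ω) = p ω + δ * (p ω * g ω) := fun ω => by ring
  have iG : Integrable (fun ω => p ω * (1 + δ * g ω)) P := by
    simp only [eint]; exact wt.int.add (pg.const_mul δ)
  have wG : Wt P (fun ω => p ω * (1 + δ * g ω)) := by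
    refine ⟨wt.meas.mul (measurable_const.add (mg.const_mul _)), fun ω => mul_pos (wt.pos ω) ?_, iG⟩
    have := abs_le.1 (hδg ω); linarith
  have isp : ∀ j t, Integrable (fun ω => s j t ω * p ω) P := fun j t => by
    have := wD_integrable.1 (h.int j t)
    simpa only [mul_comm] using this
  have ispg : ∀ j t, Integrable (fun ω => s j t ω * p ω * g ω) P := fun j t => (isp j t).mul_bdd mg.aestronglyMeasurable (ae_of_all _ hC)
  have e2 : ∀ j t ω, s j t ω * (p ω * (1 + δ * g ω)) = s j t ω * p ω + δ * (s j t ω * p ω * g ω) := fun j t ω => by ring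
  have key := hM _ wG ?_ ?_ ?_
  · filter_upwards [key] with ω hω
    have h1 : p ω * (δ * g ω) = 0 := by linarith
    rcases mul_eq_zero.1 h1 with h2 | h2
    · exact absurd h2 (wt.pos ω).ne'
    · exact (mul_eq_zero.1 h2).resolve_left δp.ne'
  · simp only [eint]
    rw [integral_add wt.int (pg.const_mul δ), integral_const_mul, hann' p (.inl rfl)]; simp
  · intro j t
    simp only [e2]
    exact (isp j t).add ((ispg j t).const_mul δ)
  · intro j r t hrt A hA
    have mA := F.le r _ hA
    have lim : ∀ t, Tendsto (fun k => ∫ ω, s j (th k (ap t k)) ω * (A.indicator (fun _ => (1:ℝ)) ω * g ω) ∂(wD P p)) atTop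
        (𝓝 (∫ ω, s j t ω * (A.indicator (fun _ => (1:ℝ)) ω * g ω) ∂(wD P p))) := by
      intro t
      refine (ui_lim (h.inf j) (fun n => F.le (th n (ap t n))) (fun n => h.ver j _) (ae_of_all _ fun ω => ?_)).2 _ ?_ ⟨C, fun ω => ?_⟩
      · exact (h.rc j ω t).tendsto.comp (th_ap_tendsto' t)
      · exact (measurable_const.indicator mA).mul mg
      · by_cases hω : ω ∈ A
        · simpa [hω] using hC ω
        · simpa [hω] using (abs_nonneg _).trans (hC ω)
    have hcv : ∀ q : Ω → ℝ, ∫ ω, q ω * (A.indicator (fun _ => (1:ℝ)) ω * g ω) ∂(wD P p) = ∫ ω in A, q ω * p ω * g ω ∂P := by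
      intro q
      rw [wD_integral, ← integral_indicator mA]
      refine integral_congr_ae (ae_of_all _ fun ω => ?_)
      by_cases hω : ω ∈ A <;> simp [hω]; ring
    have heq : ∫ ω in A, s j t ω * p ω * g ω ∂P = ∫ ω in A, s j r ω * p ω * g ω ∂P := by
      rw [← hcv, ← hcv]
      refine tendsto_nhds_unique_of_eventuallyEq (lim t) (lim r) ?_
      filter_upwards [ap_lt t, ap_lt r] with k h1 h2
      rw [hcv, hcv, ← sub_eq_zero, ← integral_sub (ispg _ _).integrableOn (ispg _ _).integrableOn, ← integral_indicator mA]
      rw [← hann' _ (.inr ⟨j, k, ap r k, ap t k, ap_mono hrt k, h1, A, by rw [TC_tm h2]; exact F.mono (lt_th_ap h2).le _ hA, rfl⟩)]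
      refine integral_congr_ae (ae_of_all _ fun ω => ?_)
      by_cases hω : ω ∈ A <;> simp [hω, gs]; ring
    simp only [e2]
    rw [integral_add (isp j t).integrableOn ((ispg j t).const_mul δ).integrableOn,
      integral_add (isp j r).integrableOn ((ispg j r).const_mul δ).integrableOn, integral_const_mul, integral_const_mul, heq]
    congr 1
    have h1 := h.set j t (F.mono hrt _ hA)
    rw [← h.set j r hA, wD_setIntegral _ mA, wD_setIntegral _ mA] at h1
    simpa only [mul_comm] using h1

end time
end DM

namespace DM
open Topology

section zero
variable {E : Type*} [NormedAddCommGroup E] [NormedSpace ℝ E] [MeasurableSpace E] [BorelSpace E] [FiniteDimensional ℝ E]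
  {ν : Measure E} [ν.IsAddHaarMeasure]

lemma zeros_null {V : Set E} (hV : IsOpen V) (hc : Convex ℝ V) {h : E → ℝ} (hh : AnalyticOnNhd ℝ h V) {y : E}
    (hy : y ∈ V) (hne : h y ≠ 0) : ν {x | x ∈ V ∧ h x = 0} = 0 := by
  have hA : MeasurableSet {x | x ∈ V ∧ h x = 0} := by
    have o : IsOpen (V ∩ h ⁻¹' {0}ᶜ) := hh.continuousOn.isOpen_inter_preimage hV isOpen_compl_singleton
    have : {x | x ∈ V ∧ h x = 0} = V \ (V ∩ h ⁻¹' {0}ᶜ) := by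
      ext x
      simp only [mem_ofPred_eq, Set.mem_sdiff, mem_inter_iff, mem_preimage, mem_compl_iff, mem_singleton_iff]
      tauto
    rw [this]
    exact MeasurableSet.diff hV.measurableSet o.measurableSet
  set A := {x | x ∈ V ∧ h x = 0} with hAdef
  have line : ∀ x : E, ∀ᵐ t : ℝ, y + t • x ∉ A := by
    intro x
    let g : ℝ → E := fun t => y + t • x
    have ga : ∀ t, AnalyticAt ℝ g t := fun t => analyticAt_const.add (analyticAt_id.smul analyticAt_const)
    have gc : Continuous g := by fun_prop
    let O := g ⁻¹' V
    have Oc : IsPreconnected O := by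
      refine Convex.isPreconnected ?_
      have : O = (AffineMap.lineMap y (y + x) : ℝ →ᵃ[ℝ] E) ⁻¹' V := by
        ext t; simp [O, g, AffineMap.lineMap_apply, add_comm]
      rw [this]
      exact hc.affine_preimage _
    have hga : AnalyticOnNhd ℝ (fun t => h (g t)) O := fun t ht => (hh (g t) ht).comp (ga t)
    rcases hga.eqOn_zero_or_eventually_ne_zero_of_preconnected Oc with h0 | h0
    · exfalso
      have : (0:ℝ) ∈ O := by simpa [O, g] using hy
      have := h0 this
      simp [g] at this
      exact hne this
    · have hd : IsDiscrete ({t | h (g t) = 0} ∩ O) := isDiscrete_of_codiscreteWithin (by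
        filter_upwards [h0] with t ht; exact ht)
      have hcn : ({t | h (g t) = 0} ∩ O).Countable := (HereditarilyLindelofSpace.isLindelof _).countable_of_isDiscrete hd
      have := hcn.measure_zero volume
      refine measure_mono_null (fun t ht => ?_) this
      simp only [mem_compl_iff, mem_ofPred_eq, not_not] at ht
      exact ⟨ht.2, ht.1⟩
  have hm : MeasurableSet {q : E × ℝ | y + q.2 • q.1 ∉ A} := by
    have : Measurable fun q : E × ℝ => y + q.2 • q.1 := by fun_prop
    exact this hA.compl
  have h1 : ∀ᵐ t : ℝ, ∀ᵐ x ∂ν, y + t • x ∉ A :=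
    (Measure.ae_ae_comm (μ := ν) (ν := volume) (p := fun x t => y + t • x ∉ A) hm).1 (ae_of_all _ line)
  have h2 : ∃ t : ℝ, t ≠ 0 ∧ ∀ᵐ x ∂ν, y + t • x ∉ A := by
    have h3 : ∀ᵐ t : ℝ, t ≠ 0 := by simp [ae_iff]
    obtain ⟨t, a, b⟩ := (h1.and h3).exists
    exact ⟨t, b, a⟩
  obtain ⟨t, t0, ht⟩ := h2
  have h4 : ν ((t • ·) ⁻¹' ((y + ·) ⁻¹' A)) = 0 := by
    refine measure_mono_null (fun x hx => ?_) ht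
    simpa using hx
  rw [Measure.addHaar_preimage_smul _ t0, measure_preimage_add] at h4
  refine (mul_eq_zero.1 h4).resolve_left ?_
  simp [t0]

end zero

section LA
variable {E : Type*} [NormedAddCommGroup E] [NormedSpace ℝ E] [MeasurableSpace E] [BorelSpace E] [FiniteDimensional ℝ E]
  {ν : Measure E} [ν.IsAddHaarMeasure] {K : Type*} [MeasurableSpace K] {L : Measure K} [IsFiniteMeasure L]

/-- locally (in the parameter) a jointly measurable, pointwise analytic version -/
def LA (L : Measure K) (U : Set E) (H : E → K → ℝ) : Prop :=
  ∀ y ∈ U, ∃ r > 0, Metric.ball y r ⊆ U ∧ ∃ h : E → K → ℝ, Measurable (fun q : E × K => h q.1 q.2) ∧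
    (∀ᵐ k ∂L, AnalyticOnNhd ℝ (fun x => h x k) (Metric.ball y r)) ∧ ∀ x ∈ Metric.ball y r, h x =ᵐ[L] H x

variable {U : Set E} {H H' : E → K → ℝ}
lemma LA.op {op : ℝ → ℝ → ℝ} (mop : Measurable fun q : ℝ × ℝ => op q.1 q.2)
    (aop : ∀ (s : Set E) (f g : E → ℝ), AnalyticOnNhd ℝ f s → AnalyticOnNhd ℝ g s → AnalyticOnNhd ℝ (fun x => op (f x) (g x)) s)
    (h1 : LA L U H) (h2 : LA L U H') : LA L U (fun x k => op (H x k) (H' x k)) := by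
  intro y hy
  obtain ⟨r, r0, hr, h, mh, ah, eh⟩ := h1 y hy
  obtain ⟨r', r0', hr', h', mh', ah', eh'⟩ := h2 y hy
  have s1 : Metric.ball y (min r r') ⊆ Metric.ball y r := Metric.ball_subset_ball (min_le_left _ _)
  have s2 : Metric.ball y (min r r') ⊆ Metric.ball y r' := Metric.ball_subset_ball (min_le_right _ _)
  refine ⟨min r r', lt_min r0 r0', s1.trans hr, fun x k => op (h x k) (h' x k), mop.comp (mh.prodMk mh'), ?_, ?_⟩
  · filter_upwards [ah, ah'] with k a b
    exact aop _ _ _ (a.mono s1) (b.mono s2)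
  · intro x hx
    filter_upwards [eh x (s1 hx), eh' x (s2 hx)] with k a b
    rw [a, b]

lemma LA.add (h1 : LA L U H) (h2 : LA L U H') : LA L U (fun x k => H x k + H' x k) :=
  LA.op (op := fun a b => a + b) (by fun_prop) (fun _ _ _ a b => a.add b) h1 h2
lemma LA.mul (h1 : LA L U H) (h2 : LA L U H') : LA L U (fun x k => H x k * H' x k) :=
  LA.op (op := fun a b => a * b) (by fun_prop) (fun _ _ _ a b => a.mul b) h1 h2
lemma LA.sub (h1 : LA L U H) (h2 : LA L U H') : LA L U (fun x k => H x k - H' x k) :=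
  LA.op (op := fun a b => a - b) (by fun_prop) (fun _ _ _ a b => a.sub b) h1 h2
lemma LA.const (hU : IsOpen U) {c : K → ℝ} (hc : Measurable c) : LA L U (fun _ k => c k) := by
  intro y hy
  obtain ⟨r, r0, hr⟩ := Metric.isOpen_iff.1 hU y hy
  exact ⟨r, r0, hr, fun _ k => c k, by fun_prop, ae_of_all _ fun k => analyticOnNhd_const, fun x _ => ae_eq_rfl⟩
lemma LA.sum (hU : IsOpen U) {ι : Type*} (s : Finset ι) {f : ι → E → K → ℝ} (hf : ∀ i, LA L U (f i)) :
    LA L U (fun x k => ∑ i ∈ s, f i x k) := by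
  classical
  induction s using Finset.induction_on with
  | empty => simpa using LA.const (L := L) hU (c := fun _ => 0) measurable_const
  | insert a s ha ih => simpa only [Finset.sum_insert ha] using (hf a).add ih
lemma LA.prod (hU : IsOpen U) {ι : Type*} (s : Finset ι) {f : ι → E → K → ℝ} (hf : ∀ i, LA L U (f i)) :
    LA L U (fun x k => ∏ i ∈ s, f i x k) := by
  classical
  induction s using Finset.induction_on with
  | empty => simpa using LA.const (L := L) hU (c := fun _ => 1) measurable_const
  | insert a s ha ih => simpa only [Finset.prod_insert ha] using (hf a).mul ih
lemma LA.det (hU : IsOpen U) {ι : Type*} [Fintype ι] [DecidableEq ι] {f : ι → ι → E → K → ℝ} (hf : ∀ i j, LA L U (f i j)) :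
    LA L U (fun x k => (Matrix.of fun i j => f i j x k).det) := by
  simp only [Matrix.det_apply', Matrix.of_apply]
  exact LA.sum hU _ fun σ => (LA.const hU (c := fun _ => ((Equiv.Perm.sign σ : ℤ) : ℝ)) measurable_const).mul
    (LA.prod hU _ fun i => hf _ _)

/-- propagation of nonvanishing -/
theorem LA.ne_zero (hU : IsOpen U) (hc : IsPreconnected U) (h : LA L U H) {B : Set K} (hB : MeasurableSet B) {x₁ : E} (hx₁ : x₁ ∈ U)
    (h1 : ∀ᵐ k ∂L, k ∈ B → H x₁ k ≠ 0) : ∀ᵐ x ∂ν, x ∈ U → ∀ᵐ k ∂L, k ∈ B → H x k ≠ 0 := by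
  -- local step
  have loc : ∀ y ∈ U, ∃ r > 0, Metric.ball y r ⊆ U ∧ ∀ x ∈ Metric.ball y r, (∀ᵐ k ∂L, k ∈ B → H x k ≠ 0) →
      ∀ᵐ x ∂ν, x ∈ Metric.ball y r → ∀ᵐ k ∂L, k ∈ B → H x k ≠ 0 := by
    intro y hy
    obtain ⟨r, r0, hr, h, mh, ah, eh⟩ := h y hy
    refine ⟨r, r0, hr, fun x hx hxT => ?_⟩
    have a1 : ∀ᵐ k ∂L, ∀ᵐ x ∂ν, (k ∈ B → x ∈ Metric.ball y r → h x k ≠ 0) := by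
      filter_upwards [ah, eh x hx, hxT] with k ha he hk
      by_cases kB : k ∈ B
      · have := zeros_null (ν := ν) Metric.isOpen_ball (convex_ball y r) ha hx (by rw [he]; exact hk kB)
        have h3 : ∀ᵐ x ∂ν, ¬ (x ∈ Metric.ball y r ∧ h x k = 0) := by
          rw [ae_iff]; simpa using this
        filter_upwards [h3] with z hz _ hzb h0
        exact hz ⟨hzb, h0⟩
      · exact ae_of_all _ fun z hz => absurd hz kB
    have mset : MeasurableSet {q : E × K | q.2 ∈ B → q.1 ∈ Metric.ball y r → h q.1 q.2 ≠ 0} := by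
      have b1 : MeasurableSet {q : E × K | q.2 ∈ B} := measurable_snd hB
      have b2 : MeasurableSet {q : E × K | q.1 ∈ Metric.ball y r} := measurable_fst measurableSet_ball
      have b3 : MeasurableSet {q : E × K | h q.1 q.2 ≠ 0} := mh (measurableSet_singleton 0).compl
      have : {q : E × K | q.2 ∈ B → q.1 ∈ Metric.ball y r → h q.1 q.2 ≠ 0} =
        {q : E × K | q.2 ∈ B}ᶜ ∪ ({q : E × K | q.1 ∈ Metric.ball y r}ᶜ ∪ {q : E × K | h q.1 q.2 ≠ 0}) := by
        ext q; simp only [mem_ofPred_eq, mem_union, mem_compl_iff]; tauto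
      rw [this]
      exact b1.compl.union (b2.compl.union b3)
    have a2 := (Measure.ae_ae_comm (μ := ν) (ν := L) (p := fun x k => k ∈ B → x ∈ Metric.ball y r → h x k ≠ 0) mset).2 a1
    filter_upwards [a2] with z hz hzb
    filter_upwards [hz, eh z hzb] with k b1 b2 b3
    rw [← b2]; exact b1 b3 hzb
  choose! r r0 hr hT using loc
  -- the set of good points
  let G : Set E := {y | ∃ s > 0, ∀ᵐ x ∂ν, x ∈ Metric.ball y s → ∀ᵐ k ∂L, k ∈ B → H x k ≠ 0}
  have step : ∀ y ∈ U, (Metric.ball y (r y) ∩ G).Nonempty → Metric.ball y (r y) ⊆ G := by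
    rintro y hy ⟨z, hzb, s, s0, hs⟩
    obtain ⟨δ, δ0, hδ⟩ := Metric.isOpen_iff.1 Metric.isOpen_ball z hzb
    have hpos : ν (Metric.ball z (min δ s)) ≠ 0 := (Metric.measure_ball_pos ν z (lt_min δ0 s0)).ne'
    obtain ⟨x, hxb, hxT⟩ : ∃ x ∈ Metric.ball z (min δ s), ∀ᵐ k ∂L, k ∈ B → H x k ≠ 0 := by
      by_contra hcon
      refine hpos (measure_mono_null (fun x hx => ?_) hs)
      simp only [mem_compl_iff, mem_ofPred_eq]
      intro h'
      exact hcon ⟨x, hx, h' (Metric.ball_subset_ball (min_le_right _ _) hx)⟩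
    have := hT y hy x (hδ (Metric.ball_subset_ball (min_le_left _ _) hxb)) hxT
    intro w hw
    obtain ⟨δ, δ0, hδ⟩ := Metric.isOpen_iff.1 Metric.isOpen_ball w hw
    refine ⟨δ, δ0, ?_⟩
    filter_upwards [this] with x hx hxb
    exact hx (hδ hxb)
  have hUG : U ⊆ G := by
    have o1 : IsOpen (⋃ y ∈ U ∩ G, Metric.ball y (r y)) := isOpen_biUnion fun _ _ => Metric.isOpen_ball
    have o2 : IsOpen (⋃ y ∈ U \ G, Metric.ball y (r y)) := isOpen_biUnion fun _ _ => Metric.isOpen_ball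
    by_contra hn
    obtain ⟨w, hwU, hwG⟩ := not_subset.1 hn
    have x1G : x₁ ∈ G := ⟨r x₁, r0 x₁ hx₁, hT x₁ hx₁ x₁ (Metric.mem_ball_self (r0 x₁ hx₁)) h1⟩
    obtain ⟨z, hzU, hz1, hz2⟩ := hc _ _ o1 o2 (fun y hy => by
      by_cases hyG : y ∈ G
      · exact .inl (mem_biUnion ⟨hy, hyG⟩ (Metric.mem_ball_self (r0 y hy)))
      · exact .inr (mem_biUnion ⟨hy, hyG⟩ (Metric.mem_ball_self (r0 y hy))))
      ⟨x₁, hx₁, mem_biUnion ⟨hx₁, x1G⟩ (Metric.mem_ball_self (r0 x₁ hx₁))⟩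
      ⟨w, hwU, mem_biUnion ⟨hwU, hwG⟩ (Metric.mem_ball_self (r0 w hwU))⟩
    obtain ⟨y1, ⟨hy1, hy1G⟩, hzb1⟩ := mem_iUnion₂.1 hz1
    obtain ⟨y2, ⟨hy2, hy2G⟩, hzb2⟩ := mem_iUnion₂.1 hz2
    have zG : z ∈ G := step y1 hy1 ⟨y1, Metric.mem_ball_self (r0 y1 hy1), hy1G⟩ hzb1
    exact hy2G (step y2 hy2 ⟨z, hzb2, zG⟩ (Metric.mem_ball_self (r0 y2 hy2)))
  -- countable cover
  rw [ae_iff]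
  refine measure_null_of_locally_null _ fun y hy => ?_
  simp only [mem_ofPred_eq, Classical.not_imp] at hy
  obtain ⟨s, s0, hs⟩ := hUG hy.1
  refine ⟨Metric.ball y s ∩ {x | ¬ (x ∈ U → ∀ᵐ k ∂L, k ∈ B → H x k ≠ 0)}, ?_, ?_⟩
  · rw [inter_comm]
    exact inter_mem_nhdsWithin _ (Metric.ball_mem_nhds y s0)
  · refine measure_mono_null (fun x hx => ?_) hs
    obtain ⟨h1, h2⟩ := hx
    simp only [mem_ofPred_eq, Classical.not_imp, mem_compl_iff] at h2 ⊢
    exact ⟨h1, h2.2⟩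

end LA
end DM

namespace DM
open Topology

section mono
variable {l : ℕ}

/-- words in `Fin l` -/
abbrev Ix (l : ℕ) := Σ n : ℕ, (Fin n → Fin l)

/-- noncommutative monomials -/
def mon (α : Ix l) (v : EuclideanSpace ℝ (Fin l)) : ℝ := ∏ i, v (α.2 i)

lemma mon_le (α : Ix l) (v : EuclideanSpace ℝ (Fin l)) : |mon α v| ≤ ‖v‖ ^ α.1 := by
  unfold mon
  rw [Finset.abs_prod]
  calc ∏ i, |v (α.2 i)| ≤ ∏ i : Fin α.1, ‖v‖ := Finset.prod_le_prod (fun _ _ => abs_nonneg _) fun i _ => by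
        simpa using PiLp.norm_apply_le v (α.2 i)
    _ = _ := by simp

lemma mon_cont (α : Ix l) : Continuous (mon α) := by
  unfold mon; fun_prop

/-- geometric summability over words -/
lemma sum_geom {q : ℝ} (q0 : 0 ≤ q) (hq : l * q < 1) : Summable fun α : Ix l => q ^ α.1 := by
  refine (summable_sigma_of_nonneg fun α => by positivity).2 ⟨fun n => (hasSum_fintype _).summable, ?_⟩
  have : (fun n : ℕ => ∑' c : Fin n → Fin l, q ^ n) = fun n => (l * q) ^ n := by
    funext n
    rw [tsum_fintype]
    simp [mul_pow]
  rw [this]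
  exact summable_geometric_of_lt_one (by positivity) hq

lemma analytic_mon {φ : Ix l → ℝ} {ρ : ℝ} (hρ : 0 < ρ) (hs : Summable fun α => |φ α| * ρ ^ α.1)
    (y : EuclideanSpace ℝ (Fin l)) :
    AnalyticOnNhd ℝ (fun x => ∑' α, mon α (x - y) * φ α) (Metric.ball y ρ) := by
  let q : FormalMultilinearSeries ℝ (EuclideanSpace ℝ (Fin l)) ℝ := fun n =>
    ∑ I : Fin n → Fin l, φ ⟨n, I⟩ • (ContinuousMultilinearMap.mkPiAlgebra ℝ (Fin n) ℝ).compContinuousLinearMap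
      (fun i => EuclideanSpace.proj (𝕜 := ℝ) (I i))
  have q_app : ∀ n v, q n (fun _ => v) = ∑ I : Fin n → Fin l, mon ⟨n, I⟩ v * φ ⟨n, I⟩ := by
    intro n v
    simp only [q, ContinuousMultilinearMap.sum_apply, ContinuousMultilinearMap.smul_apply,
      ContinuousMultilinearMap.compContinuousLinearMap_apply, ContinuousMultilinearMap.mkPiAlgebra_apply, smul_eq_mul]
    refine Finset.sum_congr rfl fun I _ => ?_
    rw [mul_comm]; rfl
  have q_norm : ∀ n, ‖q n‖ ≤ ∑ I : Fin n → Fin l, |φ ⟨n, I⟩| := by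
    intro n
    refine ContinuousMultilinearMap.opNorm_le_bound (Finset.sum_nonneg fun _ _ => abs_nonneg _) fun v => ?_
    simp only [q, ContinuousMultilinearMap.sum_apply, ContinuousMultilinearMap.smul_apply,
      ContinuousMultilinearMap.compContinuousLinearMap_apply, ContinuousMultilinearMap.mkPiAlgebra_apply, smul_eq_mul]
    rw [Finset.sum_mul]
    refine (norm_sum_le _ _).trans (Finset.sum_le_sum fun I _ => ?_)
    rw [norm_mul, Real.norm_eq_abs]
    refine mul_le_mul_of_nonneg_left ?_ (abs_nonneg _)
    rw [Real.norm_eq_abs, Finset.abs_prod]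
    refine Finset.prod_le_prod (fun _ _ => abs_nonneg _) fun i _ => ?_
    simpa using PiLp.norm_apply_le (v i) (I i)
  have hsn : Summable fun n => ∑ I : Fin n → Fin l, |φ ⟨n, I⟩| * ρ ^ n := by
    have := hs.sigma
    simpa only [tsum_fintype] using this
  lift ρ to ℝ≥0 using hρ.le with ρ' hρ'
  have hrad : (ρ' : ℝ≥0∞) ≤ q.radius := by
    refine q.le_radius_of_summable_norm ?_
    refine Summable.of_nonneg_of_le (fun n => by positivity) (fun n => ?_) hsn
    rw [← Finset.sum_mul]
    exact mul_le_mul_of_nonneg_right (q_norm n) (by positivity)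
  have hps : HasFPowerSeriesOnBall (fun x => ∑' α, mon α (x - y) * φ α) q y (ρ' : ℝ≥0∞) := by
    refine ⟨hrad, by simpa using hρ, fun {v} hv => ?_⟩
    have hv' : ‖v‖ < ρ' := by
      rw [Metric.eball_coe, mem_ball_zero_iff] at hv
      exact hv
    have hS : Summable fun α => mon α v * φ α := by
      refine Summable.of_norm_bounded hs fun α => ?_
      rw [norm_mul, Real.norm_eq_abs, Real.norm_eq_abs, mul_comm]
      exact mul_le_mul_of_nonneg_left ((mon_le α v).trans (pow_le_pow_left₀ (norm_nonneg _) hv'.le _)) (abs_nonneg _)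
    have := hS.hasSum.sigma (g := fun n => q n fun _ => v) (fun n => by
      rw [q_app]; exact hasSum_fintype _)
    simpa using this
  have := hps.analyticOnNhd
  rwa [Metric.eball_coe] at this

lemma exp_local {B : Type*} [NormedAddCommGroup B] [NormedSpace ℝ B] [CompleteSpace B] {f : EuclideanSpace ℝ (Fin l) → B}
    {y : EuclideanSpace ℝ (Fin l)} (hf : AnalyticAt ℝ f y) :
    ∃ r > 0, ∃ a : Ix l → B, Summable (fun α => ‖a α‖ * r ^ α.1) ∧
      ∀ x ∈ Metric.ball y r, HasSum (fun α => mon α (x - y) • a α) (f x) := by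
  obtain ⟨p, R, hp⟩ := hf
  obtain ⟨R', R'0, hR'⟩ := ENNReal.lt_iff_exists_nnreal_btwn.1 hp.r_pos
  have R'0 : 0 < (R' : ℝ) := by exact_mod_cast R'0
  obtain ⟨C, C0, hC⟩ := p.norm_mul_pow_le_of_lt_radius (hR'.trans_le hp.r_le)
  set r : ℝ := R' / (2 * (l + 1)) with hr
  have r0 : 0 < r := by positivity
  have hl : (0:ℝ) < 2 * (l + 1) := by positivity
  have hrR : r ≤ R' := div_le_self R'0.le (by have : (0:ℝ) ≤ l := by positivity
                                              linarith)
  let e : Fin l → EuclideanSpace ℝ (Fin l) := fun i => EuclideanSpace.single i 1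
  let a : Ix l → B := fun α => p α.1 fun i => e (α.2 i)
  have ha : ∀ α, ‖a α‖ ≤ ‖p α.1‖ := fun α => by
    refine ((p α.1).le_opNorm _).trans (le_of_eq ?_)
    simp [e]
  have hsum : Summable fun α => ‖a α‖ * r ^ α.1 := by
    have g := (sum_geom (l := l) (q := 1 / (2 * (l + 1))) (by positivity) (by
      rw [mul_one_div, div_lt_one hl]; linarith)).mul_left C
    refine Summable.of_nonneg_of_le (fun α => by positivity) (fun α => ?_) g
    have e1 : r ^ α.1 = R' ^ α.1 * (1 / (2 * (l + 1))) ^ α.1 := by rw [← mul_pow, hr]; ring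
    rw [e1, ← mul_assoc]
    refine mul_le_mul_of_nonneg_right ?_ (by positivity)
    exact (mul_le_mul_of_nonneg_right (ha α) (by positivity)).trans (hC _)
  refine ⟨r, r0, a, hsum, fun x hx => ?_⟩
  have hv : ‖x - y‖ < r := by rwa [← dist_eq_norm]
  set v := x - y
  have hS : Summable fun α => mon α v • a α := by
    refine Summable.of_norm_bounded hsum fun α => ?_
    rw [norm_smul, Real.norm_eq_abs, mul_comm]
    exact mul_le_mul_of_nonneg_left ((mon_le α v).trans (pow_le_pow_left₀ (norm_nonneg _) hv.le _)) (norm_nonneg _)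
  have h1 := hS.hasSum.sigma (g := fun n => p n fun _ => v) (fun n => by
    have : p n (fun _ => v) = ∑ I : Fin n → Fin l, mon ⟨n, I⟩ v • a ⟨n, I⟩ := by
      have ev : v = ∑ i, v i • e i := by
        ext j
        simp [e, Pi.single_apply]
      conv_lhs => rw [ev]
      rw [ContinuousMultilinearMap.map_sum]
      refine Finset.sum_congr rfl fun I _ => ?_
      rw [ContinuousMultilinearMap.map_smul_univ]
      rfl
    rw [this]; exact hasSum_fintype _)
  have h2 := hp.hasSum (y := v) (by
    rw [Metric.mem_eball, edist_zero_right]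
    refine lt_of_lt_of_le ?_ hR'.le
    rw [enorm_eq_nnnorm]
    exact_mod_cast hv.trans_le hrR)
  have h3 := h1.unique h2
  rw [show y + v = x by simp [v]] at h3
  rw [← h3]; exact hS.hasSum

end mono
end DM

namespace DM
open Topology
variable {Ω : Type*} {m : MeasurableSpace Ω} {𝒢 : Filtration ℝ m} {μ : Measure Ω} [IsFiniteMeasure μ]

lemma tail_le {ι : Type*} {u w : ι → ℝ} (hw : Summable w) (hu : ∀ a, |u a| ≤ w a) {S : ℝ} (hS : HasSum u S) (s : Finset ι) :
    |S - ∑ a ∈ s, u a| ≤ ∑' a : {a // a ∉ s}, w a := by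
  have h1 := hS.summable.sum_add_tsum_subtype_compl s
  rw [hS.tsum_eq] at h1
  rw [← h1, add_sub_cancel_left]
  exact tsum_of_norm_bounded (f := fun a : {a // a ∉ s} => u a) (hw.subtype _).hasSum fun a => hu a

lemma dm_le {X : Ω → ℝ} (hX : Measurable X) {C : ℝ} (hC : 0 ≤ C) (hb : ∀ᵐ ω ∂μ, |X ω| ≤ C) :
    dm 𝒢 μ X univ ≤ ENNReal.ofReal (C ^ 2) * μ univ := by
  rw [dm_apply ⟨hX, C, hC, hb⟩ (n := 0) (@MeasurableSet.univ _ (_))]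
  refine (dn_bound hC hX hb 0 (@MeasurableSet.univ _ (_))).trans ?_
  exact mul_le_mul_right (measure_mono (subset_univ _)) _

lemma AC.closure {L : Measure (KK 𝒢)} {X : Ω → ℝ} (hX : Bd μ X)
    (h : ∀ ε > 0, ∃ Z, AC 𝒢 μ L Z ∧ ∀ᵐ ω ∂μ, |X ω - Z ω| ≤ ε) : AC 𝒢 μ L X := by
  refine ⟨hX, Measure.AbsolutelyContinuous.mk fun N hN h0 => ?_⟩
  have key : ∀ ε > 0, dm 𝒢 μ X N ≤ ENNReal.ofReal (2 * ε ^ 2) * μ univ := by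
    intro ε hε
    obtain ⟨Z, hZ, hb⟩ := h ε hε
    have p := dm_parallelogram (𝒢 := 𝒢) (hX.sub hZ.1) hZ.1
    have e : (fun ω => X ω - Z ω + Z ω) = X := by funext ω; ring
    rw [e] at p
    have p' := congrArg (fun ν => ν N) p
    simp only [Measure.add_apply, Measure.smul_apply, hZ.2 h0, smul_zero, add_zero] at p'
    calc dm 𝒢 μ X N ≤ (2 : ℝ≥0) • dm 𝒢 μ (fun ω => X ω - Z ω) N := by rw [← p']; exact le_self_add
      _ ≤ (2 : ℝ≥0) • (ENNReal.ofReal (ε ^ 2) * μ univ) := by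
          gcongr
          exact (measure_mono (subset_univ _)).trans (dm_le (hX.sub hZ.1).1 hε.le hb)
      _ = _ := by
          rw [ENNReal.ofReal_mul (by norm_num), ENNReal.smul_def, smul_eq_mul, ← mul_assoc]
          norm_num
  have t : Tendsto (fun ε : ℝ => ENNReal.ofReal (2 * ε ^ 2) * μ univ) (𝓝[>] 0) (𝓝 0) := by
    have : Tendsto (fun ε : ℝ => ENNReal.ofReal (2 * ε ^ 2) * μ univ) (𝓝[>] 0) (𝓝 (ENNReal.ofReal (2 * 0 ^ 2) * μ univ)) := by
      refine ENNReal.Tendsto.mul_const ?_ (.inr (measure_ne_top _ _))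
      refine (ENNReal.continuous_ofReal.tendsto _).comp (Tendsto.mono_left ?_ nhdsWithin_le_nhds)
      exact Continuous.tendsto (by fun_prop) _
    simpa using this
  exact le_antisymm (ge_of_tendsto t (by filter_upwards [self_mem_nhdsWithin] with ε hε using key ε hε)) zero_le

/-- controlled linear functionals -/
structure Fn (L : Measure (KK 𝒢)) (μ : Measure Ω) [IsFiniteMeasure μ] (Φ : (Ω → ℝ) → KK 𝒢 → ℝ) : Prop where
  meas : ∀ X, Measurable (Φ X)
  add : ∀ X Z, AC 𝒢 μ L X → AC 𝒢 μ L Z → Φ (fun ω => X ω + Z ω) =ᵐ[L] fun k => Φ X k + Φ Z k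
  smul : ∀ (c : ℝ) X, AC 𝒢 μ L X → Φ (fun ω => c * X ω) =ᵐ[L] fun k => c * Φ X k
  bd : ∃ C : ℝ, 0 ≤ C ∧ ∀ X (b : ℝ), AC 𝒢 μ L X → 0 < b → (∀ᵐ ω ∂μ, |X ω| ≤ b) → ∫⁻ k, ‖Φ X k‖ₑ ∂L ≤ ENNReal.ofReal (C * b)

variable {L : Measure (KK 𝒢)} [IsFiniteMeasure L]

lemma lm_add (hL : NL L μ) {X Z : Ω → ℝ} (hX : Bd μ X) (hZ : Bd μ Z) :
    ∀ᵐ k ∂L, lm μ (fun ω => X ω + Z ω) k = lm μ X k + lm μ Z k := by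
  have e : ∀ᵐ ω ∂μ, ∀ n i, mc 𝒢 μ (fun ω => X ω + Z ω) (tm n i) ω = mc 𝒢 μ X (tm n i) ω + mc 𝒢 μ Z (tm n i) ω :=
    ae_all_iff.2 fun n => ae_all_iff.2 fun i => mc_add hX hZ _
  filter_upwards [hL _ e, lm_tendsto hL hX, lm_tendsto hL hZ, lm_tendsto hL (hX.add hZ)] with k e h1 h2 h3
  refine tendsto_nhds_unique h3 ((h1.add h2).congr fun n => ?_)
  exact (e _ _).symm

lemma lm_smul (hL : NL L μ) {X : Ω → ℝ} (c : ℝ) (hX : Bd μ X) :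
    ∀ᵐ k ∂L, lm μ (fun ω => c * X ω) k = c * lm μ X k := by
  have e : ∀ᵐ ω ∂μ, ∀ n i, mc 𝒢 μ (fun ω => c * X ω) (tm n i) ω = c * mc 𝒢 μ X (tm n i) ω :=
    ae_all_iff.2 fun n => ae_all_iff.2 fun i => mc_const_mul X c _
  filter_upwards [hL _ e, lm_tendsto hL hX, lm_tendsto hL (hX.const_mul c)] with k e h1 h3
  refine tendsto_nhds_unique h3 ((h1.const_mul c).congr fun n => ?_)
  exact (e _ _).symm

lemma lm_fn (hL : NL L μ) : Fn L μ (lm μ) where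
  meas := lm_meas
  add X Z hX hZ := lm_add hL hX.1 hZ.1
  smul c X hX := lm_smul hL c hX.1
  bd := by
    refine ⟨L.real univ, measureReal_nonneg, fun X b hX b0 hb => ?_⟩
    calc ∫⁻ k, ‖lm μ X k‖ₑ ∂L ≤ ∫⁻ k, ENNReal.ofReal b ∂L := by
          refine lintegral_mono_ae ?_
          filter_upwards [lm_le hL hX.1.1 b0.le hb] with k hk
          rw [← ofReal_norm]; exact ENNReal.ofReal_le_ofReal hk
      _ = _ := by
          rw [lintegral_const, mul_comm, ENNReal.ofReal_mul measureReal_nonneg, measureReal_def, ENNReal.ofReal_toReal (measure_ne_top _ _)]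

lemma gam_fn {M : Ω → ℝ} (hM : AC 𝒢 μ L M) : Fn L μ (fun X => gam L μ X M) where
  meas X := gam_meas _ _ _
  add X Z hX hZ := by
    have := gam_sum (L := L) (Finset.univ : Finset (Fin 2)) (X := ![X, Z]) (Y := M) (by
      intro a; fin_cases a
      · exact hX
      · exact hZ) hM (fun _ => 1)
    simpa [Fin.sum_univ_two] using this
  smul c X hX := by
    have := gam_sum (L := L) (Finset.univ : Finset (Fin 1)) (X := fun _ => X) (Y := M) (fun _ => hX) hM (fun _ => c)
    simpa using this
  bd := by
    obtain ⟨mM, CM, CM0, bM⟩ := id hM.1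
    have gi : ∀ X (b : ℝ), AC 𝒢 μ L X → 0 ≤ b → (∀ᵐ ω ∂μ, |X ω| ≤ b) → ∫ k, gam L μ X X k ∂L ≤ b ^ 2 * μ.real univ := by
      intro X b hX b0 hb
      rw [integral_congr_ae (gam_self hX)]
      have : ∫ k, rd L μ X k ∂L = (dm 𝒢 μ X).real univ := Measure.integral_toReal_rnDeriv hX.2
      rw [this, measureReal_def]
      refine (ENNReal.toReal_mono (by finiteness) (dm_le hX.1.1 b0 hb)).trans (le_of_eq ?_)
      rw [ENNReal.toReal_mul, ENNReal.toReal_ofReal (by positivity)]; rfl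
    refine ⟨(μ.real univ + CM ^ 2 * μ.real univ) / 2, by positivity, fun X b hX b0 hb => ?_⟩
    have pt : ∀ᵐ k ∂L, |gam L μ X M k| ≤ (b⁻¹ * gam L μ X X k + b * gam L μ M M k) / 2 := by
      filter_upwards [exists_gr (L := L) (X := ![X, M]) (by
        intro a; fin_cases a
        · exact hX
        · exact hM)] with k ⟨r, u, hu⟩
      have a1 := hu 0 1
      have a2 := hu 0 0
      have a3 := hu 1 1
      simp only [Matrix.cons_val_zero, Matrix.cons_val_one] at a1 a2 a3
      rw [← a1, ← a2, ← a3]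
      have c := abs_real_inner_le_norm (u 0) (u 1)
      rw [real_inner_self_eq_norm_sq, real_inner_self_eq_norm_sq]
      refine c.trans ?_
      have := sq_nonneg (‖u 0‖ - b * ‖u 1‖)
      have e : (b⁻¹ * ‖u 0‖ ^ 2 + b * ‖u 1‖ ^ 2) / 2 - ‖u 0‖ * ‖u 1‖ = b⁻¹ * (‖u 0‖ - b * ‖u 1‖) ^ 2 / 2 := by
        field_simp; ring
      have : 0 ≤ b⁻¹ * (‖u 0‖ - b * ‖u 1‖) ^ 2 / 2 := by positivity
      linarith
    have ii : Integrable (fun k => (b⁻¹ * gam L μ X X k + b * gam L μ M M k) / 2) L :=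
      (((gam_integrable L X X).const_mul _).add ((gam_integrable L M M).const_mul _)).div_const _
    calc ∫⁻ k, ‖gam L μ X M k‖ₑ ∂L ≤ ∫⁻ k, ENNReal.ofReal ((b⁻¹ * gam L μ X X k + b * gam L μ M M k) / 2) ∂L := by
          refine lintegral_mono_ae ?_
          filter_upwards [pt] with k hk
          rw [← ofReal_norm]; exact ENNReal.ofReal_le_ofReal hk
      _ = ENNReal.ofReal (∫ k, (b⁻¹ * gam L μ X X k + b * gam L μ M M k) / 2 ∂L) := by
          rw [ofReal_integral_eq_lintegral_ofReal ii]
          filter_upwards [pt] with k hk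
          exact (abs_nonneg _).trans hk
      _ ≤ _ := by
          refine ENNReal.ofReal_le_ofReal ?_
          rw [integral_div, integral_add ((gam_integrable L X X).const_mul _) ((gam_integrable L M M).const_mul _),
            integral_const_mul, integral_const_mul]
          have h1 := mul_le_mul_of_nonneg_left (gi X b hX b0.le hb) (inv_pos.2 b0).le
          have h2 := mul_le_mul_of_nonneg_left (gi M CM hM CM0 bM) b0.le
          have h3 : b⁻¹ * (b ^ 2 * μ.real univ) = b * μ.real univ := by field_simp
          rw [h3] at h1
          linarith

lemma Fn.lin {Φ : (Ω → ℝ) → KK 𝒢 → ℝ} (h : Fn L μ Φ) {ι : Type*} (s : Finset ι) {a : ι → Ω → ℝ} (c : ι → ℝ) {X : Ω → ℝ}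
    (hX : AC 𝒢 μ L X) (ha : ∀ α, AC 𝒢 μ L (a α)) :
    Φ (fun ω => X ω - ∑ α ∈ s, c α * a α ω) =ᵐ[L] fun k => Φ X k - ∑ α ∈ s, c α * Φ (a α) k := by
  classical
  induction s using Finset.induction_on with
  | empty => simp
  | insert i s hi ih =>
    have h1 := h.add _ _ (hX.sub (AC.sum s fun α _ => (ha α).const_mul (c α))) ((ha i).const_mul (-c i))
    have h2 := h.smul (-c i) _ (ha i)
    have e : (fun ω => X ω - ∑ α ∈ insert i s, c α * a α ω) = fun ω => X ω - ∑ α ∈ s, c α * a α ω + -c i * a i ω := by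
      funext ω; rw [Finset.sum_insert hi]; ring
    rw [e]
    filter_upwards [h1, h2, ih] with k k1 k2 k3
    rw [k1, k2, k3, Finset.sum_insert hi]; ring

variable {l : ℕ} {U : Set (EuclideanSpace ℝ (Fin l))}

/-- bounded local power series expansions -/
def Ex (L : Measure (KK 𝒢)) (μ : Measure Ω) [IsFiniteMeasure μ] (U : Set (EuclideanSpace ℝ (Fin l)))
    (X : EuclideanSpace ℝ (Fin l) → Ω → ℝ) (good : (Ω → ℝ) → Prop) : Prop :=
  ∀ z ∈ U, ∃ y ρ, 0 < ρ ∧ z ∈ Metric.ball y ρ ∧ Metric.ball y ρ ⊆ U ∧ ∃ (a : Ix l → Ω → ℝ) (b : Ix l → ℝ),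
    (∀ α, AC 𝒢 μ L (a α)) ∧ (∀ α, good (a α)) ∧ (∀ α, 0 < b α) ∧ (∀ α, ∀ᵐ ω ∂μ, |a α ω| ≤ b α) ∧
    Summable (fun α => b α * ρ ^ α.1) ∧ ∀ x ∈ Metric.ball y ρ, Measurable (X x) ∧
      ∀ᵐ ω ∂μ, HasSum (fun α => mon α (x - y) * a α ω) (X x ω)

lemma mon_bd {x y : EuclideanSpace ℝ (Fin l)} {ρ : ℝ} (hx : x ∈ Metric.ball y ρ) (α : Ix l) : |mon α (x - y)| ≤ ρ ^ α.1 := by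
  refine (mon_le _ _).trans (pow_le_pow_left₀ (norm_nonneg _) ?_ _)
  rw [← dist_eq_norm]; exact (Metric.mem_ball.1 hx).le

lemma tail_pt {a : Ix l → Ω → ℝ} {b : Ix l → ℝ} {ρ : ℝ} (ρ0 : 0 < ρ) (hb : ∀ α, ∀ᵐ ω ∂μ, |a α ω| ≤ b α)
    (hs : Summable (fun α => b α * ρ ^ α.1)) {x y : EuclideanSpace ℝ (Fin l)} (hx : x ∈ Metric.ball y ρ) {Z : Ω → ℝ}
    (h : ∀ᵐ ω ∂μ, HasSum (fun α => mon α (x - y) * a α ω) (Z ω)) (s : Finset (Ix l)) :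
    ∀ᵐ ω ∂μ, |Z ω - ∑ α ∈ s, mon α (x - y) * a α ω| ≤ ∑' α : {α // α ∉ s}, b α * ρ ^ (α : Ix l).1 := by
  filter_upwards [ae_all_iff.2 hb, h] with ω h1 h2
  refine tail_le hs (fun α => ?_) h2 s
  rw [abs_mul, mul_comm]
  exact mul_le_mul (h1 α) (mon_bd hx α) (abs_nonneg _) ((abs_nonneg _).trans (h1 α))

/-- uniform approximation by finite combinations -/
lemma Ex.approx {X : EuclideanSpace ℝ (Fin l) → Ω → ℝ} {good : (Ω → ℝ) → Prop} (h : Ex L μ U X good) {x : EuclideanSpace ℝ (Fin l)} (hx : x ∈ U) :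
    Bd μ (X x) ∧ ∃ (a : Ix l → Ω → ℝ), (∀ α, AC 𝒢 μ L (a α)) ∧ (∀ α, good (a α)) ∧ ∃ c : Ix l → ℝ, ∀ ε > 0, ∃ s : Finset (Ix l),
      ∀ᵐ ω ∂μ, |X x ω - ∑ α ∈ s, c α * a α ω| ≤ ε := by
  obtain ⟨y, ρ, ρ0, hz, hbU, a, b, hA, hg, b0, hb, hs, hX⟩ := h x hx
  have key : ∀ ε > 0, ∃ s : Finset (Ix l), ∀ᵐ ω ∂μ, |X x ω - ∑ α ∈ s, mon α (x - y) * a α ω| ≤ ε := by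
    intro ε hε
    have t := tendsto_tsum_compl_atTop_zero (fun α : Ix l => b α * ρ ^ α.1)
    obtain ⟨s, h'⟩ := (t.eventually (eventually_lt_nhds hε)).exists
    refine ⟨s, ?_⟩
    filter_upwards [tail_pt ρ0 hb hs hz (hX x hz).2 s] with ω hω
    exact hω.trans h'.le
  refine ⟨?_, a, hA, hg, fun α => mon α (x - y), key⟩
  obtain ⟨s, h1⟩ := key 1 one_pos
  have hB : Bd μ (fun ω => ∑ α ∈ s, mon α (x - y) * a α ω) := Bd.sum s fun α _ => (hA α).1.const_mul _
  obtain ⟨_, C, C0, h2⟩ := hB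
  refine Bd.of_le (hX x hz).1 (1 + C) ?_
  filter_upwards [h1, h2] with ω a1 a2
  have := abs_le.1 a1; have := abs_le.1 a2
  rw [abs_le]; constructor <;> linarith

lemma Ex.ac {X : EuclideanSpace ℝ (Fin l) → Ω → ℝ} {good : (Ω → ℝ) → Prop} (h : Ex L μ U X good) {x : EuclideanSpace ℝ (Fin l)} (hx : x ∈ U) :
    AC 𝒢 μ L (X x) := by
  obtain ⟨hB, a, hA, _, c, hc⟩ := h.approx hx
  refine AC.closure hB fun ε hε => ?_
  obtain ⟨s, hs⟩ := hc ε hε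
  exact ⟨_, AC.sum s fun α _ => (hA α).const_mul _, hs⟩

theorem Ex.la {X : EuclideanSpace ℝ (Fin l) → Ω → ℝ} {good : (Ω → ℝ) → Prop} (h : Ex L μ U X good)
    {Φ : (Ω → ℝ) → KK 𝒢 → ℝ} (hΦ : Fn L μ Φ) : LA L U (fun x => Φ (X x)) := by
  intro z hzU
  obtain ⟨y, ρ, ρ0, hz, hbU, a, b, hA, hg, b0, hb, hs, hX⟩ := h z hzU
  obtain ⟨r, r0, hr⟩ := Metric.isOpen_iff.1 Metric.isOpen_ball z hz
  obtain ⟨C, C0, hC⟩ := hΦ.bd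
  have mon_m : ∀ α : Ix l, Measurable (mon α) := fun α => (mon_cont α).measurable
  have lb : ∀ α, ∫⁻ k, ‖Φ (a α) k‖ₑ ∂L ≤ ENNReal.ofReal (C * b α) := fun α => hC _ _ (hA α) (b0 α) (hb α)
  have sC : Summable fun α => C * (b α * ρ ^ α.1) := hs.mul_left C
  have wb : ∀ (α : Ix l) (q : ℝ), |q| ≤ ρ ^ α.1 → ∫⁻ k, ‖q * Φ (a α) k‖ₑ ∂L ≤ ENNReal.ofReal (C * (b α * ρ ^ α.1)) := by
    intro α q hq
    simp only [enorm_mul]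
    rw [lintegral_const_mul' _ _ (by simp)]
    calc _ ≤ ENNReal.ofReal (ρ ^ α.1) * ENNReal.ofReal (C * b α) := by
          refine mul_le_mul' ?_ (lb α)
          rw [← ofReal_norm]; exact ENNReal.ofReal_le_ofReal hq
      _ = _ := by rw [← ENNReal.ofReal_mul (by positivity)]; congr 1; ring
  have sumae : ∀ᵐ k ∂L, Summable fun α => |Φ (a α) k| * ρ ^ α.1 := by
    have : ∫⁻ k, ∑' α, ‖ρ ^ α.1 * Φ (a α) k‖ₑ ∂L ≠ ∞ := by
      rw [lintegral_tsum fun α => ((hΦ.meas _).const_mul _).enorm.aemeasurable]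
      refine ne_top_of_le_ne_top (sC.tsum_ofReal_ne_top) (ENNReal.tsum_le_tsum fun α => ?_)
      exact wb α _ (abs_of_pos (by positivity)).le
    filter_upwards [ae_lt_top' (AEMeasurable.tsum fun α => ((hΦ.meas _).const_mul _).enorm.aemeasurable) this] with k hk
    have h1 : Summable fun α => ‖ρ ^ α.1 * Φ (a α) k‖ := by
      have := ENNReal.summable_toReal hk.ne
      simpa [toReal_enorm] using this
    refine h1.congr fun α => ?_
    rw [norm_mul, Real.norm_eq_abs, Real.norm_eq_abs, abs_of_pos (by positivity : 0 < ρ ^ α.1), mul_comm]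
  refine ⟨r, r0, hr.trans hbU, fun x k => ∑' α, mon α (x - y) * Φ (a α) k, ?_, ?_, ?_⟩
  · refine Measurable.tsum fun α => ?_
    exact ((mon_m α).comp (measurable_fst.sub_const y)).mul ((hΦ.meas _).comp measurable_snd)
  · filter_upwards [sumae] with k hk
    exact (analytic_mon ρ0 hk y).mono hr
  · intro x hx
    have hxb := hr hx
    have aX := h.ac (hbU hxb)
    have key : ∀ s : Finset (Ix l), ∫⁻ k, ‖(∑' α, mon α (x - y) * Φ (a α) k) - Φ (X x) k‖ₑ ∂L ≤
        2 * ∑' α : {α // α ∉ s}, ENNReal.ofReal (C * (b α * ρ ^ (α : Ix l).1)) := by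
      intro s
      have p1 : ∫⁻ k, ‖(∑' α, mon α (x - y) * Φ (a α) k) - ∑ α ∈ s, mon α (x - y) * Φ (a α) k‖ₑ ∂L ≤
          ∑' α : {α // α ∉ s}, ENNReal.ofReal (C * (b α * ρ ^ (α : Ix l).1)) := by
        calc _ ≤ ∫⁻ k, ∑' α : {α // α ∉ s}, ‖mon (α : Ix l) (x - y) * Φ (a α) k‖ₑ ∂L := by
              refine lintegral_mono_ae ?_
              filter_upwards [sumae] with k hk
              have hS : Summable fun α => mon α (x - y) * Φ (a α) k := by
                refine Summable.of_norm_bounded hk fun α => ?_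
                rw [norm_mul, Real.norm_eq_abs, Real.norm_eq_abs, mul_comm]
                exact mul_le_mul_of_nonneg_left (mon_bd hxb α) (abs_nonneg _)
              rw [← hS.sum_add_tsum_subtype_compl s, add_sub_cancel_left]
              exact enorm_tsum_le_tsum_enorm
          _ = ∑' α : {α // α ∉ s}, ∫⁻ k, ‖mon (α : Ix l) (x - y) * Φ (a α) k‖ₑ ∂L :=
              lintegral_tsum fun α => ((hΦ.meas _).const_mul _).enorm.aemeasurable
          _ ≤ _ := ENNReal.tsum_le_tsum fun α => wb α _ (mon_bd hxb α)
      have p2 : ∫⁻ k, ‖Φ (X x) k - ∑ α ∈ s, mon α (x - y) * Φ (a α) k‖ₑ ∂L ≤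
          ∑' α : {α // α ∉ s}, ENNReal.ofReal (C * (b α * ρ ^ (α : Ix l).1)) := by
        have e := hΦ.lin s (fun α => mon α (x - y)) aX hA
        have : ∀ t > (∑' α : {α // α ∉ s}, b α * ρ ^ (α : Ix l).1), ∫⁻ k, ‖Φ (X x) k - ∑ α ∈ s, mon α (x - y) * Φ (a α) k‖ₑ ∂L ≤ ENNReal.ofReal (C * t) := by
          intro t ht
          calc _ = ∫⁻ k, ‖Φ (fun ω => X x ω - ∑ α ∈ s, mon α (x - y) * a α ω) k‖ₑ ∂L :=
                lintegral_congr_ae (by filter_upwards [e] with k hk; rw [hk])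
            _ ≤ _ := by
                have n0 : 0 ≤ ∑' α : {α // α ∉ s}, b α * ρ ^ (α : Ix l).1 := tsum_nonneg fun α => by have := b0 α; positivity
                refine hC _ t (aX.sub (AC.sum s fun α _ => (hA α).const_mul _)) (n0.trans_lt ht) ?_
                filter_upwards [tail_pt ρ0 hb hs hxb (hX x hxb).2 s] with ω hω
                exact hω.trans ht.le
        have lim : Tendsto (fun t => ENNReal.ofReal (C * t)) (𝓝[>] (∑' α : {α // α ∉ s}, b α * ρ ^ (α : Ix l).1))
            (𝓝 (ENNReal.ofReal (C * ∑' α : {α // α ∉ s}, b α * ρ ^ (α : Ix l).1))) := by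
          refine Tendsto.mono_left ?_ nhdsWithin_le_nhds
          exact (ENNReal.continuous_ofReal.comp (continuous_const.mul continuous_id)).tendsto _
        refine (ge_of_tendsto lim (by filter_upwards [self_mem_nhdsWithin] with t ht using this t ht)).trans ?_
        rw [← tsum_mul_left]
        exact (ENNReal.ofReal_tsum_of_nonneg (f := fun α : {α // α ∉ s} => C * (b α * ρ ^ (α : Ix l).1))
          (fun α => by have := b0 α; positivity) (sC.subtype _)).le
      calc _ ≤ ∫⁻ k, (‖(∑' α, mon α (x - y) * Φ (a α) k) - ∑ α ∈ s, mon α (x - y) * Φ (a α) k‖ₑ + ‖Φ (X x) k - ∑ α ∈ s, mon α (x - y) * Φ (a α) k‖ₑ) ∂L := by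
            refine lintegral_mono fun k => ?_
            refine le_trans (le_of_eq ?_) enorm_sub_le
            congr 1; ring
        _ = _ := lintegral_add_left (by
            refine Measurable.enorm (Measurable.sub (Measurable.tsum fun α => (hΦ.meas _).const_mul _) ?_)
            exact Finset.measurable_fun_sum _ fun α _ => (hΦ.meas _).const_mul _) _
        _ ≤ _ := by rw [two_mul]; exact add_le_add p1 p2
    have t := ENNReal.Tendsto.const_mul (a := 2) (ENNReal.tendsto_tsum_compl_atTop_zero sC.tsum_ofReal_ne_top) (.inr (by simp))
    rw [mul_zero] at t
    have z0 := le_antisymm (ge_of_tendsto' t key) zero_le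
    have z1 := (lintegral_eq_zero_iff (by
      refine Measurable.enorm (Measurable.sub (Measurable.tsum fun α => (hΦ.meas _).const_mul _) (hΦ.meas _)))).1 z0
    filter_upwards [z1] with k hk
    have : (∑' α, mon α (x - y) * Φ (a α) k) - Φ (X x) k = 0 := by simpa using hk
    linarith

end DM

namespace DM
open Topology

lemma la_span {V : Type*} [NormedAddCommGroup V] [InnerProductSpace ℝ V] [FiniteDimensional ℝ V] {d : ℕ} (w b : Fin d → V)
    (hb : ∀ i, b i ∈ Submodule.span ℝ (range w))
    (h : ∀ (r : ℕ) (a : Fin r → Fin d), (Matrix.of fun i j => inner ℝ (w (a i)) (w (a j))).det ≠ 0 →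
      (Matrix.of fun i j => inner ℝ (b (a i)) (w (a j))).det ≠ 0) :
    Submodule.span ℝ (range w) ≤ Submodule.span ℝ (range b) := by
  obtain ⟨κ, a, ha, hs, hli⟩ := exists_linearIndependent' ℝ w
  have : Finite κ := Finite.of_injective a ha
  obtain ⟨r, ⟨e⟩⟩ := Finite.exists_equiv_fin κ
  set a' : Fin r → Fin d := a ∘ e.symm with ha'
  have hs' : Submodule.span ℝ (range (w ∘ a')) = Submodule.span ℝ (range w) := by
    rw [← hs, ha', ← Function.comp_assoc, EquivLike.range_comp]
  have hli' : LinearIndependent ℝ (w ∘ a') := by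
    rw [ha', ← Function.comp_assoc]
    exact hli.comp _ e.symm.injective
  have d1 := (Matrix.PosDef.det_pos (Matrix.posDef_gram_of_linearIndependent (𝕜 := ℝ) hli')).ne'
  have d2 := h r a' d1
  have bli : LinearIndependent ℝ (b ∘ a') := by
    rw [Fintype.linearIndependent_iff]
    intro g hg
    have hv : Matrix.vecMul g (Matrix.of fun i j => inner ℝ (b (a' i)) (w (a' j))) = 0 := by
      funext j
      have := congrArg (fun v => inner ℝ v (w (a' j))) hg
      simp only [sum_inner, inner_smul_left, inner_zero_left] at this
      simpa [Matrix.vecMul, dotProduct] using this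
    have := Matrix.eq_zero_of_vecMul_eq_zero d2 hv
    intro i; rw [this]; rfl
  have le : Submodule.span ℝ (range (b ∘ a')) ≤ Submodule.span ℝ (range w) := by
    rw [Submodule.span_le]; rintro _ ⟨i, rfl⟩; exact hb _
  have fr : Module.finrank ℝ (Submodule.span ℝ (range (b ∘ a'))) = Module.finrank ℝ (Submodule.span ℝ (range w)) := by
    rw [← hs', finrank_span_eq_card bli, finrank_span_eq_card hli']
  rw [← Submodule.eq_of_le_of_finrank_eq le fr]
  exact Submodule.span_mono (range_comp_subset_range _ _)

variable {Ω : Type*} {m : MeasurableSpace Ω} {𝒢 : Filtration ℝ m} {μ : Measure Ω} [IsFiniteMeasure μ]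
variable {L : Measure (KK 𝒢)} [IsFiniteMeasure L]

/-- inner product of wedges -/
def cc (L : Measure (KK 𝒢)) (μ : Measure Ω) [IsFiniteMeasure μ] (Y M Y0 M0 : Ω → ℝ) (k : KK 𝒢) : ℝ :=
  lm μ Y k * (lm μ Y0 k * gam L μ M M0 k - lm μ M0 k * gam L μ M Y0 k) -
    lm μ M k * (lm μ Y0 k * gam L μ Y M0 k - lm μ M0 k * gam L μ Y Y0 k)

lemma cc_meas (Y M Y0 M0 : Ω → ℝ) : Measurable (cc L μ Y M Y0 M0) := by
  unfold cc
  exact ((lm_meas _).mul (((lm_meas _).mul (gam_meas _ _ _)).sub ((lm_meas _).mul (gam_meas _ _ _)))).sub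
    ((lm_meas _).mul (((lm_meas _).mul (gam_meas _ _ _)).sub ((lm_meas _).mul (gam_meas _ _ _))))

lemma Fn.conv {Φ : (Ω → ℝ) → KK 𝒢 → ℝ} (h : Fn L μ Φ) {X : ℕ → Ω → ℝ} {X0 : Ω → ℝ} (hX : ∀ n, AC 𝒢 μ L (X n)) (h0 : AC 𝒢 μ L X0)
    {C : ℝ} (hC : 0 < C) (hb : ∀ n, ∀ᵐ ω ∂μ, |X n ω - X0 ω| ≤ C * (1 / 2) ^ n) :
    ∀ᵐ k ∂L, Tendsto (fun n => Φ (X n) k) atTop (𝓝 (Φ X0 k)) := by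
  obtain ⟨C0, hC0, hbd⟩ := h.bd
  have e : ∀ n, Φ (fun ω => X n ω - X0 ω) =ᵐ[L] fun k => Φ (X n) k - Φ X0 k := by
    intro n
    have := h.lin (Finset.univ : Finset (Fin 1)) (a := fun _ => X0) (fun _ => 1) (hX n) (fun _ => h0)
    simpa using this
  have l1 : ∀ n, ∫⁻ k, ‖Φ (fun ω => X n ω - X0 ω) k‖ₑ ∂L ≤ ENNReal.ofReal (C0 * (C * (1 / 2) ^ n)) :=
    fun n => hbd _ _ ((hX n).sub h0) (by positivity) (hb n)
  have ii : ∀ n, Integrable (Φ (fun ω => X n ω - X0 ω)) L := fun n =>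
    ⟨(h.meas _).aestronglyMeasurable, (l1 n).trans_lt ENNReal.ofReal_lt_top⟩
  have := ae_tendsto_zero_of_geom ii (C := C0 * C) (fun n => by
    have a := integral_norm_eq_lintegral_enorm (ii n).1
    simp only [Real.norm_eq_abs] at a
    rw [a, mul_assoc]
    exact ENNReal.toReal_le_of_le_ofReal (by positivity) (l1 n))
  filter_upwards [this, ae_all_iff.2 e] with k h1 h2
  have := h1.add_const (Φ X0 k)
  rw [zero_add] at this
  refine this.congr fun n => ?_
  rw [h2]; ring

lemma det_tendsto {r : ℕ} {A : ℕ → Fin r → Fin r → ℝ} {B : Fin r → Fin r → ℝ} (h : ∀ i j, Tendsto (fun n => A n i j) atTop (𝓝 (B i j))) :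
    Tendsto (fun n => (Matrix.of (A n)).det) atTop (𝓝 (Matrix.of B).det) := by
  have c : Continuous fun M : Matrix (Fin r) (Fin r) ℝ => M.det := continuous_id.matrix_det
  exact (c.tendsto _).comp (tendsto_pi_nhds.2 fun i => tendsto_pi_nhds.2 fun j => h i j)

lemma det_meas {r : ℕ} {K : Type*} [MeasurableSpace K] {A : Fin r → Fin r → K → ℝ} (h : ∀ i j, Measurable (A i j)) :
    Measurable fun k => (Matrix.of fun i j => A i j k).det := by
  simp only [Matrix.det_apply', Matrix.of_apply]
  exact Finset.measurable_fun_sum _ fun σ _ => measurable_const.mul (Finset.measurable_fun_prod _ fun i _ => h _ _)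

/-- relation on the span of coefficients passes to the limit -/
lemma Ex.rel {l : ℕ} {U : Set (EuclideanSpace ℝ (Fin l))} {d : ℕ} {Y0 : Ω → ℝ} {M0 : Fin d → Ω → ℝ} (hY0 : Bd μ Y0) (hM0 : ∀ j, Bd μ (M0 j))
    {X : EuclideanSpace ℝ (Fin l) → Ω → ℝ}
    (h : Ex L μ U X (fun a => Rel 𝒢 μ (fun _ _ _ => 1) Y0 a (fun _ : Fin d => Y0) M0)) {x : EuclideanSpace ℝ (Fin l)} (hx : x ∈ U) :
    Rel 𝒢 μ (fun _ _ _ => 1) Y0 (X x) (fun _ : Fin d => Y0) M0 := by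
  obtain ⟨hB, a, hA, hg, c, hc⟩ := h.approx hx
  refine Rel.closure GB.one hY0 hB (fun _ => hY0) hM0 fun ε hε => ?_
  have : ∃ δ > 0, δ ^ 2 * μ.real univ ≤ ε := by
    refine ⟨√(ε / (μ.real univ + 1)), by positivity, ?_⟩
    rw [Real.sq_sqrt (by positivity), div_mul_eq_mul_div, div_le_iff₀ (by positivity)]
    nlinarith [measureReal_nonneg (μ := μ) (s := univ)]
  obtain ⟨δ, δ0, hδ⟩ := this
  obtain ⟨s, hs⟩ := hc δ δ0
  have hv : Bd μ (fun ω => ∑ α ∈ s, c α * a α ω) := Bd.sum s fun α _ => (hA α).1.const_mul _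
  refine ⟨_, hv, ?_, ?_⟩
  · calc _ ≤ ∫ ω, δ ^ 2 ∂μ := by
          refine integral_mono_ae ((hB.sub hv).sq.integrable) (integrable_const _) ?_
          filter_upwards [hs] with ω hω
          exact sq_le_sq' (abs_le.1 hω).1 (abs_le.1 hω).2
      _ ≤ ε := by rw [integral_const, smul_eq_mul, mul_comm]; exact hδ
  · clear hs hv
    classical
    induction s using Finset.induction_on with
    | empty =>
      refine Rel.of_exact (n0 := 0) (φ := fun _ _ _ => 0) (fun _ => Pn.const 0) fun n _ i _ => ?_
      filter_upwards [W_const_mul (𝒢 := 𝒢) (μ := μ) Y0 Y0 0 n i] with ω hω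
      simp only [zero_mul] at hω
      simp [hω, rfn]
    | insert i s hi ih =>
      simp only [Finset.sum_insert hi]
      exact Rel.add GB.one hY0 ((hA i).1.const_mul _) (Bd.sum s fun α _ => (hA α).1.const_mul _) (fun _ => hY0) hM0
        ((hg i).const_mul _) ih

/-- the combined index family -/
def fam {d : ℕ} (Y0 Y : Ω → ℝ) (M0 M : Fin d → Ω → ℝ) : Bool ⊕ (Bool × Fin d) → Ω → ℝ
  | .inl false => Y0
  | .inl true => Y
  | .inr (false, j) => M0 j
  | .inr (true, j) => M j

/-- wedge algebra -/
lemma wedge_span {V : Type*} [AddCommGroup V] [Module ℝ V] {d : ℕ} {y0 y : ℝ} (h0 : y0 ≠ 0) {a mm : Fin d → ℝ} {u0 u1 : V} {v w : Fin d → V}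
    {T : Submodule ℝ V} (hY : y0 • u1 - y • u0 ∈ T) (hM : ∀ j, y0 • w j - mm j • u0 ∈ T) (i : Fin d) :
    y • w i - mm i • u1 ∈ T := by
  have : y • w i - mm i • u1 = y0⁻¹ • (y • (y0 • w i - mm i • u0) - mm i • (y0 • u1 - y • u0)) := by
    have e : y • (y0 • w i - mm i • u0) - mm i • (y0 • u1 - y • u0) = y0 • (y • w i - mm i • u1) := by module
    rw [e, smul_smul, inv_mul_cancel₀ h0, one_smul]
  rw [this]
  exact T.smul_mem _ (T.sub_mem (T.smul_mem _ (hM i)) (T.smul_mem _ hY))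

theorem rank_ae {l d : ℕ} {U : Set (EuclideanSpace ℝ (Fin l))} (hU : IsOpen U) (hUc : IsPreconnected U) (hL : NL L μ)
    {Y0 : Ω → ℝ} {M0 : Fin d → Ω → ℝ} (hY0 : AC 𝒢 μ L Y0) (hM0 : ∀ j, AC 𝒢 μ L (M0 j)) (pY0 : ∀ᵐ ω ∂μ, 0 < Y0 ω)
    {Y : EuclideanSpace ℝ (Fin l) → Ω → ℝ} {M : Fin d → EuclideanSpace ℝ (Fin l) → Ω → ℝ}
    (hY : Ex L μ U Y (fun a => Rel 𝒢 μ (fun _ _ _ => 1) Y0 a (fun _ : Fin d => Y0) M0))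
    (hM : ∀ j, Ex L μ U (M j) (fun a => Rel 𝒢 μ (fun _ _ _ => 1) Y0 a (fun _ : Fin d => Y0) M0))
    {xs : ℕ → EuclideanSpace ℝ (Fin l)} (hxs : ∀ n, xs n ∈ U) {C : ℝ} (hC : 0 < C)
    (cY : ∀ n, ∀ᵐ ω ∂μ, |Y (xs n) ω - Y0 ω| ≤ C * (1 / 2) ^ n)
    (cM : ∀ j n, ∀ᵐ ω ∂μ, |M j (xs n) ω - M0 j ω| ≤ C * (1 / 2) ^ n) :
    ∀ᵐ x, x ∈ U → ∀ t : Option (Fin d), Rel 𝒢 μ (fun _ _ _ => 1) (Y x) (t.elim Y0 M0) (fun _ : Fin d => Y x) (fun j => M j x) := by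
  have laL := fun (X) (h : Ex L μ U X (fun a => Rel 𝒢 μ (fun _ _ _ => 1) Y0 a (fun _ : Fin d => Y0) M0)) => h.la (lm_fn hL)
  have laG := fun (X Z) (h : Ex L μ U X (fun a => Rel 𝒢 μ (fun _ _ _ => 1) Y0 a (fun _ : Fin d => Y0) M0)) (hZ : AC 𝒢 μ L Z) => h.la (gam_fn hZ)
  have lac : ∀ i j, LA L U (fun x k => cc L μ (Y x) (M i x) Y0 (M0 j) k) := by
    intro i j
    unfold cc
    have k0 : LA L U (fun (x : EuclideanSpace ℝ (Fin l)) k => lm μ Y0 k) := LA.const hU (lm_meas _)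
    have kj : LA L U (fun (x : EuclideanSpace ℝ (Fin l)) k => lm μ (M0 j) k) := LA.const hU (lm_meas _)
    exact ((laL _ hY).mul ((k0.mul (laG _ _ (hM i) (hM0 j))).sub (kj.mul (laG _ _ (hM i) hY0)))).sub
      ((laL _ (hM i)).mul ((k0.mul (laG _ _ hY (hM0 j))).sub (kj.mul (laG _ _ hY hY0))))
  have conv : ∀ᵐ k ∂L, ∀ i j, Tendsto (fun n => cc L μ (Y (xs n)) (M i (xs n)) Y0 (M0 j) k) atTop (𝓝 (cc L μ Y0 (M0 i) Y0 (M0 j) k)) := by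
    rw [ae_all_iff]; intro i; rw [ae_all_iff]; intro j
    have aY := fun n => hY.ac (hxs n)
    have aM := fun n => (hM i).ac (hxs n)
    filter_upwards [(lm_fn hL).conv aY hY0 hC cY, (lm_fn hL).conv aM (hM0 i) hC (cM i),
      (gam_fn (hM0 j)).conv aM (hM0 i) hC (cM i), (gam_fn hY0).conv aM (hM0 i) hC (cM i),
      (gam_fn (hM0 j)).conv aY hY0 hC cY, (gam_fn hY0).conv aY hY0 hC cY] with k h1 h2 h3 h4 h5 h6
    exact (h1.mul ((h3.const_mul _).sub (h4.const_mul _))).sub (h2.mul ((h5.const_mul _).sub (h6.const_mul _)))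
  have main : ∀ᵐ x, ∀ (q : Σ r : ℕ, (Fin r → Fin d)) (n : ℕ), x ∈ U → ∀ᵐ k ∂L,
      (Matrix.of fun i j => cc L μ (Y (xs n)) (M (q.2 i) (xs n)) Y0 (M0 (q.2 j)) k).det ≠ 0 →
      (Matrix.of fun i j => cc L μ (Y x) (M (q.2 i) x) Y0 (M0 (q.2 j)) k).det ≠ 0 := by
    rw [ae_all_iff]; intro q; rw [ae_all_iff]; intro n
    have la := LA.det hU (fun i j => lac (q.2 i) (q.2 j))
    have mB : MeasurableSet {k | (Matrix.of fun i j => cc L μ (Y (xs n)) (M (q.2 i) (xs n)) Y0 (M0 (q.2 j)) k).det ≠ 0} :=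
      (det_meas fun i j => cc_meas _ _ _ _) (measurableSet_singleton 0).compl
    exact la.ne_zero hU hUc mB (hxs n) (ae_of_all _ fun k hk => hk)
  filter_upwards [main] with x hx hxU t
  let X := fam Y0 (Y x) M0 (fun j => M j x)
  have hX : ∀ e, AC 𝒢 μ L (X e) := by
    rintro ((_ | _) | ⟨_ | _, j⟩)
    exacts [hY0, hY.ac hxU, hM0 j, (hM j).ac hxU]
  have r1 := rel_span hL hX (Gate.one L) (.inl false) (.inl true) (fun _ : Fin d => .inl false) (fun j => .inr (false, j))
    (hY.rel hY0.1 (fun j => (hM0 j).1) hxU)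
  have r2 := fun i => rel_span hL hX (Gate.one L) (.inl false) (.inr (true, i)) (fun _ : Fin d => .inl false) (fun j => .inr (false, j))
    ((hM i).rel hY0.1 (fun j => (hM0 j).1) hxU)
  let b : Bool ⊕ (Bool × Fin d) := t.elim (.inl false) (fun j => .inr (false, j))
  have hb : X b = t.elim Y0 M0 := by cases t <;> rfl
  rw [← hb]
  refine span_rel hL hX (Gate.one L) (.inl true) b (fun _ => .inl true) (fun j => .inr (true, j)) ?_
  have hx' : ∀ᵐ k ∂L, ∀ (q : Σ r : ℕ, (Fin r → Fin d)) (n : ℕ),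
      (Matrix.of fun i j => cc L μ (Y (xs n)) (M (q.2 i) (xs n)) Y0 (M0 (q.2 j)) k).det ≠ 0 →
      (Matrix.of fun i j => cc L μ (Y x) (M (q.2 i) x) Y0 (M0 (q.2 j)) k).det ≠ 0 :=
    ae_all_iff.2 fun q => ae_all_iff.2 fun n => hx q n hxU
  filter_upwards [r1, ae_all_iff.2 r2, hx', conv, lm_pos hL hY0.1 pY0] with k k1 k2 k3 k4 k5 _ r u hu
  have k1 := k1 one_ne_zero r u hu
  have k2 := fun i => k2 i one_ne_zero r u hu
  simp only [Bv, X, fam] at k1 k2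
  set T := Submodule.span ℝ (range fun j => lm μ Y0 k • u (.inr (false, j)) - lm μ (M0 j) k • u (.inl false)) with hT
  have hbT : ∀ i, lm μ (Y x) k • u (.inr (true, i)) - lm μ (M i x) k • u (.inl true) ∈ T := fun i =>
    wedge_span (V := EuclideanSpace ℝ (Fin r)) k5.ne' (a := fun j => lm μ (M0 j) k) (mm := fun j => lm μ (M j x) k)
      (v := fun j => u (.inr (false, j))) (w := fun j => u (.inr (true, j))) k1 k2 i
  have gin : ∀ i j, inner ℝ (lm μ (Y x) k • u (.inr (true, i)) - lm μ (M i x) k • u (.inl true))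
      (lm μ Y0 k • u (.inr (false, j)) - lm μ (M0 j) k • u (.inl false)) = cc L μ (Y x) (M i x) Y0 (M0 j) k := by
    intro i j
    simp only [inner_sub_left, inner_sub_right, inner_smul_left, inner_smul_right, hu _ _, X, fam, cc, RCLike.conj_to_real]
    ring
  have gin0 : ∀ i j, inner ℝ (lm μ Y0 k • u (.inr (false, i)) - lm μ (M0 i) k • u (.inl false))
      (lm μ Y0 k • u (.inr (false, j)) - lm μ (M0 j) k • u (.inl false)) = cc L μ Y0 (M0 i) Y0 (M0 j) k := by
    intro i j
    simp only [inner_sub_left, inner_sub_right, inner_smul_left, inner_smul_right, hu _ _, X, fam, cc, RCLike.conj_to_real]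
    ring
  have sp := la_span _ _ hbT (fun r' a hd => by
    simp only [gin0] at hd
    simp only [gin]
    have td := det_tendsto (A := fun n i j => cc L μ (Y (xs n)) (M (a i) (xs n)) Y0 (M0 (a j)) k) (fun i j => k4 (a i) (a j))
    obtain ⟨n, hn⟩ := (td.eventually_ne hd).exists
    exact k3 ⟨r', a⟩ n hn)
  show Bv μ X k u (.inl true) b ∈ Submodule.span ℝ (range fun j => Bv μ X k u (.inl true) (.inr (true, j)))
  have sp' : T ≤ Submodule.span ℝ (range fun j => Bv μ X k u (.inl true) (.inr (true, j))) := sp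
  refine sp' ?_
  cases t with
  | none =>
    have : Bv μ X k u (.inl true) b = -(lm μ Y0 k • u (.inl true) - lm μ (Y x) k • u (.inl false)) := by
      simp only [Bv, b, Option.elim, X, fam]; module
    rw [this]; exact T.neg_mem k1
  | some j =>
    refine wedge_span (V := EuclideanSpace ℝ (Fin r)) k5.ne' (a := fun j => lm μ (M0 j) k) (mm := fun j => lm μ (M0 j) k)
      (v := fun j => u (.inr (false, j))) (w := fun j => u (.inr (false, j))) k1 (fun j => Submodule.subset_span ⟨j, rfl⟩) j

end DM

namespace DM
open Topology
variable {Ω : Type*} {m : MeasurableSpace Ω} {𝒢 : Filtration ℝ m} {μ : Measure Ω} [IsFiniteMeasure μ]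
  {P : Measure Ω} [IsProbabilityMeasure P] {l d : ℕ}

/-- a finite measure dominating countably many energy measures -/
lemma exists_L (hnull : ∀ s, MeasurableSet s → μ s = 0 → MeasurableSet[𝒢 0] s) {κ : Type*} [Countable κ] (X : κ → Ω → ℝ) :
    ∃ L : Measure (KK 𝒢), IsFiniteMeasure L ∧ NL L μ ∧ ∀ k, dm 𝒢 μ (X k) ≪ L := by
  refine ⟨(Measure.sum fun k => dm 𝒢 μ (X k)).toFinite, inferInstance, ?_, fun k => ?_⟩
  · intro p hp
    refine (toFinite_absolutelyContinuous _).ae_le ?_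
    show ∀ᵐ k ∂(Measure.sum fun k => dm 𝒢 μ (X k)), p k.fst
    rw [Measure.ae_sum_iff]
    exact fun k => dm_null hnull hp
  · exact (Measure.absolutelyContinuous_sum_right k Measure.AbsolutelyContinuous.rfl).trans (absolutelyContinuous_toFinite _)

lemma lp_int_abs (f : Lp ℝ 1 P) : ∫ ω, |(f : Ω → ℝ) ω| ∂P = ‖f‖ := by
  rw [L1.norm_eq_integral_norm]; rfl

lemma lp_integrable (f : Lp ℝ 1 P) : Integrable (f : Ω → ℝ) P := L1.integrable_coeFn f

lemma point_exp {f : EuclideanSpace ℝ (Fin l) → Lp ℝ 1 P} {y : EuclideanSpace ℝ (Fin l)} (hf : AnalyticAt ℝ f y)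
    {U : Set (EuclideanSpace ℝ (Fin l))} (hU : U ∈ 𝓝 y) :
    ∃ (ρ : ℝ) (a : Ix l → Ω → ℝ) (G : Ω → ℝ), 0 < ρ ∧ Metric.ball y ρ ⊆ U ∧ (∀ α, Measurable (a α)) ∧ (∀ α, Integrable (a α) P) ∧
      Integrable G P ∧ (∀ᵐ ω ∂P, ∀ α, |a α ω| * (2 * (l + 1) * ρ) ^ α.1 ≤ G ω) ∧
      ∀ x ∈ Metric.ball y ρ, ∀ᵐ ω ∂P, HasSum (fun α => mon α (x - y) * a α ω) ((f x : Ω → ℝ) ω) := by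
  obtain ⟨r, r0, a, ha, hs⟩ := exp_local hf
  obtain ⟨ε, e0, he⟩ := Metric.mem_nhds_iff.1 hU
  have key : 0 < r / (2 * (l + 1)) := by positivity
  set ρ := min (r / (2 * (l + 1))) ε with hρ
  have ρ0 : 0 < ρ := lt_min key e0
  have ρr : 2 * (l + 1) * ρ ≤ r := by
    have h1 : ρ ≤ r / (2 * (l + 1)) := min_le_left _ _
    rw [le_div_iff₀ (by positivity)] at h1
    linarith
  have ρr' : ρ ≤ r := by
    have : (0:ℝ) ≤ l := Nat.cast_nonneg l
    nlinarith
  obtain ⟨G, mG, iG, pG, bG⟩ := exists_dom (P := P) (g := fun (α : Ix l) ω => (a α : Ω → ℝ) ω * r ^ α.1)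
    (fun α => (lp_integrable (a α)).mul_const _) (by
      refine ha.congr fun α => ?_
      simp only [abs_mul, abs_of_pos (pow_pos r0 α.1)]
      rw [integral_mul_const, lp_int_abs])
  refine ⟨ρ, fun α => (a α : Ω → ℝ), G, ρ0, (Metric.ball_subset_ball (min_le_right _ _)).trans he,
    fun α => (Lp.stronglyMeasurable (a α)).measurable, fun α => lp_integrable _, iG, ?_, ?_⟩
  · filter_upwards [bG] with ω h α
    refine le_trans ?_ (h α)
    rw [abs_mul, abs_of_pos (pow_pos r0 α.1)]
    gcongr
  · intro x hx
    have hsx := hs x (Metric.ball_subset_ball ρr' hx)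
    have hn : Summable fun α : Ix l => ‖mon α (x - y) • a α‖ := by
      refine Summable.of_nonneg_of_le (fun _ => norm_nonneg _) (fun α => ?_) ha
      rw [norm_smul, mul_comm, Real.norm_eq_abs]
      refine mul_le_mul_of_nonneg_left ((mon_bd hx α).trans ?_) (norm_nonneg _)
      gcongr
    have h1 := Lp.hasSum_coeFn_tsum (f := fun α : Ix l => mon α (x - y) • a α) (tsum_enorm_ne_top_iff_summable_norm.2 hn)
    rw [hsx.tsum_eq] at h1
    have h2 : ∀ᵐ ω ∂P, ∀ α : Ix l, (mon α (x - y) • a α : Lp ℝ 1 P) ω = mon α (x - y) * a α ω := by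
      rw [ae_all_iff]; intro α
      filter_upwards [Lp.coeFn_smul (mon α (x - y)) (a α)] with ω h using h
    filter_upwards [h1, h2] with ω k1 k2
    simpa only [k2] using k1

/-- density-relation property of the base system -/
def RD (𝒢 : Filtration ℝ m) (P : Measure Ω) [IsFiniteMeasure P] (p0 : Ω → ℝ) (m0 : Fin d → Ω → ℝ) : Prop :=
  ∀ (ι : Type) (_ : Countable ι) (f : ι → Ω → ℝ), (∀ k, Measurable (f k)) → (∀ k, Integrable (f k) P) →
    ∃ (D : Ω → ℝ) (_ : Wt P D), Dm P D p0 ∧ (∀ j, Dm P D (m0 j)) ∧ (∀ k, Dm P D (f k)) ∧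
      ∀ (D' : Ω → ℝ) (_ : Wt P D'), (∀ᵐ ω ∂P, D ω ≤ D' ω) → ∀ γ, GB 𝒢 γ → ∀ k,
        Rel 𝒢 (wD P D') γ (nf D' p0) (nf D' (f k)) (fun _ : Fin d => nf D' p0) (fun j => nf D' (m0 j))

lemma Wt.add {D D' : Ω → ℝ} (h : Wt P D) (h' : Wt P D') : Wt P (fun ω => D ω + D' ω) :=
  ⟨h.meas.add h'.meas, fun ω => add_pos (h.pos ω) (h'.pos ω), h.int.add h'.int⟩

lemma fast_seq {U : Set (EuclideanSpace ℝ (Fin l))} {x₀ : EuclideanSpace ℝ (Fin l)} (hx₀ : x₀ ∈ closure U)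
    {f : Option (Fin d) → EuclideanSpace ℝ (Fin l) → Lp ℝ 1 P} (hc : ∀ i, ContinuousOn (f i) (U ∪ {x₀})) (n : ℕ) :
    ∃ x ∈ U, ∀ i, ‖f i x - f i x₀‖ ≤ (1 / 4) ^ n := by
  have h : ∀ᶠ x in 𝓝[U] x₀, ∀ i, ‖f i x - f i x₀‖ ≤ (1 / 4) ^ n := by
    rw [eventually_all]; intro i
    have h1 : Tendsto (f i) (𝓝[U] x₀) (𝓝 (f i x₀)) := ((hc i) x₀ (Or.inr rfl)).mono_left (nhdsWithin_mono _ subset_union_left)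
    have h2 := (tendsto_iff_norm_sub_tendsto_zero.1 h1).eventually (eventually_le_nhds (show (0:ℝ) < (1 / 4) ^ n by positivity))
    exact h2
  have : (𝓝[U] x₀).NeBot := mem_closure_iff_nhdsWithin_neBot.1 hx₀
  obtain ⟨x, hx, h2⟩ := ((h.and self_mem_nhdsWithin).exists)
  exact ⟨x, h2, hx⟩

lemma nf_abs {D f : Ω → ℝ} (hD : ∀ ω, 0 < D ω) {C : ℝ} {ω : Ω} (h : |f ω| ≤ C * D ω) : |nf D f ω| ≤ C := by
  unfold nf; rw [abs_div, abs_of_pos (hD ω), div_le_iff₀ (hD ω)]; exact h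

theorem good_ae (hnull : ∀ s, MeasurableSet s → P s = 0 → MeasurableSet[𝒢 0] s)
    {p0 : Ω → ℝ} {m0 : Fin d → Ω → ℝ} (pp : ∀ ω, 0 < p0 ω) (hRD : RD 𝒢 P p0 m0)
    {U : Set (EuclideanSpace ℝ (Fin l))} (hU : IsOpen U) (hUc : IsPreconnected U)
    {x₀ : EuclideanSpace ℝ (Fin l)} (hx₀ : x₀ ∈ closure U)
    {f : Option (Fin d) → EuclideanSpace ℝ (Fin l) → Lp ℝ 1 P} (hc : ∀ i, ContinuousOn (f i) (U ∪ {x₀}))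
    (ha : ∀ i, AnalyticOnNhd ℝ (f i) U) (hf0 : ∀ t : Option (Fin d), (f t x₀ : Ω → ℝ) =ᵐ[P] t.elim p0 m0) :
    ∃ (D : Ω → ℝ) (_ : Wt P D), (∀ t : Option (Fin d), Dm P D (t.elim p0 m0)) ∧
      ∀ᵐ x, x ∈ U → (∀ t, Dm P D (f t x)) ∧ ∀ t : Option (Fin d),
      Rel 𝒢 (wD P D) (fun _ _ _ => 1) (nf D (f none x)) (nf D (t.elim p0 m0)) (fun _ : Fin d => nf D (f none x))
        (fun j => nf D (f (some j) x)) := by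
  have hpe := fun (t : Option (Fin d)) (y : U) => point_exp (ha t y y.2) (hU.mem_nhds y.2)
  choose ρ a G ρ0 ρU ma ia iG bG sG using hpe
  have hcov : ∀ t, ∃ T : Set U, T.Countable ∧ ∀ z ∈ U, ∃ y ∈ T, z ∈ Metric.ball (y : EuclideanSpace ℝ (Fin l)) (ρ t y) := by
    intro t
    obtain ⟨T, hT, hTU⟩ := TopologicalSpace.countable_cover_nhds (f := fun y : U => {z : U | (z : EuclideanSpace ℝ (Fin l)) ∈ Metric.ball (y : EuclideanSpace ℝ (Fin l)) (ρ t y)})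
      (fun y => Metric.ball_mem_nhds y (ρ0 t y))
    refine ⟨T, hT, fun z hz => ?_⟩
    have : (⟨z, hz⟩ : U) ∈ ⋃ x ∈ T, {z : U | (z : EuclideanSpace ℝ (Fin l)) ∈ Metric.ball (x : EuclideanSpace ℝ (Fin l)) (ρ t x)} := by rw [hTU]; trivial
    simp only [mem_iUnion] at this
    obtain ⟨y, hy, h⟩ := this
    exact ⟨y, hy, h⟩
  choose T cT hT using hcov
  choose xs hxs hxc using fast_seq hx₀ hc
  have mq : ∀ t, Measurable (f t x₀ : Ω → ℝ) := fun t => (Lp.stronglyMeasurable _).measurable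
  have hH : ∀ t, ∃ H : Ω → ℝ, Measurable H ∧ Integrable H P ∧ (∀ ω, 0 ≤ H ω) ∧
      ∀ᵐ ω ∂P, ∀ n : ℕ, |2 ^ n * ((f t (xs n) - f t x₀ : Lp ℝ 1 P) : Ω → ℝ) ω| ≤ H ω := by
    intro t
    refine exists_dom (fun n => (lp_integrable _).const_mul _) ?_
    refine Summable.of_nonneg_of_le (fun n => integral_nonneg fun _ => abs_nonneg _) (fun n => ?_) summable_geometric_two
    simp only [abs_mul]
    rw [integral_const_mul, lp_int_abs]
    calc _ ≤ |(2:ℝ) ^ n| * (1 / 4 : ℝ) ^ n := mul_le_mul_of_nonneg_left (hxc n t) (abs_nonneg _)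
      _ = (1 / 2) ^ n := by rw [abs_of_pos (by positivity), ← mul_pow]; norm_num
  choose H mH iH pH bH using hH
  have cT' : ∀ t, Countable (T t) := fun t => (cT t).to_subtype
  let κ := Σ t : Option (Fin d), (T t × Ix l)
  obtain ⟨D0, w0, Dp, Dmm, Df, hR⟩ := hRD κ inferInstance (fun k => a k.1 k.2.1 k.2.2) (fun k => ma _ _ _) (fun k => ia _ _ _)
  obtain ⟨D1, w1, h1⟩ := exists_wt (P := P) (ι := (Σ t : Option (Fin d), T t) ⊕ Option (Fin d))
    (g := fun k => k.elim (fun s => G s.1 s.2) H) (by rintro (s | s); exacts [iG _ _, iH _])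
  set D : Ω → ℝ := fun ω => D0 ω + D1 ω with hD
  have w : Wt P D := w0.add w1
  have D0D : ∀ᵐ ω ∂P, D0 ω ≤ 1 * D ω := ae_of_all _ fun ω => by have := (w1.pos ω).le; simp only [hD]; linarith
  have D0D' : ∀ᵐ ω ∂P, D0 ω ≤ D ω := ae_of_all _ fun ω => by have := (w1.pos ω).le; simp only [hD]; linarith
  have D1D' : ∀ ω, D1 ω ≤ D ω := fun ω => by have := (w0.pos ω).le; simp only [hD]; linarith
  have hq : ∀ t : Option (Fin d), Dm P D (t.elim p0 m0) := by
    rintro (_ | j)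
    exacts [Dp.mono zero_le_one D0D, (Dmm j).mono zero_le_one D0D]
  have da : ∀ k : κ, Dm P D (a k.1 k.2.1 k.2.2) := fun k => (Df k).mono zero_le_one D0D
  have hR' := hR D w D0D' (fun _ _ _ => 1) (GB.one)
  have hnull' : ∀ s, MeasurableSet s → wD P D s = 0 → MeasurableSet[𝒢 0] s := fun s ms hs => hnull s ms (ac_wD (D := D) hs)
  obtain ⟨L, fL, hL, hdm⟩ := exists_L hnull' (κ := κ ⊕ Option (Fin d))
    (fun k => k.elim (fun s => nf D (a s.1 s.2.1 s.2.2)) (fun t => nf D (t.elim p0 m0)))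
  have acq : ∀ t : Option (Fin d), AC 𝒢 (wD P D) L (nf D (t.elim p0 m0)) := fun t => ⟨(hq t).bd, hdm (.inr t)⟩
  have aca : ∀ k : κ, AC 𝒢 (wD P D) L (nf D (a k.1 k.2.1 k.2.2)) := fun k => ⟨(da k).bd, hdm (.inl k)⟩
  have hEx : ∀ t, Ex L (wD P D) U (fun x => nf D (f t x))
      (fun a => Rel 𝒢 (wD P D) (fun _ _ _ => 1) (nf D p0) a (fun _ : Fin d => nf D p0) (fun j => nf D (m0 j))) := by
    intro t z hz
    obtain ⟨y, hy, hzy⟩ := hT t z hz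
    obtain ⟨C, C0, hC⟩ := h1 (.inl ⟨t, ⟨y, hy⟩⟩)
    have r0 := ρ0 t y
    have R0 : 0 < 2 * (l + 1) * ρ t y := by positivity
    refine ⟨y, ρ t y, r0, hzy, ρU t y, fun α => nf D (a t y α), fun α => (C + 1) / (2 * (l + 1) * ρ t y) ^ α.1,
      fun α => aca ⟨t, ⟨y, hy⟩, α⟩, fun α => hR' ⟨t, ⟨y, hy⟩, α⟩, fun α => by positivity, fun α => ?_, ?_, fun x hx => ⟨?_, ?_⟩⟩
    · refine wD_ac.ae_le ?_
      filter_upwards [hC, bG t y] with ω k1 k2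
      refine nf_abs w.pos ?_
      rw [div_mul_eq_mul_div, le_div_iff₀ (by positivity)]
      refine (k2 α).trans ((le_abs_self _).trans (k1.trans ?_))
      have := D1D' ω
      have := (w1.pos ω).le
      nlinarith
    · have : ∀ α : Ix l, (C + 1) / (2 * (l + 1) * ρ t y) ^ α.1 * ρ t y ^ α.1 = (C + 1) * (1 / (2 * (l + 1))) ^ α.1 := by
        intro α
        rw [div_mul_eq_mul_div, mul_div_assoc, ← div_pow]
        congr 2; field_simp
      simp only [this]
      refine (sum_geom (by positivity) ?_).mul_left _
      rw [mul_one_div, div_lt_one (by positivity)]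
      have : (0:ℝ) ≤ l := Nat.cast_nonneg l
      linarith
    · exact (Lp.stronglyMeasurable _).measurable.div w.meas
    · refine wD_ac.ae_le ?_
      filter_upwards [sG t y x hx] with ω k
      simp only [nf]
      simpa only [mul_div_assoc] using k.div_const (D ω)
  choose C C0 hC using fun t => h1 (.inr t)
  have hCt : ∀ t, C t ≤ ∑ t, C t + 1 := fun t => by
    have := Finset.single_le_sum (f := C) (fun i _ => C0 i) (Finset.mem_univ t)
    linarith
  have Cpos : 0 < ∑ t, C t + 1 := add_pos_of_nonneg_of_pos (Finset.sum_nonneg fun i _ => C0 i) one_pos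
  have hcv : ∀ (t : Option (Fin d)) (n : ℕ), ∀ᵐ ω ∂(wD P D), |nf D (f t (xs n)) ω - nf D (t.elim p0 m0) ω| ≤ (∑ t, C t + 1) * (1 / 2) ^ n := by
    intro t n
    refine wD_ac.ae_le ?_
    filter_upwards [hC t, bH t, hf0 t, Lp.coeFn_sub (f t (xs n)) (f t x₀)] with ω k1 k2 k3 k4
    have k5 := k2 n
    rw [k4, Pi.sub_apply, k3, abs_mul, abs_of_pos (by positivity)] at k5
    rw [show nf D (f t (xs n)) ω - nf D (t.elim p0 m0) ω = nf D (f t (xs n) - t.elim p0 m0) ω by rw [nf_sub]]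
    refine nf_abs w.pos ?_
    have k6 : 2 ^ n * |(f t (xs n) : Ω → ℝ) ω - t.elim p0 m0 ω| ≤ (∑ t, C t + 1) * D ω := by
      refine k5.trans ((le_abs_self _).trans (k1.trans ?_))
      exact mul_le_mul (hCt t) (D1D' ω) (w1.pos ω).le Cpos.le
    have : |(f t (xs n) : Ω → ℝ) ω - t.elim p0 m0 ω| = (1 / 2) ^ n * (2 ^ n * |(f t (xs n) : Ω → ℝ) ω - t.elim p0 m0 ω|) := by
      rw [← mul_assoc, ← mul_pow]; norm_num
    rw [Pi.sub_apply, this, mul_right_comm, mul_comm _ ((1 / 2 : ℝ) ^ n)]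
    exact mul_le_mul_of_nonneg_left k6 (by positivity)
  have main := rank_ae (L := L) (μ := wD P D) hU hUc hL (Y0 := nf D p0) (M0 := fun j => nf D (m0 j)) (acq none) (fun j => acq (some j))
    (ae_of_all _ fun ω => div_pos (pp ω) (w.pos ω)) (Y := fun x => nf D (f none x)) (M := fun j x => nf D (f (some j) x))
    (hEx none) (fun j => hEx (some j)) hxs Cpos (hcv none) (fun j => hcv (some j))
  refine ⟨D, w, hq, ?_⟩
  filter_upwards [main] with x hx hxU
  refine ⟨fun t => ?_, fun t => ?_⟩
  · have h := ((hEx t).ac hxU).1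
    refine ⟨(Lp.stronglyMeasurable _).measurable, ?_⟩
    obtain ⟨_, K, K0, hK⟩ := h
    refine ⟨K, K0, ?_⟩
    filter_upwards [(ac_wD (P := P) (D := D)).ae_le hK] with ω h
    unfold nf at h
    rwa [abs_div, abs_of_pos (w.pos ω), div_le_iff₀ (w.pos ω)] at h
  · have := hx hxU t
    cases t <;> exact this
end DM

namespace DM
open Topology
section
variable {Ω : Type*} {m : MeasurableSpace Ω} {𝒢 : Filtration ℝ m} {μ : Measure Ω} [IsFiniteMeasure μ]
variable {ι J : Type*} [Fintype ι] [Fintype J] [DecidableEq ι]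
variable {L : Measure (KK 𝒢)} [IsFiniteMeasure L] {X : ι → Ω → ℝ} {γ : ℕ → ℕ → Ω → ℝ} {γl : KK 𝒢 → ℝ}

lemma rel_key {C : ℝ} (hC : 0 ≤ C) (hb : ∀ a, ∀ᵐ ω ∂μ, |X a ω| ≤ C) (a b : ι) (p q : J → ι) (n0 n : ℕ) (φ : J → ℕ → Ω → ℝ) :
    ∑ i ∈ Finset.range (2 ^ n), ∫ ω, (γ n i ω * (W 𝒢 μ (X a) (X b) n i ω -
      ∑ j, rfn n0 n (φ j) i ω * W 𝒢 μ (X (p j)) (X (q j)) n i ω)) ^ 2 ∂μ =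
      qs 𝒢 μ X n (fun c i ω => wc (γ n i ω) (fun e => cl C (mc 𝒢 μ (X e) (tm n i) ω)) a b c -
        ∑ j, rfn n0 n (φ j) i ω * wc (γ n i ω) (fun e => cl C (mc 𝒢 μ (X e) (tm n i) ω)) (p j) (q j) c) := by
  rw [qs]
  refine Finset.sum_congr rfl fun i _ => integral_congr_ae ?_
  filter_upwards [ae_all_iff.2 fun e => mc_bound (𝒢 := 𝒢) hC (hb e) (tm n i)] with ω h
  simp only [cl_eq (h _)]
  congr 1
  simp only [sub_mul, Finset.sum_sub_distrib, Finset.sum_mul]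
  rw [Finset.sum_comm]
  simp only [mul_assoc, ← Finset.mul_sum, wc_sum', W, mul_sub]
  congr 1
  rw [Finset.mul_sum]
  refine Finset.sum_congr rfl fun j _ => ?_
  ring

lemma unique_nonneg (L : Measure (KK 𝒢)) [IsFiniteMeasure L] {g : KK 𝒢 → ℝ} (hg : Integrable g L)
    (h : ∀ n f, Pn 𝒢 n f → 0 ≤ ∫ k, lift 𝒢 n f k ^ 2 * g k ∂L) : ∀ᵐ k ∂L, 0 ≤ g k := by
  have hb : ∀ n B, MeasurableSet[lev 𝒢 n] B → 0 ≤ ∫ k in B, g k ∂L := by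
    rintro n B hB
    have hBm := lev_le 𝒢 n _ hB
    obtain ⟨C, hC, rfl⟩ := id hB
    have hP : Pn 𝒢 n (fun i => (C i).indicator fun _ => (1:ℝ)) :=
      ⟨fun i => measurable_const.indicator (hC i), 1, fun i ω => by by_cases h : ω ∈ C i <;> simp [h]⟩
    rw [← integral_indicator hBm]
    convert h n _ hP using 2
    funext k
    by_cases hk : k.fst ∈ C (idx n k.snd) <;> simp [lift, hk]
  let ℱ : Filtration ℕ (inferInstance : MeasurableSpace (KK 𝒢)) := ⟨lev 𝒢, lev_mono 𝒢, lev_le 𝒢⟩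
  have h1 : ∀ n, ∀ᵐ k ∂L, 0 ≤ (L[g | ℱ n]) k := by
    intro n
    have h_itg : Integrable (L[g | ℱ n]) (L.trim (lev_le 𝒢 n)) := integrable_condExp.trim _ stronglyMeasurable_condExp
    have := @ae_nonneg_of_forall_setIntegral_nonneg _ (lev 𝒢 n) (L.trim (lev_le 𝒢 n)) _ h_itg (by
      intro s hs _
      rw [← setIntegral_trim (lev_le 𝒢 n) stronglyMeasurable_condExp hs, setIntegral_condExp (lev_le 𝒢 n) hg hs]
      exact hb n s hs)
    exact ae_of_ae_trim (lev_le 𝒢 n) this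
  have h2 := tendsto_ae_condExp (μ := L) (ℱ := ℱ) g
  have h3 : L[g | ⨆ n, ℱ n] =ᵐ[L] g := condExp_of_aestronglyMeasurable' le_rfl hg.1 hg
  filter_upwards [ae_all_iff.2 h1, h2, h3] with k k1 k2 k3
  rw [k3] at k2
  exact ge_of_tendsto' k2 k1

lemma bil_smul (A : ι → ι → ℝ) (t : ℝ) (x : ι → ℝ) : bil A (fun a => t * x a) (fun a => t * x a) = t ^ 2 * bil A x x := by
  simp only [bil, Finset.mul_sum]
  refine Finset.sum_congr rfl fun a _ => Finset.sum_congr rfl fun b _ => by ring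

/-- norm domination passes to the limit -/
theorem dom_ae (hL : NL L μ) (hX : ∀ a, AC 𝒢 μ L (X a)) (p q p' q' : J → ι) (c : J → ℝ)
    (H : ∀ n, ∀ i < 2 ^ n, ∀ᵐ ω ∂μ, |∑ j, c j * W 𝒢 μ (X (p j)) (X (q j)) n i ω| ≤ |∑ j, c j * W 𝒢 μ (X (p' j)) (X (q' j)) n i ω|) :
    ∀ᵐ k ∂L, ∀ (r : ℕ) (u : ι → EuclideanSpace ℝ (Fin r)), Gr L μ X k u →
      ‖∑ j, c j • Bv μ X k u (p j) (q j)‖ ≤ ‖∑ j, c j • Bv μ X k u (p' j) (q' j)‖ := by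
  rcases isEmpty_or_nonempty J with hJ | ⟨⟨j0⟩⟩
  · exact ae_of_all _ fun k r u hu => by simp
  let a := p j0
  choose C hC hb using fun a => (hX a).1.2
  have hb' : ∀ a, ∀ᵐ ω ∂μ, |X a ω| ≤ ∑ a, C a := fun a => (hb a).mono fun ω h =>
    h.trans (Finset.single_le_sum (fun a _ => hC a) (Finset.mem_univ a))
  have hC' : 0 ≤ ∑ a, C a := Finset.sum_nonneg fun a _ => hC a
  set E := ∑ a, C a
  have D := fun (p q : J → ι) => mkDat hL hX (Gate.one L) hC' hb' a a p q
  let z : (p q : J → ι) → KK 𝒢 → ι → ℝ := fun p q k e => ∑ j, c j * wc 1 (fun e => lm μ (X e) k) (p j) (q j) e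
  have zm : ∀ p q e, Measurable fun k => z p q k e := fun p q e =>
    Finset.measurable_sum _ fun j _ => (wc_meas (Gate.one L) _ _ e).const_mul _
  have zi : ∀ p q, Integrable (fun k => bil (GG L μ X k) (z p q k) (z p q k)) L := by
    intro p q
    refine ((GG_int (μ := μ) L X).const_mul ((∑ j, |c j| * (2 * E)) ^ 2)).mono' (bil_meas (zm p q) (zm p q)).aestronglyMeasurable ?_
    filter_upwards [(D p q).y_le] with k hk
    refine bil_bound _ _ fun e => (Finset.abs_sum_le_sum_abs _ _).trans (Finset.sum_le_sum fun j _ => ?_)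
    rw [abs_mul]
    exact mul_le_mul_of_nonneg_left (hk j e) (abs_nonneg _)
  have lim : ∀ p q (n0 : ℕ) (g : ℕ → Ω → ℝ), Pn 𝒢 n0 g → Tendsto (fun n => ∑ i ∈ Finset.range (2 ^ n), ∫ ω, (rfn n0 n g i ω * ∑ j, c j * W 𝒢 μ (X (p j)) (X (q j)) n i ω) ^ 2 ∂μ) atTop
      (𝓝 (∫ k, lift 𝒢 n0 g k ^ 2 * bil (GG L μ X k) (z p q k) (z p q k) ∂L)) := by
    intro p q n0 g hg
    have h1 := (D p q).tend (φ := fun j i ω => c j * g i ω) (fun j => (Pn.const (c j)).mul hg)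
    have e1 := fun n => rel_key (𝒢 := 𝒢) (μ := μ) (γ := fun _ _ _ => 1) hC' hb' a a p q n0 n (fun j i ω => c j * g i ω)
    simp only [← e1] at h1
    convert h1 using 2
    · rename_i n
      refine Finset.sum_congr rfl fun i _ => integral_congr_ae (ae_of_all _ fun ω => ?_)
      simp only [rfn, W, one_mul]
      rw [show (mc 𝒢 μ (X a) (tm n i) ω * inc 𝒢 μ (X a) n i ω - mc 𝒢 μ (X a) (tm n i) ω * inc 𝒢 μ (X a) n i ω) = 0 by ring, zero_sub, neg_sq, Finset.mul_sum]
      congr 1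
      exact Finset.sum_congr rfl fun j _ => by ring
    · congr 1; funext k
      rw [← neg_sq, ← bil_smul]
      have : ∀ e, -lift 𝒢 n0 g k * z p q k e = rs (fun c => wc 1 (fun e => lm μ (X e) k) a a c)
          (fun j c => wc 1 (fun e => lm μ (X e) k) (p j) (q j) c) (fun j => lift 𝒢 n0 (fun i ω => c j * g i ω) k) e := by
        intro e
        simp only [rs, z, lift]
        rw [show wc 1 (fun e => lm μ (X e) k) a a e = 0 by simp [wc], zero_sub, neg_mul, Finset.mul_sum]
        congr 1
        exact Finset.sum_congr rfl fun j _ => by ring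
      simp only [this]
  have main := unique_nonneg L ((zi p' q').sub (zi p q)) (by
    intro n0 g hg
    obtain ⟨K, hK⟩ := hg.2
    have hgs : ∀ {f : KK 𝒢 → ℝ}, Integrable f L → Integrable (fun k => lift 𝒢 n0 g k ^ 2 * f k) L := by
      intro f hf
      have := (hg.mul hg).mul_int hf
      refine this.congr (ae_of_all _ fun k => ?_)
      simp only [lift]; ring
    simp only [Pi.sub_apply, mul_sub]
    rw [integral_sub (hgs (zi p' q')) (hgs (zi p q)), sub_nonneg]
    refine le_of_tendsto_of_tendsto (lim p q n0 g hg) (lim p' q' n0 g hg) ?_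
    filter_upwards [eventually_ge_atTop n0] with n hn
    refine Finset.sum_le_sum fun i hi => ?_
    refine integral_mono_of_nonneg (ae_of_all _ fun _ => sq_nonneg _) ?_ ?_
    · exact ((((hg.rfn hn).bd i).mul (Bd.sum _ fun j _ => (((hX _).1.W (hX _).1 n i).const_mul _))).sq).integrable
    · filter_upwards [H n i (Finset.mem_range.1 hi)] with ω h
      simp only [mul_pow]
      exact mul_le_mul_of_nonneg_left (sq_le_sq.2 h) (sq_nonneg _))
  filter_upwards [main] with k hk r u hu
  have e : ∀ p q, bil (GG L μ X k) (z p q k) (z p q k) = ‖∑ j, c j • Bv μ X k u (p j) (q j)‖ ^ 2 := by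
    intro p q
    rw [bil_inner (A := GG L μ X k) (u := u) (fun a b => hu a b), real_inner_self_eq_norm_sq]
    congr 2
    simp only [z, Finset.sum_smul]
    rw [Finset.sum_comm]
    refine Finset.sum_congr rfl fun j _ => ?_
    simp only [mul_smul, ← Finset.smul_sum, wc_sum, one_smul, Bv]
  simp only [Pi.sub_apply, e, sub_nonneg] at hk
  exact (sq_le_sq₀ (norm_nonneg _) (norm_nonneg _)).1 hk
end
end DM

namespace DM
open Topology
section
variable {Ω : Type*} {m : MeasurableSpace Ω} {𝒢 : Filtration ℝ m} {μ : Measure Ω} [IsFiniteMeasure μ]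

lemma W_congr {A A' B B' : Ω → ℝ} (hA : A =ᵐ[μ] A') (hB : B =ᵐ[μ] B') (n i : ℕ) :
    W 𝒢 μ A B n i =ᵐ[μ] W 𝒢 μ A' B' n i := by
  filter_upwards [mc_congr (𝒢 := 𝒢) hA (tm n i), mc_congr (𝒢 := 𝒢) hB (tm n i), mc_congr (𝒢 := 𝒢) hA (tm n (i+1)),
    mc_congr (𝒢 := 𝒢) hB (tm n (i+1))] with ω h1 h2 h3 h4
  simp only [W_eq, h1, h2, h3, h4]

lemma Rel.congr {J : Type*} [Fintype J] {γ : ℕ → ℕ → Ω → ℝ} {A A' B B' : Ω → ℝ} {p p' q q' : J → Ω → ℝ} (hA : A =ᵐ[μ] A') (hB : B =ᵐ[μ] B')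
    (hp : ∀ j, p j =ᵐ[μ] p' j) (hq : ∀ j, q j =ᵐ[μ] q' j) (h : Rel 𝒢 μ γ A B p q) : Rel 𝒢 μ γ A' B' p' q' := by
  intro ε hε
  obtain ⟨n0, φ, hφ, hb⟩ := h ε hε
  refine ⟨n0, φ, hφ, fun n hn => (le_of_eq ?_).trans (hb n hn)⟩
  refine Finset.sum_congr rfl fun i _ => integral_congr_ae ?_
  filter_upwards [W_congr (𝒢 := 𝒢) hA hB n i, ae_all_iff.2 fun j => W_congr (𝒢 := 𝒢) (hp j) (hq j) n i] with ω h1 h2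
  simp only [h1, h2]

lemma Rel.gate {J : Type*} [Fintype J] {γ : ℕ → ℕ → Ω → ℝ} (hγ : GB 𝒢 γ) {Y F : Ω → ℝ} {p q : J → Ω → ℝ} (hY : Bd μ Y) (hF : Bd μ F)
    (hp : ∀ j, Bd μ (p j)) (hq : ∀ j, Bd μ (q j)) (h : Rel 𝒢 μ (fun _ _ _ => 1) Y F p q) : Rel 𝒢 μ γ Y F p q := by
  intro ε hε
  obtain ⟨n0, φ, hφ, hb⟩ := h ε hε
  refine ⟨n0, φ, hφ, fun n hn => (Finset.sum_le_sum fun i _ => ?_).trans (hb n hn)⟩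
  refine integral_mono (res_bd hγ hY hF hp hq hn hφ i).sq.integrable (res_bd GB.one hY hF hp hq hn hφ i).sq.integrable fun ω => ?_
  simp only [mul_pow]
  refine mul_le_mul_of_nonneg_right ?_ (sq_nonneg _)
  have := hγ.le n i ω
  rw [one_pow, ← sq_abs]
  exact pow_le_one₀ (abs_nonneg _) this

lemma Bv_cyc {ι : Type*} {r : ℕ} (X : ι → Ω → ℝ) (k : KK 𝒢) (u : ι → EuclideanSpace ℝ (Fin r)) (a b c : ι) :
    lm μ (X a) k • Bv μ X k u b c = lm μ (X b) k • Bv μ X k u a c - lm μ (X c) k • Bv μ X k u a b := by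
  simp only [Bv, smul_sub, smul_smul]
  rw [mul_comm (lm μ (X a) k), mul_comm (lm μ (X a) k) (lm μ (X c) k), mul_comm (lm μ (X b) k) (lm μ (X c) k)]
  abel
end

section
variable {Ω : Type*} {m : MeasurableSpace Ω} {𝒢 : Filtration ℝ m} {P : Measure Ω} [IsProbabilityMeasure P] {d : ℕ}

theorem RD_good (hnull : ∀ s, MeasurableSet s → P s = 0 → MeasurableSet[𝒢 0] s)
    {p0 : Ω → ℝ} {m0 : Fin d → Ω → ℝ} (pp0 : ∀ ω, 0 < p0 ω) (hRD : RD 𝒢 P p0 m0)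
    {p : Ω → ℝ} {mm : Fin d → Ω → ℝ} (pp : ∀ ω, 0 < p ω)
    {D : Ω → ℝ} (wD' : Wt P D) (h0 : ∀ t : Option (Fin d), Dm P D (t.elim p0 m0))
    (h1 : ∀ t : Option (Fin d), Dm P D (t.elim p mm))
    (hR : ∀ t : Option (Fin d), Rel 𝒢 (wD P D) (fun _ _ _ => 1) (nf D p) (nf D (t.elim p0 m0)) (fun _ : Fin d => nf D p)
        (fun j => nf D (mm j))) : RD 𝒢 P p mm := by
  intro ι hι f mf jf
  obtain ⟨D0, w0, -, -, hf, hrel⟩ := hRD ι hι f mf jf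
  have w1 := w0.add wD'
  have le0 : ∀ ω, D0 ω ≤ D0 ω + D ω := fun ω => by have := wD'.pos ω; linarith
  have le1 : ∀ ω, D ω ≤ D0 ω + D ω := fun ω => by have := w0.pos ω; linarith
  refine ⟨_, w1, (h1 none).mono zero_le_one (ae_of_all _ (by simpa using le1)),
    fun j => (h1 (some j)).mono zero_le_one (ae_of_all _ (by simpa using le1)),
    fun k => (hf k).mono zero_le_one (ae_of_all _ (by simpa using le0)), fun D' w' hle γ hγ k => ?_⟩
  have hle0 : ∀ᵐ ω ∂P, D0 ω ≤ D' ω := hle.mono fun ω h => (le0 ω).trans h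
  have hle1 : ∀ᵐ ω ∂P, D ω ≤ D' ω := hle.mono fun ω h => (le1 ω).trans h
  have h0' : ∀ t : Option (Fin d), Dm P D' (t.elim p0 m0) := fun t => (h0 t).mono zero_le_one (by simpa using hle1)
  have h1' : ∀ t : Option (Fin d), Dm P D' (t.elim p mm) := fun t => (h1 t).mono zero_le_one (by simpa using hle1)
  have hf' : Dm P D' (f k) := (hf k).mono zero_le_one (by simpa using hle0)
  have hR' := fun t => Rel.transfer hle1 GB.one (h1 none) (h0 t) (fun _ => h1 none) (fun j => h1 (some j)) (hR t)
  have hRk := hrel D' w' hle0 _ GB.one k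
  refine Rel.gate hγ (h1' none).bd hf'.bd (fun _ => (h1' none).bd) (fun j => (h1' (some j)).bd) ?_
  let X : Option (Fin d) ⊕ Option (Fin d) ⊕ Unit → Ω → ℝ :=
    Sum.elim (fun t => nf D' (t.elim p0 m0)) (Sum.elim (fun t => nf D' (t.elim p mm)) fun _ => nf D' (f k))
  have hnull' : ∀ s, MeasurableSet s → wD P D' s = 0 → MeasurableSet[𝒢 0] s := fun s hs h => hnull s hs (ac_wD h)
  obtain ⟨L, fL, hL, hdm⟩ := exists_L hnull' X
  have hX : ∀ a, AC 𝒢 (wD P D') L (X a) := by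
    intro a
    refine ⟨?_, hdm a⟩
    rcases a with t | t | t
    · exact (h0' t).bd
    · exact (h1' t).bd
    · exact hf'.bd
  have posnf : ∀ g : Ω → ℝ, (∀ ω, 0 < g ω) → ∀ᵐ ω ∂(wD P D'), 0 < nf D' g ω := fun g hg =>
    ae_of_all _ fun ω => div_pos (hg ω) (w'.pos ω)
  have q0 := lm_pos (𝒢 := 𝒢) hL (h0' none).bd (posnf _ pp0)
  have q1 := lm_pos (𝒢 := 𝒢) hL (h1' none).bd (posnf _ pp)
  have s1 := fun t => rel_span hL hX (Gate.one L) (.inr (.inl none)) (.inl t) (fun _ : Fin d => .inr (.inl none)) (fun j => .inr (.inl (some j))) (hR' t)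
  have s2 := rel_span hL hX (Gate.one L) (.inl none) (.inr (.inr ())) (fun _ : Fin d => .inl none) (fun j => .inl (some j)) hRk
  refine span_rel hL hX (Gate.one L) (.inr (.inl none)) (.inr (.inr ())) (fun _ : Fin d => .inr (.inl none)) (fun j => .inr (.inl (some j))) ?_
  filter_upwards [q0, q1, ae_all_iff.2 s1, s2] with κ k0 k1 e1 e2 _ r u hu
  replace e1 := fun t => e1 t one_ne_zero r u hu
  replace e2 := e2 one_ne_zero r u hu
  set T := Submodule.span ℝ (range fun j : Fin d => Bv (wD P D') X κ u (.inr (.inl none)) (.inr (.inl (some j))))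
  have inv : ∀ {c : ℝ} {v : EuclideanSpace ℝ (Fin r)}, c ≠ 0 → c • v ∈ T → v ∈ T := fun hc h => (Submodule.smul_mem_iff T hc).1 h
  have k0' : lm (wD P D') (X (.inl none)) κ ≠ 0 := k0.ne'
  have k1' : lm (wD P D') (X (.inr (.inl none))) κ ≠ 0 := k1.ne'
  have e3 : Bv (wD P D') X κ u (.inl none) (.inr (.inr ())) ∈ T := by
    refine Submodule.span_le.2 ?_ e2
    rintro _ ⟨j, rfl⟩
    refine inv k1' ?_
    rw [Bv_cyc]
    exact T.sub_mem (T.smul_mem _ (e1 (some j))) (T.smul_mem _ (e1 none))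
  refine inv k0' ?_
  have := Bv_cyc (μ := wD P D') X κ u (.inr (.inl none)) (.inl none) (.inr (.inr ()))
  rw [eq_sub_iff_add_eq] at this
  rw [← this]
  exact T.add_mem (T.smul_mem _ e3) (T.smul_mem _ (e1 none))
end
end DM

namespace DM
open Topology
section
variable {Ω : Type*} {m : MeasurableSpace Ω} {𝒢 : Filtration ℝ m} {μ : Measure Ω} [IsFiniteMeasure μ] {d : ℕ}

lemma rank_dom {r : ℕ} (f g : Fin d → EuclideanSpace ℝ (Fin r))
    (h : ∀ c : Fin d → ℚ, ‖∑ j, (c j : ℝ) • f j‖ ≤ ‖∑ j, (c j : ℝ) • g j‖) :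
    Module.finrank ℝ (Submodule.span ℝ (range f)) ≤ Module.finrank ℝ (Submodule.span ℝ (range g)) := by
  have hc : ∀ c : Fin d → ℝ, ‖∑ j, c j • f j‖ ≤ ‖∑ j, c j • g j‖ := by
    have hd : DenseRange (Pi.map fun (_ : Fin d) (q : ℚ) => (q : ℝ)) := DenseRange.piMap fun _ => Rat.denseRange_cast
    intro c
    refine hd.induction_on (p := fun c : Fin d → ℝ => ‖∑ j, c j • f j‖ ≤ ‖∑ j, c j • g j‖) c (isClosed_le (by fun_prop) (by fun_prop)) ?_
    intro c; exact h c
  have ker : LinearMap.ker (Fintype.linearCombination ℝ g) ≤ LinearMap.ker (Fintype.linearCombination ℝ f) := by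
    intro c hcg
    rw [LinearMap.mem_ker, Fintype.linearCombination_apply] at hcg ⊢
    have := hc c
    rw [hcg, norm_zero] at this
    exact norm_le_zero_iff.1 this
  rw [← Fintype.range_linearCombination, ← Fintype.range_linearCombination]
  have e1 := LinearMap.finrank_range_add_finrank_ker (Fintype.linearCombination ℝ f)
  have e2 := LinearMap.finrank_range_add_finrank_ker (Fintype.linearCombination ℝ g)
  have := Submodule.finrank_mono ker
  omega

lemma mc_le {Y G : Ω → ℝ} (hY : Integrable Y μ) (hG : Integrable G μ) (h : ∀ᵐ ω ∂μ, Y ω ≤ G ω) (s : ℝ) :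
    ∀ᵐ ω ∂μ, mc 𝒢 μ Y s ω ≤ mc 𝒢 μ G s ω := condExp_mono hY hG h

theorem core_rel (hnull : ∀ s, MeasurableSet s → μ s = 0 → MeasurableSet[𝒢 0] s) {γ : ℕ → ℕ → Ω → ℝ} {γl : KK 𝒢 → ℝ}
    (hγ : ∀ L : Measure (KK 𝒢), Gate L γ γl) {Y G : Ω → ℝ} {M N K : Fin d → Ω → ℝ} (hY : Bd μ Y) (hG : Bd μ G)
    (hM : ∀ j, Bd μ (M j)) (hN : ∀ j, Bd μ (N j)) (hK : ∀ j, Bd μ (K j)) (Yp : ∀ᵐ ω ∂μ, 0 < Y ω) (YG : ∀ᵐ ω ∂μ, Y ω ≤ G ω)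
    (CR : ∀ n, ∀ i ≤ 2 ^ n, ∀ j, ∀ᵐ ω ∂μ, mc 𝒢 μ G (tm n i) ω * mc 𝒢 μ (N j) (tm n i) ω = mc 𝒢 μ (K j) (tm n i) ω * mc 𝒢 μ Y (tm n i) ω)
    (r1 : Rel 𝒢 μ (fun _ _ _ => 1) Y G (fun _ : Fin d => Y) M) (r2 : ∀ j, Rel 𝒢 μ (fun _ _ _ => 1) Y (K j) (fun _ : Fin d => Y) M)
    (r3 : ∀ j, Rel 𝒢 μ γ Y (M j) (fun _ : Fin d => Y) N) : Rel 𝒢 μ γ G Y (fun _ : Fin d => G) K := by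
  have Gp : ∀ᵐ ω ∂μ, 0 < G ω := by filter_upwards [Yp, YG] with ω a b using a.trans_le b
  let X : Bool ⊕ (Fin d ⊕ Fin d ⊕ Fin d) → Ω → ℝ := Sum.elim (fun b => if b then Y else G) (Sum.elim M (Sum.elim N K))
  obtain ⟨L, fL, hL, hdm⟩ := exists_L hnull X
  have hX : ∀ a, AC 𝒢 μ L (X a) := by
    intro a
    refine ⟨?_, hdm a⟩
    rcases a with b | j | j | j
    · cases b
      · exact hG
      · exact hY
    · exact hM j
    · exact hN j
    · exact hK j
  have q0 := lm_pos (𝒢 := 𝒢) hL hG Gp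
  have q1 := lm_pos (𝒢 := 𝒢) hL hY Yp
  have s1 := rel_span hL hX (Gate.one L) (.inl true) (.inl false) (fun _ : Fin d => .inl true) (fun j => .inr (.inl j)) r1
  have s2 := fun j => rel_span hL hX (Gate.one L) (.inl true) (.inr (.inr (.inr j))) (fun _ : Fin d => .inl true) (fun j => .inr (.inl j)) (r2 j)
  have s3 := fun j => rel_span hL hX (hγ L) (.inl true) (.inr (.inl j)) (fun _ : Fin d => .inl true) (fun j => .inr (.inr (.inl j))) (r3 j)
  have s4 := fun c : Fin d → ℚ => dom_ae hL hX (fun _ : Fin d => .inl true) (fun j => .inr (.inr (.inl j)))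
    (fun _ : Fin d => .inl false) (fun j => .inr (.inr (.inr j))) (fun j => (c j : ℝ)) (by
      intro n i hi
      have py := fun s => mc_posP (𝒢 := 𝒢) hY.integrable Yp s
      have le := fun s => mc_le (𝒢 := 𝒢) hY.integrable hG.integrable YG s
      filter_upwards [py (tm n i), py (tm n (i+1)), le (tm n i), le (tm n (i+1)), ae_all_iff.2 (CR n i hi.le), ae_all_iff.2 (CR n (i+1) hi)]
        with ω y y' l l' c1 c2
      have g := y.trans_le l
      have g' := y'.trans_le l'
      have e : ∀ j, W 𝒢 μ Y (N j) n i ω = (mc 𝒢 μ Y (tm n i) ω / mc 𝒢 μ G (tm n i) ω * (mc 𝒢 μ Y (tm n (i+1)) ω / mc 𝒢 μ G (tm n (i+1)) ω))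
          * W 𝒢 μ G (K j) n i ω := by
        intro j
        have a1 : mc 𝒢 μ (N j) (tm n i) ω = mc 𝒢 μ (K j) (tm n i) ω * mc 𝒢 μ Y (tm n i) ω / mc 𝒢 μ G (tm n i) ω := by
          rw [eq_div_iff g.ne', ← c1 j, mul_comm]
        have a2 : mc 𝒢 μ (N j) (tm n (i+1)) ω = mc 𝒢 μ (K j) (tm n (i+1)) ω * mc 𝒢 μ Y (tm n (i+1)) ω / mc 𝒢 μ G (tm n (i+1)) ω := by
          rw [eq_div_iff g'.ne', ← c2 j, mul_comm]
        rw [W_eq, W_eq, a1, a2]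
        field_simp
      show |∑ j, (c j : ℝ) * W 𝒢 μ Y (N j) n i ω| ≤ |∑ j, (c j : ℝ) * W 𝒢 μ G (K j) n i ω|
      simp only [e, mul_left_comm ((c _ : ℚ) : ℝ), ← Finset.mul_sum]
      rw [abs_mul]
      refine mul_le_of_le_one_left (abs_nonneg _) ?_
      rw [abs_of_nonneg (by positivity)]
      exact mul_le_one₀ ((div_le_one g).2 l) (by positivity) ((div_le_one g').2 l'))
  refine span_rel hL hX (hγ L) (.inl false) (.inl true) (fun _ : Fin d => .inl false) (fun j => .inr (.inr (.inr j))) ?_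
  filter_upwards [q0, q1, s1, ae_all_iff.2 s2, ae_all_iff.2 s3, ae_all_iff.2 s4] with κ k0 k1 e1 e2 e3 e4 hγ0 r u hu
  replace e1 := e1 one_ne_zero r u hu
  replace e2 := fun j => e2 j one_ne_zero r u hu
  replace e3 := fun j => e3 j hγ0 r u hu
  replace e4 := rank_dom _ _ fun c => e4 c r u hu
  set T := Submodule.span ℝ (range fun j : Fin d => Bv μ X κ u (.inl true) (.inr (.inl j)))
  set SN := Submodule.span ℝ (range fun j : Fin d => Bv μ X κ u (.inl true) (.inr (.inr (.inl j))))
  set SK := Submodule.span ℝ (range fun j : Fin d => Bv μ X κ u (.inl false) (.inr (.inr (.inr j))))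
  have TN : T ≤ SN := by
    refine Submodule.span_le.2 ?_
    rintro _ ⟨j, rfl⟩
    exact e3 j
  have KT : SK ≤ T := by
    refine Submodule.span_le.2 ?_
    rintro _ ⟨j, rfl⟩
    have k1' : lm μ (X (.inl true)) κ ≠ 0 := k1.ne'
    refine (Submodule.smul_mem_iff T k1').1 ?_
    rw [Bv_cyc]
    exact T.sub_mem (T.smul_mem _ (e2 j)) (T.smul_mem _ e1)
  have eq : SK = SN := Submodule.eq_of_le_of_finrank_le (KT.trans TN) e4
  have : Bv μ X κ u (.inl false) (.inl true) = - Bv μ X κ u (.inl true) (.inl false) := by simp [Bv]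
  rw [this, eq]
  exact SN.neg_mem (TN e1)
end
end DM

namespace DM
open Topology
section
variable {Ω : Type*} {m : MeasurableSpace Ω} {𝒢 : Filtration ℝ m} {μ : Measure Ω} [IsFiniteMeasure μ] {d : ℕ}

/-- ratio process -/
def vv (𝒢 : Filtration ℝ m) (μ : Measure Ω) (Y G : Ω → ℝ) (s : ℝ) (ω : Ω) : ℝ := mc 𝒢 μ Y s ω / mc 𝒢 μ G s ω

/-- scaled increment of the ratio process -/
def VV (𝒢 : Filtration ℝ m) (μ : Measure Ω) (Y G : Ω → ℝ) (n i : ℕ) (ω : Ω) : ℝ :=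
  mc 𝒢 μ G (tm n i) ω * vv 𝒢 μ Y G (tm n (i + 1)) ω - mc 𝒢 μ Y (tm n i) ω

lemma vv_meas (Y G : Ω → ℝ) (s : ℝ) : Measurable[𝒢 s] (vv 𝒢 μ Y G s) := (mc_meas Y s).div (mc_meas G s)

lemma vv_meas_of_le (Y G : Ω → ℝ) {s t : ℝ} (h : s ≤ t) : Measurable[𝒢 t] (vv 𝒢 μ Y G s) :=
  (vv_meas Y G s).mono (𝒢.mono h) le_rfl

variable {Y G : Ω → ℝ} {N K : Fin d → Ω → ℝ}

lemma mc_both (hY : Bd μ Y) (hG : Bd μ G) (Yp : ∀ᵐ ω ∂μ, 0 < Y ω) (YG : ∀ᵐ ω ∂μ, Y ω ≤ G ω) (s : ℝ) :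
    ∀ᵐ ω ∂μ, 0 < mc 𝒢 μ Y s ω ∧ mc 𝒢 μ Y s ω ≤ mc 𝒢 μ G s ω := by
  filter_upwards [mc_posP (𝒢 := 𝒢) hY.integrable Yp s, mc_le (𝒢 := 𝒢) hY.integrable hG.integrable YG s] with ω a b using ⟨a, b⟩

lemma vv_bd (hY : Bd μ Y) (hG : Bd μ G) (Yp : ∀ᵐ ω ∂μ, 0 < Y ω) (YG : ∀ᵐ ω ∂μ, Y ω ≤ G ω) (s : ℝ) :
    Bd μ (vv 𝒢 μ Y G s) := by
  refine Bd.of_le ((vv_meas Y G s).mono (𝒢.le s) le_rfl) 1 ?_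
  filter_upwards [mc_both (𝒢 := 𝒢) hY hG Yp YG s] with ω ⟨a, b⟩
  have g := a.trans_le b
  rw [vv, abs_of_nonneg (by positivity)]
  exact (div_le_one g).2 b

lemma VV_bd (hY : Bd μ Y) (hG : Bd μ G) (Yp : ∀ᵐ ω ∂μ, 0 < Y ω) (YG : ∀ᵐ ω ∂μ, Y ω ≤ G ω) (n i : ℕ) :
    Bd μ (VV 𝒢 μ Y G n i) := ((hG.mc _).mul (vv_bd hY hG Yp YG _)).sub (hY.mc _)

lemma VV_energy (hY : Bd μ Y) (hG : Bd μ G) (Yp : ∀ᵐ ω ∂μ, 0 < Y ω) (YG : ∀ᵐ ω ∂μ, Y ω ≤ G ω) (n N : ℕ) :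
    ∑ i ∈ Finset.range N, ∫ ω, VV 𝒢 μ Y G n i ω ^ 2 ∂μ ≤ 2 * ∫ ω, Y ω ^ 2 ∂μ + 2 * ∫ ω, G ω ^ 2 ∂μ := by
  have h1 : ∀ i ∈ Finset.range N, ∫ ω, VV 𝒢 μ Y G n i ω ^ 2 ∂μ ≤ 2 * ∫ ω, inc 𝒢 μ Y n i ω ^ 2 ∂μ + 2 * ∫ ω, inc 𝒢 μ G n i ω ^ 2 ∂μ := by
    intro i _
    refine sq_int_le_two (VV_bd hY hG Yp YG n i) (hY.inc n i) (hG.inc n i) ?_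
    filter_upwards [mc_both (𝒢 := 𝒢) hY hG Yp YG (tm n (i+1))] with ω ⟨a, b⟩
    have g := a.trans_le b
    have e : VV 𝒢 μ Y G n i ω = inc 𝒢 μ Y n i ω - vv 𝒢 μ Y G (tm n (i+1)) ω * inc 𝒢 μ G n i ω := by
      simp only [VV, inc, vv]; field_simp; ring
    have hv : |vv 𝒢 μ Y G (tm n (i+1)) ω| ≤ 1 := by
      rw [vv, abs_of_nonneg (by positivity)]
      exact (div_le_one g).2 b
    rw [e]
    refine (abs_sub _ _).trans (add_le_add le_rfl ?_)
    rw [abs_mul]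
    exact mul_le_of_le_one_left (abs_nonneg _) hv
  refine (Finset.sum_le_sum h1).trans ?_
  rw [Finset.sum_add_distrib, ← Finset.mul_sum, ← Finset.mul_sum]
  have := sum_inc_sq_le (𝒢 := 𝒢) hY n N
  have := sum_inc_sq_le (𝒢 := 𝒢) hG n N
  linarith

lemma cross_zero (hY : Bd μ Y) (hG : Bd μ G) {N K : Ω → ℝ} (hN : Bd μ N) (hK : Bd μ K) (Yp : ∀ᵐ ω ∂μ, 0 < Y ω) (YG : ∀ᵐ ω ∂μ, Y ω ≤ G ω)
    (n i : ℕ) (CR : ∀ᵐ ω ∂μ, mc 𝒢 μ G (tm n i) ω * mc 𝒢 μ N (tm n i) ω = mc 𝒢 μ K (tm n i) ω * mc 𝒢 μ Y (tm n i) ω)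
    (CR' : ∀ᵐ ω ∂μ, mc 𝒢 μ G (tm n (i+1)) ω * mc 𝒢 μ N (tm n (i+1)) ω = mc 𝒢 μ K (tm n (i+1)) ω * mc 𝒢 μ Y (tm n (i+1)) ω)
    {h : Ω → ℝ} (mh : Measurable[𝒢 (tm n i)] h) (bh : Bd μ h) :
    ∫ ω, h ω * (W 𝒢 μ G K n i ω * VV 𝒢 μ Y G n i ω) ∂μ = 0 := by
  let g := mc 𝒢 μ G (tm n i)
  let y := mc 𝒢 μ Y (tm n i)
  let k := mc 𝒢 μ K (tm n i)
  have mg : Measurable[𝒢 (tm n i)] g := mc_meas _ _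
  have my : Measurable[𝒢 (tm n i)] y := mc_meas _ _
  have mk : Measurable[𝒢 (tm n i)] k := mc_meas _ _
  have bg : Bd μ g := hG.mc _
  have by' : Bd μ y := hY.mc _
  have bk : Bd μ k := hK.mc _
  have e1 : ∫ ω, h ω * (W 𝒢 μ G K n i ω * VV 𝒢 μ Y G n i ω) ∂μ =
      ∫ ω, ((h ω * g ω * g ω) * mc 𝒢 μ N (tm n (i+1)) ω - (h ω * g ω * y ω) * mc 𝒢 μ K (tm n (i+1)) ω -
        (h ω * k ω * g ω) * mc 𝒢 μ Y (tm n (i+1)) ω + (h ω * k ω * y ω) * mc 𝒢 μ G (tm n (i+1)) ω) ∂μ := by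
    refine integral_congr_ae ?_
    filter_upwards [CR', mc_both (𝒢 := 𝒢) hY hG Yp YG (tm n (i+1))] with ω c ⟨a, b⟩
    have g' := a.trans_le b
    have : mc 𝒢 μ N (tm n (i+1)) ω = mc 𝒢 μ K (tm n (i+1)) ω * mc 𝒢 μ Y (tm n (i+1)) ω / mc 𝒢 μ G (tm n (i+1)) ω := by
      rw [eq_div_iff g'.ne', ← c, mul_comm]
    rw [W_eq, VV, vv, this]
    simp only [g, y, k]
    field_simp
    ring
  have split : ∀ (A B C D : Ω → ℝ), Bd μ A → Bd μ B → Bd μ C → Bd μ D →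
      ∫ ω, (A ω - B ω - C ω + D ω) ∂μ = ∫ ω, A ω ∂μ - ∫ ω, B ω ∂μ - ∫ ω, C ω ∂μ + ∫ ω, D ω ∂μ := by
    intro A B C D hA hB hC hD
    rw [integral_add ((hA.sub hB).sub hC).integrable hD.integrable, integral_sub (hA.sub hB).integrable hC.integrable,
      integral_sub hA.integrable hB.integrable]
  have hle := tm_le_succ n i
  have b1 := (bh.mul bg).mul bg
  have b2 := (bh.mul bg).mul by'
  have b3 := (bh.mul bk).mul bg
  have b4 := (bh.mul bk).mul by'
  rw [e1, split _ _ _ _ (b1.mul (hN.mc _)) (b2.mul (hK.mc _)) (b3.mul (hY.mc _)) (b4.mul (hG.mc _)),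
    int_mul_mc_le (f := fun ω => h ω * g ω * g ω) hle ((mh.mul mg).mul mg) b1 hN, int_mul_mc_le (f := fun ω => h ω * g ω * y ω) hle ((mh.mul mg).mul my) b2 hK,
    int_mul_mc_le (f := fun ω => h ω * k ω * g ω) hle ((mh.mul mk).mul mg) b3 hY, int_mul_mc_le (f := fun ω => h ω * k ω * y ω) hle ((mh.mul mk).mul my) b4 hG,
    ← split _ _ _ _ (b1.mul (hN.mc _)) (b2.mul (hK.mc _)) (b3.mul (hY.mc _)) (b4.mul (hG.mc _))]
  refine integral_eq_zero_of_ae ?_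
  filter_upwards [CR] with ω c
  simp only [Pi.zero_apply]
  have : g ω * mc 𝒢 μ N (tm n i) ω = k ω * y ω := c
  have c2 : mc 𝒢 μ K (tm n i) ω = k ω := rfl
  have c3 : mc 𝒢 μ Y (tm n i) ω = y ω := rfl
  have c4 : mc 𝒢 μ G (tm n i) ω = g ω := rfl
  rw [c2, c3, c4]
  linear_combination (h ω * g ω) * this

lemma W_VV (hY : Bd μ Y) (hG : Bd μ G) (Yp : ∀ᵐ ω ∂μ, 0 < Y ω) (YG : ∀ᵐ ω ∂μ, Y ω ≤ G ω) (n i : ℕ) :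
    ∀ᵐ ω ∂μ, W 𝒢 μ G Y n i ω = mc 𝒢 μ G (tm n (i+1)) ω * VV 𝒢 μ Y G n i ω := by
  filter_upwards [mc_both (𝒢 := 𝒢) hY hG Yp YG (tm n (i+1))] with ω ⟨a, b⟩
  have g' := a.trans_le b
  rw [W_eq, VV, vv]; field_simp

theorem est1 (hY : Bd μ Y) (hG : Bd μ G) (hN : ∀ j, Bd μ (N j)) (hK : ∀ j, Bd μ (K j)) (Yp : ∀ᵐ ω ∂μ, 0 < Y ω) (YG : ∀ᵐ ω ∂μ, Y ω ≤ G ω)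
    (CR : ∀ n, ∀ i ≤ 2 ^ n, ∀ j, ∀ᵐ ω ∂μ, mc 𝒢 μ G (tm n i) ω * mc 𝒢 μ (N j) (tm n i) ω = mc 𝒢 μ (K j) (tm n i) ω * mc 𝒢 μ Y (tm n i) ω)
    {γ : ℕ → ℕ → Ω → ℝ} (hγ : GB 𝒢 γ) (h01 : ∀ n i ω, γ n i ω = 0 ∨ γ n i ω = 1)
    (hR : Rel 𝒢 μ γ G Y (fun _ : Fin d => G) K) {η : ℝ} (hη : 0 < η) :
    ∃ n0, ∀ n ≥ n0, ∑ i ∈ Finset.range (2 ^ n), ∫ ω, γ n i ω * (mc 𝒢 μ G (tm n (i+1)) ω * VV 𝒢 μ Y G n i ω ^ 2) ∂μ ≤ η := by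
  set E := 2 * ∫ ω, Y ω ^ 2 ∂μ + 2 * ∫ ω, G ω ^ 2 ∂μ
  have hE : 0 ≤ E := by
    have : 0 ≤ ∫ ω, Y ω ^ 2 ∂μ := integral_nonneg fun _ => sq_nonneg _
    have : 0 ≤ ∫ ω, G ω ^ 2 ∂μ := integral_nonneg fun _ => sq_nonneg _
    positivity
  let t := η / (E + 1)
  have ht : 0 < t := by positivity
  have htE : t * E ≤ η := by
    simp only [t]; rw [div_mul_eq_mul_div, div_le_iff₀ (by positivity)]; nlinarith
  obtain ⟨n0, φ, hφ, hb⟩ := hR (t * η) (by positivity)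
  refine ⟨n0, fun n hn => ?_⟩
  have key : ∀ i ∈ Finset.range (2 ^ n), ∫ ω, γ n i ω * (mc 𝒢 μ G (tm n (i+1)) ω * VV 𝒢 μ Y G n i ω ^ 2) ∂μ ≤
      1 / (2 * t) * ∫ ω, (γ n i ω * (W 𝒢 μ G Y n i ω - ∑ j, rfn n0 n (φ j) i ω * W 𝒢 μ G (K j) n i ω)) ^ 2 ∂μ
      + t / 2 * ∫ ω, VV 𝒢 μ Y G n i ω ^ 2 ∂μ := by
    intro i hi
    have hi := Finset.mem_range.1 hi
    have br := res_bd hγ hG hY (fun _ => hG) hK hn hφ i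
    have bV := VV_bd (𝒢 := 𝒢) hY hG Yp YG n i
    have bφ := fun j => ((hγ.P n).bd i (μ := μ)).mul (((hφ j).rfn hn).bd i (μ := μ))
    have bz := fun j => (bφ j).mul ((hG.W (𝒢 := 𝒢) (hK j) n i).mul bV)
    have e1 : ∫ ω, γ n i ω * (mc 𝒢 μ G (tm n (i+1)) ω * VV 𝒢 μ Y G n i ω ^ 2) ∂μ =
        ∫ ω, (γ n i ω * (W 𝒢 μ G Y n i ω - ∑ j, rfn n0 n (φ j) i ω * W 𝒢 μ G (K j) n i ω) * VV 𝒢 μ Y G n i ω +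
         ∑ j, γ n i ω * rfn n0 n (φ j) i ω * (W 𝒢 μ G (K j) n i ω * VV 𝒢 μ Y G n i ω)) ∂μ := by
      refine integral_congr_ae ?_
      filter_upwards [W_VV (𝒢 := 𝒢) hY hG Yp YG n i] with ω h
      have : ∑ j, γ n i ω * rfn n0 n (φ j) i ω * (W 𝒢 μ G (K j) n i ω * VV 𝒢 μ Y G n i ω) =
          γ n i ω * (∑ j, rfn n0 n (φ j) i ω * W 𝒢 μ G (K j) n i ω) * VV 𝒢 μ Y G n i ω := by
        rw [Finset.mul_sum, Finset.sum_mul]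
        exact Finset.sum_congr rfl fun j _ => by ring
      rw [this, h]; ring
    rw [e1, integral_add (br.mul bV).integrable (Bd.sum _ fun j _ => bz j).integrable, integral_finsetSum _ fun j _ => (bz j).integrable,
      Finset.sum_eq_zero fun j _ => cross_zero (h := fun ω => γ n i ω * rfn n0 n (φ j) i ω) hY hG (hN j) (hK j) Yp YG n i (CR n i hi.le j) (CR n (i+1) hi j)
        (((hγ.P n).1 i).mul (((hφ j).rfn hn).1 i)) (bφ j), add_zero, ← integral_const_mul, ← integral_const_mul,
        ← integral_add (br.sq.const_mul _).integrable (bV.sq.const_mul _).integrable]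
    refine integral_mono (br.mul bV).integrable ((br.sq.const_mul _).add (bV.sq.const_mul _)).integrable fun ω => ?_
    simp only
    have am : ∀ a b : ℝ, a * b ≤ 1 / (2 * t) * a ^ 2 + t / 2 * b ^ 2 := by
      intro a b
      have e : 1 / (2 * t) * a ^ 2 + t / 2 * b ^ 2 - a * b = (a - t * b) ^ 2 / (2 * t) := by field_simp; ring
      have : 0 ≤ (a - t * b) ^ 2 / (2 * t) := by positivity
      linarith
    exact am _ _
  refine (Finset.sum_le_sum key).trans ?_
  rw [Finset.sum_add_distrib, ← Finset.mul_sum, ← Finset.mul_sum]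
  have h1 := mul_le_mul_of_nonneg_left (hb n hn) (show 0 ≤ 1 / (2 * t) by positivity)
  have h2 := mul_le_mul_of_nonneg_left (VV_energy (𝒢 := 𝒢) hY hG Yp YG n (2 ^ n)) (show 0 ≤ t / 2 by positivity)
  have e3 : 1 / (2 * t) * (t * η) = η / 2 := by field_simp
  have e4 : t / 2 * E ≤ η / 2 := by linarith
  linarith
end
end DM

namespace DM
open Topology
section
variable {Ω : Type*} {m : MeasurableSpace Ω} {𝒢 : Filtration ℝ m} {μ : Measure Ω} [IsFiniteMeasure μ] {d : ℕ}
variable {Y G : Ω → ℝ}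

/-- discrete stochastic integral of the ratio process -/
def II (𝒢 : Filtration ℝ m) (μ : Measure Ω) (Y G : Ω → ℝ) (n : ℕ) (α : ℕ → Ω → ℝ) (i : ℕ) (ω : Ω) : ℝ :=
  ∑ k ∈ Finset.range i, α k ω * (vv 𝒢 μ Y G (tm n (k+1)) ω - vv 𝒢 μ Y G (tm n k) ω)

lemma II_meas {n : ℕ} {α : ℕ → Ω → ℝ} (hα : ∀ k, Measurable[𝒢 (tm n k)] (α k)) (i : ℕ) :
    Measurable[𝒢 (tm n i)] (II 𝒢 μ Y G n α i) := by
  refine @Finset.measurable_fun_sum _ _ _ _ _ _ _ _ _ fun k hk => ?_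
  have hk := Finset.mem_range.1 hk
  exact ((hα k).mono (𝒢.mono (tm_mono n hk.le)) le_rfl).mul ((vv_meas_of_le Y G (tm_mono n hk)).sub (vv_meas_of_le Y G (tm_mono n hk.le)))

lemma II_bd (hY : Bd μ Y) (hG : Bd μ G) (Yp : ∀ᵐ ω ∂μ, 0 < Y ω) (YG : ∀ᵐ ω ∂μ, Y ω ≤ G ω) {n : ℕ} {α : ℕ → Ω → ℝ}
    (bα : ∀ k, Bd μ (α k)) (i : ℕ) : Bd μ (II 𝒢 μ Y G n α i) :=
  Bd.sum _ fun k _ => (bα k).mul ((vv_bd hY hG Yp YG _).sub (vv_bd hY hG Yp YG _))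

lemma iso (hY : Bd μ Y) (hG : Bd μ G) (Yp : ∀ᵐ ω ∂μ, 0 < Y ω) (YG : ∀ᵐ ω ∂μ, Y ω ≤ G ω) {n : ℕ} {α : ℕ → Ω → ℝ}
    (hα : ∀ k, Measurable[𝒢 (tm n k)] (α k)) (bα : ∀ k, Bd μ (α k)) (i : ℕ) :
    ∫ ω, mc 𝒢 μ G (tm n i) ω * II 𝒢 μ Y G n α i ω ^ 2 ∂μ = ∑ k ∈ Finset.range i, ∫ ω, mc 𝒢 μ G (tm n (k+1)) ω *
      (α k ω * (vv 𝒢 μ Y G (tm n (k+1)) ω - vv 𝒢 μ Y G (tm n k) ω)) ^ 2 ∂μ := by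
  induction i with
  | zero => simp [II]
  | succ i ih =>
    rw [Finset.sum_range_succ, ← ih]
    have bI := II_bd (𝒢 := 𝒢) hY hG Yp YG (n := n) bα i
    have mI := II_meas (μ := μ) (Y := Y) (G := G) hα i
    have bv := fun s => vv_bd (𝒢 := 𝒢) hY hG Yp YG s
    have mv := vv_meas (𝒢 := 𝒢) (μ := μ) Y G (tm n i)
    set I := II 𝒢 μ Y G n α i with hI
    have b1 : Bd μ (fun ω => I ω * I ω) := bI.mul bI
    have b2 : Bd μ (fun ω => 2 * I ω * α i ω) := (bI.const_mul 2).mul (bα i)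
    have b3 : Bd μ (fun ω => 2 * I ω * α i ω * vv 𝒢 μ Y G (tm n i) ω) := b2.mul (bv _)
    have b4 : Bd μ (fun ω => mc 𝒢 μ G (tm n (i+1)) ω *
      (α i ω * (vv 𝒢 μ Y G (tm n (i+1)) ω - vv 𝒢 μ Y G (tm n i) ω)) ^ 2) := (hG.mc _).mul ((bα i).mul ((bv _).sub (bv _))).sq
    have m2 : Measurable[𝒢 (tm n i)] (fun ω => 2 * I ω * α i ω) := (mI.const_mul 2).mul (hα i)
    have e1 : ∫ ω, mc 𝒢 μ G (tm n (i+1)) ω * II 𝒢 μ Y G n α (i+1) ω ^ 2 ∂μ = ∫ ω, (((I ω * I ω) * mc 𝒢 μ G (tm n (i+1)) ω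
        + ((2 * I ω * α i ω) * mc 𝒢 μ Y (tm n (i+1)) ω - (2 * I ω * α i ω * vv 𝒢 μ Y G (tm n i) ω) * mc 𝒢 μ G (tm n (i+1)) ω))
        + mc 𝒢 μ G (tm n (i+1)) ω * (α i ω * (vv 𝒢 μ Y G (tm n (i+1)) ω - vv 𝒢 μ Y G (tm n i) ω)) ^ 2) ∂μ := by
      refine integral_congr_ae ?_
      filter_upwards [mc_both (𝒢 := 𝒢) hY hG Yp YG (tm n (i+1))] with ω ⟨a, b⟩
      have g' := a.trans_le b
      have e : mc 𝒢 μ Y (tm n (i+1)) ω = mc 𝒢 μ G (tm n (i+1)) ω * vv 𝒢 μ Y G (tm n (i+1)) ω := by rw [vv]; field_simp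
      have e' : II 𝒢 μ Y G n α (i+1) ω = I ω + α i ω * (vv 𝒢 μ Y G (tm n (i+1)) ω - vv 𝒢 μ Y G (tm n i) ω) := by
        simp only [II, Finset.sum_range_succ, hI]
      rw [e', e]; ring
    have hle := tm_le_succ n i
    rw [e1, integral_add ((b1.mul (hG.mc _)).add ((b2.mul (hY.mc _)).sub (b3.mul (hG.mc _)))).integrable b4.integrable,
      integral_add (b1.mul (hG.mc _)).integrable ((b2.mul (hY.mc _)).sub (b3.mul (hG.mc _))).integrable,
      integral_sub (b2.mul (hY.mc _)).integrable (b3.mul (hG.mc _)).integrable,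
      int_mul_mc_le (f := fun ω => I ω * I ω) hle (mI.mul mI) b1 hG,
      int_mul_mc_le (f := fun ω => 2 * I ω * α i ω) hle m2 b2 hY,
      int_mul_mc_le (f := fun ω => 2 * I ω * α i ω * vv 𝒢 μ Y G (tm n i) ω) hle (m2.mul mv) b3 hG]
    have e2 : ∫ ω, (2 * I ω * α i ω) * mc 𝒢 μ Y (tm n i) ω ∂μ = ∫ ω, (2 * I ω * α i ω * vv 𝒢 μ Y G (tm n i) ω) * mc 𝒢 μ G (tm n i) ω ∂μ := by
      refine integral_congr_ae ?_
      filter_upwards [mc_both (𝒢 := 𝒢) hY hG Yp YG (tm n i)] with ω ⟨a, b⟩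
      have g' := a.trans_le b
      rw [vv]; field_simp
    rw [e2, sub_self, add_zero]
    congr 1
    refine integral_congr_ae (ae_of_all _ fun ω => ?_)
    simp only; ring

theorem est2 (hY : Bd μ Y) (hG : Bd μ G) (Yp : ∀ᵐ ω ∂μ, 0 < Y ω) (YG : ∀ᵐ ω ∂μ, Y ω ≤ G ω)
    {γ : ℕ → ℕ → Ω → ℝ} (hγ : GB 𝒢 γ) (h01 : ∀ n i ω, γ n i ω = 0 ∨ γ n i ω = 1) (hanti : ∀ n ω, Antitone fun i => γ n i ω)
    {c0 : ℝ} (hc : ∀ n, ∀ᵐ ω ∂μ, mc 𝒢 μ Y (tm n 0) ω = c0 * mc 𝒢 μ G (tm n 0) ω)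
    (hE : ∀ η > 0, ∃ n0, ∀ n ≥ n0, ∑ i ∈ Finset.range (2 ^ n), ∫ ω, γ n i ω * (mc 𝒢 μ G (tm n (i+1)) ω * VV 𝒢 μ Y G n i ω ^ 2) ∂μ ≤ η)
    {ε : ℝ} (hε : 0 < ε) : ∃ n0, ∀ n ≥ n0, ∀ i < 2 ^ n, ∀ B, MeasurableSet[𝒢 (tm n i)] B →
      |∫ ω in B ∩ {ω | γ n i ω = 1}, (Y ω - c0 * G ω) ∂μ| ≤ ε := by
  have Gp : ∀ᵐ ω ∂μ, 0 < G ω := by filter_upwards [Yp, YG] with ω a b using a.trans_le b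
  have iG : 0 ≤ ∫ ω, G ω ∂μ := integral_nonneg_of_ae (Gp.mono fun ω h => h.le)
  set δ := ε / (2 * (1 + |c0|) * (μ.real univ + 1)) with hδ'
  have hμ : 0 ≤ μ.real univ := measureReal_nonneg
  have hc0 := abs_nonneg c0
  have hδ : 0 < δ := by positivity
  set t := ε / (2 * (∫ ω, G ω ∂μ + 1)) with ht'
  have ht : 0 < t := by positivity
  obtain ⟨n0, hn0⟩ := hE (ε * t * δ ^ 2 / 2) (by positivity)
  refine ⟨n0, fun n hn i hi B hB => ?_⟩
  let Lw : ℕ → Set Ω := fun k => {ω | ∃ l < k + 1, mc 𝒢 μ G (tm n l) ω ≤ δ}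
  have mLw : ∀ k, MeasurableSet[𝒢 (tm n k)] (Lw k) := by
    intro k
    have : Lw k = ⋃ l ∈ Finset.range (k+1), {ω | mc 𝒢 μ G (tm n l) ω ≤ δ} := by
      ext ω; simp [Lw]
    rw [this]
    refine @Finset.measurableSet_biUnion _ _ (_) _ _ fun l hl => ?_
    have hm : Measurable[𝒢 (tm n k)] (mc 𝒢 μ G (tm n l)) := mc_meas_of_le G (tm_mono n (by have := Finset.mem_range.1 hl; omega))
    exact hm measurableSet_Iic
  have mγ1 : ∀ k, MeasurableSet[𝒢 (tm n k)] {ω | γ n k ω = 1} := fun k => ((hγ.P n).1 k) (measurableSet_singleton 1)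
  let B' := B ∩ {ω | γ n i ω = 1}
  have mB' : MeasurableSet[𝒢 (tm n i)] B' := MeasurableSet.inter hB (mγ1 i)
  have mB'' : MeasurableSet[𝒢 (tm n i)] (B' \ Lw i) := MeasurableSet.diff mB' (mLw i)
  have bH : Bd μ (fun ω => Y ω - c0 * G ω) := hY.sub (hG.const_mul _)
  have hsplit := integral_inter_add_sdiff (μ := μ) (f := fun ω => Y ω - c0 * G ω) (s := B') (𝒢.le _ _ (mLw i)) bH.integrable.integrableOn
  have p1 : |∫ ω in B' ∩ Lw i, (Y ω - c0 * G ω) ∂μ| ≤ ε / 2 := by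
    calc |∫ ω in B' ∩ Lw i, (Y ω - c0 * G ω) ∂μ| ≤ ∫ ω in B' ∩ Lw i, |Y ω - c0 * G ω| ∂μ := abs_integral_le_integral_abs
      _ ≤ ∫ ω in B' ∩ Lw i, (1 + |c0|) * G ω ∂μ := by
          refine integral_mono_ae bH.integrable.integrableOn.abs (hG.const_mul _).integrable.integrableOn (ae_restrict_of_ae ?_)
          filter_upwards [Yp, YG] with ω a b
          refine (abs_sub _ _).trans ?_
          rw [abs_mul, abs_of_pos a, abs_of_pos (a.trans_le b)]
          linarith
      _ ≤ ∫ ω in Lw i, (1 + |c0|) * G ω ∂μ := by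
          refine setIntegral_mono_set (hG.const_mul _).integrable.integrableOn (ae_restrict_of_ae (Gp.mono fun ω h => ?_)) (Eventually.of_forall inter_subset_right)
          simp only [Pi.zero_apply]; positivity
      _ = (1 + |c0|) * ∫ ω in Lw i, G ω ∂μ := integral_const_mul _ _
      _ ≤ (1 + |c0|) * (δ * (μ.real univ + 1)) := by
          refine mul_le_mul_of_nonneg_left ?_ (by positivity)
          refine (min_ineq hG δ (tm n) (fun i j h => tm_mono n h) (i+1)).trans (mul_le_mul_of_nonneg_left ?_ hδ.le)
          exact (measureReal_mono (μ := μ) (Set.subset_univ _)).trans (by linarith)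
      _ = ε / 2 := by rw [hδ']; field_simp
  let α : ℕ → Ω → ℝ := fun k => (({ω | γ n k ω = 1} \ Lw k).indicator fun _ => (1:ℝ))
  have mα : ∀ k, Measurable[𝒢 (tm n k)] (α k) := fun k => measurable_const.indicator (MeasurableSet.diff (mγ1 k) (mLw k))
  have bα : ∀ k, Bd μ (α k) := fun k => Bd.indicator (𝒢.le _ _ (MeasurableSet.diff (mγ1 k) (mLw k)))
  have bI := II_bd (𝒢 := 𝒢) hY hG Yp YG (n := n) bα i
  have hiso := iso (𝒢 := 𝒢) hY hG Yp YG mα bα i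
  have bvv := fun s => vv_bd (𝒢 := 𝒢) hY hG Yp YG s
  have hsum : ∫ ω, mc 𝒢 μ G (tm n i) ω * II 𝒢 μ Y G n α i ω ^ 2 ∂μ ≤ ε * t / 2 := by
    rw [hiso]
    have h1 : ∀ k ∈ Finset.range (2 ^ n), ∫ ω, mc 𝒢 μ G (tm n (k+1)) ω *
      (α k ω * (vv 𝒢 μ Y G (tm n (k+1)) ω - vv 𝒢 μ Y G (tm n k) ω)) ^ 2 ∂μ ≤
        (1 / δ ^ 2) * ∫ ω, γ n k ω * (mc 𝒢 μ G (tm n (k+1)) ω * VV 𝒢 μ Y G n k ω ^ 2) ∂μ := by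
      intro k _
      rw [← integral_const_mul]
      refine integral_mono_ae ((hG.mc _).mul ((bα k).mul ((bvv _).sub (bvv _))).sq).integrable
        ((((hγ.P n).bd k).mul ((hG.mc _).mul (VV_bd hY hG Yp YG n k).sq)).const_mul _).integrable ?_
      filter_upwards [mc_both (𝒢 := 𝒢) hY hG Yp YG (tm n k), mc_both (𝒢 := 𝒢) hY hG Yp YG (tm n (k+1))] with ω ⟨a, b⟩ ⟨a', b'⟩
      have g := a.trans_le b
      have g' := a'.trans_le b'
      by_cases hω : ω ∈ {ω | γ n k ω = 1} \ Lw k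
      · have hα1 : α k ω = 1 := by simp only [α]; rw [indicator_of_mem hω]
        have hγ1 : γ n k ω = 1 := hω.1
        have hδ1 : δ < mc 𝒢 μ G (tm n k) ω := by
          by_contra hh
          exact hω.2 ⟨k, Nat.lt_succ_self k, not_lt.1 hh⟩
        simp only [hα1, hγ1, one_mul]
        have e : VV 𝒢 μ Y G n k ω = mc 𝒢 μ G (tm n k) ω * (vv 𝒢 μ Y G (tm n (k+1)) ω - vv 𝒢 μ Y G (tm n k) ω) := by
          rw [VV, mul_sub]; congr 1; rw [vv]; field_simp
        rw [e, mul_pow, mul_left_comm]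
        refine mul_le_mul_of_nonneg_left ?_ g'.le
        rw [← mul_assoc]
        refine le_mul_of_one_le_left (sq_nonneg _) ?_
        rw [one_div, inv_mul_eq_div, one_le_div (by positivity)]
        exact pow_le_pow_left₀ hδ.le hδ1.le 2
      · have hα1 : α k ω = 0 := by simp only [α]; rw [indicator_of_notMem hω]
        simp only [hα1, zero_mul]
        rw [zero_pow two_ne_zero, mul_zero]
        have : 0 ≤ γ n k ω := by rcases h01 n k ω with h | h <;> rw [h]; exact zero_le_one
        positivity
    calc _ ≤ ∑ k ∈ Finset.range (2 ^ n), ∫ ω, mc 𝒢 μ G (tm n (k+1)) ω *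
      (α k ω * (vv 𝒢 μ Y G (tm n (k+1)) ω - vv 𝒢 μ Y G (tm n k) ω)) ^ 2 ∂μ := by
          refine Finset.sum_le_sum_of_subset_of_nonneg (by simpa using hi.le) fun k _ _ => integral_nonneg_of_ae ?_
          filter_upwards [mc_both (𝒢 := 𝒢) hY hG Yp YG (tm n (k+1))] with ω ⟨a, b⟩
          have g := a.trans_le b
          simp only [Pi.zero_apply]; positivity
      _ ≤ _ := Finset.sum_le_sum h1
      _ = (1 / δ ^ 2) * _ := by rw [← Finset.mul_sum]
      _ ≤ (1 / δ ^ 2) * (ε * t * δ ^ 2 / 2) := mul_le_mul_of_nonneg_left (hn0 n hn) (by positivity)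
      _ = ε * t / 2 := by field_simp
  have p2 : |∫ ω in B' \ Lw i, (Y ω - c0 * G ω) ∂μ| ≤ ε / 2 := by
    set ψ := (B' \ Lw i).indicator fun _ => (1:ℝ) with hψ
    have mψ : Measurable[𝒢 (tm n i)] ψ := measurable_const.indicator mB''
    have bψ : Bd μ ψ := Bd.indicator (𝒢.le _ _ mB'')
    have e1 : ∫ ω in B' \ Lw i, (Y ω - c0 * G ω) ∂μ = ∫ ω, ψ ω * (mc 𝒢 μ G (tm n i) ω * II 𝒢 μ Y G n α i ω) ∂μ := by
      have : ∫ ω in B' \ Lw i, (Y ω - c0 * G ω) ∂μ = ∫ ω, (ψ ω * Y ω - (c0 * ψ ω) * G ω) ∂μ := by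
        rw [← integral_indicator (𝒢.le _ _ mB'')]
        refine integral_congr_ae (ae_of_all _ fun ω => ?_)
        by_cases hω : ω ∈ B' \ Lw i
        · simp [hψ, hω]
        · simp only [hψ, indicator_of_notMem hω]; ring
      rw [this, integral_sub (bψ.mul hY).integrable ((bψ.const_mul c0).mul hG).integrable, ← int_mul_mc mψ bψ hY,
        ← int_mul_mc (f := fun ω => c0 * ψ ω) (mψ.const_mul c0) (bψ.const_mul c0) hG,
        ← integral_sub (bψ.mul (hY.mc _)).integrable ((bψ.const_mul c0).mul (hG.mc _)).integrable]
      refine integral_congr_ae ?_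
      filter_upwards [mc_both (𝒢 := 𝒢) hY hG Yp YG (tm n i), mc_both (𝒢 := 𝒢) hY hG Yp YG (tm n 0), hc n] with ω ⟨a, b⟩ ⟨a0, b0⟩ h0
      have g := a.trans_le b
      have g0 := a0.trans_le b0
      by_cases hω : ω ∈ B' \ Lw i
      · have hψ1 : ψ ω = 1 := by simp only [hψ]; rw [indicator_of_mem hω]
        have hα1 : ∀ k ∈ Finset.range i, α k ω = 1 := by
          intro k hk
          have hk := Finset.mem_range.1 hk
          have hmem : ω ∈ {ω | γ n k ω = 1} \ Lw k := by
            refine ⟨?_, fun ⟨l, hl, hl'⟩ => hω.2 ⟨l, by omega, hl'⟩⟩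
            have h1 : γ n i ω = 1 := hω.1.2
            have h2 := hanti n ω hk.le
            simp only [h1] at h2
            rcases h01 n k ω with h | h
            · rw [h] at h2; exact absurd h2 (by norm_num)
            · exact h
          simp only [α]; rw [indicator_of_mem hmem]
        have hI : II 𝒢 μ Y G n α i ω = vv 𝒢 μ Y G (tm n i) ω - vv 𝒢 μ Y G (tm n 0) ω := by
          rw [II, ← Finset.sum_range_sub (fun k => vv 𝒢 μ Y G (tm n k) ω)]
          exact Finset.sum_congr rfl fun k hk => by rw [hα1 k hk, one_mul]
        have hv0 : vv 𝒢 μ Y G (tm n 0) ω = c0 := by rw [vv, h0]; field_simp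
        rw [hI, hv0, hψ1, vv]; field_simp
      · have hψ1 : ψ ω = 0 := by simp only [hψ]; rw [indicator_of_notMem hω]
        rw [hψ1]; ring
    have bR : Bd μ (fun ω => 1 / (2 * t) * (mc 𝒢 μ G (tm n i) ω * II 𝒢 μ Y G n α i ω ^ 2) + t / 2 * mc 𝒢 μ G (tm n i) ω) :=
      (((hG.mc _).mul bI.sq).const_mul _).add ((hG.mc _).const_mul _)
    rw [e1]
    refine abs_integral_le_integral_abs.trans ?_
    have step : ∫ ω, |ψ ω * (mc 𝒢 μ G (tm n i) ω * II 𝒢 μ Y G n α i ω)| ∂μ ≤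
        ∫ ω, (1 / (2 * t) * (mc 𝒢 μ G (tm n i) ω * II 𝒢 μ Y G n α i ω ^ 2) + t / 2 * mc 𝒢 μ G (tm n i) ω) ∂μ := by
      refine integral_mono_ae (bψ.mul ((hG.mc _).mul bI)).integrable.abs bR.integrable ?_
      filter_upwards [mc_both (𝒢 := 𝒢) hY hG Yp YG (tm n i)] with ω ⟨a, b⟩
      have g := a.trans_le b
      have hψ1 : |ψ ω| ≤ 1 := by by_cases hω : ω ∈ B' \ Lw i <;> simp [hψ, hω]
      rw [abs_mul, abs_mul, abs_of_pos g]
      set x := II 𝒢 μ Y G n α i ω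
      have e : 1 / (2 * t) * (mc 𝒢 μ G (tm n i) ω * x ^ 2) + t / 2 * mc 𝒢 μ G (tm n i) ω - mc 𝒢 μ G (tm n i) ω * |x|
          = mc 𝒢 μ G (tm n i) ω * ((|x| - t) ^ 2 / (2 * t)) := by
        rw [← sq_abs x]; field_simp; ring
      have h3 : 0 ≤ mc 𝒢 μ G (tm n i) ω * ((|x| - t) ^ 2 / (2 * t)) := by positivity
      have h4 : |ψ ω| * (mc 𝒢 μ G (tm n i) ω * |x|) ≤ mc 𝒢 μ G (tm n i) ω * |x| :=
        mul_le_of_le_one_left (by positivity) hψ1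
      linarith
    refine step.trans ?_
    rw [integral_add (((hG.mc _).mul bI.sq).const_mul _).integrable ((hG.mc _).const_mul _).integrable, integral_const_mul, integral_const_mul]
    have eG : ∫ ω, mc 𝒢 μ G (tm n i) ω ∂μ = ∫ ω, G ω ∂μ := integral_condExp (𝒢.le _)
    rw [eG]
    have h5 := mul_le_mul_of_nonneg_left hsum (show 0 ≤ 1 / (2 * t) by positivity)
    have e5 : 1 / (2 * t) * (ε * t / 2) = ε / 4 := by field_simp; norm_num
    have e6 : t / 2 * (∫ ω, G ω ∂μ + 1) = ε / 4 := by rw [ht']; field_simp; norm_num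
    have : 0 ≤ t / 2 := by positivity
    linarith
  show |∫ ω in B', (Y ω - c0 * G ω) ∂μ| ≤ ε
  rw [← hsplit]
  exact (abs_add_le _ _).trans (by linarith)
end
end DM

namespace DM
open Topology

section
variable {Ω : Type*} {m : MeasurableSpace Ω} {F : Filtration ℝ≥0 m} {ν : Measure Ω} [IsFiniteMeasure ν]

lemma stop_lt {τ : Ω → ℝ≥0∞} (hτ : IsStoppingTimeENN F τ) (t : ℝ≥0) : MeasurableSet[F t] {ω | τ ω < t} :=
  IsStoppingTime.measurableSet_lt (f := F) (τ := (τ : Ω → WithTop ℝ≥0)) hτ t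

lemma stop_gt {τ : Ω → ℝ≥0∞} (hτ : IsStoppingTimeENN F τ) (t : ℝ≥0) : MeasurableSet[F t] {ω | (t : ℝ≥0∞) < τ ω} := by
  have : {ω | (t : ℝ≥0∞) < τ ω} = {ω | τ ω ≤ t}ᶜ := by ext ω; simp
  rw [this]
  exact (hτ t).compl

/-- dyadic approximation from above -/
def rho (t : ℝ≥0) (x : ℝ≥0∞) (k : ℕ) : ℝ≥0 := min t ((⌊2 ^ k * (min x t).toNNReal⌋₊ + 1) / 2 ^ k)

lemma rho_ge (t : ℝ≥0) (x : ℝ≥0∞) (k : ℕ) : (min x t).toNNReal ≤ rho t x k := by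
  refine le_min ?_ ?_
  · have : min x t ≤ t := min_le_right _ _
    have := ENNReal.toNNReal_mono (by simp) this
    simpa using this
  · rw [le_div_iff₀ (by positivity), mul_comm]
    exact (Nat.lt_floor_add_one _).le

lemma rho_lim (t : ℝ≥0) (x : ℝ≥0∞) : Tendsto (rho t x) atTop (𝓝[≥] (min x t).toNNReal) := by
  refine tendsto_nhdsWithin_iff.2 ⟨?_, Eventually.of_forall fun k => rho_ge t x k⟩
  have hl : Tendsto (fun k : ℕ => (min x t).toNNReal + (1 / 2 : ℝ≥0) ^ k) atTop (𝓝 ((min x t).toNNReal + 0)) :=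
    tendsto_const_nhds.add (tendsto_pow_atTop_nhds_zero_of_lt_one zero_le (by rw [← NNReal.coe_lt_coe]; norm_num))
  rw [add_zero] at hl
  refine tendsto_of_tendsto_of_tendsto_of_le_of_le tendsto_const_nhds hl (rho_ge t x) fun k => ?_
  refine (min_le_right _ _).trans ?_
  rw [div_le_iff₀ (by positivity), add_mul, ← mul_pow]
  norm_num
  rw [mul_comm _ ((2 : ℝ≥0) ^ k)]
  exact Nat.floor_le (by positivity)

lemma rho_le_iff {t u : ℝ≥0} (h : u < t) (x : ℝ≥0∞) (k : ℕ) :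
    rho t x k ≤ u ↔ x < ((⌊2 ^ k * u⌋₊ / 2 ^ k : ℝ≥0) : ℝ≥0∞) := by
  have hc : (⌊2 ^ k * u⌋₊ / 2 ^ k : ℝ≥0) ≤ u := by
    rw [div_le_iff₀ (by positivity), mul_comm]; exact Nat.floor_le (by positivity)
  have h1 : rho t x k ≤ u ↔ (min x t).toNNReal < (⌊2 ^ k * u⌋₊ / 2 ^ k : ℝ≥0) := by
    unfold rho
    rw [min_le_iff, or_iff_right (not_le.2 h), div_le_iff₀ (by positivity), lt_div_iff₀ (by positivity), mul_comm u,
      mul_comm _ ((2:ℝ≥0)^k)]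
    rw [← Nat.cast_one, ← Nat.cast_add, ← Nat.le_floor_iff (by positivity), Nat.succ_le_iff, Nat.floor_lt (by positivity)]
  rw [h1]
  have h2 : min x (t : ℝ≥0∞) ≠ ∞ := ((min_le_right _ _).trans_lt ENNReal.coe_lt_top).ne
  rw [← ENNReal.coe_lt_coe, ENNReal.coe_toNNReal h2, min_lt_iff, or_iff_left]
  rw [not_lt, ENNReal.coe_le_coe]
  exact hc.trans h.le

lemma stop_rho {τ : Ω → ℝ≥0∞} (hτ : IsStoppingTimeENN F τ) (t : ℝ≥0) (k : ℕ) :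
    IsStoppingTime F (fun ω => ((rho t (τ ω) k : ℝ≥0) : WithTop ℝ≥0)) := by
  intro u
  have e : {ω | ((rho t (τ ω) k : ℝ≥0) : WithTop ℝ≥0) ≤ u} = {ω | rho t (τ ω) k ≤ u} := by
    ext ω; exact WithTop.coe_le_coe
  rw [e]
  rcases lt_or_ge u t with h | h
  · simp_rw [rho_le_iff h]
    refine F.mono ?_ _ (stop_lt hτ _)
    rw [div_le_iff₀ (by positivity), mul_comm]; exact Nat.floor_le (by positivity)
  · have : {ω | rho t (τ ω) k ≤ u} = univ := eq_univ_of_forall fun ω => (min_le_left _ _).trans h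
    rw [this]
    exact @MeasurableSet.univ _ (F u)

lemma stopped_eq (X : ℝ≥0 → Ω → ℝ) (τ : Ω → ℝ≥0∞) (t : ℝ≥0) (ω : Ω) :
    stoppedAtENN X τ t ω = X (min (τ ω) t).toNNReal ω := by
  unfold stoppedAtENN
  split_ifs with h
  · rw [min_eq_left h]
  · rw [min_eq_right (not_le.1 h).le]; simp

/-- optional stopping -/
theorem opt_stop {X : ℝ≥0 → Ω → ℝ} (hX : Martingale X F ν) (rc : ∀ ω t, ContinuousWithinAt (fun r => X r ω) (Ici t) t)
    {τ : Ω → ℝ≥0∞} (hτ : IsStoppingTimeENN F τ) (t : ℝ≥0) :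
    Integrable (stoppedAtENN X τ t) ν ∧ ∀ r ≤ t, ∀ A, MeasurableSet[F r] A →
      ∫ ω in A, stoppedAtENN X τ t ω ∂ν = ∫ ω in A, stoppedAtENN X τ r ω ∂ν := by
  have main : ∀ t : ℝ≥0, Integrable (stoppedAtENN X τ t) ν ∧ ∀ r ≤ t, ∀ B, MeasurableSet[F r] B → (∀ ω ∈ B, (r : ℝ≥0∞) < τ ω) →
      ∫ ω in B, stoppedAtENN X τ t ω ∂ν = ∫ ω in B, X t ω ∂ν := by
    intro t
    have hle : ∀ k ω, ((rho t (τ ω) k : ℝ≥0) : WithTop ℝ≥0) ≤ t := fun k ω => WithTop.coe_le_coe.2 (min_le_left _ _)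
    have hcr : ∀ k, (Set.range fun ω => ((rho t (τ ω) k : ℝ≥0) : WithTop ℝ≥0)).Countable := by
      intro k
      refine (Set.countable_range (fun i : ℕ => ((min t ((i + 1) / 2 ^ k) : ℝ≥0) : WithTop ℝ≥0))).mono ?_
      rintro _ ⟨ω, rfl⟩
      exact ⟨_, rfl⟩
    have hml := fun k => (stop_rho hτ t k).measurableSpace_le
    have hf : ∀ k, (fun ω => X (rho t (τ ω) k) ω) =ᵐ[ν] ν[X t | (stop_rho hτ t k).measurableSpace] := fun k =>
      hX.stoppedValue_ae_eq_condExp_of_le_const_of_countable_range (stop_rho hτ t k) (hle k) (hcr k)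
    obtain ⟨ig, hl⟩ := ui_lim (hX.integrable t) hml hf (g := stoppedAtENN X τ t) (ae_of_all _ fun ω => by
      rw [stopped_eq]
      exact (rc ω _).tendsto.comp (rho_lim t (τ ω)))
    refine ⟨ig, fun r hr B hB hBτ => ?_⟩
    have mB := F.le r _ hB
    have h1 := hl (B.indicator fun _ => 1) (measurable_const.indicator mB) ⟨1, fun ω => by
      by_cases hω : ω ∈ B <;> simp [hω]⟩
    have e : ∀ f : Ω → ℝ, (∫ ω, f ω * B.indicator (fun _ => (1:ℝ)) ω ∂ν) = ∫ ω in B, f ω ∂ν := by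
      intro f
      rw [← integral_indicator mB]
      refine integral_congr_ae (ae_of_all _ fun ω => ?_)
      by_cases hω : ω ∈ B <;> simp [hω]
    simp_rw [e] at h1
    refine tendsto_nhds_unique h1 ?_
    refine tendsto_const_nhds.congr fun k => ?_
    have hB' : MeasurableSet[(stop_rho hτ t k).measurableSpace] B := by
      refine ⟨le_iSup (fun t => (F t : MeasurableSpace Ω)) r _ hB, fun u => ?_⟩
      rcases lt_or_ge u r with h | h
      · have : B ∩ {ω | ((rho t (τ ω) k : ℝ≥0) : WithTop ℝ≥0) ≤ u} = ∅ := by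
          refine Set.eq_empty_of_forall_notMem fun ω hω => ?_
          have h1 := WithTop.coe_le_coe.1 hω.2
          have h2 := rho_ge t (τ ω) k
          have h3 : (r : ℝ≥0∞) ≤ min (τ ω) t := le_min (hBτ ω hω.1).le (by exact_mod_cast hr)
          have h4 := ENNReal.toNNReal_mono ((min_le_right _ _).trans_lt ENNReal.coe_lt_top).ne h3
          rw [ENNReal.toNNReal_coe] at h4
          exact absurd (h4.trans (h2.trans h1)) (not_le.2 h)
        rw [this]
        exact @MeasurableSet.empty _ (F u)
      · exact (F.mono h _ hB).inter ((stop_rho hτ t k) u)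
    rw [setIntegral_congr_ae mB ((hf k).mono fun _ h _ => h), setIntegral_condExp (hml k) (hX.integrable t) hB']
  refine ⟨(main t).1, fun r hr A hA => ?_⟩
  have mA := F.le r _ hA
  have mτ := F.le r _ (stop_gt hτ r)
  rw [← integral_inter_add_sdiff mτ (main t).1.integrableOn, ← integral_inter_add_sdiff mτ (main r).1.integrableOn]
  congr 1
  · have hB : MeasurableSet[F r] (A ∩ {ω | (r : ℝ≥0∞) < τ ω}) := hA.inter (stop_gt hτ r)
    rw [(main t).2 r hr _ hB fun ω h => h.2, (main r).2 r le_rfl _ hB fun ω h => h.2]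
    exact (hX.setIntegral_eq hr hB).symm
  · refine setIntegral_congr_fun (mA.diff mτ) fun ω hω => ?_
    have h : τ ω ≤ r := not_lt.1 hω.2
    rw [stopped_eq, stopped_eq, min_eq_left h, min_eq_left (h.trans (by exact_mod_cast hr))]

end
end DM

namespace DM
open Topology

section
variable {Ω : Type*} {m : MeasurableSpace Ω} {F : Filtration ℝ≥0 m} {μ : Measure Ω} [IsFiniteMeasure μ] {σ : Ω → ℝ≥0} {d : ℕ}

open Classical in
/-- the gate of a stopping time -/
def gst (σ : Ω → ℝ≥0) (n i : ℕ) (ω : Ω) : ℝ := if i < 2 ^ n ∧ th n i < σ ω then 1 else 0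

lemma gst_01 (n i : ℕ) (ω : Ω) : gst σ n i ω = 0 ∨ gst σ n i ω = 1 := by
  unfold gst; split_ifs <;> simp

lemma gst_one {n i : ℕ} (hi : i < 2 ^ n) (ω : Ω) : gst σ n i ω = 1 ↔ th n i < σ ω := by
  unfold gst; simp [hi]

lemma gst_mono {n n' i i' : ℕ} {ω : Ω} (h : i' < 2 ^ n' → th n' i' < σ ω → i < 2 ^ n ∧ th n i < σ ω) :
    gst σ n' i' ω ≤ gst σ n i ω := by
  unfold gst
  by_cases h' : i' < 2 ^ n' ∧ th n' i' < σ ω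
  · rw [if_pos h', if_pos (h h'.1 h'.2)]
  · rw [if_neg h']; split_ifs <;> simp

lemma gst_anti (n : ℕ) (ω : Ω) : Antitone fun i => gst σ n i ω := fun i j h =>
  gst_mono fun hj hσ => ⟨h.trans_lt hj, (th_mono h hj).trans_lt hσ⟩

lemma gst_GB (hσ : ∀ t : ℝ≥0, MeasurableSet[F t] {ω | t < σ ω}) : GB (TC F) (gst σ) := by
  have hle : ∀ n i ω, |gst σ n i ω| ≤ 1 := fun n i ω => by rcases gst_01 (σ := σ) n i ω with h | h <;> simp [h]
  refine ⟨fun n => ⟨fun i => ?_, 1, hle n⟩, hle⟩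
  by_cases hi : i < 2 ^ n
  · have : gst σ n i = {ω | th n i < σ ω}.indicator fun _ => 1 := by
      ext ω; simp [gst, hi, Set.indicator_apply]
    rw [this, TC_tm hi]
    exact measurable_const.indicator (hσ _)
  · have : gst σ n i = fun _ => 0 := by ext ω; simp [gst, hi]
    rw [this]; exact measurable_const

lemma gst_gate (hσ : ∀ t : ℝ≥0, MeasurableSet[F t] {ω | t < σ ω}) (L : Measure (KK (TC F))) :
    Gate L (gst σ) (fun k => ⨅ n, lift (TC F) n (gst σ n) k) := by
  have hG := gst_GB hσ
  refine ⟨hG.P, hG.le, Measurable.iInf fun n => (hG.P n).lift_meas, ae_of_all _ fun k => ?_⟩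
  refine tendsto_atTop_ciInf (antitone_nat_of_succ_le fun n => ?_) ⟨0, ?_⟩
  · refine gst_mono fun _ h => ⟨idx_lt _ _, ?_⟩
    refine lt_of_le_of_lt ?_ h
    refine tcs_mono ?_ (tm_lt (idx_lt _ _))
    rw [← idx_succ_div]
    exact tm_div_le _ _
  · rintro _ ⟨n, rfl⟩
    rcases gst_01 (σ := σ) n (idx n k.snd) k.fst with h | h <;> simp [lift, h]

lemma ap_eq {t : ℝ≥0} {n i : ℕ} (hi : i + 1 < 2 ^ n) (h1 : th n i < t) (h2 : t < th n (i + 1)) : ap t n = i + 1 := by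
  have a1 : tm n i ≤ uu t := by
    have := uu_mono h1.le
    rwa [th, uu_tcs tm_nonneg (tm_lt (by omega))] at this
  have a2 : uu t < tm n (i + 1) := by
    by_contra hc
    have := tcs_mono (not_lt.1 hc) (uu_lt t)
    rw [tcs_uu] at this
    exact absurd h2 (not_lt.2 this)
  unfold ap
  congr 1
  rw [Nat.floor_eq_iff (by have := uu_nonneg t; positivity)]
  unfold tm at a1 a2
  rw [div_le_iff₀ (by positivity)] at a1
  rw [lt_div_iff₀ (by positivity)] at a2
  push_cast at a2
  exact ⟨a1, a2⟩

/-- before the stopping time the two processes agree up to the last cell -/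
lemma rel_stop {T : ℝ≥0} (hσ : ∀ t : ℝ≥0, MeasurableSet[F t] {ω | t < σ ω}) (hT : ∀ ω, σ ω ≤ T) {Y M : Ω → ℝ} {N : Fin d → Ω → ℝ} {j : Fin d}
    (hY : Bd μ Y) (hM : Bd μ M) (hN : Bd μ (N j)) {a : ℝ≥0 → Ω → ℝ} (rc : ∀ ω t, ContinuousWithinAt (fun r => a r ω) (Ici t) t)
    (eM : ∀ n i, i < 2 ^ n → ∀ᵐ ω ∂μ, mc (TC F) μ M (tm n i) ω = a (th n i) ω * mc (TC F) μ Y (tm n i) ω)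
    (eN : ∀ n i, i < 2 ^ n → ∀ᵐ ω ∂μ, mc (TC F) μ (N j) (tm n i) ω = a (min (σ ω) (th n i)) ω * mc (TC F) μ Y (tm n i) ω) :
    Rel (TC F) μ (gst σ) Y M (fun _ : Fin d => Y) N := by
  intro ε hε
  have hG := gst_GB (F := F) hσ
  set q : ℕ → ℕ → Ω → ℝ := fun n i ω => (gst σ n i ω * (W (TC F) μ Y M n i ω - W (TC F) μ Y (N j) n i ω)) ^ 2 with hq
  have bq : ∀ n i, Bd μ (q n i) := fun n i => (((hG.P n).bd i).mul ((hY.W hM n i).sub (hY.W hN n i))).sq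
  obtain ⟨_, C1, hC1, b1⟩ := id hY
  obtain ⟨_, C2, hC2, b2⟩ := id hM
  obtain ⟨_, C3, hC3, b3⟩ := id hN
  set C := C1 ^ 2 * (C2 + C3) ^ 2 with hC
  have big : ∀ᶠ n in atTop, ap T n < 2 ^ n := ap_lt T
  have key : ∀ᵐ ω ∂μ, ∀ n, ap T n < 2 ^ n → ∑ i ∈ Finset.range (2 ^ n), q n i ω ≤
      min C (C1 ^ 4 * (a (th n (ap (σ ω) n)) ω - a (σ ω) ω) ^ 2) := by
    have e1 : ∀ᵐ ω ∂μ, ∀ n i, i < 2 ^ n → mc (TC F) μ M (tm n i) ω = a (th n i) ω * mc (TC F) μ Y (tm n i) ω ∧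
        mc (TC F) μ (N j) (tm n i) ω = a (min (σ ω) (th n i)) ω * mc (TC F) μ Y (tm n i) ω := by
      rw [ae_all_iff]; intro n; rw [ae_all_iff]; intro i
      by_cases hi : i < 2 ^ n
      · filter_upwards [eM n i hi, eN n i hi] with ω x y _ using ⟨x, y⟩
      · exact ae_of_all _ fun ω h => absurd h hi
    have e2 : ∀ᵐ ω ∂μ, ∀ n i, |mc (TC F) μ Y (tm n i) ω| ≤ C1 ∧ |mc (TC F) μ M (tm n i) ω| ≤ C2 ∧ |mc (TC F) μ (N j) (tm n i) ω| ≤ C3 := by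
      rw [ae_all_iff]; intro n; rw [ae_all_iff]; intro i
      filter_upwards [mc_bound hC1 b1 (tm n i), mc_bound hC2 b2 (tm n i), mc_bound hC3 b3 (tm n i)] with ω x y z using ⟨x, y, z⟩
    filter_upwards [e1, e2] with ω e1 e2 n hn
    have hR : 0 ≤ min C (C1 ^ 4 * (a (th n (ap (σ ω) n)) ω - a (σ ω) ω) ^ 2) := le_min (by positivity) (by positivity)
    have z : ∀ i < 2 ^ n, i + 1 ≠ ap (σ ω) n → q n i ω = 0 := by
      intro i hi hne
      simp only [hq]
      by_cases hs : th n i < σ ω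
      · have hlt : i + 1 < 2 ^ n := by
          by_contra hc
          have h1 : th n (ap T n) ≤ th n i := th_mono (by omega) hi
          exact absurd ((lt_th_ap hn).trans_le (h1.trans hs.le)) (not_lt.2 (hT ω))
        have hle : th n (i + 1) ≤ σ ω := not_lt.1 fun hc => hne (ap_eq hlt hs hc).symm
        rw [W_eq, W_eq, (e1 n i hi).1, (e1 n i hi).2, (e1 n (i+1) hlt).1, (e1 n (i+1) hlt).2, min_eq_right hle, min_eq_right hs.le]
        ring
      · simp [gst, hs]
    by_cases hap : ap (σ ω) n - 1 < 2 ^ n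
    · have hpos : 1 ≤ ap (σ ω) n := by unfold ap; omega
      rw [Finset.sum_eq_single_of_mem (ap (σ ω) n - 1) (Finset.mem_range.2 hap)
        (fun i hi hne => z i (Finset.mem_range.1 hi) (by omega))]
      set i := ap (σ ω) n - 1 with hi'
      have hi1 : i + 1 = ap (σ ω) n := by omega
      have hlt : i + 1 < 2 ^ n := by rw [hi1]; exact (ap_mono (hT ω) n).trans_lt hn
      simp only [hq]
      by_cases hs : th n i < σ ω
      · have g1 : gst σ n i ω = 1 := (gst_one hap ω).2 hs
        have hge : σ ω ≤ th n (i + 1) := by rw [hi1]; exact (lt_th_ap (hi1 ▸ hlt)).le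
        have d1 : W (TC F) μ Y M n i ω - W (TC F) μ Y (N j) n i ω =
            mc (TC F) μ Y (tm n i) ω * (mc (TC F) μ M (tm n (i+1)) ω - mc (TC F) μ (N j) (tm n (i+1)) ω) := by
          rw [W_eq, W_eq, (e1 n i hap).1, (e1 n i hap).2, min_eq_right hs.le]; ring
        rw [g1, one_mul, d1, mul_pow]
        have y0 : mc (TC F) μ Y (tm n i) ω ^ 2 ≤ C1 ^ 2 := sq_le_sq.2 (by rw [abs_of_nonneg hC1]; exact (e2 n i).1)
        have y1 : mc (TC F) μ Y (tm n (i+1)) ω ^ 2 ≤ C1 ^ 2 := sq_le_sq.2 (by rw [abs_of_nonneg hC1]; exact (e2 n (i+1)).1)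
        refine le_min ?_ ?_
        · refine mul_le_mul y0 ?_ (sq_nonneg _) (by positivity)
          refine sq_le_sq.2 ?_
          rw [abs_of_nonneg (a := C2 + C3) (by positivity)]
          exact (abs_sub _ _).trans (add_le_add (e2 n (i+1)).2.1 (e2 n (i+1)).2.2)
        · rw [(e1 n (i+1) hlt).1, (e1 n (i+1) hlt).2, min_eq_left hge, ← sub_mul, mul_pow, hi1,
            show C1 ^ 4 * (a (th n (ap (σ ω) n)) ω - a (σ ω) ω) ^ 2 = C1 ^ 2 * ((a (th n (ap (σ ω) n)) ω - a (σ ω) ω) ^ 2 * C1 ^ 2) by ring]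
          rw [hi1] at y1
          exact mul_le_mul y0 (mul_le_mul_of_nonneg_left y1 (sq_nonneg _)) (by positivity) (by positivity)
      · simpa [gst, hs] using hR
    · rw [Finset.sum_eq_zero fun i hi => z i (Finset.mem_range.1 hi) (by have := Finset.mem_range.1 hi; omega)]
      exact hR
  have q0 : ∀ n ω, 0 ≤ ∑ i ∈ Finset.range (2 ^ n), q n i ω := fun n ω => Finset.sum_nonneg fun i _ => sq_nonneg _
  have lim : Tendsto (fun n => ∫ ω, ∑ i ∈ Finset.range (2 ^ n), q n i ω ∂μ) atTop (𝓝 (∫ ω, (0:ℝ) ∂μ)) := by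
    refine tendsto_integral_filter_of_dominated_convergence (fun _ => C) (Eventually.of_forall fun n => ?_) ?_ (integrable_const C) ?_
    · exact (Finset.measurable_fun_sum _ fun i _ => (bq n i).1).aestronglyMeasurable
    · filter_upwards [big] with n hn
      filter_upwards [key] with ω k
      rw [Real.norm_of_nonneg (q0 n ω)]
      exact (k n hn).trans (min_le_left _ _)
    · filter_upwards [key] with ω k
      have h1 : Tendsto (fun n => C1 ^ 4 * (a (th n (ap (σ ω) n)) ω - a (σ ω) ω) ^ 2) atTop (𝓝 (C1 ^ 4 * (a (σ ω) ω - a (σ ω) ω) ^ 2)) :=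
        (((rc ω (σ ω)).tendsto.comp (th_ap_tendsto' (σ ω))).sub_const _).pow 2 |>.const_mul _
      rw [sub_self, zero_pow two_ne_zero, mul_zero] at h1
      refine tendsto_of_tendsto_of_tendsto_of_le_of_le' tendsto_const_nhds h1 (Eventually.of_forall fun n => q0 n ω) ?_
      filter_upwards [big] with n hn using (k n hn).trans (min_le_right _ _)
  rw [integral_zero] at lim
  obtain ⟨n0, hn0⟩ := eventually_atTop.1 (lim.eventually (gt_mem_nhds hε))
  refine ⟨n0, fun k _ _ => if k = j then 1 else 0, fun k => Pn.const _, fun n hn => ?_⟩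
  have := (hn0 n hn).le
  rw [integral_finsetSum _ fun i _ => (bq n i).integrable] at this
  refine le_trans (le_of_eq ?_) this
  refine Finset.sum_congr rfl fun i _ => integral_congr_ae (ae_of_all _ fun ω => ?_)
  simp [hq, rfn]

end
end DM

namespace DM
open Topology

section
variable {Ω : Type*} {m : MeasurableSpace Ω} {F : Filtration ℝ≥0 m} {P : Measure Ω} [IsProbabilityMeasure P] {σ : Ω → ℝ≥0} {d : ℕ}
  {s : Fin d → ℝ≥0 → Ω → ℝ}

/-- martingale property of the process stopped at `σ` under the weight `f` -/
structure ST (F : Filtration ℝ≥0 m) (P : Measure Ω) (s : Fin d → ℝ≥0 → Ω → ℝ) (σ : Ω → ℝ≥0) (f : Ω → ℝ) : Prop where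
  i1 : ∀ j, Integrable (fun ω => s j (σ ω) ω * f ω) P
  i2 : ∀ j t, Integrable (fun ω => s j (min (σ ω) t) ω * f ω) P
  eq : ∀ j t A, MeasurableSet[F t] A → ∫ ω in A, s j (σ ω) ω * f ω ∂P = ∫ ω in A, s j (min (σ ω) t) ω * f ω ∂P

lemma ST.add {f g : Ω → ℝ} (hf : ST F P s σ f) (hg : ST F P s σ g) : ST F P s σ (fun ω => f ω + g ω) := by
  refine ⟨fun j => ?_, fun j t => ?_, fun j t A hA => ?_⟩
  · simp only [mul_add]; exact (hf.i1 j).add (hg.i1 j)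
  · simp only [mul_add]; exact (hf.i2 j t).add (hg.i2 j t)
  · simp only [mul_add]
    rw [integral_add (hf.i1 j).integrableOn (hg.i1 j).integrableOn, integral_add (hf.i2 j t).integrableOn (hg.i2 j t).integrableOn,
      hf.eq j t A hA, hg.eq j t A hA]

lemma ST.ce {f : Ω → ℝ} (hf : ST F P s σ f) (fi : Integrable f P) (mZ : ∀ j t, Measurable[F t] fun ω => s j (min (σ ω) t) ω)
    (j : Fin d) {n i : ℕ} (hi : i < 2 ^ n) :
    ∀ᵐ ω ∂P, mc (TC F) P (fun ω => s j (σ ω) ω * f ω) (tm n i) ω = s j (min (σ ω) (th n i)) ω * mc (TC F) P f (tm n i) ω := by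
  unfold mc
  rw [TC_tm hi]
  have h1 : P[fun ω => s j (min (σ ω) (th n i)) ω * f ω | F (th n i)] =ᵐ[P] P[fun ω => s j (σ ω) ω * f ω | F (th n i)] := by
    refine ae_eq_condExp_of_forall_setIntegral_eq (F.le _) (hf.i1 j) (fun _ _ _ => integrable_condExp.integrableOn) (fun A hA _ => ?_)
      stronglyMeasurable_condExp.aestronglyMeasurable
    rw [setIntegral_condExp (F.le _) (hf.i2 j _) hA, hf.eq j _ A hA]
  have h2 := condExp_mul_of_stronglyMeasurable_left (m := F (th n i)) (mZ j (th n i)).stronglyMeasurable (hf.i2 j (th n i)) fi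
  exact h1.symm.trans h2

lemma bayes_tr {𝒢 : Filtration ℝ m} {D f g z : Ω → ℝ} (wt : Wt P D) (hf : Integrable f P) (hg : Integrable g P) {r : ℝ}
    (h : ∀ᵐ ω ∂P, mc 𝒢 P f r ω = z ω * mc 𝒢 P g r ω) :
    ∀ᵐ ω ∂(wD P D), mc 𝒢 (wD P D) (nf D f) r ω = z ω * mc 𝒢 (wD P D) (nf D g) r ω := by
  refine wD_ac.ae_le ?_
  filter_upwards [h, bayes (𝒢 := 𝒢) (D := D) hf r, bayes (𝒢 := 𝒢) (D := D) hg r, mc_posP (𝒢 := 𝒢) wt.int (ae_of_all _ wt.pos) r] with ω a b c e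
  rw [b, c, ← mul_assoc] at a
  exact mul_right_cancel₀ e.ne' a

lemma triv_ce (htrivial : ∀ A : Set Ω, MeasurableSet[F 0] A → P A = 0 ∨ P A = 1) {f : Ω → ℝ} (hf : Integrable f P) (n : ℕ) :
    ∀ᵐ ω ∂P, mc (TC F) P f (tm n 0) ω = ∫ ω, f ω ∂P := by
  have e : th n 0 = 0 := by simp [th, tm, tcs]
  unfold mc
  rw [TC_tm (by positivity), e]
  refine Filter.EventuallyEq.symm (ae_eq_condExp_of_forall_setIntegral_eq (F.le _) hf (fun _ _ _ => (integrable_const _).integrableOn) (fun A hA _ => ?_)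
    aestronglyMeasurable_const)
  have mA := F.le _ _ hA
  rcases htrivial A hA with h | h
  · rw [Measure.restrict_eq_zero.2 h]; simp
  · have : P.restrict A = P := by
      rw [Measure.restrict_eq_self_of_ae_mem]
      exact (prob_compl_eq_zero_iff mA).2 h
    rw [this]; simp

theorem stop_core (hnull : ∀ A, MeasurableSet A → P A = 0 → MeasurableSet[F 0] A)
    (htrivial : ∀ A : Set Ω, MeasurableSet[F 0] A → P A = 0 ∨ P A = 1) {p g : Ω → ℝ} {ξ : Fin d → Ω → ℝ}
    (h : SD F P p ξ s) (hRD : RD (TC F) P p ξ) (wg : Wt P g) {T : ℝ≥0} (hσ : ∀ t : ℝ≥0, MeasurableSet[F t] {ω | t < σ ω}) (hT : ∀ ω, σ ω ≤ T)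
    (mZ : ∀ j t, Measurable[F t] fun ω => s j (min (σ ω) t) ω) (hp : ST F P s σ p) (hg : ST F P s σ g)
    {c0 : ℝ} (hc0 : ∫ ω, p ω ∂P = c0 * ∫ ω, (p ω + g ω) ∂P) {r : ℝ≥0} {A : Set Ω} (hA : MeasurableSet[F r] A) :
    ∫ ω in A ∩ {ω | r < σ ω}, (p ω - c0 * (p ω + g ω)) ∂P = 0 := by
  have wp := h.wt
  set G : Ω → ℝ := fun ω => p ω + g ω with hG
  have wG : Wt P G := wp.add wg
  have hSG : ST F P s σ G := hp.add hg
  have eSg : ∀ j, (fun ω => s j (σ ω) ω) = fun ω => s j (min (σ ω) T) ω := fun j => by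
    ext ω; rw [min_eq_left (hT ω)]
  have mSg : ∀ j, Measurable fun ω => s j (σ ω) ω := fun j => by
    rw [eSg]; exact (mZ j T).mono (F.le _) le_rfl
  let ι := Option (Fin d ⊕ Fin d)
  let f : ι → Ω → ℝ := fun k => k.elim G (Sum.elim (fun j ω => s j (σ ω) ω * p ω) (fun j ω => s j (σ ω) ω * G ω))
  obtain ⟨D, wt, d0, d1, d2, hR⟩ := hRD ι inferInstance f
    (by
      rintro (_ | j | j)
      · exact wG.meas
      · exact (mSg j).mul wp.meas
      · exact (mSg j).mul wG.meas)
    (by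
      rintro (_ | j | j)
      · exact wG.int
      · exact hp.i1 j
      · exact hSG.i1 j)
  set μ := wD P D with hμ
  have rr := fun k => hR D wt (ae_of_all _ fun _ => le_rfl) (fun _ _ _ => 1) GB.one k
  have nullμ : ∀ A, MeasurableSet A → μ A = 0 → MeasurableSet[(TC F) 0] A := by
    intro A mA h0
    rw [TC_lt one_pos, show tcs 0 = 0 by simp [tcs]]
    exact hnull A mA (ac_wD (D := D) h0)
  have hY : Bd μ (nf D p) := d0.bd
  have hGb : Bd μ (nf D G) := (d2 none).bd
  have hM : ∀ j, Bd μ (nf D (ξ j)) := fun j => (d1 j).bd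
  have hN : ∀ j, Bd μ (nf D fun ω => s j (σ ω) ω * p ω) := fun j => (d2 (some (Sum.inl j))).bd
  have hK : ∀ j, Bd μ (nf D fun ω => s j (σ ω) ω * G ω) := fun j => (d2 (some (Sum.inr j))).bd
  have Yp : ∀ᵐ ω ∂μ, 0 < nf D p ω := ae_of_all _ fun ω => div_pos (wp.pos ω) (wt.pos ω)
  have YG : ∀ᵐ ω ∂μ, nf D p ω ≤ nf D G ω := ae_of_all _ fun ω =>
    div_le_div_of_nonneg_right (by simp only [hG]; linarith [wg.pos ω]) (wt.pos ω).le
  have eM : ∀ j n i, i < 2 ^ n → ∀ᵐ ω ∂μ, mc (TC F) μ (nf D (ξ j)) (tm n i) ω = s j (th n i) ω * mc (TC F) μ (nf D p) (tm n i) ω :=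
    fun j n i hi => bayes_tr wt (h.iξ j) wp.int (h.gs_eq j n i hi)
  have eN : ∀ j n i, i < 2 ^ n → ∀ᵐ ω ∂μ, mc (TC F) μ (nf D fun ω => s j (σ ω) ω * p ω) (tm n i) ω =
      s j (min (σ ω) (th n i)) ω * mc (TC F) μ (nf D p) (tm n i) ω :=
    fun j n i hi => bayes_tr wt (hp.i1 j) wp.int (hp.ce wp.int mZ j hi)
  have eK : ∀ j n i, i < 2 ^ n → ∀ᵐ ω ∂μ, mc (TC F) μ (nf D fun ω => s j (σ ω) ω * G ω) (tm n i) ω =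
      s j (min (σ ω) (th n i)) ω * mc (TC F) μ (nf D G) (tm n i) ω :=
    fun j n i hi => bayes_tr wt (hSG.i1 j) wG.int (hSG.ce wG.int mZ j hi)
  have top : ∀ {f : Ω → ℝ}, Bd μ f → ∀ n, mc (TC F) μ f (tm n (2 ^ n)) = f := by
    intro f hf n
    unfold mc
    rw [tm_top, TC_ge le_rfl]
    exact condExp_of_stronglyMeasurable le_rfl hf.1.stronglyMeasurable hf.integrable
  have CR : ∀ n, ∀ i ≤ 2 ^ n, ∀ j, ∀ᵐ ω ∂μ, mc (TC F) μ (nf D G) (tm n i) ω * mc (TC F) μ (nf D fun ω => s j (σ ω) ω * p ω) (tm n i) ω =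
      mc (TC F) μ (nf D fun ω => s j (σ ω) ω * G ω) (tm n i) ω * mc (TC F) μ (nf D p) (tm n i) ω := by
    intro n i hi j
    rcases hi.lt_or_eq with hi | rfl
    · filter_upwards [eN j n i hi, eK j n i hi] with ω a b
      rw [a, b]; ring
    · rw [top hGb, top (hN j), top (hK j), top hY]
      exact ae_of_all _ fun ω => by simp only [nf]; ring
  have r3 : ∀ j, Rel (TC F) μ (gst σ) (nf D p) (nf D (ξ j)) (fun _ : Fin d => nf D p) (fun j => nf D fun ω => s j (σ ω) ω * p ω) := fun j =>
    rel_stop hσ hT hY (hM j) (hN j) (a := s j) (h.rc j) (eM j) (eN j)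
  have R := core_rel nullμ (gst_gate hσ) hY hGb hM hN hK Yp YG CR (rr none) (fun j => rr (some (Sum.inr j))) r3
  have E1 := fun η (hη : 0 < η) => est1 hY hGb hN hK Yp YG CR (gst_GB hσ) gst_01 R hη
  have hc : ∀ n, ∀ᵐ ω ∂μ, mc (TC F) μ (nf D p) (tm n 0) ω = c0 * mc (TC F) μ (nf D G) (tm n 0) ω := by
    intro n
    refine bayes_tr wt (z := fun _ => c0) wp.int wG.int ?_
    filter_upwards [triv_ce htrivial wp.int n, triv_ce htrivial wG.int n] with ω a b
    rw [a, b, hc0]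
  have iH : Integrable (fun ω => p ω - c0 * G ω) P := wp.int.sub (wG.int.const_mul _)
  have mA := F.le _ _ hA
  have lim : Tendsto (fun n => ∫ ω in A ∩ {ω | th n (ap r n) < σ ω}, (p ω - c0 * G ω) ∂P) atTop
      (𝓝 (∫ ω in A ∩ {ω | r < σ ω}, (p ω - c0 * G ω) ∂P)) := by
    have mS : ∀ u : ℝ≥0, MeasurableSet (A ∩ {ω | u < σ ω}) := fun u => mA.inter (F.le _ _ (hσ u))
    simp_rw [← integral_indicator (mS _)]
    refine tendsto_integral_of_dominated_convergence (fun ω => |p ω - c0 * G ω|) (fun n => (iH.indicator (mS _)).aestronglyMeasurable)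
      iH.abs (fun n => ae_of_all _ fun ω => ?_) (ae_of_all _ fun ω => ?_)
    · exact norm_indicator_le_norm_self _ _
    · by_cases hω : ω ∈ A ∩ {ω | r < σ ω}
      · refine tendsto_const_nhds.congr' ?_
        filter_upwards [(th_ap_tendsto r).eventually (gt_mem_nhds hω.2)] with n hn
        rw [indicator_of_mem hω, indicator_of_mem (show ω ∈ A ∩ {ω | th n (ap r n) < σ ω} from ⟨hω.1, hn⟩)]
      · refine tendsto_const_nhds.congr' ?_
        filter_upwards [ap_lt r] with n hn
        rw [indicator_of_notMem hω, indicator_of_notMem fun hh => hω ⟨hh.1, (lt_th_ap hn).trans hh.2⟩]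
  refine abs_eq_zero.1 (le_antisymm (le_of_forall_pos_le_add fun ε hε => ?_) (abs_nonneg _))
  rw [zero_add]
  obtain ⟨n0, hn0⟩ := est2 hY hGb Yp YG (gst_GB hσ) gst_01 gst_anti hc E1 hε
  refine le_of_tendsto lim.abs ?_
  filter_upwards [eventually_ge_atTop n0, ap_lt r] with n hn hap
  have hB : MeasurableSet[(TC F) (tm n (ap r n))] A := by
    rw [TC_tm hap]; exact F.mono (lt_th_ap hap).le _ hA
  have := hn0 n hn _ hap A hB
  have e : {ω | gst σ n (ap r n) ω = 1} = {ω | th n (ap r n) < σ ω} := by ext ω; exact gst_one hap ω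
  rw [e, wD_setIntegral _ (mA.inter (F.le _ _ (hσ _)))] at this
  refine le_trans (le_of_eq ?_) this
  congr 1
  refine setIntegral_congr_fun (mA.inter (F.le _ _ (hσ _))) fun ω _ => ?_
  have := (wt.pos ω).ne'
  simp only [nf]
  field_simp

end
end DM

namespace DM
open Topology

section
variable {Ω : Type*} {m : MeasurableSpace Ω} {F : Filtration ℝ≥0 m} {P : Measure Ω} [IsProbabilityMeasure P] {d : ℕ}
  {s : Fin d → ℝ≥0 → Ω → ℝ}

lemma SD.mart {p : Ω → ℝ} {ξ : Fin d → Ω → ℝ} (h : SD F P p ξ s) (j : Fin d) : Martingale (s j) F (wD P p) := by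
  have := h.wt
  refine ⟨fun t => (h.ms j t).stronglyMeasurable, fun r t hrt => ?_⟩
  refine (condExp_congr_ae (h.ver j t)).trans ?_
  exact (condExp_condExp_of_le (F.mono hrt) (F.le t)).trans (h.ver j r).symm

/-- scalar martingale property of stopped processes under a weight -/
def SM (F : Filtration ℝ≥0 m) (P : Measure Ω) (s : Fin d → ℝ≥0 → Ω → ℝ) (τ : Ω → ℝ≥0∞) (f : Ω → ℝ) : Prop :=
  ∀ j t, Integrable (fun ω => stoppedAtENN (s j) τ t ω * f ω) P ∧ ∀ r ≤ t, ∀ A, MeasurableSet[F r] A →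
    ∫ ω in A, stoppedAtENN (s j) τ t ω * f ω ∂P = ∫ ω in A, stoppedAtENN (s j) τ r ω * f ω ∂P

lemma SD.sm {p : Ω → ℝ} {ξ : Fin d → Ω → ℝ} (h : SD F P p ξ s) {τ : Ω → ℝ≥0∞} (hτ : IsStoppingTimeENN F τ) : SM F P s τ p := by
  have := h.wt
  intro j t
  obtain ⟨a, b⟩ := opt_stop (h.mart j) (h.rc j) hτ t
  refine ⟨by simpa only [mul_comm] using wD_integrable.1 a, fun r hr A hA => ?_⟩
  have := b r hr A hA
  rw [wD_setIntegral _ (F.le _ _ hA), wD_setIntegral _ (F.le _ _ hA)] at this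
  simpa only [mul_comm] using this

/-- truncated stopping time -/
def sg (τ : Ω → ℝ≥0∞) (N : ℝ≥0) (ω : Ω) : ℝ≥0 := (min (τ ω) N).toNNReal

lemma coe_sg (τ : Ω → ℝ≥0∞) (N : ℝ≥0) (ω : Ω) : (sg τ N ω : ℝ≥0∞) = min (τ ω) N :=
  ENNReal.coe_toNNReal ((min_le_right _ _).trans_lt ENNReal.coe_lt_top).ne

lemma stopped_sg (τ : Ω → ℝ≥0∞) (N t : ℝ≥0) (j : Fin d) (ω : Ω) : s j (min (sg τ N ω) t) ω = stoppedAtENN (s j) τ (min N t) ω := by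
  rw [stopped_eq]
  congr 1
  rw [← ENNReal.coe_inj, ENNReal.coe_toNNReal ((min_le_right _ _).trans_lt ENNReal.coe_lt_top).ne, ENNReal.coe_min, coe_sg,
    ENNReal.coe_min, min_assoc]

lemma sg_le (τ : Ω → ℝ≥0∞) (N : ℝ≥0) (ω : Ω) : sg τ N ω ≤ N := by
  rw [← ENNReal.coe_le_coe, coe_sg]; exact min_le_right _ _

lemma SM.st {τ : Ω → ℝ≥0∞} {f : Ω → ℝ} (h : SM F P s τ f) (N : ℝ≥0) : ST F P s (sg τ N) f := by
  have e : ∀ j ω, s j (sg τ N ω) ω = stoppedAtENN (s j) τ N ω := fun j ω => by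
    have := stopped_sg (s := s) τ N N j ω
    rwa [min_self, min_eq_left (sg_le τ N ω)] at this
  refine ⟨fun j => ?_, fun j t => ?_, fun j t A hA => ?_⟩
  · simp_rw [e]; exact (h j N).1
  · simp_rw [stopped_sg]; exact (h j _).1
  · simp_rw [e, stopped_sg]
    rcases le_total t N with ht | ht
    · rw [min_eq_right ht]; exact (h j N).2 t ht A hA
    · rw [min_eq_left ht]

theorem fin_unique (hnull : ∀ A, MeasurableSet A → P A = 0 → MeasurableSet[F 0] A)
    (htrivial : ∀ A : Set Ω, MeasurableSet[F 0] A → P A = 0 ∨ P A = 1) (hgen : (⨆ t : ℝ≥0, (F t : MeasurableSpace Ω)) = m)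
    {p g : Ω → ℝ} {ξ : Fin d → Ω → ℝ}
    (h : SD F P p ξ s) (hRD : RD (TC F) P p ξ) (wg : Wt P g) (hpg : ∫ ω, g ω ∂P = ∫ ω, p ω ∂P) {τ : ℕ → Ω → ℝ≥0∞}
    (hτ : ∀ n, IsStoppingTimeENN F (τ n)) (hmono : ∀ ω, Monotone fun n => τ n ω) (hsup : ∀ ω, (⨆ n, τ n ω) = ∞)
    (mZ : ∀ n j t, Measurable[F t] (stoppedAtENN (s j) (τ n) t)) (hg : ∀ n, SM F P s (τ n) g) : g =ᵐ[P] p := by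
  have wp := h.wt
  have iH : Integrable (fun ω => p ω - 1 / 2 * (p ω + g ω)) P := wp.int.sub ((wp.int.add wg.int).const_mul _)
  have h1 : ∀ r : ℝ≥0, ∀ A, MeasurableSet[F r] A → ∫ ω in A, (p ω - 1 / 2 * (p ω + g ω)) ∂P = 0 := by
    intro r A hA
    have mA := F.le _ _ hA
    have hσ : ∀ n (t : ℝ≥0), MeasurableSet[F t] {ω | t < sg (τ n) n ω} := by
      intro n t
      have : {ω | t < sg (τ n) n ω} = {ω | (t : ℝ≥0∞) < τ n ω} ∩ {ω | t < n} := by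
        ext ω
        simp only [Set.mem_ofPred_eq, Set.mem_inter_iff]
        rw [← ENNReal.coe_lt_coe, coe_sg, lt_min_iff, ENNReal.coe_lt_coe]
      rw [this]
      exact (stop_gt (hτ n) t).inter (MeasurableSet.const _)
    have h0 : ∀ n : ℕ, ∫ ω in A ∩ {ω | r < sg (τ n) n ω}, (p ω - 1 / 2 * (p ω + g ω)) ∂P = 0 := by
      intro n
      refine stop_core (s := s) hnull htrivial h hRD wg (hσ n) (sg_le (τ n) n) (fun j t => ?_) ((h.sm (hτ n)).st n) ((hg n).st n) ?_ hA
      · simp_rw [stopped_sg]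
        exact (mZ n j _).mono (F.mono (min_le_right _ _)) le_rfl
      · rw [integral_add wp.int wg.int, hpg]; ring
    have mS : ∀ n : ℕ, MeasurableSet (A ∩ {ω | r < sg (τ n) n ω}) := fun n => mA.inter (F.le _ _ (hσ n r))
    have lim : Tendsto (fun n : ℕ => ∫ ω in A ∩ {ω | r < sg (τ n) n ω}, (p ω - 1 / 2 * (p ω + g ω)) ∂P) atTop
        (𝓝 (∫ ω in A, (p ω - 1 / 2 * (p ω + g ω)) ∂P)) := by
      simp_rw [← integral_indicator (mS _), ← integral_indicator mA]
      refine tendsto_integral_of_dominated_convergence (fun ω => |p ω - 1 / 2 * (p ω + g ω)|) (fun n => (iH.indicator (mS _)).aestronglyMeasurable)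
        iH.abs (fun n => ae_of_all _ fun ω => norm_indicator_le_norm_self _ _) (ae_of_all _ fun ω => ?_)
      refine tendsto_const_nhds.congr' ?_
      have h2 : ∀ᶠ n in atTop, (r : ℝ≥0∞) < τ n ω := by
        have := tendsto_atTop_iSup (hmono ω)
        rw [hsup ω] at this
        exact this.eventually (lt_mem_nhds ENNReal.coe_lt_top)
      obtain ⟨k, hk⟩ := exists_nat_gt r
      filter_upwards [h2, eventually_ge_atTop k] with n hn hkn
      have : r < sg (τ n) n ω := by
        rw [← ENNReal.coe_lt_coe, coe_sg, lt_min_iff, ENNReal.coe_lt_coe]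
        exact ⟨hn, hk.trans_le (by exact_mod_cast hkn)⟩
      by_cases hω : ω ∈ A
      · rw [indicator_of_mem hω, indicator_of_mem (show ω ∈ A ∩ {ω | r < sg (τ n) n ω} from ⟨hω, this⟩)]
      · rw [indicator_of_notMem hω, indicator_of_notMem fun hh => hω hh.1]
    simp_rw [h0] at lim
    exact tendsto_nhds_unique lim tendsto_const_nhds
  have h2 : ∀ A, MeasurableSet A → ∫ ω in A, (p ω - 1 / 2 * (p ω + g ω)) ∂P = 0 := by
    intro A hA
    induction A, hA using MeasurableSpace.induction_on_inter (s := {A | ∃ r, MeasurableSet[F r] A}) with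
    | h_eq =>
      refine hgen.symm.trans ((MeasurableSpace.generateFrom_iUnion_measurableSet (fun r => (F r : MeasurableSpace Ω))).symm.trans ?_)
      congr 1
      ext A
      simp
    | h_inter =>
      rintro A ⟨r, hA⟩ B ⟨t, hB⟩ _
      exact ⟨max r t, (F.mono (le_max_left _ _) _ hA).inter (F.mono (le_max_right _ _) _ hB)⟩
    | empty => simp
    | basic A hA => obtain ⟨r, hA⟩ := hA; exact h1 r A hA
    | compl A hA ih =>
      rw [setIntegral_compl hA iH, ih, sub_zero]
      have := h1 0 univ (@MeasurableSet.univ _ (_))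
      rwa [setIntegral_univ] at this
    | iUnion B hd hB ih =>
      rw [integral_iUnion hB hd iH.integrableOn]
      rw [tsum_congr ih, tsum_zero]
  have h3 : (fun ω => p ω - 1 / 2 * (p ω + g ω)) =ᵐ[P] 0 :=
    iH.ae_eq_zero_of_forall_setIntegral_eq_zero fun A hA _ => h2 A hA
  filter_upwards [h3] with ω hω
  simp only [Pi.zero_apply] at hω
  linarith

end
end DM

namespace DM
open Topology

section
variable {Ω : Type*} {m : MeasurableSpace Ω} {F : Filtration ℝ≥0 m} {P : Measure Ω} [IsProbabilityMeasure P] {d : ℕ}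

/-- strictly positive version -/
def pv (f : Ω → ℝ) (ω : Ω) : ℝ := if 0 < f ω then f ω else 1

lemma pv_ae {f : Ω → ℝ} (h : ∀ᵐ ω ∂P, 0 < f ω) : pv f =ᵐ[P] f := by
  filter_upwards [h] with ω hω
  exact if_pos hω

lemma pv_wt {f : Ω → ℝ} (mf : Measurable f) (jf : Integrable f P) (h : ∀ᵐ ω ∂P, 0 < f ω) : Wt P (pv f) := by
  refine ⟨Measurable.ite (measurableSet_lt measurable_const mf) mf measurable_const, fun ω => ?_, jf.congr (pv_ae h).symm⟩
  unfold pv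
  split_ifs with h
  exacts [h, one_pos]

lemma Wt.scale {p : Ω → ℝ} (h : Wt P p) {c : ℝ} (hc : 0 < c) : Wt P (fun ω => c * p ω) :=
  ⟨h.meas.const_mul c, fun ω => mul_pos hc (h.pos ω), h.int.const_mul c⟩

lemma Wt.ipos {p : Ω → ℝ} (h : Wt P p) : 0 < ∫ ω, p ω ∂P := by
  rw [integral_pos_iff_support_of_nonneg (fun ω => (h.pos ω).le) h.int]
  have : Function.support p = univ := by
    ext ω; simp [(h.pos ω).ne']
  rw [this]; simp

lemma Wt.prob {p : Ω → ℝ} (h : Wt P p) (h1 : ∫ ω, p ω ∂P = 1) : IsProbabilityMeasure (wD P p) := by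
  refine ⟨?_⟩
  rw [wD, withDensity_apply _ MeasurableSet.univ, Measure.restrict_univ,
    ← ofReal_integral_eq_lintegral_ofReal h.int (ae_of_all _ fun ω => (h.pos ω).le), h1, ENNReal.ofReal_one]

lemma wD_congr {p q : Ω → ℝ} (h : p =ᵐ[P] q) : wD P p = wD P q :=
  withDensity_congr_ae (h.mono fun ω hω => congrArg ENNReal.ofReal hω)

lemma wD_inj {p q : Ω → ℝ} (h : Wt P p) (h' : Wt P q) (e : wD P p = wD P q) : p =ᵐ[P] q := by
  refine h.int.ae_eq_of_forall_setIntegral_eq _ _ h'.int fun A hA _ => ?_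
  have h1 := wD_setIntegral (P := P) (D := p) (fun _ => 1) hA
  have h2 := wD_setIntegral (P := P) (D := q) (fun _ => 1) hA
  rw [e, h2] at h1
  simpa using h1.symm

lemma ce_scale {p : Ω → ℝ} (h : Wt P p) {c : ℝ} (hc : 0 < c) {f : Ω → ℝ} (hf : Integrable f (wD P p)) (t : ℝ≥0) :
    (wD P (fun ω => c * p ω))[f | F t] =ᵐ[wD P p] (wD P p)[f | F t] := by
  have h' := h.scale hc
  have hf' : Integrable f (wD P fun ω => c * p ω) := by
    rw [wD_integrable] at hf ⊢
    simpa only [mul_assoc] using hf.const_mul c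
  have key : ∀ (g : Ω → ℝ) {A : Set Ω}, MeasurableSet A → ∫ ω in A, g ω ∂(wD P fun ω => c * p ω) = c * ∫ ω in A, g ω ∂(wD P p) := by
    intro g A hA
    rw [wD_setIntegral _ hA, wD_setIntegral _ hA, ← integral_const_mul]
    simp only [mul_assoc]
  refine ae_eq_condExp_of_forall_setIntegral_eq (F.le t) hf (fun A hA _ => ?_) (fun A hA _ => ?_)
    stronglyMeasurable_condExp.aestronglyMeasurable
  · refine Integrable.integrableOn ?_
    have := wD_integrable.1 (integrable_condExp (f := f) (μ := wD P fun ω => c * p ω) (m := F t))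
    rw [wD_integrable]
    refine (this.const_mul c⁻¹).congr (ae_of_all _ fun ω => ?_)
    field_simp
  · have := setIntegral_condExp (F.le t) hf' hA
    rw [key _ (F.le t _ hA), key _ (F.le t _ hA)] at this
    exact mul_left_cancel₀ hc.ne' this

lemma mk_SD {p ζ : Ω → ℝ} (wp : Wt P p) (hζ : ζ =ᵐ[P] p) {ξ : Ω → EuclideanSpace ℝ (Fin d)} (mξ : Measurable ξ)
    (iξ : Integrable ξ P) {S : ℝ≥0 → Ω → EuclideanSpace ℝ (Fin d)} (hS : Adapted F S)
    (hrc : ∀ ω, ∀ t : ℝ≥0, ContinuousWithinAt (fun s => S s ω) (Ici t) t) {c : ℝ} (hc : 0 < c)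
    (hv : ∀ t : ℝ≥0, S t =ᵐ[wD P fun ω => c * p ω] (wD P fun ω => c * p ω)[fun ω => (ζ ω)⁻¹ • ξ ω | F t]) :
    SD F P p (fun j ω => ξ ω j) (fun j t ω => S t ω j) := by
  have wc := wp.scale hc
  have hj : ∀ j : Fin d, Measurable fun x : EuclideanSpace ℝ (Fin d) => x j := fun j => (EuclideanSpace.proj (𝕜 := ℝ) j).measurable
  have iξj : ∀ j : Fin d, Integrable (fun ω => ξ ω j) P := integrable_piLp_iff.1 iξ
  have inf : ∀ j : Fin d, Integrable (nf p (fun ω => ξ ω j)) (wD P p) := by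
    intro j
    rw [wD_integrable]
    refine (iξj j).congr (ae_of_all _ fun ω => ?_)
    simp only [nf]
    rw [mul_div_cancel₀ _ (wp.pos ω).ne']
  refine ⟨wp, fun j => (hj j).comp mξ, iξj, fun j t => (hj j).comp (hS t), fun j ω t =>
    (EuclideanSpace.proj (𝕜 := ℝ) j).continuous.continuousAt.comp_continuousWithinAt (hrc ω t), fun j t => ?_⟩
  have e : ∀ j : Fin d, (fun ω => ((ζ ω)⁻¹ • ξ ω) j) =ᵐ[P] nf p (fun ω => ξ ω j) := by
    intro j
    filter_upwards [hζ] with ω hω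
    simp only [nf, PiLp.smul_apply, smul_eq_mul, hω]
    field_simp
  have iv : Integrable (fun ω => (ζ ω)⁻¹ • ξ ω) (wD P fun ω => c * p ω) := by
    rw [integrable_piLp_iff]
    intro j
    refine Integrable.congr ?_ (wD_ac.ae_le (e j).symm)
    have := wD_integrable.1 (inf j)
    rw [wD_integrable]
    simpa only [mul_assoc] using this.const_mul c
  have h1 := ContinuousLinearMap.comp_condExp_comm (m := F t) iv (EuclideanSpace.proj (𝕜 := ℝ) j)
  have h2 : (wD P fun ω => c * p ω)[fun ω => ((ζ ω)⁻¹ • ξ ω) j | F t] =ᵐ[wD P fun ω => c * p ω] (wD P fun ω => c * p ω)[nf p (fun ω => ξ ω j) | F t] :=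
    condExp_congr_ae (wD_ac.ae_le (e j))
  have ac : wD P p ≪ wD P fun ω => c * p ω := wD_ac.trans ac_wD
  filter_upwards [ac.ae_le (hv t), ac.ae_le h1, ac.ae_le h2, ce_scale (F := F) wp hc (inf j) t] with ω a b c' d'
  rw [← d', ← c', a]
  exact b

lemma mart_of_coord {R : Measure Ω} [IsFiniteMeasure R] {X : ℝ≥0 → Ω → EuclideanSpace ℝ (Fin d)} (hX : Adapted F X)
    (hi : ∀ j t, Integrable (fun ω => X t ω j) R)
    (he : ∀ j, ∀ r t, r ≤ t → ∀ A, MeasurableSet[F r] A → ∫ ω in A, X t ω j ∂(R) = ∫ ω in A, X r ω j ∂(R)) : Martingale X F R := by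
  have iX : ∀ t, Integrable (X t) R := fun t => integrable_piLp_iff.2 fun j => hi j t
  refine ⟨fun t => (hX t).stronglyMeasurable, fun r t hrt => ?_⟩
  refine (ae_eq_condExp_of_forall_setIntegral_eq (F.le r) (iX t) (fun A _ _ => (iX r).integrableOn) (fun A hA _ => ?_)
    (hX r).stronglyMeasurable.aestronglyMeasurable).symm
  ext j
  rw [eval_integral_piLp (fun i => (hi i _).integrableOn), eval_integral_piLp (fun i => (hi i _).integrableOn)]
  exact (he j r t hrt A hA).symm

lemma stopped_coord (X : ℝ≥0 → Ω → EuclideanSpace ℝ (Fin d)) (τ : Ω → ℝ≥0∞) (j : Fin d) (t : ℝ≥0) (ω : Ω) :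
    stoppedAtENN (fun t ω => X t ω j) τ t ω = stoppedAtENN X τ t ω j := by
  unfold stoppedAtENN
  split_ifs <;> rfl

lemma locmart_of_mart {R : Measure Ω} {X : ℝ≥0 → Ω → EuclideanSpace ℝ (Fin d)} (h : Martingale X F R) : IsLocalMartingale F X R := by
  refine ⟨fun _ _ => ∞, fun n t => ?_, fun ω => monotone_const, fun ω => by simp, fun n => ?_⟩
  · simp
  · have : stoppedAtENN X (fun _ => ∞) = X := by
      ext t ω; simp [stoppedAtENN]
    rwa [this]

lemma RD_of_MRP (hnull : ∀ A, MeasurableSet A → P A = 0 → MeasurableSet[F 0] A)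
    {p : Ω → ℝ} {ξ : Fin d → Ω → ℝ} {S : ℝ≥0 → Ω → EuclideanSpace ℝ (Fin d)} (hS : Adapted F S)
    (h : SD F P p ξ (fun j t ω => S t ω j)) (hM : HasMRP F S P (wD P fun ω => (∫ ω, p ω ∂P)⁻¹ * p ω)) : RD (TC F) P p ξ := by
  have wp := h.wt
  have hc : 0 < (∫ ω, p ω ∂P)⁻¹ := inv_pos.2 wp.ipos
  have hd := h.dense ?_
  · intro ι hι f mf jf
    obtain ⟨D, hD⟩ := dens_rel wp.meas wp.int h.mξ h.iξ h.gs_meas (fun j n i _ => h.gs_int j n i) h.gs_eq hd mf jf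
    exact ⟨D, hD.1, hD.2⟩
  · intro g wg hpg ig eg
    have wgc := wg.scale hc
    have wpc := wp.scale hc
    have pr : IsProbabilityMeasure (wD P fun ω => (∫ ω, p ω ∂P)⁻¹ * g ω) := by
      refine wgc.prob ?_
      rw [integral_const_mul, hpg, inv_mul_cancel₀ wp.ipos.ne']
    have e := hM.2 _ pr ⟨wD_ac, ac_wD⟩ (locmart_of_mart (mart_of_coord hS (fun j t => ?_) fun j r t hrt A hA => ?_))
    · filter_upwards [wD_inj wgc wpc e] with ω hω
      exact mul_left_cancel₀ hc.ne' hω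
    · rw [wD_integrable]
      refine ((ig j t).const_mul (∫ ω, p ω ∂P)⁻¹).congr (ae_of_all _ fun ω => ?_)
      simp only; ring
    · rw [wD_setIntegral _ (F.le _ _ hA), wD_setIntegral _ (F.le _ _ hA)]
      have := eg j r t hrt A hA
      simp only [mul_assoc]
      rw [integral_const_mul, integral_const_mul]
      simp only [mul_comm (g _)]
      rw [this]

lemma MRP_of_RD (hnull : ∀ A, MeasurableSet A → P A = 0 → MeasurableSet[F 0] A)
    (htrivial : ∀ A : Set Ω, MeasurableSet[F 0] A → P A = 0 ∨ P A = 1) (hgen : (⨆ t : ℝ≥0, (F t : MeasurableSpace Ω)) = m)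
    {p : Ω → ℝ} {ξ : Fin d → Ω → ℝ} {S : ℝ≥0 → Ω → EuclideanSpace ℝ (Fin d)}
    (h : SD F P p ξ (fun j t ω => S t ω j)) (hRD : RD (TC F) P p ξ)
    (hSm : Martingale S F (wD P fun ω => (∫ ω, p ω ∂P)⁻¹ * p ω)) :
    HasMRP F S P (wD P fun ω => (∫ ω, p ω ∂P)⁻¹ * p ω) := by
  refine ⟨locmart_of_mart hSm, fun R hR hac hloc => ?_⟩
  have wp := h.wt
  have hc := wp.ipos
  obtain ⟨τ, hτ, hmono, hsup, hmart⟩ := hloc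
  have m0 : Measurable fun ω => (R.rnDeriv P ω).toReal := (Measure.measurable_rnDeriv R P).ennreal_toReal
  have p0 : ∀ᵐ ω ∂P, 0 < (R.rnDeriv P ω).toReal := by
    filter_upwards [Measure.rnDeriv_pos' hac.2, Measure.rnDeriv_lt_top R P] with ω a b
    exact ENNReal.toReal_pos a.ne' b.ne
  have w0 := pv_wt m0 Measure.integrable_toReal_rnDeriv p0
  have eR : wD P (pv fun ω => (R.rnDeriv P ω).toReal) = R := by
    rw [wD_congr (pv_ae p0), wD]
    refine Eq.trans (withDensity_congr_ae ?_) (Measure.withDensity_rnDeriv_eq R P hac.1)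
    filter_upwards [Measure.rnDeriv_lt_top R P] with ω b
    exact ENNReal.ofReal_toReal b.ne
  generalize (pv fun ω => (R.rnDeriv P ω).toReal) = g at w0 eR
  subst eR
  have ig : ∫ ω, g ω ∂P = 1 := by
    have := wD_integral (P := P) (D := g) (fun _ => 1)
    simpa using this.symm
  have wg := w0.scale hc
  have key := fin_unique hnull htrivial hgen h hRD wg (by rw [integral_const_mul, ig, mul_one]) hτ hmono hsup (fun n j t => ?_) (fun n j t => ?_)
  · refine wD_congr ?_
    filter_upwards [key] with ω hω
    rw [← hω, inv_mul_cancel_left₀ hc.ne']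
  · have e : stoppedAtENN (fun t ω => S t ω j) (τ n) t = fun ω => stoppedAtENN S (τ n) t ω j := by
      ext ω; exact stopped_coord _ _ _ _ _
    rw [e]
    exact (EuclideanSpace.proj (𝕜 := ℝ) j).measurable.comp ((hmart n).1 t).measurable
  · simp only [stopped_coord]
    have iM : ∀ t (i : Fin d), Integrable (fun ω => stoppedAtENN S (τ n) t ω i) (wD P g) := fun t => integrable_piLp_iff.1 ((hmart n).integrable t)
    refine ⟨?_, fun r hr A hA => ?_⟩
    · refine ((wD_integrable.1 (iM t j)).const_mul (∫ ω, p ω ∂P)).congr (ae_of_all _ fun ω => ?_)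
      simp only; ring
    · have h1 := congrArg (fun v : EuclideanSpace ℝ (Fin d) => v j) ((hmart n).setIntegral_eq hr hA)
      simp only at h1
      rw [eval_integral_piLp (fun i => (iM _ i).integrableOn), eval_integral_piLp (fun i => (iM _ i).integrableOn),
        wD_setIntegral _ (F.le _ _ hA), wD_setIntegral _ (F.le _ _ hA)] at h1
      simp only [mul_comm _ (_ * g _), mul_assoc]
      rw [integral_const_mul, integral_const_mul, h1]

end
end DM

open DM

theorem analytic_field_MRP_ae
    {Ω : Type*} {m : MeasurableSpace Ω} {P : Measure Ω} [IsProbabilityMeasure P]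
    (F : Filtration ℝ≥0 m)
    -- usual conditions: right-continuity and completeness of the filtration
    (hright : ∀ t : ℝ≥0, (F t : MeasurableSpace Ω) = ⨅ (s : ℝ≥0) (_ : t < s), F s)
    (hcomplete : ∀ s : Set Ω, MeasurableSet[m] s → P s = 0 → MeasurableSet[F 0] s)
    -- `F 0` is `P`-trivial and `F = ⋁ t, F t`
    (htrivial : ∀ s : Set Ω, MeasurableSet[F 0] s → P s = 0 ∨ P s = 1)
    (hgen : (⨆ t : ℝ≥0, (F t : MeasurableSpace Ω)) = m)
    {l d : ℕ}
    (U : Set (EuclideanSpace ℝ (Fin l))) (hUopen : IsOpen U) (hUconn : IsConnected U)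
    (x₀ : EuclideanSpace ℝ (Fin l)) (hx₀ : x₀ ∈ closure U)
    -- the fields `x ↦ ζ(x)` and `x ↦ ξ(x)`, continuous on `U ∪ {x₀}` and analytic on `U`
    (ζ : EuclideanSpace ℝ (Fin l) → Lp ℝ 1 P)
    (ξ : EuclideanSpace ℝ (Fin l) → Lp (EuclideanSpace ℝ (Fin d)) 1 P)
    (hζcont : ContinuousOn ζ (U ∪ {x₀})) (hξcont : ContinuousOn ξ (U ∪ {x₀}))
    (hζanal : AnalyticOnNhd ℝ ζ U) (hξanal : AnalyticOnNhd ℝ ξ U)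
    (hζpos : ∀ x ∈ U ∪ {x₀}, ∀ᵐ ω ∂P, 0 < (ζ x : Ω → ℝ) ω)
    -- the probability measures `Q(x)` with `dQ(x)/dP = ζ(x) / E_P[ζ(x)]`
    (Q : EuclideanSpace ℝ (Fin l) → Measure Ω)
    (hQ : ∀ x ∈ U ∪ {x₀}, Q x =
      P.withDensity (fun ω => ENNReal.ofReal ((ζ x : Ω → ℝ) ω / ∫ ω', (ζ x : Ω → ℝ) ω' ∂P)))
    -- `S(x)`: a right-continuous adapted version of the `Q(x)`-martingale
    -- `t ↦ E_{Q(x)}[ξ(x)/ζ(x) | F t]`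
    (S : EuclideanSpace ℝ (Fin l) → ℝ≥0 → Ω → EuclideanSpace ℝ (Fin d))
    (hSadapted : ∀ x ∈ U ∪ {x₀}, Adapted F (S x))
    (hSrc : ∀ x ∈ U ∪ {x₀}, ∀ ω, ∀ t : ℝ≥0,
      ContinuousWithinAt (fun s => S x s ω) (Ici t) t)
    (hSver : ∀ x ∈ U ∪ {x₀}, ∀ t : ℝ≥0, S x t =ᵐ[Q x]
      (Q x)[fun ω => ((ζ x : Ω → ℝ) ω)⁻¹ • (ξ x : Ω → EuclideanSpace ℝ (Fin d)) ω | F t])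
    (hSmart : ∀ x ∈ U ∪ {x₀}, Martingale (S x) F (Q x))
    -- `S(x₀)` has the MRP
    (hx₀MRP : HasMRP F (S x₀) P (Q x₀)) :
    volume {x ∈ U | ¬ HasMRP F (S x) P (Q x)} = 0 := by
  let p : EuclideanSpace ℝ (Fin l) → Ω → ℝ := fun x => pv (ζ x)
  let k : EuclideanSpace ℝ (Fin l) → Fin d → Ω → ℝ := fun x j ω => (ξ x : Ω → EuclideanSpace ℝ (Fin d)) ω j
  have pe : ∀ x ∈ U ∪ {x₀}, p x =ᵐ[P] ζ x := fun x hx => pv_ae (hζpos x hx)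
  have wp : ∀ x ∈ U ∪ {x₀}, Wt P (p x) := fun x hx =>
    pv_wt (Lp.stronglyMeasurable _).measurable ((Lp.memLp (ζ x)).integrable le_rfl) (hζpos x hx)
  have eQ : ∀ x ∈ U ∪ {x₀}, Q x = wD P fun ω => (∫ ω, p x ω ∂P)⁻¹ * p x ω := by
    intro x hx
    rw [hQ x hx]
    refine withDensity_congr_ae ?_
    rw [← integral_congr_ae (pe x hx)]
    filter_upwards [pe x hx] with ω hω
    rw [← hω, div_eq_inv_mul]
  have hSD : ∀ x ∈ U ∪ {x₀}, SD F P (p x) (k x) (fun j t ω => S x t ω j) := by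
    intro x hx
    refine mk_SD (wp x hx) (pe x hx).symm (Lp.stronglyMeasurable _).measurable ((Lp.memLp (ξ x)).integrable le_rfl)
      (hSadapted x hx) (hSrc x hx) (inv_pos.2 (wp x hx).ipos) ?_
    rw [← eQ x hx]
    exact hSver x hx
  have h0 : x₀ ∈ U ∪ {x₀} := Or.inr rfl
  have hn : ∀ s, MeasurableSet s → P s = 0 → MeasurableSet[(TC F) 0] s := by
    intro s hs h
    rw [TC_lt one_pos]
    have : tcs 0 = 0 := by simp [tcs]
    rw [this]
    exact hcomplete s hs h
  have hRD := RD_of_MRP hcomplete (hSadapted x₀ h0) (hSD x₀ h0) (by rw [← eQ x₀ h0]; exact hx₀MRP)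
  let f : Option (Fin d) → EuclideanSpace ℝ (Fin l) → Lp ℝ 1 P := fun t x =>
    t.elim (ζ x) fun j => (EuclideanSpace.proj (𝕜 := ℝ) j : EuclideanSpace ℝ (Fin d) →L[ℝ] ℝ).compLpL 1 P (ξ x)
  have fe : ∀ j x, (f (some j) x : Ω → ℝ) =ᵐ[P] k x j := fun j x => ContinuousLinearMap.coeFn_compLpL _ _
  obtain ⟨D, wtD, hD0, hae⟩ := good_ae (f := f) hn (wp x₀ h0).pos hRD hUopen hUconn.isPreconnected hx₀
    (fun t => by
      cases t with
      | none => exact hζcont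
      | some j => exact (ContinuousLinearMap.continuous _).comp_continuousOn hξcont)
    (fun t => by
      cases t with
      | none => exact hζanal
      | some j => exact ContinuousLinearMap.comp_analyticOnNhd _ hξanal)
    (fun t => by
      cases t with
      | none => exact (pe x₀ h0).symm
      | some j => exact fe j x₀)
  have good : ∀ᵐ x, x ∈ U → HasMRP F (S x) P (Q x) := by
    filter_upwards [hae] with x hx hxU
    obtain ⟨hd, hr⟩ := hx hxU
    have h1 : x ∈ U ∪ {x₀} := Or.inl hxU
    have tr : ∀ {a b : Ω → ℝ}, a =ᵐ[P] b → Measurable b → Dm P D a → Dm P D b := by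
      rintro a b e mb ⟨-, C, hC, h⟩
      refine ⟨mb, C, hC, ?_⟩
      filter_upwards [e, h] with ω e h
      rwa [← e]
    have nfc : ∀ {a b : Ω → ℝ}, a =ᵐ[P] b → nf D a =ᵐ[wD P D] nf D b := by
      intro a b e
      refine wD_ac.ae_le ?_
      filter_upwards [e] with ω e
      simp only [nf, e]
    rw [eQ x h1]
    refine MRP_of_RD hcomplete htrivial hgen (hSD x h1) ?_ (by rw [← eQ x h1]; exact hSmart x h1)
    refine RD_good hn (wp x₀ h0).pos hRD (wp x h1).pos wtD hD0 (fun t => ?_) (fun t => ?_)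
    · cases t with
      | none => exact tr (pe x h1).symm (wp x h1).meas (hd none)
      | some j => exact tr (fe j x) ((hSD x h1).mξ j) (hd (some j))
    · have a := nfc (pe x h1).symm
      exact Rel.congr a EventuallyEq.rfl (fun _ => a) (fun j => nfc (fe j x)) (hr t)
  refine measure_mono_null ?_ (ae_iff.1 good)
  rintro x ⟨hx, hM⟩
  exact fun h => hM (h hx)
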